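/- Let A and B be Young functions such that there is c > 0 with B(t) ≤ A(ct) for all t > 0, A is finite-valued, and ∫_0^∞ B(κ log(1 + 1/t)) dt < ∞ for some κ > 0. Then the following are equivalent: (i) for every measurable f : ℝ → ℝ with ∫_ℝ A(c|f|) < ∞ for all c > 0, one has lim_{n→∞} ∫_ℝ B(|χ_n · S_n(f·χ_n) − f|) = 0; (ii) there exists K > 0 such that for every t > 0, ∫_0^t B(s)/s² ds ≤ A(Kt)/t and ∫_0^t Ã(s)/s² ds ≤ B̃(Kt)/t, where Ã and B̃ are the conjugate Young functions of A and B. -/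

import Mathlib

open MeasureTheory Filter Set

/-- The `k`-th Hermite function
`h_k(x) = (-1)^k π^{-1/4} 2^{-k/2} (k!)^{-1/2} e^{x²/2} (d^k/dx^k)(e^{-x²})`. -/
noncomputable def hermiteFun (k : ℕ) (x : ℝ) : ℝ :=
  (-1 : ℝ) ^ k *
    (Real.pi ^ (-(1 : ℝ) / 4) * (2 : ℝ) ^ (-(k : ℝ) / 2) *
      ((k.factorial : ℝ)) ^ (-(1 : ℝ) / 2)) *
    Real.exp (x ^ 2 / 2) * iteratedDeriv k (fun y : ℝ => Real.exp (-y ^ 2)) x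

/-- The `n`-th partial sum of the Hermite series of `f`:
`S_n f = ∑_{k=0}^n (∫ f h_k) h_k`. -/
noncomputable def hermitePartialSum (n : ℕ) (f : ℝ → ℝ) (x : ℝ) : ℝ :=
  ∑ k ∈ Finset.range (n + 1), (∫ y : ℝ, f y * hermiteFun k y) * hermiteFun k x

/-- A Young function: `[0,∞] `-valued, convex, left-continuous, vanishing at `0` and
not constant on `(0,∞)`.  (The values on negative reals are irrelevant.) -/
structure YoungFunction where
  toFun : ℝ → ENNReal
  zero' : toFun 0 = 0
  convex' : ∀ ⦃x y a b : ℝ⦄, 0 ≤ x → 0 ≤ y → 0 ≤ a → 0 ≤ b → a + b = 1 →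
    toFun (a * x + b * y) ≤ ENNReal.ofReal a * toFun x + ENNReal.ofReal b * toFun y
  leftContinuous' : ∀ t : ℝ, 0 < t →
    Filter.Tendsto toFun (nhdsWithin t (Set.Iio t)) (nhds (toFun t))
  nonconstant' : ∃ s t : ℝ, 0 < s ∧ 0 < t ∧ toFun s ≠ toFun t

/-- The conjugate Young function `Ã(t) = sup_{τ ≥ 0} (τ·t − A(τ))`. -/
noncomputable def YoungFunction.conj (A : YoungFunction) (t : ℝ) : ENNReal :=
  ⨆ τ : {τ : ℝ // 0 ≤ τ}, ENNReal.ofReal (τ.1 * t) - A.toFun τ.1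

namespace YoungFunction

theorem le_smul (A : YoungFunction) {θ t : ℝ} (h0 : 0 ≤ θ) (h1 : θ ≤ 1) (ht : 0 ≤ t) :
    A.toFun (θ * t) ≤ ENNReal.ofReal θ * A.toFun t := by
  have := A.convex' ht le_rfl h0 (sub_nonneg.2 h1) (by ring)
  simpa [A.zero'] using this

theorem mono (A : YoungFunction) {s t : ℝ} (hs : 0 ≤ s) (hst : s ≤ t) :
    A.toFun s ≤ A.toFun t := by
  rcases hs.eq_or_lt with rfl | hs
  · simp [A.zero']
  have ht : 0 < t := hs.trans_le hst
  have h1 : s / t ≤ 1 := (div_le_one ht).2 hst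
  have := A.le_smul (θ := s / t) (by positivity) h1 ht.le
  rw [div_mul_cancel₀ _ ht.ne'] at this
  exact this.trans (mul_le_of_le_one_left (by simp) (by simpa using h1))

theorem mul_le (A : YoungFunction) {C t : ℝ} (hC : 1 ≤ C) (ht : 0 ≤ t) :
    ENNReal.ofReal C * A.toFun t ≤ A.toFun (C * t) := by
  have hC0 : 0 < C := by linarith
  have := A.le_smul (θ := C⁻¹) (t := C * t) (by positivity) (inv_le_one_of_one_le₀ hC)
    (by positivity)
  rw [inv_mul_cancel_left₀ hC0.ne'] at this
  calc _ ≤ ENNReal.ofReal C * (ENNReal.ofReal C⁻¹ * A.toFun (C * t)) := by gcongr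
    _ = _ := by
      rw [← mul_assoc, ← ENNReal.ofReal_mul hC0.le, mul_inv_cancel₀ hC0.ne']; simp

theorem measurable_comp_abs (A : YoungFunction) {X : Type*} [MeasurableSpace X] {f : X → ℝ}
    (hf : Measurable f) : Measurable fun x => A.toFun |f x| := by
  have h : Monotone fun t : ℝ => A.toFun (max t 0) := fun s t hst =>
    A.mono (le_max_right _ _) (max_le_max_right _ hst)
  have : (fun x => A.toFun |f x|) = (fun t : ℝ => A.toFun (max t 0)) ∘ fun x => |f x| := by
    ext x; simp
  rw [this]
  exact h.measurable.comp (by fun_prop)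

theorem measurable_comp (A : YoungFunction) {X : Type*} [MeasurableSpace X] {f : X → ℝ}
    (hf : Measurable f) (h0 : ∀ x, 0 ≤ f x) : Measurable fun x => A.toFun (f x) := by
  simpa [abs_of_nonneg (h0 _)] using A.measurable_comp_abs hf

theorem conj_zero (A : YoungFunction) : A.conj 0 = 0 := by simp [conj]

theorem young (A : YoungFunction) {s : ℝ} (hs : 0 ≤ s) (t : ℝ) :
    ENNReal.ofReal (s * t) ≤ A.toFun s + A.conj t := by
  have : ENNReal.ofReal (s * t) - A.toFun s ≤ A.conj t :=
    le_iSup (fun τ : {τ : ℝ // 0 ≤ τ} => ENNReal.ofReal (τ.1 * t) - A.toFun τ.1) ⟨s, hs⟩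
  rw [add_comm]
  exact tsub_le_iff_right.1 this

theorem conj_mono (A : YoungFunction) {s t : ℝ} (hst : s ≤ t) : A.conj s ≤ A.conj t := by
  refine iSup_mono fun τ => tsub_le_tsub_right (ENNReal.ofReal_le_ofReal ?_) _
  exact mul_le_mul_of_nonneg_left hst τ.2

theorem conj_mul_le (A : YoungFunction) {C : ℝ} (hC : 1 ≤ C) (t : ℝ) :
    ENNReal.ofReal C * A.conj t ≤ A.conj (C * t) := by
  have hC0 : 0 ≤ C := by linarith
  rw [conj, ENNReal.mul_iSup]
  refine iSup_le fun τ => ?_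
  refine le_trans ?_ (le_iSup (fun τ : {τ : ℝ // 0 ≤ τ} =>
    ENNReal.ofReal (τ.1 * (C * t)) - A.toFun τ.1) τ)
  rw [ENNReal.mul_sub (by simp), ← ENNReal.ofReal_mul hC0]
  refine tsub_le_tsub (ENNReal.ofReal_le_ofReal (by nlinarith [τ.2])) ?_
  exact le_mul_of_one_le_left (by simp) (by simpa using hC)

theorem conj_measurable_comp (A : YoungFunction) {X : Type*} [MeasurableSpace X] {f : X → ℝ}
    (hf : Measurable f) : Measurable fun x => A.conj (f x) :=
  (Monotone.measurable fun _ _ h => A.conj_mono h).comp hf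

/-- A Young function dominates a linear function up to an additive constant. -/
theorem exists_le_linear (A : YoungFunction) :
    ∃ t₀ C : ℝ, 0 < t₀ ∧ 0 < C ∧ ∀ t, 0 ≤ t → ENNReal.ofReal t ≤
      ENNReal.ofReal t₀ + ENNReal.ofReal C * A.toFun t := by
  obtain ⟨s, t, hs, ht, hne⟩ := A.nonconstant'
  obtain ⟨t₀, ht₀, hA⟩ : ∃ t₀, 0 < t₀ ∧ A.toFun t₀ ≠ 0 := by
    by_contra! h
    exact hne ((h s hs).trans (h t ht).symm)
  rcases eq_or_ne (A.toFun t₀) ⊤ with htop | htop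
  · refine ⟨t₀, 1, ht₀, one_pos, fun r hr => ?_⟩
    rcases le_total r t₀ with h | h
    · exact (ENNReal.ofReal_le_ofReal h).trans le_self_add
    · have : A.toFun r = ⊤ := top_le_iff.1 (htop ▸ A.mono ht₀.le h)
      simp [this]
  · set a := (A.toFun t₀).toReal
    have ha : 0 < a := ENNReal.toReal_pos hA htop
    have haA : ENNReal.ofReal a = A.toFun t₀ := ENNReal.ofReal_toReal htop
    refine ⟨t₀, t₀ / a, ht₀, by positivity, fun r hr => ?_⟩
    rcases le_total r t₀ with h | h
    · exact (ENNReal.ofReal_le_ofReal h).trans le_self_add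
    · refine le_trans ?_ le_add_self
      have h1 := A.mul_le (C := r / t₀) (by rwa [le_div_iff₀ ht₀, one_mul]) ht₀.le
      rw [div_mul_cancel₀ _ ht₀.ne', ← haA, ← ENNReal.ofReal_mul (by positivity)] at h1
      calc ENNReal.ofReal r = ENNReal.ofReal (t₀ / a) * ENNReal.ofReal (r / t₀ * a) := by
            rw [← ENNReal.ofReal_mul (by positivity)]; congr 1; field_simp
        _ ≤ _ := by gcongr

theorem tendsto_zero (A : YoungFunction) (hfin : ∀ t, 0 ≤ t → A.toFun t < ⊤) {ι : Type*}
    {l : Filter ι} {f : ι → ℝ} (hf : Tendsto f l (nhds 0)) (h0 : ∀ i, 0 ≤ f i) :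
    Tendsto (fun i => A.toFun (f i)) l (nhds 0) := by
  have h1 : Tendsto (fun i => ENNReal.ofReal (f i) * A.toFun 1) l (nhds 0) := by
    have := ENNReal.Tendsto.mul_const (b := A.toFun 1) (ENNReal.tendsto_ofReal hf)
      (Or.inr (hfin 1 zero_le_one).ne)
    simpa using this
  refine tendsto_of_tendsto_of_tendsto_of_le_of_le' tendsto_const_nhds h1
    (Eventually.of_forall fun _ => zero_le) ?_
  filter_upwards [hf.eventually (ge_mem_nhds zero_lt_one)] with i hi
  simpa using A.le_smul (h0 i) hi zero_le_one

theorem add_le (A : YoungFunction) {s t : ℝ} (hs : 0 ≤ s) (ht : 0 ≤ t) :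
    A.toFun (s + t) ≤ A.toFun (2 * s) + A.toFun (2 * t) := by
  rcases le_total s t with h | h
  · exact (A.mono (by positivity) (by linarith)).trans le_add_self
  · exact (A.mono (by positivity) (by linarith)).trans le_self_add

/-- A finite Young function has a monotone selection of subgradients. -/
theorem exists_subgradient (A : YoungFunction) (hfin : ∀ t, 0 ≤ t → A.toFun t < ⊤) :
    ∃ b : ℝ → ℝ, MonotoneOn b (Ici 0) ∧ (∀ s, 0 ≤ s → 0 ≤ b s) ∧
      ∀ s, 0 ≤ s → A.toFun s + A.conj (b s) ≤ ENNReal.ofReal (s * b s) := by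
  set φ : ℝ → ℝ := fun t => (A.toFun |t|).toReal with hφ
  have hφA : ∀ t, 0 ≤ t → ENNReal.ofReal (φ t) = A.toFun t := fun t ht => by
    simp only [hφ, abs_of_nonneg ht]
    exact ENNReal.ofReal_toReal (hfin t ht).ne
  have hconv : ConvexOn ℝ univ φ := by
    refine ⟨convex_univ, fun x _ y _ a b ha hb hab => ?_⟩
    have h1 := A.convex' (abs_nonneg x) (abs_nonneg y) ha hb hab
    have h2 : A.toFun |a * x + b * y| ≤ A.toFun (a * |x| + b * |y|) := by
      refine A.mono (abs_nonneg _) ((abs_add_le _ _).trans ?_)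
      rw [abs_mul, abs_mul, abs_of_nonneg ha, abs_of_nonneg hb]
    have h3 := ENNReal.toReal_mono (ENNReal.add_ne_top.2
      ⟨ENNReal.mul_ne_top (by simp) (hfin _ (abs_nonneg x)).ne,
       ENNReal.mul_ne_top (by simp) (hfin _ (abs_nonneg y)).ne⟩) (h2.trans h1)
    rw [ENNReal.toReal_add (ENNReal.mul_ne_top (by simp) (hfin _ (abs_nonneg x)).ne)
      (ENNReal.mul_ne_top (by simp) (hfin _ (abs_nonneg y)).ne)] at h3
    simpa [hφ, ENNReal.toReal_ofReal ha, ENNReal.toReal_ofReal hb] using h3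
  set b : ℝ → ℝ := fun s => derivWithin φ (Ioi s) s with hb
  have hmono : Monotone b := by
    have := hconv.monotoneOn_rightDeriv
    simpa [monotoneOn_univ] using this
  have hsub : ∀ s t, φ s + b s * (t - s) ≤ φ t := by
    intro s t
    rcases lt_trichotomy s t with h | rfl | h
    · have h1 := hconv.rightDeriv_le_slope_of_mem_interior (x := s) (y := t)
        (by simp) (by simp) h
      rw [slope_def_field, le_div_iff₀ (by linarith)] at h1
      simp only [hb]; linarith
    · simp
    · have h1 := (hconv.slope_le_leftDeriv_of_mem_interior (x := t) (y := s)
        (by simp) (by simp) h).trans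
        (hconv.leftDeriv_le_rightDeriv_of_mem_interior (x := s) (by simp))
      rw [slope_def_field, div_le_iff₀ (by linarith)] at h1
      simp only [hb]; nlinarith
  have hφ0 : φ 0 = 0 := by simp [hφ, A.zero']
  have hφnn : ∀ t, 0 ≤ φ t := fun t => ENNReal.toReal_nonneg
  have hb0 : 0 ≤ b 0 := by
      have hd := (hconv.hasDerivWithinAt_rightDeriv_of_mem_interior (x := 0) (by simp))
      have hm : MonotoneOn φ (Ici 0) := fun x hx y hy hxy => by
        simp only [hφ, abs_of_nonneg (show (0:ℝ) ≤ x from hx),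
          abs_of_nonneg (show (0:ℝ) ≤ y from hy)]
        exact ENNReal.toReal_mono (hfin y hy).ne (A.mono hx hxy)
      have := (hasDerivWithinAt_iff_tendsto_slope' (by simp)).1 hd
      refine ge_of_tendsto this ?_
      filter_upwards [self_mem_nhdsWithin] with x hx
      rw [slope_def_field, hφ0]
      have : 0 < x := hx
      have := hφnn x
      simp; positivity
  have hbnn : ∀ s, 0 ≤ s → 0 ≤ b s := fun s hs => hb0.trans (hmono hs)
  refine ⟨b, hmono.monotoneOn _, hbnn, fun s hs => ?_⟩
  have hle : A.conj (b s) ≤ ENNReal.ofReal (s * b s) - A.toFun s := by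
    refine iSup_le fun τ => ?_
    rw [← hφA τ.1 τ.2, ← hφA s hs, ← ENNReal.ofReal_sub _ (hφnn _),
      ← ENNReal.ofReal_sub _ (hφnn _)]
    refine ENNReal.ofReal_le_ofReal ?_
    have := hsub s τ.1
    nlinarith
  have hA : A.toFun s ≤ ENNReal.ofReal (s * b s) := by
    rw [← hφA s hs]
    refine ENNReal.ofReal_le_ofReal ?_
    have := hsub s 0
    rw [hφ0] at this
    nlinarith
  calc _ ≤ A.toFun s + (ENNReal.ofReal (s * b s) - A.toFun s) := by gcongr
    _ = _ := add_tsub_cancel_of_le hA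

end YoungFunction

theorem two_zpow_mono {i j : ℤ} (h : i ≤ j) : (2 : ENNReal) ^ i ≤ 2 ^ j :=
  ENNReal.zpow_le_of_le (by norm_num) h

theorem two_zpow_add (i j : ℤ) : (2 : ENNReal) ^ (i + j) = 2 ^ i * 2 ^ j :=
  ENNReal.zpow_add (by norm_num) (by norm_num) i j

theorem two_zpow_pos (i : ℤ) : (0 : ENNReal) < 2 ^ i :=
  ENNReal.zpow_pos (by norm_num) (by norm_num) i

theorem two_zpow_ne_top (i : ℤ) : (2 : ENNReal) ^ i ≠ ⊤ :=
  (ENNReal.zpow_lt_top (by norm_num) (by norm_num) i).ne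

theorem ofReal_two_zpow (i : ℤ) : ENNReal.ofReal ((2 : ℝ) ^ i) = 2 ^ i := by
  rcases i with n | n
  · simp [ENNReal.ofReal_pow]
  · rw [zpow_negSucc, zpow_negSucc, ENNReal.ofReal_inv_of_pos (by positivity)]
    simp [ENNReal.ofReal_pow]

theorem tsum_inv_two_pow : ∑' i : ℕ, (2⁻¹ : ENNReal) ^ i = 2 := by
  rw [ENNReal.tsum_geometric, ENNReal.one_sub_inv_two, inv_inv]

theorem two_zpow_sub_nat (J : ℤ) (i : ℕ) : (2 : ENNReal) ^ (J - i) = 2 ^ J * 2⁻¹ ^ i := by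
  rw [sub_eq_add_neg, two_zpow_add, ENNReal.zpow_neg, zpow_natCast, ENNReal.inv_pow]

theorem tsum_int_eq_tsum_nat {f : ℤ → ENNReal} {J : ℤ} (h : ∀ j, J < j → f j = 0) :
    ∑' j, f j = ∑' i : ℕ, f (J - i) := by
  refine (Function.Injective.tsum_eq (g := fun i : ℕ => J - i)
    (fun a b h => by simpa using h) fun j hj => ?_).symm
  have : j ≤ J := by
    by_contra! hlt
    exact hj (h j hlt)
  exact ⟨(J - j).toNat, by simp; omega⟩

theorem tsum_two_zpow_le (X : ENNReal) :
    ∑' j : ℤ, (if (2 : ENNReal) ^ j ≤ X then (2 : ENNReal) ^ j else 0) ≤ 2 * X := by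
  rcases eq_or_ne X 0 with rfl | h0
  · have : ∀ j : ℤ, ¬ (2 : ENNReal) ^ j ≤ 0 := fun j => not_le.2 (two_zpow_pos j)
    simp [this]
  rcases eq_or_ne X ⊤ with rfl | htop
  · simp
  obtain ⟨J, hJ1, hJ2⟩ := ENNReal.exists_mem_Ico_zpow h0 htop (y := 2) (by norm_num) (by norm_num)
  rw [tsum_int_eq_tsum_nat (J := J)]
  · calc _ ≤ ∑' i : ℕ, (2 : ENNReal) ^ J * 2⁻¹ ^ i := by
          refine ENNReal.tsum_le_tsum fun i => ?_
          rw [← two_zpow_sub_nat]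
          split_ifs <;> simp
      _ = 2 * 2 ^ J := by rw [ENNReal.tsum_mul_left, tsum_inv_two_pow, mul_comm]
      _ ≤ _ := by gcongr
  · intro j hj
    rw [if_neg (not_le.2 (hJ2.trans_le (two_zpow_mono hj)))]

theorem tsum_nat_half (g : ℕ → ENNReal) : ∑' i : ℕ, g (i / 2) = 2 * ∑' i, g i := by
  rw [← tsum_even_add_odd (f := fun i => g (i / 2)) ENNReal.summable ENNReal.summable, two_mul]
  congr 1
  · simp
  · congr 1; ext k; congr 1; omega

theorem tsum_nat_shift (g : ℕ → ENNReal) (L : ℕ) :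
    ∑' i : ℕ, (if L ≤ i then g (i - L) else 0) = ∑' i, g i := by
  rw [← Function.Injective.tsum_eq (g := fun m : ℕ => m + L) (add_left_injective L)]
  · simp
  · intro i hi
    have : L ≤ i := by
      by_contra! h
      simp [not_le.2 h] at hi
    exact ⟨i - L, by simp; omega⟩

/-- The dyadic region above the interpolating curve between `β` and `α`. -/
def Stair (α β : ℤ → ENNReal) (N k j : ℤ) : Prop :=
  k ≤ N ∧ ∃ L : ℕ, α (k + 2 * L) ≤ 2 ^ (L + j) ∧ β (k + L) ≤ 2 ^ j

/-- The dyadic pairs along the interpolating curve between `β` and `α`. -/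
def StairEdge (α β : ℤ → ENNReal) (N k j : ℤ) : Prop :=
  Stair α β N k j ∧ ¬ Stair α β N (k + 1) (j - 1)

section
variable {α β : ℤ → ENNReal} {N : ℤ}

theorem Stair.mono (hα : Monotone α) (hβ : Monotone β) {k k' j j' : ℤ} (hk : k' ≤ k)
    (hj : j ≤ j') (h : Stair α β N k j) : Stair α β N k' j' := by
  obtain ⟨h1, L, h2, h3⟩ := h
  exact ⟨hk.trans h1, L, (hα (by omega)).trans (h2.trans (two_zpow_mono (by omega))),
    (hβ (by omega)).trans (h3.trans (two_zpow_mono hj))⟩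

open Classical in
theorem tsum_stairEdge_le (hα : Monotone α) (κ : ℤ) :
    ∑' k : ℤ, ∑' j : ℤ, (if StairEdge α β N k j ∧ k ≤ κ + 2 ∧ k < N then (2 : ENNReal) ^ j else 0)
      ≤ 16 * α (κ + 4) + 8 * ∑' m : ℕ, β (κ + 3 - m) := by
  rw [tsum_int_eq_tsum_nat (J := κ + 2)]
  swap
  · intro j hj
    have : ∀ i, ¬ (StairEdge α β N j i ∧ j ≤ κ + 2 ∧ j < N) := fun i h => by omega
    simp [this]
  set X : ℕ → ENNReal := fun i => 2⁻¹ ^ (i / 2) * α (κ + 4) + β (κ + 3 - (i / 2 : ℕ)) with hX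
  have key : ∀ i : ℕ, ∑' j : ℤ, (if StairEdge α β N (κ + 2 - i) j ∧ κ + 2 - (i : ℤ) ≤ κ + 2 ∧
      κ + 2 - (i : ℤ) < N then (2 : ENNReal) ^ j else 0) ≤ 4 * X i := by
    intro i
    calc _ ≤ ∑' j : ℤ, (if (2 : ENNReal) ^ j ≤ 2 * X i then (2 : ENNReal) ^ j else 0) := by
          refine ENNReal.tsum_le_tsum fun j => ?_
          by_cases h : StairEdge α β N (κ + 2 - i) j ∧ κ + 2 - (i : ℤ) ≤ κ + 2 ∧
            κ + 2 - (i : ℤ) < N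
          swap
          · rw [if_neg h]; exact zero_le
          rw [if_pos h, if_pos]
          obtain ⟨⟨-, hn⟩, -, hN⟩ := h
          have hn' : ∀ L : ℕ, ¬ (α (κ + 2 - i + 1 + 2 * L) ≤ 2 ^ ((L : ℤ) + (j - 1)) ∧
              β (κ + 2 - i + 1 + L) ≤ 2 ^ (j - 1)) := fun L hL => hn ⟨by omega, L, hL⟩
          have h1 := hn' ((i + 1) / 2)
          have h2 : (2 : ENNReal) ^ (j - 1) ≤ X i := by
            rw [not_and_or, not_le, not_le] at h1
            rcases h1 with h1 | h1
            · refine le_trans ?_ le_self_add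
              have h3 : α (κ + 2 - i + 1 + 2 * ((i + 1) / 2 : ℕ)) ≤ α (κ + 4) :=
                hα (by push_cast; omega)
              have h4 := (h1.trans_le h3).le
              have h5 : (2 : ENNReal) ^ (j - 1) = 2⁻¹ ^ ((i + 1) / 2) *
                  2 ^ ((((i + 1) / 2 : ℕ) : ℤ) + (j - 1)) := by
                rw [two_zpow_add, zpow_natCast, ← mul_assoc, ← mul_pow,
                  ENNReal.inv_mul_cancel (by norm_num) (by norm_num), one_pow, one_mul]
              rw [h5]
              refine mul_le_mul ?_ h4 zero_le zero_le
              exact pow_le_pow_of_le_one zero_le (by simp) (by omega)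
            · refine le_trans (h1.le.trans (le_of_eq ?_)) le_add_self
              congr 1; push_cast; omega
          calc (2 : ENNReal) ^ j = 2 * 2 ^ (j - 1) := by
                conv_lhs => rw [show j = 1 + (j - 1) by ring, two_zpow_add, zpow_one]
            _ ≤ _ := by gcongr
      _ ≤ 2 * (2 * X i) := tsum_two_zpow_le _
      _ = 4 * X i := by rw [← mul_assoc]; norm_num
  refine (ENNReal.tsum_le_tsum key).trans ?_
  rw [ENNReal.tsum_mul_left, ENNReal.tsum_add, tsum_nat_half (fun i => 2⁻¹ ^ i * α (κ + 4)),
    tsum_nat_half (fun i => β (κ + 3 - i)), ENNReal.tsum_mul_right, tsum_inv_two_pow]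
  apply le_of_eq
  ring

open Classical in
theorem tsum_stair_le {a' b' : ℤ → ENNReal} (hb' : Monotone b')
    (h1 : ∀ k j, α k ≤ 2 ^ j → 2 ^ k ≤ 2 * a' (j + 1))
    (h2 : ∀ k j, β k ≤ 2 ^ j → 2 ^ k ≤ 2 * b' (j + 1)) (J : ℤ) :
    ∑' j : ℤ, ∑' k : ℤ, (if Stair α β N k j ∧ j ≤ J + 2 then (2 : ENNReal) ^ k else 0)
      ≤ 8 * ∑' m : ℕ, a' (J + 3 - m) + 8 * b' (J + 3) := by
  rw [tsum_int_eq_tsum_nat (J := J + 2)]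
  swap
  · intro j hj
    have : ∀ k, ¬ (Stair α β N k j ∧ j ≤ J + 2) := fun i h => by omega
    simp [this]
  set Y : ℕ → ℕ → ENNReal := fun i L =>
    (if L ≤ i then 2 * 2⁻¹ ^ L * a' (J + 3 - (i - L : ℕ)) else 0) +
    (if i + 1 ≤ L then 2⁻¹ ^ i * (2⁻¹ ^ (L - (i + 1)) * b' (J + 3)) else 0) with hY
  have hstep : ∀ (k : ℤ) (L : ℕ) (Z : ENNReal), (2 : ENNReal) ^ (k + L) ≤ Z →
      (2 : ENNReal) ^ k ≤ 2⁻¹ ^ L * Z := by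
    intro k L Z h
    calc (2 : ENNReal) ^ k = 2⁻¹ ^ L * 2 ^ (k + L) := by
          rw [two_zpow_add, zpow_natCast, mul_comm, mul_assoc, ← mul_pow,
            ENNReal.mul_inv_cancel (by norm_num) (by norm_num), one_pow, mul_one]
      _ ≤ _ := by gcongr
  have key : ∀ i : ℕ, ∑' k : ℤ, (if Stair α β N k (J + 2 - i) ∧ J + 2 - (i : ℤ) ≤ J + 2
      then (2 : ENNReal) ^ k else 0) ≤ 2 * ∑' L, Y i L := by
    intro i
    calc _ ≤ ∑' k : ℤ, ∑' L : ℕ,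
            (if (2 : ENNReal) ^ k ≤ Y i L then (2 : ENNReal) ^ k else 0) := by
          refine ENNReal.tsum_le_tsum fun k => ?_
          by_cases h : Stair α β N k (J + 2 - i) ∧ J + 2 - (i : ℤ) ≤ J + 2
          swap
          · rw [if_neg h]; exact zero_le
          rw [if_pos h]
          obtain ⟨⟨-, L, hL1, hL2⟩, -⟩ := h
          refine le_trans ?_ (ENNReal.le_tsum L)
          rw [if_pos]
          by_cases hLi : L ≤ i
          · simp only [hY, if_pos hLi]
            refine le_trans ?_ le_self_add
            have h3 := h1 _ _ hL1
            have h4 := hstep k L (2 * a' (J + 3 - (i - L : ℕ))) ?_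
            · exact h4.trans (le_of_eq (by ring))
            · refine (two_zpow_mono (by omega)).trans (h3.trans (le_of_eq ?_))
              congr 2; omega
          · simp only [hY, if_neg hLi, if_pos (show i + 1 ≤ L by omega), zero_add]
            have h3 := hstep k L _ (h2 _ _ hL2)
            refine h3.trans ?_
            have h4 : b' (J + 2 - i + 1) ≤ b' (J + 3) := hb' (by omega)
            calc _ ≤ 2⁻¹ ^ L * (2 * b' (J + 3)) := by gcongr
              _ = _ := by
                conv_lhs => rw [show L = i + 1 + (L - (i + 1)) by omega, pow_add, pow_succ]
                have : (2⁻¹ : ENNReal) * 2 = 1 :=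
                  ENNReal.inv_mul_cancel (by norm_num) (by norm_num)
                calc _ = (2⁻¹ * 2) * (2⁻¹ ^ i * (2⁻¹ ^ (L - (i + 1)) * b' (J + 3))) := by ring
                  _ = _ := by rw [this, one_mul]
      _ = ∑' L : ℕ, ∑' k : ℤ, (if (2 : ENNReal) ^ k ≤ Y i L then (2 : ENNReal) ^ k else 0) :=
          ENNReal.tsum_comm
      _ ≤ ∑' L, 2 * Y i L := ENNReal.tsum_le_tsum fun L => tsum_two_zpow_le _
      _ = _ := ENNReal.tsum_mul_left
  refine (ENNReal.tsum_le_tsum key).trans ?_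
  rw [ENNReal.tsum_mul_left]
  have e1 : ∑' i : ℕ, ∑' L : ℕ, (if L ≤ i then 2 * 2⁻¹ ^ L * a' (J + 3 - (i - L : ℕ)) else 0)
      = 4 * ∑' m : ℕ, a' (J + 3 - m) := by
    rw [ENNReal.tsum_comm]
    calc _ = ∑' L : ℕ, ∑' m : ℕ, 2 * 2⁻¹ ^ L * a' (J + 3 - m) := by
          congr 1; ext L
          exact tsum_nat_shift (fun m : ℕ => 2 * 2⁻¹ ^ L * a' (J + 3 - m)) L
      _ = ∑' L : ℕ, 2⁻¹ ^ L * (2 * ∑' m : ℕ, a' (J + 3 - m)) := by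
          congr 1; ext L; rw [ENNReal.tsum_mul_left]; ring
      _ = _ := by rw [ENNReal.tsum_mul_right, tsum_inv_two_pow]; ring
  have e2 : ∑' i : ℕ, ∑' L : ℕ,
      (if i + 1 ≤ L then (2⁻¹ : ENNReal) ^ i * (2⁻¹ ^ (L - (i + 1)) * b' (J + 3)) else 0)
      = 4 * b' (J + 3) := by
    calc _ = ∑' i : ℕ, (2⁻¹ : ENNReal) ^ i * (2 * b' (J + 3)) := by
          congr 1; ext i
          rw [tsum_nat_shift (fun m : ℕ => (2⁻¹ : ENNReal) ^ i * (2⁻¹ ^ m * b' (J + 3))) (i + 1),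
            ENNReal.tsum_mul_left, ENNReal.tsum_mul_right, tsum_inv_two_pow]
      _ = _ := by rw [ENNReal.tsum_mul_right, tsum_inv_two_pow]; ring
  have e3 : ∑' i : ℕ, ∑' L, Y i L = 4 * ∑' m : ℕ, a' (J + 3 - m) + 4 * b' (J + 3) := by
    simp only [hY, ENNReal.tsum_add]
    rw [e1, e2]
  rw [e3]
  apply le_of_eq; ring

/-- Every pair is covered by an edge pair, in one of the two directions. -/
theorem exists_stairEdge (hα : Monotone α) (hβ : Monotone β) {k j : ℤ} (hk : k ≤ N)
    (hfa : α k ≠ ⊤) (hfb : β k ≠ ⊤) :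
    (∃ k', k ≤ k' ∧ StairEdge α β N k' j) ∨ (∃ j', j ≤ j' ∧ StairEdge α β N k j') := by
  by_cases h : Stair α β N k j
  · left
    obtain ⟨m, hm, hmax⟩ := Int.exists_greatest_of_bdd (P := fun m => Stair α β N m j)
      ⟨N, fun z hz => hz.1⟩ ⟨k, h⟩
    refine ⟨m, hmax k h, hm, fun h' => ?_⟩
    have := hmax _ (h'.mono hα hβ le_rfl (show j - 1 ≤ j by omega))
    omega
  · right
    have hex : ∃ z, Stair α β N k z := by
      obtain ⟨n, hn⟩ := ENNReal.exists_nat_gt (ENNReal.add_ne_top.2 ⟨hfa, hfb⟩)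
      have h3 : α k + β k ≤ (2 : ENNReal) ^ (n : ℤ) := by
        refine hn.le.trans ?_
        rw [zpow_natCast]
        exact_mod_cast n.lt_two_pow_self.le
      exact ⟨n, hk, 0, by simpa using le_self_add.trans h3, by simpa using le_add_self.trans h3⟩
    obtain ⟨m, hm, hmin⟩ := Int.exists_least_of_bdd (P := fun m => Stair α β N k m)
      ⟨j, fun z hz => by
        by_contra! hlt
        exact h (hz.mono hα hβ le_rfl hlt.le)⟩ hex
    refine ⟨m, ?_, hm, fun h' => ?_⟩
    · by_contra! hlt
      exact h (hm.mono hα hβ le_rfl hlt.le)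
    · have := hmin _ (h'.mono hα hβ (show k ≤ k + 1 by omega) le_rfl)
      omega

end

/-- Functions `Φ` with `C Φ(t) ≤ Φ(C t)` for `C ≥ 1`. -/
def SuperHomogeneous (Φ : ℝ → ENNReal) : Prop :=
  ∀ C t : ℝ, 1 ≤ C → 0 ≤ t → ENNReal.ofReal C * Φ t ≤ Φ (C * t)

/-- The slopes `Φ(2^k) / 2^k`. -/
noncomputable def dyadicSlope (Φ : ℝ → ENNReal) (k : ℤ) : ENNReal :=
  Φ ((2 : ℝ) ^ k) / 2 ^ k

theorem YoungFunction.superHomogeneous (A : YoungFunction) : SuperHomogeneous A.toFun :=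
  fun _ _ hC ht => A.mul_le hC ht

theorem YoungFunction.superHomogeneous_conj (A : YoungFunction) : SuperHomogeneous A.conj :=
  fun _ t hC _ => A.conj_mul_le hC t

theorem dyadicSlope_mul (Φ : ℝ → ENNReal) (k : ℤ) :
    2 ^ k * dyadicSlope Φ k = Φ ((2 : ℝ) ^ k) :=
  ENNReal.mul_div_cancel (two_zpow_pos k).ne' (two_zpow_ne_top k)

namespace SuperHomogeneous
variable {Φ : ℝ → ENNReal}

theorem mono (h : SuperHomogeneous Φ) {s t : ℝ} (hs : 0 < s) (hst : s ≤ t) : Φ s ≤ Φ t := by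
  have h1 : 1 ≤ t / s := (one_le_div hs).2 hst
  have := h (t / s) s h1 hs.le
  rw [div_mul_cancel₀ _ hs.ne'] at this
  refine le_trans ?_ this
  exact le_mul_of_one_le_left zero_le (by simpa using h1)

theorem dyadicSlope_monotone (h : SuperHomogeneous Φ) : Monotone (dyadicSlope Φ) := by
  intro i j hij
  have h1 := h ((2 : ℝ) ^ (j - i)) ((2 : ℝ) ^ i) (one_le_zpow₀ (by norm_num) (by omega))
    (by positivity)
  rw [← zpow_add₀ (by norm_num), sub_add_cancel, ofReal_two_zpow] at h1
  unfold dyadicSlope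
  rw [ENNReal.le_div_iff_mul_le (Or.inl (two_zpow_pos j).ne') (Or.inl (two_zpow_ne_top j))]
  refine le_trans (le_of_eq ?_) h1
  conv_lhs => rw [show j = (j - i) + i by ring, two_zpow_add]
  rw [mul_comm, mul_assoc, ENNReal.mul_div_cancel (two_zpow_pos i).ne' (two_zpow_ne_top i)]

theorem tsum_dyadicSlope_le (h : SuperHomogeneous Φ) (κ : ℤ) :
    ∑' m : ℕ, dyadicSlope Φ (κ - m) ≤
      4 * ∫⁻ s in Ioo (0 : ℝ) (2 ^ (κ + 1)), Φ s / ENNReal.ofReal (s ^ 2) := by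
  set I : ℕ → Set ℝ := fun m => Ioo ((2 : ℝ) ^ (κ - m)) (2 ^ (κ - m + 1)) with hI
  have hsub : (⋃ m, I m) ⊆ Ioo (0 : ℝ) (2 ^ (κ + 1)) := by
    refine iUnion_subset fun m x hx => ⟨lt_trans (by positivity) hx.1, hx.2.trans_le ?_⟩
    exact zpow_le_zpow_right₀ (by norm_num) (by omega)
  have hdisj : Pairwise (Function.onFun Disjoint I) := by
    have : ∀ m n, m < n → Disjoint (I m) (I n) := by
      intro m n hmn
      rw [Set.disjoint_left]
      intro x hx hx'
      have : (2 : ℝ) ^ (κ - n + 1) ≤ 2 ^ (κ - m) :=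
        zpow_le_zpow_right₀ (by norm_num) (by omega)
      exact absurd (hx.1.trans (hx'.2.trans_le this)) (lt_irrefl _)
    intro m n hmn
    rcases lt_or_gt_of_ne hmn with h | h
    · exact this _ _ h
    · exact (this _ _ h).symm
  calc ∑' m : ℕ, dyadicSlope Φ (κ - m)
      ≤ ∑' m : ℕ, 4 * ∫⁻ s in I m, Φ s / ENNReal.ofReal (s ^ 2) := by
        refine ENNReal.tsum_le_tsum fun m => ?_
        set i : ℤ := κ - m
        have h1 : ∀ s ∈ I m, Φ ((2 : ℝ) ^ i) / (4 * (2 ^ i * 2 ^ i)) ≤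
            Φ s / ENNReal.ofReal (s ^ 2) := by
          intro s hs
          refine ENNReal.div_le_div (h.mono (by positivity) hs.1.le) ?_
          have h0 : 0 < s := lt_trans (by positivity) hs.1
          calc ENNReal.ofReal (s ^ 2) ≤ ENNReal.ofReal ((2 ^ (i + 1)) ^ 2) := by
                gcongr; exact hs.2.le
            _ = 4 * (2 ^ i * 2 ^ i) := by
                rw [ENNReal.ofReal_pow (by positivity), ofReal_two_zpow, two_zpow_add, zpow_one]
                ring
        have h2 := setLIntegral_mono' (μ := volume) measurableSet_Ioo h1
        rw [setLIntegral_const, Real.volume_Ioo] at h2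
        have h3 : (2 : ℝ) ^ (i + 1) - 2 ^ i = 2 ^ i := by
          rw [zpow_add₀ (by norm_num), zpow_one]; ring
        rw [h3, ofReal_two_zpow] at h2
        refine le_trans (le_of_eq ?_) (mul_le_mul_right h2 4)
        have hp := (two_zpow_pos i).ne'
        have ht := two_zpow_ne_top i
        unfold dyadicSlope
        rw [div_eq_mul_inv, div_eq_mul_inv, ENNReal.mul_inv (by simp) (by simp),
          ENNReal.mul_inv (by simp [hp]) (by simp [ht])]
        calc Φ (2 ^ i) * (2 ^ i)⁻¹ = Φ (2 ^ i) * (2 ^ i)⁻¹ * 1 * 1 := by simp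
          _ = Φ (2 ^ i) * (2 ^ i)⁻¹ * (4 * 4⁻¹) * (2 ^ i * (2 ^ i)⁻¹) := by
            rw [ENNReal.mul_inv_cancel (by norm_num) (by norm_num), ENNReal.mul_inv_cancel hp ht]
          _ = _ := by ring
    _ = 4 * ∫⁻ s in ⋃ m, I m, Φ s / ENNReal.ofReal (s ^ 2) := by
        rw [ENNReal.tsum_mul_left, lintegral_iUnion (fun m => measurableSet_Ioo) hdisj]
    _ ≤ _ := by gcongr

theorem nat_mul_le (h : SuperHomogeneous Φ) (n : ℕ) (hn : 1 ≤ n) {t : ℝ} (ht : 0 ≤ t) :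
    n * Φ t ≤ Φ (n * t) := by
  have := h n t (by exact_mod_cast hn) ht
  simpa using this

theorem tsum_dyadicSlope_le' (h : SuperHomogeneous Φ) {Ψ : ℝ → ENNReal} {K : ℝ}
    (hK : ∀ t : ℝ, 0 < t → (∫⁻ s in Ioo (0 : ℝ) t, Φ s / ENNReal.ofReal (s ^ 2))
      ≤ Ψ (K * t) / ENNReal.ofReal t) (κ : ℤ) :
    2 ^ (κ + 1) * ∑' m : ℕ, dyadicSlope Φ (κ - m) ≤ 4 * Ψ (K * 2 ^ (κ + 1)) := by
  calc _ ≤ 2 ^ (κ + 1) * (4 * (Ψ (K * 2 ^ (κ + 1)) / ENNReal.ofReal (2 ^ (κ + 1)))) := by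
        gcongr
        exact (h.tsum_dyadicSlope_le κ).trans (by gcongr; exact hK _ (by positivity))
    _ = _ := by
        rw [ofReal_two_zpow, mul_left_comm,
          ENNReal.mul_div_cancel (two_zpow_pos _).ne' (two_zpow_ne_top _)]

end SuperHomogeneous

theorem YoungFunction.dyadicSlope_young (A : YoungFunction) (k j : ℤ)
    (h : dyadicSlope A.toFun k ≤ 2 ^ j) : (2 : ENNReal) ^ k ≤ 2 * dyadicSlope A.conj (j + 1) := by
  have h1 := A.young (s := (2 : ℝ) ^ k) (by positivity) (2 ^ (j + 1))
  rw [ENNReal.ofReal_mul (by positivity), ofReal_two_zpow, ofReal_two_zpow,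
    ← dyadicSlope_mul A.toFun k, ← dyadicSlope_mul A.conj (j + 1)] at h1
  have h2 : (2 : ENNReal) ^ k * 2 ^ j + 2 ^ k * 2 ^ j ≤
      2 ^ k * 2 ^ j + 2 ^ (j + 1) * dyadicSlope A.conj (j + 1) := by
    calc _ = (2 : ENNReal) ^ k * 2 ^ (j + 1) := by rw [two_zpow_add j, zpow_one]; ring
      _ ≤ _ := h1.trans (by gcongr)
  have h3 := (ENNReal.add_le_add_iff_left
    (ENNReal.mul_ne_top (two_zpow_ne_top k) (two_zpow_ne_top j))).1 h2
  rw [two_zpow_add, zpow_one, mul_comm, mul_assoc] at h3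
  exact (ENNReal.mul_le_mul_iff_right (two_zpow_pos j).ne' (two_zpow_ne_top j)).1 h3

theorem exists_dyadic {u : ℝ} (hu : 0 < u) : ∃ κ : ℤ, (2 : ℝ) ^ κ ≤ 2 * u ∧ u ≤ 2 ^ κ := by
  obtain ⟨n, h1, h2⟩ := exists_mem_Ico_zpow hu (y := 2) (by norm_num)
  refine ⟨n + 1, ?_, h2.le⟩
  rw [zpow_add₀ (by norm_num), zpow_one]; linarith

open Classical in
/-- The dyadic boxes along the interpolating curve have controlled total cost. -/
theorem exists_tsum_stairEdge_le (A B : YoungFunction) {K : ℝ}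
    (hK : ∀ t : ℝ, 0 < t →
        (∫⁻ s in Set.Ioo (0 : ℝ) t, B.toFun s / ENNReal.ofReal (s ^ 2))
            ≤ A.toFun (K * t) / ENNReal.ofReal t ∧
        (∫⁻ s in Set.Ioo (0 : ℝ) t, A.conj s / ENNReal.ofReal (s ^ 2))
            ≤ B.conj (K * t) / ENNReal.ofReal t) (hK1 : 1 ≤ K) (N : ℤ) {u v : ℝ}
    (hu : 0 ≤ u) (hv : 0 ≤ v) (huN : u ≤ 2 ^ (N - 3)) :
    ∑' k : ℤ, ∑' j : ℤ,
      (if StairEdge (dyadicSlope A.toFun) (dyadicSlope B.toFun) N k j then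
        2 ^ k * ENNReal.ofReal (v - 2 ^ (j - 3)) + 2 ^ j * ENNReal.ofReal (u - 2 ^ (k - 3)) else 0)
      ≤ A.toFun (96 * K * u) + B.conj (96 * K * v) := by
  set α := dyadicSlope A.toFun with hα
  set β := dyadicSlope B.toFun with hβ
  have hsplit : ∀ k j : ℤ, (if StairEdge α β N k j then
        2 ^ k * ENNReal.ofReal (v - 2 ^ (j - 3)) + 2 ^ j * ENNReal.ofReal (u - 2 ^ (k - 3)) else 0)
      = (if StairEdge α β N k j then 2 ^ j * ENNReal.ofReal (u - 2 ^ (k - 3)) else 0) +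
        (if StairEdge α β N k j then 2 ^ k * ENNReal.ofReal (v - 2 ^ (j - 3)) else 0) := by
    intro k j; split_ifs <;> simp [add_comm]
  simp only [hsplit, ENNReal.tsum_add]
  refine add_le_add ?_ ?_
  · rcases hu.eq_or_lt with rfl | hu
    · have : ∀ k : ℤ, ENNReal.ofReal (0 - 2 ^ (k - 3)) = 0 := fun k =>
        ENNReal.ofReal_of_nonpos (by have : (0 : ℝ) < 2 ^ (k - 3) := by positivity
                                     linarith)
      simp only [this, mul_zero, ite_self, tsum_zero, zero_le]
    obtain ⟨κ, h1, h2⟩ := exists_dyadic hu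
    have h2' : ENNReal.ofReal u ≤ 2 ^ κ := by
      rw [← ofReal_two_zpow]; exact ENNReal.ofReal_le_ofReal h2
    calc _ ≤ ∑' k : ℤ, ∑' j : ℤ, 2 ^ κ *
          (if StairEdge α β N k j ∧ k ≤ κ + 2 ∧ k < N then (2 : ENNReal) ^ j else 0) := by
          refine ENNReal.tsum_le_tsum fun k => ENNReal.tsum_le_tsum fun j => ?_
          by_cases hE : StairEdge α β N k j
          swap
          · simp [hE]
          rw [if_pos hE]
          by_cases hk : u ≤ 2 ^ (k - 3)
          · rw [ENNReal.ofReal_of_nonpos (by linarith)]; simp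
          push Not at hk
          rw [if_pos, mul_comm]
          · gcongr
            exact (ENNReal.ofReal_le_ofReal (sub_le_self u (by positivity))).trans h2'
          · refine ⟨hE, ?_, ?_⟩
            · have := (zpow_lt_zpow_iff_right₀ (by norm_num : (1 : ℝ) < 2)).1 (hk.trans_le h2)
              omega
            · have := (zpow_lt_zpow_iff_right₀ (by norm_num : (1 : ℝ) < 2)).1 (hk.trans_le huN)
              omega
      _ ≤ 2 ^ κ * (16 * α (κ + 4) + 8 * ∑' m : ℕ, β (κ + 3 - m)) := by
          simp_rw [ENNReal.tsum_mul_left]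
          gcongr
          exact tsum_stairEdge_le A.superHomogeneous.dyadicSlope_monotone κ
      _ ≤ A.toFun (2 ^ (κ + 4)) + 2 * A.toFun (K * 2 ^ (κ + 4)) := by
          have h3 := B.superHomogeneous.tsum_dyadicSlope_le' (fun t ht => (hK t ht).1) (κ + 3)
          rw [show κ + 3 + 1 = κ + 4 by ring] at h3
          have h4 := dyadicSlope_mul A.toFun (κ + 4)
          rw [← h4, mul_add]
          have h5 : (2 : ENNReal) ^ (κ + 4) = 2 ^ κ * 16 := by
            rw [two_zpow_add]; norm_num
          refine add_le_add (le_of_eq ?_) ?_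
          · rw [h5]; ring
          · have h6 : (2 : ENNReal) * (2 ^ κ * (8 * ∑' m : ℕ, β (κ + 3 - m))) ≤
                2 * (2 * A.toFun (K * 2 ^ (κ + 4))) := by
              refine le_trans (le_of_eq ?_) (h3.trans (le_of_eq ?_))
              · rw [h5]; ring
              · rw [← mul_assoc]; norm_num
            exact (ENNReal.mul_le_mul_iff_right (by norm_num) (by norm_num)).1 h6
      _ ≤ 3 * A.toFun (32 * K * u) := by
          have h3 : K * 2 ^ (κ + 4) ≤ 32 * K * u := by
            rw [zpow_add₀ (by norm_num)]; nlinarith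
          have h4 : (2 : ℝ) ^ (κ + 4) ≤ 32 * K * u := by
            refine le_trans (le_mul_of_one_le_left (by positivity) hK1) h3
          calc _ ≤ A.toFun (32 * K * u) + 2 * A.toFun (32 * K * u) := by
                gcongr
                · exact A.mono (by positivity) h4
                · exact A.mono (by positivity) h3
            _ = _ := by ring
      _ ≤ _ := by
          refine (A.superHomogeneous.nat_mul_le 3 (by norm_num) (by positivity)).trans
            (le_of_eq ?_)
          congr 1; push_cast; ring
  · rcases hv.eq_or_lt with rfl | hv
    · have : ∀ k : ℤ, ENNReal.ofReal (0 - 2 ^ (k - 3)) = 0 := fun k =>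
        ENNReal.ofReal_of_nonpos (by have : (0 : ℝ) < 2 ^ (k - 3) := by positivity
                                     linarith)
      simp only [this, mul_zero, ite_self, tsum_zero, zero_le]
    obtain ⟨J, h1, h2⟩ := exists_dyadic hv
    have h2' : ENNReal.ofReal v ≤ 2 ^ J := by
      rw [← ofReal_two_zpow]; exact ENNReal.ofReal_le_ofReal h2
    rw [ENNReal.tsum_comm]
    calc _ ≤ ∑' j : ℤ, ∑' k : ℤ, 2 ^ J *
          (if Stair α β N k j ∧ j ≤ J + 2 then (2 : ENNReal) ^ k else 0) := by
          refine ENNReal.tsum_le_tsum fun j => ENNReal.tsum_le_tsum fun k => ?_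
          by_cases hE : StairEdge α β N k j
          swap
          · simp [hE]
          rw [if_pos hE]
          by_cases hk : v ≤ 2 ^ (j - 3)
          · rw [ENNReal.ofReal_of_nonpos (by linarith)]; simp
          push Not at hk
          rw [if_pos, mul_comm]
          · gcongr
            exact (ENNReal.ofReal_le_ofReal (sub_le_self v (by positivity))).trans h2'
          · refine ⟨hE.1, ?_⟩
            have := (zpow_lt_zpow_iff_right₀ (by norm_num : (1 : ℝ) < 2)).1 (hk.trans_le h2)
            omega
      _ ≤ 2 ^ J * (8 * ∑' m : ℕ, dyadicSlope A.conj (J + 3 - m) +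
            8 * dyadicSlope B.conj (J + 3)) := by
          simp_rw [ENNReal.tsum_mul_left]
          gcongr
          exact tsum_stair_le B.superHomogeneous_conj.dyadicSlope_monotone
            A.dyadicSlope_young B.dyadicSlope_young J
      _ ≤ 2 * B.conj (K * 2 ^ (J + 4)) + B.conj (2 ^ (J + 3)) := by
          have h3 := A.superHomogeneous_conj.tsum_dyadicSlope_le' (fun t ht => (hK t ht).2) (J + 3)
          rw [show J + 3 + 1 = J + 4 by ring] at h3
          have h4 := dyadicSlope_mul B.conj (J + 3)
          rw [← h4, mul_add]
          have h5 : (2 : ENNReal) ^ (J + 4) = 2 ^ J * 16 := by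
            rw [two_zpow_add]; norm_num
          have h5' : (2 : ENNReal) ^ (J + 3) = 2 ^ J * 8 := by
            rw [two_zpow_add]; norm_num
          refine add_le_add ?_ (le_of_eq ?_)
          · have h6 : (2 : ENNReal) * (2 ^ J * (8 * ∑' m : ℕ, dyadicSlope A.conj (J + 3 - m))) ≤
                2 * (2 * B.conj (K * 2 ^ (J + 4))) := by
              refine le_trans (le_of_eq ?_) (h3.trans (le_of_eq ?_))
              · rw [h5]; ring
              · rw [← mul_assoc]; norm_num
            exact (ENNReal.mul_le_mul_iff_right (by norm_num) (by norm_num)).1 h6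
          · rw [h5']; ring
      _ ≤ 3 * B.conj (32 * K * v) := by
          have h3 : K * 2 ^ (J + 4) ≤ 32 * K * v := by
            rw [zpow_add₀ (by norm_num)]; nlinarith
          have h4 : (2 : ℝ) ^ (J + 3) ≤ 32 * K * v := by
            refine le_trans ?_ h3
            refine le_trans (zpow_le_zpow_right₀ (by norm_num) (by omega))
              (le_mul_of_one_le_left (by positivity) hK1)
          calc _ ≤ 2 * B.conj (32 * K * v) + B.conj (32 * K * v) := by
                gcongr
                · exact B.conj_mono h3
                · exact B.conj_mono h4
            _ = _ := by ring
      _ ≤ _ := by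
          refine (B.superHomogeneous_conj.nat_mul_le 3 (by norm_num) (by positivity)).trans
            (le_of_eq ?_)
          congr 1; push_cast; ring

/-- Bounded nonnegative measurable functions supported in `[-R, R]`. -/
structure BoundedBump (f : ℝ → ℝ) (M R : ℝ) : Prop where
  meas : Measurable f
  nonneg : ∀ t, 0 ≤ f t
  le : ∀ t, f t ≤ M
  supp : ∀ t, R < |t| → f t = 0

/-- Moments of the Cauchy kernel, `∫ f(t) (z - t)^{-n} dt`. -/
noncomputable def cauchyPow (f : ℝ → ℝ) (n : ℕ) (z : ℂ) : ℂ :=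
  ∫ t : ℝ, (f t : ℂ) * ((z - t)⁻¹) ^ n

/-- The normalized Cauchy transform on the upper half-plane. -/
noncomputable def cauchyTr (f : ℝ → ℝ) (z : ℂ) : ℂ := (Real.pi : ℂ)⁻¹ * cauchyPow f 1 z

noncomputable def cauchyTr' (f : ℝ → ℝ) (z : ℂ) : ℂ := -((Real.pi : ℂ)⁻¹ * cauchyPow f 2 z)

noncomputable def cauchyTr'' (f : ℝ → ℝ) (z : ℂ) : ℂ := 2 * ((Real.pi : ℂ)⁻¹ * cauchyPow f 3 z)

theorem norm_inv_sub_ofReal_le {z : ℂ} (hz : 0 < z.im) (t : ℝ) : ‖(z - t)⁻¹‖ ≤ z.im⁻¹ := by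
  rw [norm_inv]
  refine inv_anti₀ hz ?_
  have := Complex.abs_im_le_norm (z - t)
  simp only [Complex.sub_im, Complex.ofReal_im, sub_zero] at this
  exact (le_abs_self _).trans this

theorem measurable_cauchy_integrand {f : ℝ → ℝ} (hf : Measurable f) (n : ℕ) (z : ℂ) :
    Measurable fun t : ℝ => (f t : ℂ) * ((z - t)⁻¹) ^ n := by
  have : Measurable fun t : ℝ => (f t : ℂ) := Complex.measurable_ofReal.comp hf
  have h2 : Measurable fun t : ℝ => z - (t : ℂ) := by fun_prop
  exact this.mul (h2.inv.pow_const n)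

namespace BoundedBump
variable {f : ℝ → ℝ} {M R : ℝ}

theorem integrable (hf : BoundedBump f M R) : Integrable f := by
  have h1 : IntegrableOn f (Icc (-R) R) := by
    refine Measure.integrableOn_of_bounded (M := M) (by simp) hf.meas.aestronglyMeasurable ?_
    exact ae_of_all _ fun t => by
      rw [Real.norm_eq_abs, abs_of_nonneg (hf.nonneg t)]; exact hf.le t
  rw [← integrable_indicator_iff measurableSet_Icc] at h1
  refine h1.congr (ae_of_all _ fun t => ?_)
  by_cases ht : t ∈ Icc (-R) R
  · rw [indicator_of_mem ht]
  · rw [indicator_of_notMem ht]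
    refine (hf.supp t ?_).symm
    by_contra! h
    exact ht (abs_le.1 h)

theorem integrable_cauchyPow (hf : BoundedBump f M R) (n : ℕ) {z : ℂ} (hz : 0 < z.im) :
    Integrable fun t : ℝ => (f t : ℂ) * ((z - t)⁻¹) ^ n := by
  refine Integrable.mono' (hf.integrable.mul_const ((z.im⁻¹) ^ n))
    (measurable_cauchy_integrand hf.meas n z).aestronglyMeasurable (ae_of_all _ fun t => ?_)
  rw [norm_mul, Complex.norm_real, Real.norm_eq_abs, abs_of_nonneg (hf.nonneg t), norm_pow]
  gcongr
  · exact hf.nonneg t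
  · exact norm_inv_sub_ofReal_le hz t

theorem hasDerivAt_cauchyPow (hf : BoundedBump f M R) (n : ℕ) {z : ℂ} (hz : 0 < z.im) :
    HasDerivAt (cauchyPow f n) (-(n : ℂ) * cauchyPow f (n + 1) z) z := by
  have hs : {w : ℂ | z.im / 2 < w.im} ∈ nhds z :=
    (isOpen_lt continuous_const Complex.continuous_im).mem_nhds (by simp; linarith)
  have key := (hasDerivAt_integral_of_dominated_loc_of_deriv_le (μ := volume)
    (F := fun (w : ℂ) (t : ℝ) => (f t : ℂ) * ((w - t)⁻¹) ^ n)
    (F' := fun (w : ℂ) (t : ℝ) => -(n : ℂ) * ((f t : ℂ) * ((w - t)⁻¹) ^ (n + 1)))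
    (x₀ := z) (bound := fun t => n * (f t * ((z.im / 2)⁻¹) ^ (n + 1))) hs ?_
    (hf.integrable_cauchyPow n hz) ?_ ?_ ?_ ?_).2
  · rw [integral_const_mul] at key
    exact key
  · exact Eventually.of_forall fun w =>
      (measurable_cauchy_integrand hf.meas n w).aestronglyMeasurable
  · exact ((measurable_cauchy_integrand hf.meas (n + 1) z).const_mul _).aestronglyMeasurable
  · refine ae_of_all _ fun t w hw => ?_
    simp only [mem_ofPred_eq] at hw
    have hw0 : 0 < w.im := by linarith
    rw [norm_mul, norm_neg, Complex.norm_natCast, norm_mul, Complex.norm_real, Real.norm_eq_abs,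
      abs_of_nonneg (hf.nonneg t), norm_pow]
    gcongr
    · exact hf.nonneg t
    · exact (norm_inv_sub_ofReal_le hw0 t).trans (inv_anti₀ (by linarith) hw.le)
  · exact (hf.integrable.mul_const _).const_mul _
  · refine ae_of_all _ fun t w hw => ?_
    simp only [mem_ofPred_eq] at hw
    have hne : w - t ≠ 0 := by
      intro h
      have := congrArg Complex.im h
      simp at this
      linarith
    have h1 : HasDerivAt (fun w : ℂ => w - t) 1 w := (hasDerivAt_id w).sub_const _
    have h2 := ((h1.inv hne).pow n).const_mul (f t : ℂ)
    refine h2.congr_deriv ?_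
    rcases n with _ | n
    · simp
    · simp only [Pi.inv_apply, Nat.add_sub_cancel]
      rw [pow_succ (w - (t : ℂ))⁻¹, pow_succ (w - (t : ℂ))⁻¹]
      field_simp

theorem hasDerivAt_cauchyTr (hf : BoundedBump f M R) {z : ℂ} (hz : 0 < z.im) :
    HasDerivAt (cauchyTr f) (cauchyTr' f z) z := by
  refine ((hf.hasDerivAt_cauchyPow 1 hz).const_mul _).congr_deriv ?_
  simp [cauchyTr']

theorem hasDerivAt_cauchyTr' (hf : BoundedBump f M R) {z : ℂ} (hz : 0 < z.im) :
    HasDerivAt (cauchyTr' f) (cauchyTr'' f z) z := by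
  refine (((hf.hasDerivAt_cauchyPow 2 hz).const_mul _).neg).congr_deriv ?_
  simp [cauchyTr'']; ring

theorem continuousOn_cauchyPow (hf : BoundedBump f M R) (n : ℕ) :
    ContinuousOn (cauchyPow f n) {z | 0 < z.im} :=
  fun _ hz => (hf.hasDerivAt_cauchyPow n hz).continuousAt.continuousWithinAt

theorem norm_cauchyPow_le (hf : BoundedBump f M R) (n : ℕ) {z : ℂ} (hz : 2 * R ≤ ‖z‖)
    (hz0 : 0 < ‖z‖) : ‖cauchyPow f n z‖ ≤ (∫ t, f t) * (2 / ‖z‖) ^ n := by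
  rw [← integral_mul_const]
  refine norm_integral_le_of_norm_le (hf.integrable.mul_const _) (ae_of_all _ fun t => ?_)
  by_cases ht : R < |t|
  · simp [hf.supp t ht]
  · rw [norm_mul, Complex.norm_real, Real.norm_eq_abs, abs_of_nonneg (hf.nonneg t), norm_pow]
    refine mul_le_mul_of_nonneg_left ?_ (hf.nonneg t)
    refine pow_le_pow_left₀ (norm_nonneg _) ?_ n
    rw [norm_inv, show 2 / ‖z‖ = (‖z‖ / 2)⁻¹ by rw [inv_div]]
    refine inv_anti₀ (by positivity) ?_
    have := norm_sub_norm_le z (t : ℂ)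
    rw [Complex.norm_real, Real.norm_eq_abs] at this
    linarith

/-- The negative imaginary part of the Cauchy transform is the Poisson average. -/
theorem neg_im_cauchyTr (hf : BoundedBump f M R) {x y : ℝ} (hy : 0 < y) :
    -(cauchyTr f ⟨x, y⟩).im = ∫ t, f t * (Real.pi⁻¹ * y * ((t - x) ^ 2 + y ^ 2)⁻¹) := by
  have h1 := hf.integrable_cauchyPow 1 (z := ⟨x, y⟩) hy
  have h2 : (cauchyTr f ⟨x, y⟩).im = Real.pi⁻¹ * (cauchyPow f 1 ⟨x, y⟩).im := by
    rw [cauchyTr, ← Complex.ofReal_inv, Complex.im_ofReal_mul]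
  rw [h2, cauchyPow]
  have h3 := integral_im (𝕜 := ℂ) h1
  simp only [RCLike.im_to_complex] at h3
  rw [← h3, ← integral_const_mul, ← integral_neg]
  congr 1; ext t
  have h4 : Complex.normSq ((⟨x, y⟩ : ℂ) - t) = (t - x) ^ 2 + y ^ 2 := by
    simp [Complex.normSq_apply]; ring
  rw [pow_one, Complex.im_ofReal_mul, Complex.inv_im, h4]
  simp
  field_simp

theorem re_cauchyTr (hf : BoundedBump f M R) {x y : ℝ} (hy : 0 < y) :
    (cauchyTr f ⟨x, y⟩).re = ∫ t, f t * (Real.pi⁻¹ * (x - t) * ((t - x) ^ 2 + y ^ 2)⁻¹) := by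
  have h1 := hf.integrable_cauchyPow 1 (z := ⟨x, y⟩) hy
  have h2 : (cauchyTr f ⟨x, y⟩).re = Real.pi⁻¹ * (cauchyPow f 1 ⟨x, y⟩).re := by
    rw [cauchyTr, ← Complex.ofReal_inv, Complex.re_ofReal_mul]
  rw [h2, cauchyPow]
  have h3 := integral_re (𝕜 := ℂ) h1
  simp only [RCLike.re_to_complex] at h3
  rw [← h3, ← integral_const_mul]
  congr 1; ext t
  have h4 : Complex.normSq ((⟨x, y⟩ : ℂ) - t) = (t - x) ^ 2 + y ^ 2 := by
    simp [Complex.normSq_apply]; ring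
  rw [pow_one, Complex.re_ofReal_mul, Complex.inv_re, h4]
  simp
  field_simp

end BoundedBump

theorem integrable_poisson (x : ℝ) {y : ℝ} (hy : 0 < y) :
    Integrable fun t : ℝ => Real.pi⁻¹ * y * ((t - x) ^ 2 + y ^ 2)⁻¹ := by
  exact ProbabilityTheory.integrable_cauchyPDFReal x (γ := ⟨y, hy.le⟩)

/-- The Poisson kernel has mass one. -/
theorem integral_poisson (x : ℝ) {y : ℝ} (hy : 0 < y) :
    ∫ t : ℝ, Real.pi⁻¹ * y * ((t - x) ^ 2 + y ^ 2)⁻¹ = 1 := by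
  exact ProbabilityTheory.integral_cauchyPDFReal_eq_one x (γ := ⟨y, hy.le⟩)
      (by intro h; exact hy.ne' (congrArg NNReal.toReal h))

theorem poisson_nonneg (x t : ℝ) {y : ℝ} (hy : 0 < y) :
    0 ≤ Real.pi⁻¹ * y * ((t - x) ^ 2 + y ^ 2)⁻¹ := by
  have := Real.pi_pos; positivity

namespace BoundedBump
variable {f : ℝ → ℝ} {M R : ℝ}

theorem integrable_mul_poisson (hf : BoundedBump f M R) (x : ℝ) {y : ℝ} (hy : 0 < y) :
    Integrable fun t : ℝ => f t * (Real.pi⁻¹ * y * ((t - x) ^ 2 + y ^ 2)⁻¹) := by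
  refine (integrable_poisson x hy).bdd_mul (c := M) hf.meas.aestronglyMeasurable
    (ae_of_all _ fun t => ?_)
  rw [Real.norm_eq_abs, abs_of_nonneg (hf.nonneg t)]; exact hf.le t

theorem neg_im_cauchyTr_nonneg (hf : BoundedBump f M R) {x y : ℝ} (hy : 0 < y) :
    0 ≤ -(cauchyTr f ⟨x, y⟩).im := by
  rw [hf.neg_im_cauchyTr hy]
  exact integral_nonneg fun t => mul_nonneg (hf.nonneg t) (poisson_nonneg x t hy)

theorem neg_im_cauchyTr_le (hf : BoundedBump f M R) {x y : ℝ} (hy : 0 < y) :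
    -(cauchyTr f ⟨x, y⟩).im ≤ M := by
  rw [hf.neg_im_cauchyTr hy]
  calc _ ≤ ∫ t, M * (Real.pi⁻¹ * y * ((t - x) ^ 2 + y ^ 2)⁻¹) :=
        integral_mono (hf.integrable_mul_poisson x hy) ((integrable_poisson x hy).const_mul _)
          fun t => mul_le_mul_of_nonneg_right (hf.le t) (poisson_nonneg x t hy)
    _ = M := by rw [integral_const_mul, integral_poisson x hy, mul_one]

theorem cauchyTr'_eq_zero (hf : BoundedBump f M R) {x y : ℝ} (hy : 0 < y)
    (h : -(cauchyTr f ⟨x, y⟩).im = 0) (z : ℂ) : cauchyTr' f z = 0 := by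
  rw [hf.neg_im_cauchyTr hy, integral_eq_zero_iff_of_nonneg
    (fun t => mul_nonneg (hf.nonneg t) (poisson_nonneg x t hy)) (hf.integrable_mul_poisson x hy)]
    at h
  have h0 : ∀ᵐ t, f t = 0 := by
    filter_upwards [h] with t ht
    have hp : (0 : ℝ) < Real.pi⁻¹ * y * ((t - x) ^ 2 + y ^ 2)⁻¹ := by
      have := Real.pi_pos; positivity
    exact (mul_eq_zero.1 ht).resolve_right hp.ne'
  rw [cauchyTr', cauchyPow, integral_eq_zero_of_ae]
  · simp
  · filter_upwards [h0] with t ht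
    simp [ht]

/-- Jensen's inequality for the truncation `(· - a)₊` against the Poisson kernel. -/
theorem lintegral_neg_im_cauchyTr_le (hf : BoundedBump f M R) {y : ℝ} (hy : 0 < y) (a : ℝ) :
    ∫⁻ x, ENNReal.ofReal (-(cauchyTr f ⟨x, y⟩).im - a) ≤ ∫⁻ t, ENNReal.ofReal (f t - a) := by
  have hk : Measurable fun p : ℝ × ℝ => ENNReal.ofReal (f p.2 - a) *
      ENNReal.ofReal (Real.pi⁻¹ * y * ((p.2 - p.1) ^ 2 + y ^ 2)⁻¹) := by
    have := hf.meas
    fun_prop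
  calc _ ≤ ∫⁻ x, ∫⁻ t, ENNReal.ofReal (f t - a) *
        ENNReal.ofReal (Real.pi⁻¹ * y * ((t - x) ^ 2 + y ^ 2)⁻¹) := by
        refine lintegral_mono fun x => ?_
        have h1 : -(cauchyTr f ⟨x, y⟩).im - a =
            ∫ t, (f t - a) * (Real.pi⁻¹ * y * ((t - x) ^ 2 + y ^ 2)⁻¹) := by
          simp_rw [sub_mul]
          rw [integral_sub (hf.integrable_mul_poisson x hy) ((integrable_poisson x hy).const_mul a),
            integral_const_mul, integral_poisson x hy, hf.neg_im_cauchyTr hy, mul_one]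
        have hInt : Integrable fun t => (f t - a) * (Real.pi⁻¹ * y * ((t - x) ^ 2 + y ^ 2)⁻¹) := by
          simp_rw [sub_mul]
          exact (hf.integrable_mul_poisson x hy).sub ((integrable_poisson x hy).const_mul a)
        rw [h1]
        refine (ENNReal.ofReal_le_ofReal (integral_mono hInt hInt.pos_part
          fun t => le_max_left _ _)).trans ?_
        rw [ofReal_integral_eq_lintegral_ofReal hInt.pos_part (ae_of_all _ fun t => le_max_right _ _)]
        refine lintegral_mono fun t => ?_
        rw [← ENNReal.ofReal_mul' (poisson_nonneg x t hy)]
        simp only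
        rcases le_total 0 ((f t - a) * (Real.pi⁻¹ * y * ((t - x) ^ 2 + y ^ 2)⁻¹)) with h | h
        · rw [max_eq_left h]
        · rw [max_eq_right h]; simp
    _ = ∫⁻ t, ∫⁻ x, ENNReal.ofReal (f t - a) *
        ENNReal.ofReal (Real.pi⁻¹ * y * ((t - x) ^ 2 + y ^ 2)⁻¹) :=
        lintegral_lintegral_swap hk.aemeasurable
    _ = _ := by
        congr 1; ext t
        rw [lintegral_const_mul _ (by fun_prop)]
        have h2 : ∀ x : ℝ, Real.pi⁻¹ * y * ((t - x) ^ 2 + y ^ 2)⁻¹ =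
            Real.pi⁻¹ * y * ((x - t) ^ 2 + y ^ 2)⁻¹ := fun x => by
          rw [← neg_sub, neg_sq]
        simp_rw [h2]
        rw [← ofReal_integral_eq_lintegral_ofReal (integrable_poisson t hy)
          (ae_of_all _ fun x => poisson_nonneg t x hy), integral_poisson t hy]
        simp

end BoundedBump

theorem integrableOn_weight_rectangle {φ : ℝ × ℝ → ℝ} (hφ : ContinuousOn φ {p | 0 < p.2})
    (X Y : ℝ) :
    IntegrableOn (fun p => (p.2 - 1 / 2) * φ p) (Ioc (-X) X ×ˢ Ioc (1 / 2) Y) := by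
  have hsub : Icc (-X) X ×ˢ Icc (1 / 2) Y ⊆ {p : ℝ × ℝ | 0 < p.2} := by
    rintro ⟨x, y⟩ ⟨-, hy⟩
    exact lt_of_lt_of_le (by norm_num) hy.1
  refine IntegrableOn.mono_set (t := Icc (-X) X ×ˢ Icc (1 / 2) Y) ?_
    (prod_mono Ioc_subset_Icc_self Ioc_subset_Icc_self)
  refine ContinuousOn.integrableOn_compact (isCompact_Icc.prod isCompact_Icc) ?_
  exact ((by fun_prop : Continuous fun p : ℝ × ℝ => p.2 - 1 / 2).continuousOn).mul
    (hφ.mono hsub)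

/-- Green's formula against the weight `y - 1/2` on a rectangle. -/
theorem green_rectangle {ζ ζx ζy ζxx ζyy : ℝ → ℝ → ℝ}
    (hy : ∀ x y, 0 < y → HasDerivAt (fun y => ζ x y) (ζy x y) y)
    (hxx : ∀ x y, 0 < y → HasDerivAt (fun x => ζx x y) (ζxx x y) x)
    (hyy : ∀ x y, 0 < y → HasDerivAt (fun y => ζy x y) (ζyy x y) y)
    (cxx : ContinuousOn (fun p : ℝ × ℝ => ζxx p.1 p.2) {p | 0 < p.2})
    (cyy : ContinuousOn (fun p : ℝ × ℝ => ζyy p.1 p.2) {p | 0 < p.2})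
    {X Y : ℝ} (hX : 0 ≤ X) (hY : 1 / 2 ≤ Y) :
    ∫ p in Ioc (-X) X ×ˢ Ioc (1 / 2) Y, (p.2 - 1 / 2) * (ζxx p.1 p.2 + ζyy p.1 p.2) =
      (∫ y in (1 / 2)..Y, (y - 1 / 2) * (ζx X y - ζx (-X) y)) +
      ∫ x in (-X)..X, ((Y - 1 / 2) * ζy x Y - ζ x Y + ζ x (1 / 2)) := by
  have hXX : -X ≤ X := by linarith
  have slice1 : ∀ {φ : ℝ → ℝ → ℝ}, ContinuousOn (fun p : ℝ × ℝ => φ p.1 p.2) {p | 0 < p.2} →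
      ∀ y, 0 < y → Continuous fun x => φ x y := fun h y hy =>
    h.comp_continuous (by fun_prop : Continuous fun x : ℝ => (x, y)) fun x => hy
  have slice2 : ∀ {φ : ℝ → ℝ → ℝ}, ContinuousOn (fun p : ℝ × ℝ => φ p.1 p.2) {p | 0 < p.2} →
      ∀ x, ContinuousOn (fun y => φ x y) (Ioi 0) := fun h x =>
    h.comp (by fun_prop : Continuous fun y : ℝ => (x, y)).continuousOn fun y hy => hy
  have hIoi : ∀ y ∈ uIcc (1 / 2) Y, y ∈ Ioi (0 : ℝ) := by
    intro y hy'
    rw [uIcc_of_le hY] at hy'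
    exact lt_of_lt_of_le (by norm_num) hy'.1
  simp_rw [mul_add]
  rw [integral_add (integrableOn_weight_rectangle cxx X Y)
    (integrableOn_weight_rectangle cyy X Y)]
  congr 1
  · rw [Measure.volume_eq_prod, ← setIntegral_prod_swap,
      setIntegral_prod _ (by exact (integrableOn_weight_rectangle cxx X Y).swap),
      ← intervalIntegral.integral_of_le hY]
    refine intervalIntegral.integral_congr fun y hy' => ?_
    have hy0 : 0 < y := hIoi y hy'
    simp only [Prod.swap_prod_mk]
    rw [integral_const_mul, ← intervalIntegral.integral_of_le hXX,
      intervalIntegral.integral_eq_sub_of_hasDerivAt (fun x _ => hxx x y hy0)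
        ((slice1 cxx y hy0).intervalIntegrable _ _)]
  · rw [Measure.volume_eq_prod, setIntegral_prod _ (by exact integrableOn_weight_rectangle cyy X Y),
      ← intervalIntegral.integral_of_le hXX]
    refine intervalIntegral.integral_congr fun x _ => ?_
    simp only
    rw [← intervalIntegral.integral_of_le hY,
      intervalIntegral.integral_eq_sub_of_hasDerivAt
        (f := fun y => (y - 1 / 2) * ζy x y - ζ x y) ?_ ?_]
    · ring
    · intro y hy'
      have hy0 : 0 < y := hIoi y hy'
      have := ((((hasDerivAt_id y).sub_const (1 / 2)).mul (hyy x y hy0)).sub (hy x y hy0))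
      refine this.congr_deriv ?_
      simp
    · refine ContinuousOn.intervalIntegrable ?_
      exact (by fun_prop : Continuous fun y : ℝ => y - 1 / 2).continuousOn.mul
        ((slice2 cyy x).mono hIoi)

theorem hasDerivAt_comp_max {φ φ' : ℝ → ℝ} (h : ∀ x, 0 ≤ x → HasDerivAt φ (φ' x) x)
    (h0 : φ' 0 = 0) (x : ℝ) : HasDerivAt (fun x => φ (max x 0)) (φ' (max x 0)) x := by
  rcases lt_trichotomy x 0 with hx | rfl | hx
  · rw [max_eq_right hx.le, h0]
    refine (hasDerivAt_const x (φ 0)).congr_of_eventuallyEq ?_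
    filter_upwards [Iio_mem_nhds hx] with z hz
    rw [max_eq_right (le_of_lt hz)]
  · rw [max_self]
    have h1 : HasDerivWithinAt (fun x => φ (max x 0)) (φ' 0) (Ici 0) 0 :=
      (h 0 le_rfl).hasDerivWithinAt.congr (fun y hy => by rw [max_eq_left hy]) (by simp)
    have h2 : HasDerivWithinAt (fun x => φ (max x 0)) (φ' 0) (Iic 0) 0 := by
      rw [h0]
      exact (hasDerivWithinAt_const 0 _ (φ 0)).congr (fun y hy => by rw [max_eq_right hy])
        (by simp)
    have := h1.union h2
    rw [Ici_union_Iic] at this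
    exact hasDerivWithinAt_univ.1 this
  · rw [max_eq_left hx.le]
    refine (h x hx.le).congr_of_eventuallyEq ?_
    filter_upwards [Ioi_mem_nhds hx] with z hz
    rw [max_eq_left (le_of_lt hz)]

/-- A `C²` convex function of linear growth vanishing on the negative axis. -/
noncomputable def softPlus (x : ℝ) : ℝ := max x 0 - Real.arctan (max x 0)

noncomputable def softPlus' (x : ℝ) : ℝ := max x 0 ^ 2 / (1 + max x 0 ^ 2)

noncomputable def softPlus'' (x : ℝ) : ℝ := 2 * max x 0 / (1 + max x 0 ^ 2) ^ 2

theorem hasDerivAt_softPlus (x : ℝ) : HasDerivAt softPlus (softPlus' x) x := by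
  refine hasDerivAt_comp_max (φ := fun x => x - Real.arctan x)
    (φ' := fun x => x ^ 2 / (1 + x ^ 2)) (fun x _ => ?_) (by simp) x
  refine ((hasDerivAt_id x).sub (Real.hasDerivAt_arctan x)).congr_deriv ?_
  have : 1 + x ^ 2 ≠ 0 := by positivity
  field_simp; ring

theorem hasDerivAt_softPlus' (x : ℝ) : HasDerivAt softPlus' (softPlus'' x) x := by
  refine hasDerivAt_comp_max (φ := fun x => x ^ 2 / (1 + x ^ 2))
    (φ' := fun x => 2 * x / (1 + x ^ 2) ^ 2) (fun x _ => ?_) (by simp) x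
  have hne : 1 + x ^ 2 ≠ 0 := by positivity
  refine ((hasDerivAt_pow 2 x).div ((hasDerivAt_pow 2 x).const_add 1) hne).congr_deriv ?_
  field_simp; ring

theorem arctan_le_self {x : ℝ} (hx : 0 ≤ x) : Real.arctan x ≤ x := by
  have := Real.le_tan (Real.arctan_nonneg.2 hx) (Real.arctan_lt_pi_div_two x)
  rwa [Real.tan_arctan] at this

theorem softPlus_nonneg (x : ℝ) : 0 ≤ softPlus x :=
  sub_nonneg.2 (arctan_le_self (le_max_right _ _))

theorem softPlus_le (x : ℝ) : softPlus x ≤ max x 0 :=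
  sub_le_self _ (Real.arctan_nonneg.2 (le_max_right _ _))

theorem softPlus_eq_zero {x : ℝ} (hx : x ≤ 0) : softPlus x = 0 := by
  simp [softPlus, max_eq_right hx]

theorem softPlus'_eq_zero {x : ℝ} (hx : x ≤ 0) : softPlus' x = 0 := by
  simp [softPlus', max_eq_right hx]

theorem softPlus'_nonneg (x : ℝ) : 0 ≤ softPlus' x := by
  unfold softPlus'; positivity

theorem softPlus''_nonneg (x : ℝ) : 0 ≤ softPlus'' x := by
  have := le_max_right x 0
  unfold softPlus''; positivity

/-- The radial variable `√(1 + p² + q²)`. -/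
noncomputable def boxRho (p q : ℝ) : ℝ := √(1 + p ^ 2 + q ^ 2)

theorem boxRho_pos (p q : ℝ) : 0 < boxRho p q := Real.sqrt_pos.2 (by positivity)

theorem boxRho_sq (p q : ℝ) : boxRho p q ^ 2 = 1 + p ^ 2 + q ^ 2 :=
  Real.sq_sqrt (by positivity)

/-- The test function vanishing near the origin and subharmonic along harmonic pairs. -/
noncomputable def boxFun (p q : ℝ) : ℝ := softPlus (boxRho p q - 1.02)

/-- First derivative of `boxFun` along a curve. -/
noncomputable def boxFun' (p q p' q' : ℝ) : ℝ :=
  softPlus' (boxRho p q - 1.02) * ((p * p' + q * q') / boxRho p q)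

/-- Second derivative of `boxFun` along a curve. -/
noncomputable def boxFun'' (p q p' q' p'' q'' : ℝ) : ℝ :=
  softPlus'' (boxRho p q - 1.02) * ((p * p' + q * q') / boxRho p q) ^ 2 +
  softPlus' (boxRho p q - 1.02) * ((p' ^ 2 + q' ^ 2 + p * p'' + q * q'') / boxRho p q -
    (p * p' + q * q') ^ 2 / boxRho p q ^ 3)

theorem hasDerivAt_boxRho {p q : ℝ → ℝ} {p' q' x : ℝ} (hp : HasDerivAt p p' x)
    (hq : HasDerivAt q q' x) : HasDerivAt (fun x => boxRho (p x) (q x))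
      ((p x * p' + q x * q') / boxRho (p x) (q x)) x := by
  have h1 := (((hp.pow 2).const_add 1).add (hq.pow 2)).sqrt
    (show 1 + p x ^ 2 + q x ^ 2 ≠ 0 by positivity)
  refine h1.congr_deriv ?_
  have := (boxRho_pos (p x) (q x)).ne'
  unfold boxRho at *
  simp only [Pi.add_apply, Pi.pow_apply]
  field_simp
  ring

theorem hasDerivAt_boxFun {p q : ℝ → ℝ} {p' q' x : ℝ} (hp : HasDerivAt p p' x)
    (hq : HasDerivAt q q' x) : HasDerivAt (fun x => boxFun (p x) (q x))
      (boxFun' (p x) (q x) p' q') x :=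
  (hasDerivAt_softPlus _).comp x ((hasDerivAt_boxRho hp hq).sub_const _)

theorem hasDerivAt_boxFun' {p q p' q' : ℝ → ℝ} {p'' q'' x : ℝ} (hp : HasDerivAt p (p' x) x)
    (hq : HasDerivAt q (q' x) x) (hp' : HasDerivAt p' p'' x) (hq' : HasDerivAt q' q'' x) :
    HasDerivAt (fun x => boxFun' (p x) (q x) (p' x) (q' x))
      (boxFun'' (p x) (q x) (p' x) (q' x) p'' q'') x := by
  have hρ := hasDerivAt_boxRho hp hq
  have h1 := (hasDerivAt_softPlus' _).comp x (hρ.sub_const 1.02)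
  have h0 := (boxRho_pos (p x) (q x)).ne'
  have h2 := ((hp.mul hp').add (hq.mul hq')).div hρ h0
  refine (h1.mul h2).congr_deriv ?_
  simp only [boxFun'', Function.comp, Pi.add_apply, Pi.mul_apply, Pi.div_apply]
  field_simp
  ring

theorem boxFun_eq_zero {p q : ℝ} (hp : |p| ≤ 1 / 8) (hq : |q| ≤ 1 / 8) :
    boxRho p q - 1.02 ≤ 0 := by
  have h1 : p ^ 2 ≤ (1 / 8) ^ 2 := sq_le_sq' (by linarith [neg_le_of_abs_le hp]) (le_of_abs_le hp)
  have h2 : q ^ 2 ≤ (1 / 8) ^ 2 := sq_le_sq' (by linarith [neg_le_of_abs_le hq]) (le_of_abs_le hq)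
  have h3 := boxRho_sq p q
  nlinarith [boxRho_pos p q]

theorem boxFun_le {p q : ℝ} (hp : 0 ≤ p) (hq : 0 ≤ q) :
    boxFun p q ≤ max (p - 1 / 8) 0 + max (q - 1 / 8) 0 := by
  set a := max (p - 1 / 8) 0 with ha
  set b := max (q - 1 / 8) 0 with hb
  have ha0 : 0 ≤ a := le_max_right _ _
  have hb0 : 0 ≤ b := le_max_right _ _
  have ha1 : p ≤ a + 1 / 8 := by linarith [le_max_left (p - 1 / 8) 0]
  have hb1 : q ≤ b + 1 / 8 := by linarith [le_max_left (q - 1 / 8) 0]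
  refine (softPlus_le _).trans (max_le ?_ (by positivity))
  have h3 := boxRho_sq p q
  by_contra! h
  nlinarith [boxRho_pos p q, mul_nonneg ha0 hb0]

/-- Quantitative subharmonicity of `boxFun` along a pair of harmonic functions. -/
theorem boxFun_laplacian_ge (p q px py qx qy pxx pyy qxx qyy : ℝ) (hp : pxx + pyy = 0)
    (hq : qxx + qyy = 0) :
    softPlus' (boxRho p q - 1.02) * ((px ^ 2 + py ^ 2 + qx ^ 2 + qy ^ 2) / boxRho p q ^ 3) ≤
      boxFun'' p q px qx pxx qxx + boxFun'' p q py qy pyy qyy := by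
  have h0 := boxRho_pos p q
  have h1 := boxRho_sq p q
  unfold boxFun''
  have h2 := softPlus''_nonneg (boxRho p q - 1.02)
  have h3 := softPlus'_nonneg (boxRho p q - 1.02)
  have h4 : (px ^ 2 + py ^ 2 + qx ^ 2 + qy ^ 2) / boxRho p q ^ 3 ≤
      ((px ^ 2 + qx ^ 2 + p * pxx + q * qxx) / boxRho p q -
        (p * px + q * qx) ^ 2 / boxRho p q ^ 3) +
      ((py ^ 2 + qy ^ 2 + p * pyy + q * qyy) / boxRho p q -
        (p * py + q * qy) ^ 2 / boxRho p q ^ 3) := by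
    have e1 : ((px ^ 2 + qx ^ 2 + p * pxx + q * qxx) / boxRho p q -
        (p * px + q * qx) ^ 2 / boxRho p q ^ 3) +
      ((py ^ 2 + qy ^ 2 + p * pyy + q * qyy) / boxRho p q -
        (p * py + q * qy) ^ 2 / boxRho p q ^ 3) =
      ((px ^ 2 + qx ^ 2 + py ^ 2 + qy ^ 2 + p * (pxx + pyy) + q * (qxx + qyy)) *
        (1 + p ^ 2 + q ^ 2) - (p * px + q * qx) ^ 2 - (p * py + q * qy) ^ 2) /
        boxRho p q ^ 3 := by
      rw [← h1]; field_simp; ring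
    rw [e1, hp, hq]
    gcongr
    nlinarith [sq_nonneg (p * qx - q * px), sq_nonneg (p * qy - q * py)]
  have h5 := mul_le_mul_of_nonneg_left h4 h3
  have h6 : 0 ≤ softPlus'' (boxRho p q - 1.02) * ((p * px + q * qx) / boxRho p q) ^ 2 := by
    positivity
  have h7 : 0 ≤ softPlus'' (boxRho p q - 1.02) * ((p * py + q * qy) / boxRho p q) ^ 2 := by
    positivity
  linarith

/-- The pairs where `boxFun` is uniformly subharmonic. -/
def boxAnnulus (s r : ℝ) : Set (ℝ × ℝ) :=
  {p | p.1 ≤ s ∧ p.2 ≤ r ∧ (s / 2 ≤ p.1 ∨ r / 2 ≤ p.2)}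

theorem softPlus'_ge_of_mem {p q : ℝ} (hp : 0 ≤ p) (hq : 0 ≤ q) (h : (p, q) ∈ boxAnnulus 1 1) :
    1 / 1000 ≤ softPlus' (boxRho p q - 1.02) / boxRho p q ^ 3 := by
  obtain ⟨h1, h2, h3⟩ := h
  simp only at h1 h2 h3
  have hs := boxRho_sq p q
  have h0 := boxRho_pos p q
  have h4 : 1.11 ≤ boxRho p q := by
    by_contra! h
    have : p ^ 2 + q ^ 2 ≥ 1 / 4 := by
      rcases h3 with h3 | h3 <;> nlinarith
    nlinarith
  have h5 : boxRho p q ≤ 1.74 := by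
    by_contra! h
    nlinarith
  have h6 : 0.008 ≤ softPlus' (boxRho p q - 1.02) := by
    unfold softPlus'
    rw [max_eq_left (by linarith), le_div_iff₀ (by positivity)]
    nlinarith
  have h7 : boxRho p q ^ 3 ≤ 1.74 ^ 3 := pow_le_pow_left₀ h0.le h5 3
  rw [le_div_iff₀ (by positivity)]
  norm_num at h7 h6 ⊢
  linarith

section HolomorphicPartials
variable {F : ℂ → ℂ} {F' : ℂ} {x y : ℝ}

theorem hasDerivAt_horizontal (h : HasDerivAt F F' ⟨x, y⟩) :
    HasDerivAt (fun x : ℝ => F ⟨x, y⟩) F' x := by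
  have h1 : HasDerivAt (fun x : ℝ => (⟨x, y⟩ : ℂ)) 1 x := by
    have := (Complex.ofRealCLM.hasDerivAt (x := x)).add_const (y * Complex.I)
    simpa [Complex.mk_eq_add_mul_I] using this
  simpa [Function.comp_def] using h.scomp x h1

theorem hasDerivAt_vertical (h : HasDerivAt F F' ⟨x, y⟩) :
    HasDerivAt (fun y : ℝ => F ⟨x, y⟩) (Complex.I * F') y := by
  have h1 : HasDerivAt (fun y : ℝ => (⟨x, y⟩ : ℂ)) Complex.I y := by
    have := ((Complex.ofRealCLM.hasDerivAt (x := y)).mul_const Complex.I).const_add (x : ℂ)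
    simpa [Complex.mk_eq_add_mul_I] using this
  simpa [Function.comp_def] using h.scomp y h1

theorem HasDerivAt.complex_re {G : ℝ → ℂ} {G' : ℂ} (h : HasDerivAt G G' x) :
    HasDerivAt (fun x => (G x).re) G'.re x :=
  Complex.reCLM.hasFDerivAt.comp_hasDerivAt x h

theorem HasDerivAt.complex_im {G : ℝ → ℂ} {G' : ℂ} (h : HasDerivAt G G' x) :
    HasDerivAt (fun x => (G x).im) G'.im x :=
  Complex.imCLM.hasFDerivAt.comp_hasDerivAt x h

end HolomorphicPartials

theorem continuous_boxRho : Continuous fun p : ℝ × ℝ => boxRho p.1 p.2 := by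
  unfold boxRho; fun_prop

theorem continuous_softPlus' : Continuous softPlus' :=
  continuous_iff_continuousAt.2 fun x => (hasDerivAt_softPlus' x).continuousAt

theorem continuous_softPlus'' : Continuous softPlus'' := by
  unfold softPlus''
  refine Continuous.div (by fun_prop) (by fun_prop) fun x => ?_
  positivity

theorem continuousOn_boxFun'' {S : Set (ℝ × ℝ)} {p q p' q' p'' q'' : ℝ × ℝ → ℝ}
    (h1 : ContinuousOn p S) (h2 : ContinuousOn q S) (h3 : ContinuousOn p' S)
    (h4 : ContinuousOn q' S) (h5 : ContinuousOn p'' S) (h6 : ContinuousOn q'' S) :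
    ContinuousOn (fun z => boxFun'' (p z) (q z) (p' z) (q' z) (p'' z) (q'' z)) S := by
  have hρ : ContinuousOn (fun z => boxRho (p z) (q z)) S :=
    continuous_boxRho.comp_continuousOn (h1.prodMk h2)
  have hne : ∀ z ∈ S, boxRho (p z) (q z) ≠ 0 := fun z _ => (boxRho_pos _ _).ne'
  have e1 := continuous_softPlus'.comp_continuousOn (hρ.sub (continuousOn_const (c := 1.02)))
  have e2 := continuous_softPlus''.comp_continuousOn (hρ.sub (continuousOn_const (c := 1.02)))
  have e3 := ((h1.mul h3).add (h2.mul h4))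
  refine (e2.mul ((e3.div hρ hne).pow 2)).add (e1.mul (ContinuousOn.sub (ContinuousOn.div
    ((((h3.pow 2).add (h4.pow 2)).add (h1.mul h5)).add (h2.mul h6)) hρ hne)
    ((e3.pow 2).div (hρ.pow 3) fun z _ => pow_ne_zero 3 (boxRho_pos _ _).ne')))

namespace BoundedBump
variable {f g : ℝ → ℝ} {M R M' R' : ℝ}

theorem continuousOn_cauchyPow_mk (hf : BoundedBump f M R) (n : ℕ) :
    ContinuousOn (fun p : ℝ × ℝ => cauchyPow f n ⟨p.1, p.2⟩) {p | 0 < p.2} := by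
  refine (hf.continuousOn_cauchyPow n).comp (Continuous.continuousOn ?_) fun p hp => hp
  simp_rw [Complex.mk_eq_add_mul_I]
  fun_prop

theorem continuousOn_cauchyTr (hf : BoundedBump f M R) :
    ContinuousOn (fun p : ℝ × ℝ => cauchyTr f ⟨p.1, p.2⟩) {p | 0 < p.2} :=
  continuousOn_const.mul (hf.continuousOn_cauchyPow_mk 1)

theorem continuousOn_cauchyTr' (hf : BoundedBump f M R) :
    ContinuousOn (fun p : ℝ × ℝ => cauchyTr' f ⟨p.1, p.2⟩) {p | 0 < p.2} :=
  (continuousOn_const.mul (hf.continuousOn_cauchyPow_mk 2)).neg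

theorem continuousOn_cauchyTr'' (hf : BoundedBump f M R) :
    ContinuousOn (fun p : ℝ × ℝ => cauchyTr'' f ⟨p.1, p.2⟩) {p | 0 < p.2} :=
  continuousOn_const.mul (continuousOn_const.mul (hf.continuousOn_cauchyPow_mk 3))

theorem norm_cauchyTr_le (hf : BoundedBump f M R) {z : ℂ} (hz : 2 * R ≤ ‖z‖)
    (hz0 : 0 < ‖z‖) : ‖cauchyTr f z‖ ≤ (∫ t, f t) * (2 / ‖z‖) := by
  have h1 := hf.norm_cauchyPow_le 1 hz hz0
  rw [cauchyTr, norm_mul, norm_inv, Complex.norm_real, Real.norm_eq_abs, abs_of_pos Real.pi_pos]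
  rw [pow_one] at h1
  refine le_trans (mul_le_of_le_one_left (norm_nonneg _) ?_) h1
  exact inv_le_one_of_one_le₀ (by linarith [Real.pi_gt_three])

theorem norm_cauchyTr'_le (hf : BoundedBump f M R) {z : ℂ} (hz : 2 * R ≤ ‖z‖)
    (hz0 : 0 < ‖z‖) : ‖cauchyTr' f z‖ ≤ (∫ t, f t) * (2 / ‖z‖) ^ 2 := by
  have h1 := hf.norm_cauchyPow_le 2 hz hz0
  rw [cauchyTr', norm_neg, norm_mul, norm_inv, Complex.norm_real, Real.norm_eq_abs,
    abs_of_pos Real.pi_pos]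
  refine le_trans (mul_le_of_le_one_left (norm_nonneg _) ?_) h1
  exact inv_le_one_of_one_le₀ (by linarith [Real.pi_gt_three])

theorem integral_nonneg' (hf : BoundedBump f M R) : 0 ≤ ∫ t, f t :=
  integral_nonneg hf.nonneg

theorem exists_small_cauchyTr (hf : BoundedBump f M R) {ε : ℝ} (hε : 0 < ε) :
    ∃ X₀ : ℝ, 0 < X₀ ∧ ∀ z : ℂ, X₀ ≤ ‖z‖ → ‖cauchyTr f z‖ ≤ ε := by
  have h0 := hf.integral_nonneg'
  refine ⟨max (max 1 (2 * R)) ((∫ t, f t) * 2 / ε), ?_, fun z hz => ?_⟩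
  · exact lt_of_lt_of_le one_pos ((le_max_left _ _).trans (le_max_left _ _))
  · have h1 : 1 ≤ ‖z‖ := ((le_max_left _ _).trans (le_max_left _ _)).trans hz
    have h2 : 2 * R ≤ ‖z‖ := ((le_max_right _ _).trans (le_max_left _ _)).trans hz
    have h3 : (∫ t, f t) * 2 / ε ≤ ‖z‖ := (le_max_right _ _).trans hz
    refine (hf.norm_cauchyTr_le h2 (by linarith)).trans ?_
    rw [div_le_iff₀ hε] at h3
    rw [← mul_div_assoc, div_le_iff₀ (by linarith)]
    linarith

/-- Energy in a dyadic box is controlled by the truncated masses. -/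
theorem box_energy_le (hf : BoundedBump f M R) (hg : BoundedBump g M' R') {s r : ℝ} (hs : 0 < s)
    (hr : 0 < r) (X Y : ℝ) :
    ∫⁻ p in Ioc (-X) X ×ˢ Ioc (1 / 2) Y,
      {p : ℝ × ℝ | (-(cauchyTr f ⟨p.1, p.2⟩).im, -(cauchyTr g ⟨p.1, p.2⟩).im) ∈
          boxAnnulus s r}.indicator (fun p => ENNReal.ofReal ((p.2 - 1 / 2) *
            (‖cauchyTr' f ⟨p.1, p.2⟩‖ * ‖cauchyTr' g ⟨p.1, p.2⟩‖))) p
      ≤ 500 * ∫⁻ t, (ENNReal.ofReal r * ENNReal.ofReal (f t - s / 8) +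
          ENNReal.ofReal s * ENNReal.ofReal (g t - r / 8)) := by
  obtain ⟨X₁, hX₁, hf1⟩ := hf.exists_small_cauchyTr (show 0 < s / 8 by positivity)
  obtain ⟨X₂, hX₂, hg1⟩ := hg.exists_small_cauchyTr (show 0 < r / 8 by positivity)
  set Z : ℝ := max (max X Y) (max X₁ X₂) + 1 with hZ
  have hZX : X ≤ Z := by linarith [le_max_left X Y, le_max_left (max X Y) (max X₁ X₂)]
  have hZY : Y ≤ Z := by linarith [le_max_right X Y, le_max_left (max X Y) (max X₁ X₂)]
  have hZ1 : X₁ ≤ Z := by linarith [le_max_left X₁ X₂, le_max_right (max X Y) (max X₁ X₂)]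
  have hZ2 : X₂ ≤ Z := by linarith [le_max_right X₁ X₂, le_max_right (max X Y) (max X₁ X₂)]
  have hZ3 : 1 ≤ Z := by
    have := le_max_left X₁ X₂
    have := le_max_right (max X Y) (max X₁ X₂)
    linarith
  set p : ℝ → ℝ → ℝ := fun x y => -(cauchyTr f ⟨x, y⟩).im / s with hp
  set q : ℝ → ℝ → ℝ := fun x y => -(cauchyTr g ⟨x, y⟩).im / r with hq
  set px : ℝ → ℝ → ℝ := fun x y => -(cauchyTr' f ⟨x, y⟩).im / s with hpx
  set qx : ℝ → ℝ → ℝ := fun x y => -(cauchyTr' g ⟨x, y⟩).im / r with hqx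
  set py : ℝ → ℝ → ℝ := fun x y => -(cauchyTr' f ⟨x, y⟩).re / s with hpy
  set qy : ℝ → ℝ → ℝ := fun x y => -(cauchyTr' g ⟨x, y⟩).re / r with hqy
  set pxx : ℝ → ℝ → ℝ := fun x y => -(cauchyTr'' f ⟨x, y⟩).im / s with hpxx
  set qxx : ℝ → ℝ → ℝ := fun x y => -(cauchyTr'' g ⟨x, y⟩).im / r with hqxx
  set pyy : ℝ → ℝ → ℝ := fun x y => (cauchyTr'' f ⟨x, y⟩).im / s with hpyy
  set qyy : ℝ → ℝ → ℝ := fun x y => (cauchyTr'' g ⟨x, y⟩).im / r with hqyy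
  have dx : ∀ {f : ℝ → ℝ} {M R : ℝ} (_ : BoundedBump f M R) (s : ℝ) x y, 0 < y →
      HasDerivAt (fun x => -(cauchyTr f ⟨x, y⟩).im / s) (-(cauchyTr' f ⟨x, y⟩).im / s) x :=
    fun hf s x y hy =>
      (hasDerivAt_horizontal (hf.hasDerivAt_cauchyTr (z := ⟨x, y⟩) hy)).complex_im.neg.div_const s
  have dxx : ∀ {f : ℝ → ℝ} {M R : ℝ} (_ : BoundedBump f M R) (s : ℝ) x y, 0 < y →
      HasDerivAt (fun x => -(cauchyTr' f ⟨x, y⟩).im / s) (-(cauchyTr'' f ⟨x, y⟩).im / s) x :=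
    fun hf s x y hy =>
      (hasDerivAt_horizontal (hf.hasDerivAt_cauchyTr' (z := ⟨x, y⟩) hy)).complex_im.neg.div_const s
  have dy : ∀ {f : ℝ → ℝ} {M R : ℝ} (_ : BoundedBump f M R) (s : ℝ) x y, 0 < y →
      HasDerivAt (fun y => -(cauchyTr f ⟨x, y⟩).im / s) (-(cauchyTr' f ⟨x, y⟩).re / s) y :=
    fun hf s x y hy => by
      simpa using
      (hasDerivAt_vertical (hf.hasDerivAt_cauchyTr (z := ⟨x, y⟩) hy)).complex_im.neg.div_const s
  have dyy : ∀ {f : ℝ → ℝ} {M R : ℝ} (_ : BoundedBump f M R) (s : ℝ) x y, 0 < y →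
      HasDerivAt (fun y => -(cauchyTr' f ⟨x, y⟩).re / s) ((cauchyTr'' f ⟨x, y⟩).im / s) y :=
    fun hf s x y hy => by
      simpa using
      (hasDerivAt_vertical (hf.hasDerivAt_cauchyTr' (z := ⟨x, y⟩) hy)).complex_re.neg.div_const s
  have cim : ∀ {φ : ℝ × ℝ → ℂ} (s : ℝ), ContinuousOn φ {p | 0 < p.2} →
      ContinuousOn (fun p => -(φ p).im / s) {p | 0 < p.2} := fun s h =>
    (Complex.continuous_im.comp_continuousOn h).neg.div_const s
  have cre : ∀ {φ : ℝ × ℝ → ℂ} (s : ℝ), ContinuousOn φ {p | 0 < p.2} →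
      ContinuousOn (fun p => -(φ p).re / s) {p | 0 < p.2} := fun s h =>
    (Complex.continuous_re.comp_continuousOn h).neg.div_const s
  have cim' : ∀ {φ : ℝ × ℝ → ℂ} (s : ℝ), ContinuousOn φ {p | 0 < p.2} →
      ContinuousOn (fun p => (φ p).im / s) {p | 0 < p.2} := fun s h =>
    (Complex.continuous_im.comp_continuousOn h).div_const s
  set L : ℝ × ℝ → ℝ := fun z =>
    boxFun'' (p z.1 z.2) (q z.1 z.2) (px z.1 z.2) (qx z.1 z.2) (pxx z.1 z.2) (qxx z.1 z.2) +
    boxFun'' (p z.1 z.2) (q z.1 z.2) (py z.1 z.2) (qy z.1 z.2) (pyy z.1 z.2) (qyy z.1 z.2) with hL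
  have cxx : ContinuousOn (fun z : ℝ × ℝ => boxFun'' (p z.1 z.2) (q z.1 z.2) (px z.1 z.2)
      (qx z.1 z.2) (pxx z.1 z.2) (qxx z.1 z.2)) {p | 0 < p.2} :=
    continuousOn_boxFun'' (cim s hf.continuousOn_cauchyTr) (cim r hg.continuousOn_cauchyTr)
      (cim s hf.continuousOn_cauchyTr') (cim r hg.continuousOn_cauchyTr')
      (cim s hf.continuousOn_cauchyTr'') (cim r hg.continuousOn_cauchyTr'')
  have cyy : ContinuousOn (fun z : ℝ × ℝ => boxFun'' (p z.1 z.2) (q z.1 z.2) (py z.1 z.2)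
      (qy z.1 z.2) (pyy z.1 z.2) (qyy z.1 z.2)) {p | 0 < p.2} :=
    continuousOn_boxFun'' (cim s hf.continuousOn_cauchyTr) (cim r hg.continuousOn_cauchyTr)
      (cre s hf.continuousOn_cauchyTr') (cre r hg.continuousOn_cauchyTr')
      (cim' s hf.continuousOn_cauchyTr'') (cim' r hg.continuousOn_cauchyTr'')
  have green := green_rectangle (ζ := fun x y => boxFun (p x y) (q x y))
    (ζx := fun x y => boxFun' (p x y) (q x y) (px x y) (qx x y))
    (ζy := fun x y => boxFun' (p x y) (q x y) (py x y) (qy x y))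
    (ζxx := fun x y => boxFun'' (p x y) (q x y) (px x y) (qx x y) (pxx x y) (qxx x y))
    (ζyy := fun x y => boxFun'' (p x y) (q x y) (py x y) (qy x y) (pyy x y) (qyy x y))
    (fun x y hy => hasDerivAt_boxFun (dy hf s x y hy) (dy hg r x y hy))
    (fun x y hy => hasDerivAt_boxFun' (dx hf s x y hy) (dx hg r x y hy)
      (dxx hf s x y hy) (dxx hg r x y hy))
    (fun x y hy => hasDerivAt_boxFun' (dy hf s x y hy) (dy hg r x y hy)
      (dyy hf s x y hy) (dyy hg r x y hy)) cxx cyy (X := Z) (Y := Z) (by linarith) (by linarith)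
  have hfar : ∀ x y : ℝ, Z ≤ |x| ∨ Z ≤ |y| → boxRho (p x y) (q x y) - 1.02 ≤ 0 := by
    intro x y h
    have hn : Z ≤ ‖(⟨x, y⟩ : ℂ)‖ := by
      rcases h with h | h
      · exact h.trans (Complex.abs_re_le_norm (⟨x, y⟩ : ℂ))
      · exact h.trans (Complex.abs_im_le_norm (⟨x, y⟩ : ℂ))
    have h1 := (Complex.abs_im_le_norm _).trans (hf1 ⟨x, y⟩ (hZ1.trans hn))
    have h2 := (Complex.abs_im_le_norm _).trans (hg1 ⟨x, y⟩ (hZ2.trans hn))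
    refine boxFun_eq_zero ?_ ?_
    · simp only [hp, abs_div, abs_neg, abs_of_pos hs]
      rw [div_le_iff₀ hs]; linarith
    · simp only [hq, abs_div, abs_neg, abs_of_pos hr]
      rw [div_le_iff₀ hr]; linarith
  have hfar' : ∀ x y a b : ℝ, Z ≤ |x| ∨ Z ≤ |y| → boxFun' (p x y) (q x y) a b = 0 := by
    intro x y a b h
    simp [boxFun', softPlus'_eq_zero (hfar x y h)]
  have hgreen : ∫ z in Ioc (-Z) Z ×ˢ Ioc (1 / 2) Z, (z.2 - 1 / 2) * L z =
      ∫ x in (-Z)..Z, boxFun (p x (1 / 2)) (q x (1 / 2)) := by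
    refine green.trans ?_
    have e1 : ∀ y, (y - 1 / 2) * (boxFun' (p Z y) (q Z y) (px Z y) (qx Z y) -
        boxFun' (p (-Z) y) (q (-Z) y) (px (-Z) y) (qx (-Z) y)) = 0 := by
      intro y
      rw [hfar' Z y _ _ (Or.inl (le_abs_self _)),
        hfar' (-Z) y _ _ (Or.inl (by rw [abs_neg]; exact le_abs_self _))]
      simp
    have e2 : ∀ x, (Z - 1 / 2) * boxFun' (p x Z) (q x Z) (py x Z) (qy x Z) -
        boxFun (p x Z) (q x Z) + boxFun (p x (1 / 2)) (q x (1 / 2)) =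
        boxFun (p x (1 / 2)) (q x (1 / 2)) := by
      intro x
      rw [hfar' x Z _ _ (Or.inr (le_abs_self _)), boxFun,
        softPlus_eq_zero (hfar x Z (Or.inr (le_abs_self _)))]
      simp
    simp only [e1, e2]
    simp
  have hlap : ∀ z : ℝ × ℝ, softPlus' (boxRho (p z.1 z.2) (q z.1 z.2) - 1.02) *
      ((px z.1 z.2 ^ 2 + py z.1 z.2 ^ 2 + qx z.1 z.2 ^ 2 + qy z.1 z.2 ^ 2) /
        boxRho (p z.1 z.2) (q z.1 z.2) ^ 3) ≤ L z := fun z =>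
    boxFun_laplacian_ge _ _ _ _ _ _ _ _ _ _ (by simp only [hpxx, hpyy]; ring)
      (by simp only [hqxx, hqyy]; ring)
  have hL0 : ∀ z, 0 ≤ L z := fun z => by
    refine le_trans ?_ (hlap z)
    have := softPlus'_nonneg (boxRho (p z.1 z.2) (q z.1 z.2) - 1.02)
    have := boxRho_pos (p z.1 z.2) (q z.1 z.2)
    positivity
  have hLint : IntegrableOn (fun z : ℝ × ℝ => (z.2 - 1 / 2) * L z)
      (Ioc (-Z) Z ×ˢ Ioc (1 / 2) Z) := integrableOn_weight_rectangle (cxx.add cyy) Z Z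
  have hcont : Continuous fun x => boxFun (p x (1 / 2)) (q x (1 / 2)) :=
    continuous_iff_continuousAt.2 fun x => (hasDerivAt_boxFun
      (dx hf s x (1 / 2) (by norm_num)) (dx hg r x (1 / 2) (by norm_num))).continuousAt
  have hmr : MeasurableSet (Ioc (-Z) Z ×ˢ Ioc (1 / 2 : ℝ) Z) :=
    measurableSet_Ioc.prod measurableSet_Ioc
  calc _ ≤ ∫⁻ z in Ioc (-Z) Z ×ˢ Ioc (1 / 2) Z,
        ENNReal.ofReal (500 * s * r) * ENNReal.ofReal ((z.2 - 1 / 2) * L z) := by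
        refine (lintegral_mono_set (prod_mono (Ioc_subset_Ioc (by linarith) hZX)
          (Ioc_subset_Ioc le_rfl hZY))).trans (setLIntegral_mono' hmr fun z hz => ?_)
        have hz2 : 1 / 2 < z.2 := hz.2.1
        by_cases hmem : z ∈ {p : ℝ × ℝ | (-(cauchyTr f ⟨p.1, p.2⟩).im,
          -(cauchyTr g ⟨p.1, p.2⟩).im) ∈ boxAnnulus s r}
        swap
        · rw [indicator_of_notMem hmem]; exact zero_le
        rw [indicator_of_mem hmem, ← ENNReal.ofReal_mul (by positivity)]
        refine ENNReal.ofReal_le_ofReal ?_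
        have hy0 : 0 < z.2 := by linarith
        have hU := hf.neg_im_cauchyTr_nonneg (x := z.1) hy0
        have hW := hg.neg_im_cauchyTr_nonneg (x := z.1) hy0
        have hmem' : (p z.1 z.2, q z.1 z.2) ∈ boxAnnulus 1 1 := by
          obtain ⟨h1, h2, h3⟩ := hmem
          simp only at h1 h2 h3
          refine ⟨?_, ?_, ?_⟩
          · simp only [hp]; rwa [div_le_one hs]
          · simp only [hq]; rwa [div_le_one hr]
          · simp only [hp, hq]
            rw [le_div_iff₀ hs, le_div_iff₀ hr]
            exact h3.imp (fun h => by linarith) (fun h => by linarith)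
        have hge := softPlus'_ge_of_mem (div_nonneg hU hs.le) (div_nonneg hW hr.le) hmem'
        have hnf : px z.1 z.2 ^ 2 + py z.1 z.2 ^ 2 = (‖cauchyTr' f ⟨z.1, z.2⟩‖ / s) ^ 2 := by
          have := Complex.normSq_eq_norm_sq (cauchyTr' f ⟨z.1, z.2⟩)
          rw [Complex.normSq_apply] at this
          rw [div_pow ‖_‖ _ 2, ← this]
          simp only [hpx, hpy]; ring
        have hng : qx z.1 z.2 ^ 2 + qy z.1 z.2 ^ 2 = (‖cauchyTr' g ⟨z.1, z.2⟩‖ / r) ^ 2 := by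
          have := Complex.normSq_eq_norm_sq (cauchyTr' g ⟨z.1, z.2⟩)
          rw [Complex.normSq_apply] at this
          rw [div_pow ‖_‖ _ 2, ← this]
          simp only [hqx, hqy]; ring
        set a := ‖cauchyTr' f ⟨z.1, z.2⟩‖ with ha
        set b := ‖cauchyTr' g ⟨z.1, z.2⟩‖ with hb
        have h1 : 1 / 1000 * ((a / s) ^ 2 + (b / r) ^ 2) ≤ L z := by
          refine le_trans ?_ (hlap z)
          rw [add_assoc (px z.1 z.2 ^ 2 + py z.1 z.2 ^ 2), hnf, hng, mul_div_assoc',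
            mul_div_right_comm]
          exact mul_le_mul_of_nonneg_right hge (by positivity)
        have h2 : a * b ≤ 500 * s * r * L z := by
          have h3 : 2 * (a / s) * (b / r) ≤ (a / s) ^ 2 + (b / r) ^ 2 := two_mul_le_add_sq _ _
          have h4 : a * b = s * r * ((a / s) * (b / r)) := by field_simp
          rw [h4]
          have h5 : (a / s) * (b / r) ≤ 500 * L z := by linarith
          have := mul_le_mul_of_nonneg_left h5 (mul_pos hs hr).le
          linarith
        have := mul_le_mul_of_nonneg_left h2 (show 0 ≤ z.2 - 1 / 2 by linarith)
        linarith
    _ = ENNReal.ofReal (500 * s * r) *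
        ENNReal.ofReal (∫ x in (-Z)..Z, boxFun (p x (1 / 2)) (q x (1 / 2))) := by
        rw [lintegral_const_mul' _ _ ENNReal.ofReal_ne_top, ← hgreen,
          ofReal_integral_eq_lintegral_ofReal hLint]
        refine (ae_restrict_iff' hmr).2 (ae_of_all _ fun z hz => ?_)
        exact mul_nonneg (by linarith [hz.2.1]) (hL0 z)
    _ = ENNReal.ofReal (500 * s * r) *
        ∫⁻ x in Ioc (-Z) Z, ENNReal.ofReal (boxFun (p x (1 / 2)) (q x (1 / 2))) := by
        rw [intervalIntegral.integral_of_le (by linarith), ofReal_integral_eq_lintegral_ofReal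
          hcont.integrableOn_Ioc (ae_of_all _ fun x => softPlus_nonneg _)]
    _ ≤ 500 * ∫⁻ x, (ENNReal.ofReal r * ENNReal.ofReal (-(cauchyTr f ⟨x, 1 / 2⟩).im - s / 8) +
          ENNReal.ofReal s * ENNReal.ofReal (-(cauchyTr g ⟨x, 1 / 2⟩).im - r / 8)) := by
        have h500 : ENNReal.ofReal (500 * s * r) = 500 * ENNReal.ofReal (s * r) := by
          rw [mul_assoc, ENNReal.ofReal_mul (by norm_num)]; norm_num
        rw [h500, mul_assoc]
        refine mul_le_mul_right ?_ _
        rw [← lintegral_const_mul' _ _ ENNReal.ofReal_ne_top]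
        refine (setLIntegral_le_lintegral _ _).trans (lintegral_mono fun x => ?_)
        simp only
        have hU := hf.neg_im_cauchyTr_nonneg (x := x) (y := 1 / 2) (by norm_num)
        have hW := hg.neg_im_cauchyTr_nonneg (x := x) (y := 1 / 2) (by norm_num)
        rw [← ENNReal.ofReal_mul (by positivity), ← ENNReal.ofReal_mul hr.le,
          ← ENNReal.ofReal_mul hs.le]
        have h1 := boxFun_le (div_nonneg hU hs.le) (div_nonneg hW hr.le)
        have h2 := mul_le_mul_of_nonneg_left h1 (mul_pos hs hr).le
        refine (ENNReal.ofReal_le_ofReal h2).trans ?_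
        rw [mul_add, ENNReal.ofReal_add (by positivity) (by positivity)]
        refine add_le_add ?_ ?_
        · rw [mul_max_of_nonneg _ _ (by positivity), mul_zero, ENNReal.ofReal_max]
          simp only [ENNReal.ofReal_zero, max_le_iff, zero_le, and_true]
          refine ENNReal.ofReal_le_ofReal (le_of_eq ?_)
          field_simp
        · rw [mul_max_of_nonneg _ _ (by positivity), mul_zero, ENNReal.ofReal_max]
          simp only [ENNReal.ofReal_zero, max_le_iff, zero_le, and_true]
          refine ENNReal.ofReal_le_ofReal (le_of_eq ?_)
          field_simp
    _ ≤ _ := by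
        refine mul_le_mul_right ?_ _
        have hmf : Measurable fun x => ENNReal.ofReal r *
            ENNReal.ofReal (-(cauchyTr f ⟨x, 1 / 2⟩).im - s / 8) := by
          have : Continuous fun x => -(cauchyTr f ⟨x, 1 / 2⟩).im / 1 :=
            continuous_iff_continuousAt.2 fun x => (dx hf 1 x (1 / 2) (by norm_num)).continuousAt
          simp only [div_one] at this
          exact ((this.measurable.sub_const _).ennreal_ofReal).const_mul _
        rw [lintegral_add_left hmf, lintegral_add_left
          (((hf.meas.sub_const _).ennreal_ofReal).const_mul _),
          lintegral_const_mul' _ _ ENNReal.ofReal_ne_top,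
          lintegral_const_mul' _ _ ENNReal.ofReal_ne_top,
          lintegral_const_mul' _ _ ENNReal.ofReal_ne_top,
          lintegral_const_mul' _ _ ENNReal.ofReal_ne_top]
        exact add_le_add (mul_le_mul_right (hf.lintegral_neg_im_cauchyTr_le one_half_pos _) _)
          (mul_le_mul_right (hg.lintegral_neg_im_cauchyTr_le one_half_pos _) _)

end BoundedBump

theorem dyadicSlope_ne_top {Φ : ℝ → ENNReal} (h : ∀ t, 0 ≤ t → Φ t < ⊤) (k : ℤ) :
    dyadicSlope Φ k ≠ ⊤ := by
  unfold dyadicSlope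
  exact ENNReal.div_ne_top (h _ (by positivity)).ne (two_zpow_pos k).ne'

theorem exists_dyadic_zpow_ge (M : ℝ) : ∃ N : ℤ, M ≤ 2 ^ (N - 3) := by
  obtain ⟨n, hn⟩ := pow_unbounded_of_one_lt M (one_lt_two (α := ℝ))
  exact ⟨n + 3, by simpa using hn.le⟩

open Classical in
/-- The weighted product energy of two Cauchy transforms is controlled by the modulars. -/
theorem lintegral_energy_le (A B : YoungFunction) {K : ℝ}
    (hAfin : ∀ t : ℝ, 0 ≤ t → A.toFun t < ⊤) (hBfin : ∀ t : ℝ, 0 ≤ t → B.toFun t < ⊤)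
    (hK : ∀ t : ℝ, 0 < t →
        (∫⁻ s in Set.Ioo (0 : ℝ) t, B.toFun s / ENNReal.ofReal (s ^ 2))
            ≤ A.toFun (K * t) / ENNReal.ofReal t ∧
        (∫⁻ s in Set.Ioo (0 : ℝ) t, A.conj s / ENNReal.ofReal (s ^ 2))
            ≤ B.conj (K * t) / ENNReal.ofReal t) (hK1 : 1 ≤ K)
    {f g : ℝ → ℝ} {M R M' R' : ℝ} (hf : BoundedBump f M R) (hg : BoundedBump g M' R') (X Y : ℝ) :
    ∫⁻ p in Ioc (-X) X ×ˢ Ioc (1 / 2) Y, ENNReal.ofReal ((p.2 - 1 / 2) *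
            (‖cauchyTr' f ⟨p.1, p.2⟩‖ * ‖cauchyTr' g ⟨p.1, p.2⟩‖))
      ≤ 500 * ∫⁻ t, (A.toFun (96 * K * f t) + B.conj (96 * K * g t)) := by
  obtain ⟨N, hN⟩ := exists_dyadic_zpow_ge M
  set α := dyadicSlope A.toFun with hα
  set β := dyadicSlope B.toFun with hβ
  have hαm : Monotone α := A.superHomogeneous.dyadicSlope_monotone
  have hβm : Monotone β := B.superHomogeneous.dyadicSlope_monotone
  set E : ℝ × ℝ → ENNReal := fun p => ENNReal.ofReal ((p.2 - 1 / 2) *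
            (‖cauchyTr' f ⟨p.1, p.2⟩‖ * ‖cauchyTr' g ⟨p.1, p.2⟩‖)) with hE
  set S : ℝ → ℝ → Set (ℝ × ℝ) := fun s r => {p : ℝ × ℝ | (-(cauchyTr f ⟨p.1, p.2⟩).im,
    -(cauchyTr g ⟨p.1, p.2⟩).im) ∈ boxAnnulus s r} with hS
  have hmr : MeasurableSet (Ioc (-X) X ×ˢ Ioc (1 / 2 : ℝ) Y) :=
    measurableSet_Ioc.prod measurableSet_Ioc
  have hpos : MeasurableSet {p : ℝ × ℝ | 0 < p.2} := measurableSet_lt measurable_const measurable_snd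
  have hsub : Ioc (-X) X ×ˢ Ioc (1 / 2 : ℝ) Y ⊆ {p : ℝ × ℝ | 0 < p.2} := fun p hp => by
    have := hp.2.1
    simp only [mem_ofPred_eq]; linarith
  have hmE : AEMeasurable E (volume.restrict (Ioc (-X) X ×ˢ Ioc (1 / 2 : ℝ) Y)) := by
    have hc : ContinuousOn (fun p : ℝ × ℝ => (p.2 - 1 / 2) *
            (‖cauchyTr' f ⟨p.1, p.2⟩‖ * ‖cauchyTr' g ⟨p.1, p.2⟩‖))
            (Ioc (-X) X ×ˢ Ioc (1 / 2 : ℝ) Y) :=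
      ((continuous_snd.sub continuous_const).continuousOn.mul
        (hf.continuousOn_cauchyTr'.norm.mul hg.continuousOn_cauchyTr'.norm)).mono hsub
    exact (hc.aemeasurable hmr).ennreal_ofReal
  have hmS : ∀ s r, NullMeasurableSet (S s r) (volume.restrict (Ioc (-X) X ×ˢ Ioc (1 / 2 : ℝ) Y)) := by
    intro s r
    have c1 : AEMeasurable (fun p : ℝ × ℝ => -(cauchyTr f ⟨p.1, p.2⟩).im)
        (volume.restrict (Ioc (-X) X ×ˢ Ioc (1 / 2 : ℝ) Y)) :=
      ((Complex.continuous_im.comp_continuousOn hf.continuousOn_cauchyTr).neg.mono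
        hsub).aemeasurable hmr
    have c2 : AEMeasurable (fun p : ℝ × ℝ => -(cauchyTr g ⟨p.1, p.2⟩).im)
        (volume.restrict (Ioc (-X) X ×ˢ Ioc (1 / 2 : ℝ) Y)) :=
      ((Complex.continuous_im.comp_continuousOn hg.continuousOn_cauchyTr).neg.mono
        hsub).aemeasurable hmr
    refine (c1.prodMk c2).nullMeasurableSet_preimage ?_
    unfold boxAnnulus
    exact (measurableSet_le measurable_fst measurable_const).inter
      ((measurableSet_le measurable_snd measurable_const).inter
      ((measurableSet_le measurable_const measurable_fst).union
      (measurableSet_le measurable_const measurable_snd)))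
  set G : ℤ → ℤ → ℝ × ℝ → ENNReal := fun k j p =>
    if StairEdge α β N k j then (S (2 ^ k) (2 ^ j)).indicator E p else 0 with hG
  have hmG : ∀ k j, AEMeasurable (G k j) (volume.restrict (Ioc (-X) X ×ˢ Ioc (1 / 2 : ℝ) Y)) := by
    intro k j
    by_cases h : StairEdge α β N k j
    · simp only [hG, if_pos h]
      exact hmE.indicator₀ (hmS _ _)
    · simp only [hG, if_neg h]
      exact aemeasurable_const
  have hcover : ∀ p ∈ Ioc (-X) X ×ˢ Ioc (1 / 2 : ℝ) Y, E p ≤ ∑' k, ∑' j, G k j p := by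
    intro p hp
    have hy : 0 < p.2 := hsub hp
    have hU := hf.neg_im_cauchyTr_nonneg (x := p.1) hy
    have hW := hg.neg_im_cauchyTr_nonneg (x := p.1) hy
    rcases hU.eq_or_lt with hU0 | hU0
    · have := hf.cauchyTr'_eq_zero hy hU0.symm ⟨p.1, p.2⟩
      simp [hE, this]
    rcases hW.eq_or_lt with hW0 | hW0
    · have := hg.cauchyTr'_eq_zero hy hW0.symm ⟨p.1, p.2⟩
      simp [hE, this]
    obtain ⟨k, hk1, hk2⟩ := exists_dyadic hU0
    obtain ⟨j, hj1, hj2⟩ := exists_dyadic hW0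
    have hkN : k ≤ N := by
      have h1 : (2 : ℝ) ^ k ≤ 2 ^ (N - 2) := by
        refine hk1.trans ?_
        have h2 := (hf.neg_im_cauchyTr_le (x := p.1) hy).trans hN
        have h3 : (2 : ℝ) ^ (N - 2) = 2 * 2 ^ (N - 3) := by
          rw [show N - 2 = 1 + (N - 3) by ring, zpow_add₀ (by norm_num), zpow_one]
        linarith
      have := (zpow_le_zpow_iff_right₀ (one_lt_two (α := ℝ))).1 h1
      omega
    have hone : ∀ k' j', StairEdge α β N k' j' → p ∈ S (2 ^ k') (2 ^ j') →
        E p ≤ ∑' k, ∑' j, G k j p := by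
      intro k' j' h1 h2
      refine le_trans ?_ ((ENNReal.le_tsum j').trans (ENNReal.le_tsum k'))
      simp only [hG, if_pos h1, indicator_of_mem h2]
      exact le_rfl
    rcases exists_stairEdge hαm hβm hkN (dyadicSlope_ne_top hAfin k)
      (dyadicSlope_ne_top hBfin k) with ⟨k', hk', h⟩ | ⟨j', hj', h⟩
    · refine hone k' j h ⟨?_, hj2, Or.inr ?_⟩
      · exact hk2.trans (zpow_le_zpow_right₀ one_le_two hk')
      · show (2 : ℝ) ^ j / 2 ≤ -(cauchyTr g ⟨p.1, p.2⟩).im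
        linarith
    · refine hone k j' h ⟨hk2, ?_, Or.inl ?_⟩
      · exact hj2.trans (zpow_le_zpow_right₀ one_le_two hj')
      · show (2 : ℝ) ^ k / 2 ≤ -(cauchyTr f ⟨p.1, p.2⟩).im
        linarith
  have hterm : ∀ k j : ℤ, ∫⁻ p in Ioc (-X) X ×ˢ Ioc (1 / 2) Y, G k j p ≤
      500 * ∫⁻ t, (if StairEdge α β N k j then
        2 ^ k * ENNReal.ofReal (g t - 2 ^ (j - 3)) +
          2 ^ j * ENNReal.ofReal (f t - 2 ^ (k - 3)) else 0) := by
    intro k j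
    by_cases h : StairEdge α β N k j
    swap
    · simp [hG, h]
    simp only [hG, if_pos h]
    refine (hf.box_energy_le hg (s := 2 ^ k) (r := 2 ^ j) (by positivity) (by positivity)
      X Y).trans (le_of_eq ?_)
    have e : ∀ k : ℤ, (2 : ℝ) ^ k / 8 = 2 ^ (k - 3) := fun k => by
      rw [zpow_sub₀ (by norm_num)]; norm_num
    congr 1
    refine lintegral_congr fun t => ?_
    rw [e, e, ofReal_two_zpow, ofReal_two_zpow, add_comm]
  have hmf := hf.meas
  have hmg := hg.meas
  calc _ ≤ ∫⁻ p in Ioc (-X) X ×ˢ Ioc (1 / 2) Y, ∑' k, ∑' j, G k j p :=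
        setLIntegral_mono' hmr hcover
    _ = ∑' k, ∑' j, ∫⁻ p in Ioc (-X) X ×ˢ Ioc (1 / 2) Y, G k j p := by
        rw [lintegral_tsum fun k => AEMeasurable.tsum fun j => hmG k j]
        exact tsum_congr fun k => lintegral_tsum fun j => hmG k j
    _ ≤ ∑' k, ∑' j, 500 * ∫⁻ t, (if StairEdge α β N k j then
        2 ^ k * ENNReal.ofReal (g t - 2 ^ (j - 3)) +
          2 ^ j * ENNReal.ofReal (f t - 2 ^ (k - 3)) else 0) :=
        ENNReal.tsum_le_tsum fun k => ENNReal.tsum_le_tsum fun j => hterm k j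
    _ = 500 * ∫⁻ t, ∑' k, ∑' j, (if StairEdge α β N k j then
        2 ^ k * ENNReal.ofReal (g t - 2 ^ (j - 3)) +
          2 ^ j * ENNReal.ofReal (f t - 2 ^ (k - 3)) else 0) := by
        have hm : ∀ k j : ℤ, AEMeasurable (fun t => if StairEdge α β N k j then
          (2 : ENNReal) ^ k * ENNReal.ofReal (g t - 2 ^ (j - 3)) +
          2 ^ j * ENNReal.ofReal (f t - 2 ^ (k - 3)) else 0) volume := by
          intro k j
          by_cases h : StairEdge α β N k j
          · simp only [if_pos h]; fun_prop
          · simp only [if_neg h]; fun_prop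
        rw [lintegral_tsum fun k => AEMeasurable.tsum fun j => hm k j]
        simp_rw [ENNReal.tsum_mul_left]
        congr 1
        exact tsum_congr fun k => (lintegral_tsum fun j => hm k j).symm
    _ ≤ _ := mul_le_mul_right (lintegral_mono fun t => exists_tsum_stairEdge_le A B hK hK1 N
        (hf.nonneg t) (hg.nonneg t) ((hf.le t).trans hN)) _

/-- The conjugate Poisson kernel at height `1/2` convolved with the Poisson kernel at height `1/2`
is the conjugate Poisson kernel at height `1`. -/
theorem integral_conjPoisson_mul_poisson (a : ℝ) :
    ∫ x : ℝ, ((x + a) * ((x + a) ^ 2 + 1 / 4)⁻¹) * (1 / 2 * (x ^ 2 + 1 / 4)⁻¹) =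
      Real.pi * (a * (a ^ 2 + 1)⁻¹) := by
  have hQ : ∀ x : ℝ, 0 < x ^ 2 + 1 / 4 := fun x => by positivity
  rcases eq_or_ne a 0 with rfl | ha
  · have h := integral_neg_eq_self (fun x : ℝ => (x + 0) * ((x + 0) ^ 2 + 1 / 4)⁻¹ *
      (1 / 2 * (x ^ 2 + 1 / 4)⁻¹)) volume
    have h2 : ∀ x : ℝ, (-x + 0) * ((-x + 0) ^ 2 + 1 / 4)⁻¹ * (1 / 2 * ((-x) ^ 2 + 1 / 4)⁻¹) =
      -((x + 0) * ((x + 0) ^ 2 + 1 / 4)⁻¹ * (1 / 2 * (x ^ 2 + 1 / 4)⁻¹)) := fun x => by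
      simp only [add_zero, neg_sq]; ring
    simp_rw [h2, integral_neg] at h
    simp only [zero_mul, mul_zero]
    linarith
  have ha1 : 0 < a ^ 2 + 1 := by positivity
  set α : ℝ := -(1 / 2) / (a ^ 2 + 1) with hα
  set β : ℝ := (1 / 2 + a ^ 2) / (2 * a * (a ^ 2 + 1)) with hβ
  set δ : ℝ := (a ^ 2 - 1 / 2) / (2 * a * (a ^ 2 + 1)) with hδ
  set Φ : ℝ → ℝ := fun x => α / 2 * Real.log ((x ^ 2 + 1 / 4) / ((x + a) ^ 2 + 1 / 4)) +
    2 * β * Real.arctan (2 * x) + 2 * (δ + α * a) * Real.arctan (2 * (x + a)) with hΦ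
  have hderiv : ∀ x, HasDerivAt Φ (((x + a) * ((x + a) ^ 2 + 1 / 4)⁻¹) *
      (1 / 2 * (x ^ 2 + 1 / 4)⁻¹)) x := by
    intro x
    have q1 : HasDerivAt (fun x : ℝ => x ^ 2 + 1 / 4) (2 * x) x := by
      simpa using ((hasDerivAt_id x).pow 2).add_const (1 / 4)
    have q2 : HasDerivAt (fun x : ℝ => (x + a) ^ 2 + 1 / 4) (2 * (x + a)) x := by
      simpa using (((hasDerivAt_id x).add_const a).pow 2).add_const (1 / 4)
    have q3 := (q1.div q2 (hQ _).ne').log (div_pos (hQ x) (hQ (x + a))).ne'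
    have q4 : HasDerivAt (fun x : ℝ => 2 * x) 2 x := by simpa using (hasDerivAt_id x).const_mul 2
    have q5 : HasDerivAt (fun x : ℝ => 2 * (x + a)) 2 x := by
      simpa using ((hasDerivAt_id x).add_const a).const_mul 2
    have := ((q3.const_mul (α / 2)).add (q4.arctan.const_mul (2 * β))).add
      (q5.arctan.const_mul (2 * (δ + α * a)))
    refine this.congr_deriv ?_
    have e1 := (hQ x).ne'
    have e2 := (hQ (x + a)).ne'
    have e3 : 1 + (2 * x) ^ 2 ≠ 0 := by positivity
    have e4 : 1 + (2 * (x + a)) ^ 2 ≠ 0 := by positivity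
    have e5 : (1 : ℝ) / (1 + (2 * x) ^ 2) = 1 / 4 * (x ^ 2 + 1 / 4)⁻¹ := by
      field_simp; ring
    have e6 : (1 : ℝ) / (1 + (2 * (x + a)) ^ 2) = 1 / 4 * ((x + a) ^ 2 + 1 / 4)⁻¹ := by
      field_simp; ring
    simp only [Pi.div_apply]
    rw [e5, e6]
    generalize hP : (x + a) ^ 2 + 1 / 4 = P at *
    generalize hQ' : x ^ 2 + 1 / 4 = Q at *
    have hk : α * x * P + β * P + (-α * x + δ) * Q = (x + a) / 2 := by
      rw [← hP, ← hQ', hα, hβ, hδ]; field_simp; ring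
    have e7 : (2 * x * P - Q * (2 * (x + a))) / P ^ 2 / (Q / P) =
        2 * x * Q⁻¹ - 2 * (x + a) * P⁻¹ := by field_simp
    rw [e7]
    have e8 : (x + a) * P⁻¹ * (1 / 2 * Q⁻¹) = (x + a) / 2 * (P⁻¹ * Q⁻¹) := by ring
    rw [e8, ← hk]
    field_simp
    ring
  have htop : Tendsto (fun x : ℝ => (x ^ 2 + 1 / 4) / ((x + a) ^ 2 + 1 / 4)) (cocompact ℝ)
      (nhds 1) := by
    have h0 : Tendsto (fun x : ℝ => x⁻¹) (cocompact ℝ) (nhds 0) := by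
      simpa using Filter.tendsto_inv₀_cobounded (α := ℝ)
    have h1 : Tendsto (fun x : ℝ => (1 + 1 / 4 * (x⁻¹) ^ 2) / ((1 + a * x⁻¹) ^ 2 + 1 / 4 * x⁻¹ ^ 2))
        (cocompact ℝ) (nhds ((1 + 1 / 4 * 0 ^ 2) / ((1 + a * 0) ^ 2 + 1 / 4 * 0 ^ 2))) :=
      Tendsto.div ((h0.pow 2).const_mul _ |>.const_add _)
        ((((h0.const_mul a).const_add 1).pow 2).add ((h0.pow 2).const_mul _)) (by norm_num)
    rw [show ((1 : ℝ) + 1 / 4 * 0 ^ 2) / ((1 + a * 0) ^ 2 + 1 / 4 * 0 ^ 2) = 1 by norm_num] at h1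
    refine h1.congr' ?_
    have : ∀ᶠ x : ℝ in cocompact ℝ, x ≠ 0 := by
      have := (isCompact_singleton (x := (0 : ℝ))).compl_mem_cocompact
      filter_upwards [this] with x hx using hx
    filter_upwards [this] with x hx
    have e1 := (hQ x).ne'
    have e2 := (hQ (x + a)).ne'
    field_simp
  have hlog : Tendsto (fun x : ℝ => α / 2 *
      Real.log ((x ^ 2 + 1 / 4) / ((x + a) ^ 2 + 1 / 4))) (cocompact ℝ) (nhds 0) := by
    have := ((Real.continuousAt_log one_ne_zero).tendsto.comp htop).const_mul (α / 2)
    simpa [Function.comp_def] using this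
  have hat : Tendsto Φ atTop (nhds (0 + 2 * β * (Real.pi / 2) +
      2 * (δ + α * a) * (Real.pi / 2))) := by
    refine ((hlog.mono_left atTop_le_cocompact).add (Tendsto.const_mul _ ?_)).add
      (Tendsto.const_mul _ ?_)
    · exact (tendsto_nhds_of_tendsto_nhdsWithin Real.tendsto_arctan_atTop).comp
        (tendsto_id.const_mul_atTop two_pos)
    · exact (tendsto_nhds_of_tendsto_nhdsWithin Real.tendsto_arctan_atTop).comp
        ((tendsto_atTop_add_const_right _ a tendsto_id).const_mul_atTop two_pos)
  have hbot : Tendsto Φ atBot (nhds (0 + 2 * β * (-(Real.pi / 2)) +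
      2 * (δ + α * a) * (-(Real.pi / 2)))) := by
    refine ((hlog.mono_left atBot_le_cocompact).add (Tendsto.const_mul _ ?_)).add
      (Tendsto.const_mul _ ?_)
    · exact (tendsto_nhds_of_tendsto_nhdsWithin Real.tendsto_arctan_atBot).comp
        (tendsto_id.const_mul_atBot two_pos)
    · exact (tendsto_nhds_of_tendsto_nhdsWithin Real.tendsto_arctan_atBot).comp
        ((tendsto_atBot_add_const_right _ a tendsto_id).const_mul_atBot two_pos)
  have hbd : ∀ u : ℝ, |u * (u ^ 2 + 1 / 4)⁻¹| ≤ 1 := by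
    intro u
    rw [← div_eq_mul_inv, abs_div, abs_of_pos (hQ u), div_le_one (hQ u)]
    nlinarith [sq_nonneg (|u| - 1 / 2), sq_abs u]
  have hPint : Integrable fun x : ℝ => 1 / 2 * (x ^ 2 + 1 / 4)⁻¹ := by
    have := (integrable_poisson 0 (y := 1 / 2) (by norm_num)).const_mul Real.pi
    refine this.congr (ae_of_all _ fun x => ?_)
    have := Real.pi_pos.ne'
    simp only [sub_zero]
    rw [← mul_assoc, ← mul_assoc, mul_inv_cancel₀ this]; norm_num
  have hInt : Integrable fun x : ℝ => ((x + a) * ((x + a) ^ 2 + 1 / 4)⁻¹) *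
      (1 / 2 * (x ^ 2 + 1 / 4)⁻¹) := by
    refine hPint.bdd_mul (c := 1) (by fun_prop) (ae_of_all _ fun x => hbd (x + a))
  rw [integral_of_hasDerivAt_of_tendsto hderiv hInt hbot hat]
  rw [hα, hβ, hδ]
  field_simp
  ring

namespace BoundedBump
variable {f g : ℝ → ℝ} {M R M' R' : ℝ}

/-- Green's formula for `Re F · (-Im G)` on a large square. -/
theorem abs_intervalIntegral_re_mul_im_le (hf : BoundedBump f M R) (hg : BoundedBump g M' R')
    {E : ENNReal} (hE : E ≠ ⊤)
    (hEle : ∀ X Y : ℝ, ∫⁻ p in Ioc (-X) X ×ˢ Ioc (1 / 2) Y, ENNReal.ofReal ((p.2 - 1 / 2) *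
            (‖cauchyTr' f ⟨p.1, p.2⟩‖ * ‖cauchyTr' g ⟨p.1, p.2⟩‖)) ≤ E)
    {Z : ℝ} (hZ1 : 1 ≤ Z) (hZR : 2 * R ≤ Z) (hZR' : 2 * R' ≤ Z) :
    |∫ x in (-Z)..Z, (cauchyTr f ⟨x, 1 / 2⟩).re * -(cauchyTr g ⟨x, 1 / 2⟩).im| ≤
      2 * E.toReal + 72 * ((∫ t, f t) * ∫ t, g t) / Z := by
  set m := ∫ t, f t with hm
  set m' := ∫ t, g t with hm'
  have hm0 : 0 ≤ m := hf.integral_nonneg'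
  have hm0' : 0 ≤ m' := hg.integral_nonneg'
  have hZ0 : 0 < Z := by linarith
  set p : ℝ → ℝ → ℝ := fun x y => (cauchyTr f ⟨x, y⟩).re with hp
  set q : ℝ → ℝ → ℝ := fun x y => -(cauchyTr g ⟨x, y⟩).im with hq
  set px : ℝ → ℝ → ℝ := fun x y => (cauchyTr' f ⟨x, y⟩).re with hpx
  set qx : ℝ → ℝ → ℝ := fun x y => -(cauchyTr' g ⟨x, y⟩).im with hqx
  set py : ℝ → ℝ → ℝ := fun x y => -(cauchyTr' f ⟨x, y⟩).im with hpy
  set qy : ℝ → ℝ → ℝ := fun x y => -(cauchyTr' g ⟨x, y⟩).re with hqy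
  set pxx : ℝ → ℝ → ℝ := fun x y => (cauchyTr'' f ⟨x, y⟩).re with hpxx
  set qxx : ℝ → ℝ → ℝ := fun x y => -(cauchyTr'' g ⟨x, y⟩).im with hqxx
  set pyy : ℝ → ℝ → ℝ := fun x y => -(cauchyTr'' f ⟨x, y⟩).re with hpyy
  set qyy : ℝ → ℝ → ℝ := fun x y => (cauchyTr'' g ⟨x, y⟩).im with hqyy
  have hF : ∀ x y, 0 < y → HasDerivAt (fun x : ℝ => cauchyTr f ⟨x, y⟩) (cauchyTr' f ⟨x, y⟩) x :=
    fun x y hy => hasDerivAt_horizontal (hf.hasDerivAt_cauchyTr (z := ⟨x, y⟩) hy)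
  have hG : ∀ x y, 0 < y → HasDerivAt (fun x : ℝ => cauchyTr g ⟨x, y⟩) (cauchyTr' g ⟨x, y⟩) x :=
    fun x y hy => hasDerivAt_horizontal (hg.hasDerivAt_cauchyTr (z := ⟨x, y⟩) hy)
  have hF' : ∀ x y, 0 < y → HasDerivAt (fun x : ℝ => cauchyTr' f ⟨x, y⟩) (cauchyTr'' f ⟨x, y⟩) x :=
    fun x y hy => hasDerivAt_horizontal (hf.hasDerivAt_cauchyTr' (z := ⟨x, y⟩) hy)
  have hG' : ∀ x y, 0 < y → HasDerivAt (fun x : ℝ => cauchyTr' g ⟨x, y⟩) (cauchyTr'' g ⟨x, y⟩) x :=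
    fun x y hy => hasDerivAt_horizontal (hg.hasDerivAt_cauchyTr' (z := ⟨x, y⟩) hy)
  have vF : ∀ x y, 0 < y → HasDerivAt (fun y : ℝ => cauchyTr f ⟨x, y⟩)
      (Complex.I * cauchyTr' f ⟨x, y⟩) y :=
    fun x y hy => hasDerivAt_vertical (hf.hasDerivAt_cauchyTr (z := ⟨x, y⟩) hy)
  have vG : ∀ x y, 0 < y → HasDerivAt (fun y : ℝ => cauchyTr g ⟨x, y⟩)
      (Complex.I * cauchyTr' g ⟨x, y⟩) y :=
    fun x y hy => hasDerivAt_vertical (hg.hasDerivAt_cauchyTr (z := ⟨x, y⟩) hy)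
  have vF' : ∀ x y, 0 < y → HasDerivAt (fun y : ℝ => cauchyTr' f ⟨x, y⟩)
      (Complex.I * cauchyTr'' f ⟨x, y⟩) y :=
    fun x y hy => hasDerivAt_vertical (hf.hasDerivAt_cauchyTr' (z := ⟨x, y⟩) hy)
  have vG' : ∀ x y, 0 < y → HasDerivAt (fun y : ℝ => cauchyTr' g ⟨x, y⟩)
      (Complex.I * cauchyTr'' g ⟨x, y⟩) y :=
    fun x y hy => hasDerivAt_vertical (hg.hasDerivAt_cauchyTr' (z := ⟨x, y⟩) hy)
  have hpx' : ∀ x y, 0 < y → HasDerivAt (fun x => p x y) (px x y) x := fun x y hy =>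
    (hF x y hy).complex_re
  have hqx' : ∀ x y, 0 < y → HasDerivAt (fun x => q x y) (qx x y) x := fun x y hy =>
    (hG x y hy).complex_im.neg
  have hpxx' : ∀ x y, 0 < y → HasDerivAt (fun x => px x y) (pxx x y) x := fun x y hy =>
    (hF' x y hy).complex_re
  have hqxx' : ∀ x y, 0 < y → HasDerivAt (fun x => qx x y) (qxx x y) x := fun x y hy =>
    (hG' x y hy).complex_im.neg
  have hpy' : ∀ x y, 0 < y → HasDerivAt (fun y => p x y) (py x y) y := fun x y hy => by
    simpa using (vF x y hy).complex_re
  have hqy' : ∀ x y, 0 < y → HasDerivAt (fun y => q x y) (qy x y) y := fun x y hy => by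
    exact (vG x y hy).complex_im.neg.congr_deriv (by simp [hqy])
  have hpyy' : ∀ x y, 0 < y → HasDerivAt (fun y => py x y) (pyy x y) y := fun x y hy => by
    exact (vF' x y hy).complex_im.neg.congr_deriv (by simp [hpyy])
  have hqyy' : ∀ x y, 0 < y → HasDerivAt (fun y => qy x y) (qyy x y) y := fun x y hy => by
    exact (vG' x y hy).complex_re.neg.congr_deriv (by simp [hqyy])
  have cre : ∀ {φ : ℝ × ℝ → ℂ}, ContinuousOn φ {p | 0 < p.2} →
      ContinuousOn (fun p => (φ p).re) {p | 0 < p.2} := fun h =>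
    Complex.continuous_re.comp_continuousOn h
  have cim : ∀ {φ : ℝ × ℝ → ℂ}, ContinuousOn φ {p | 0 < p.2} →
      ContinuousOn (fun p => (φ p).im) {p | 0 < p.2} := fun h =>
    Complex.continuous_im.comp_continuousOn h
  have f0 := hf.continuousOn_cauchyTr
  have f1 := hf.continuousOn_cauchyTr'
  have f2 := hf.continuousOn_cauchyTr''
  have g0 := hg.continuousOn_cauchyTr
  have g1 := hg.continuousOn_cauchyTr'
  have g2 := hg.continuousOn_cauchyTr''
  have green := green_rectangle (ζ := fun x y => p x y * q x y)
    (ζx := fun x y => px x y * q x y + p x y * qx x y)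
    (ζy := fun x y => py x y * q x y + p x y * qy x y)
    (ζxx := fun x y => pxx x y * q x y + px x y * qx x y + (px x y * qx x y + p x y * qxx x y))
    (ζyy := fun x y => pyy x y * q x y + py x y * qy x y + (py x y * qy x y + p x y * qyy x y))
    (fun x y hy => (hpy' x y hy).mul (hqy' x y hy))
    (fun x y hy => ((hpxx' x y hy).mul (hqx' x y hy)).add ((hpx' x y hy).mul (hqxx' x y hy)))
    (fun x y hy => ((hpyy' x y hy).mul (hqy' x y hy)).add ((hpy' x y hy).mul (hqyy' x y hy)))
    ((((cre f2).mul (cim g0).neg).add ((cre f1).mul (cim g1).neg)).add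
      (((cre f1).mul (cim g1).neg).add ((cre f0).mul (cim g2).neg)))
    ((((cre f2).neg.mul (cim g0).neg).add ((cim f1).neg.mul (cre g1).neg)).add
      (((cim f1).neg.mul (cre g1).neg).add ((cre f0).mul (cim g2))))
    (X := Z) (Y := Z) (by linarith) (by linarith)
  have hre : ∀ z : ℂ, |z.re| ≤ ‖z‖ := Complex.abs_re_le_norm
  have him : ∀ z : ℂ, |-z.im| ≤ ‖z‖ := fun z => by rw [abs_neg]; exact Complex.abs_im_le_norm z
  have bulk : |∫ z in Ioc (-Z) Z ×ˢ Ioc (1 / 2) Z, (z.2 - 1 / 2) *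
      (pxx z.1 z.2 * q z.1 z.2 + px z.1 z.2 * qx z.1 z.2 +
        (px z.1 z.2 * qx z.1 z.2 + p z.1 z.2 * qxx z.1 z.2) +
       (pyy z.1 z.2 * q z.1 z.2 + py z.1 z.2 * qy z.1 z.2 +
        (py z.1 z.2 * qy z.1 z.2 + p z.1 z.2 * qyy z.1 z.2)))| ≤ 2 * E.toReal := by
    rw [← Real.norm_eq_abs, ← toReal_enorm,
      show 2 * E.toReal = (2 * E).toReal by rw [ENNReal.toReal_mul, ENNReal.toReal_ofNat]]
    refine ENNReal.toReal_mono (ENNReal.mul_ne_top (by simp) hE) ?_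
    refine (enorm_integral_le_lintegral_enorm _).trans ?_
    refine le_trans ?_ (mul_le_mul_right (hEle Z Z) _)
    rw [← lintegral_const_mul' _ _ (by simp)]
    refine setLIntegral_mono' (measurableSet_Ioc.prod measurableSet_Ioc) fun z hz => ?_
    have hz2 : 1 / 2 < z.2 := hz.2.1
    rw [Real.enorm_eq_ofReal_abs, show (2 : ENNReal) = ENNReal.ofReal 2 by norm_num,
      ← ENNReal.ofReal_mul (by norm_num)]
    refine ENNReal.ofReal_le_ofReal ?_
    rw [abs_mul, abs_of_pos (show 0 < z.2 - 1 / 2 by linarith)]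
    have e : pxx z.1 z.2 * q z.1 z.2 + px z.1 z.2 * qx z.1 z.2 +
        (px z.1 z.2 * qx z.1 z.2 + p z.1 z.2 * qxx z.1 z.2) +
       (pyy z.1 z.2 * q z.1 z.2 + py z.1 z.2 * qy z.1 z.2 +
        (py z.1 z.2 * qy z.1 z.2 + p z.1 z.2 * qyy z.1 z.2)) =
        -2 * (cauchyTr' f ⟨z.1, z.2⟩ * -star (cauchyTr' g ⟨z.1, z.2⟩)).im := by
      simp only [hpxx, hq, hpx, hqx, hp, hqxx, hpyy, hpy, hqy, hqyy]
      simp [Complex.mul_im]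
      ring
    rw [e, abs_mul]
    have h1 := Complex.abs_im_le_norm (cauchyTr' f ⟨z.1, z.2⟩ * -star (cauchyTr' g ⟨z.1, z.2⟩))
    rw [norm_mul, norm_neg, norm_star] at h1
    have := mul_le_mul_of_nonneg_left h1 (show 0 ≤ z.2 - 1 / 2 by linarith)
    rw [abs_neg, abs_two]
    linarith
  have far : ∀ x y : ℝ, Z ≤ |x| ∨ Z ≤ |y| → ‖cauchyTr f ⟨x, y⟩‖ ≤ m * (2 / Z) ∧
      ‖cauchyTr' f ⟨x, y⟩‖ ≤ m * (2 / Z) ^ 2 ∧ ‖cauchyTr g ⟨x, y⟩‖ ≤ m' * (2 / Z) ∧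
      ‖cauchyTr' g ⟨x, y⟩‖ ≤ m' * (2 / Z) ^ 2 := by
    intro x y h
    have hn : Z ≤ ‖(⟨x, y⟩ : ℂ)‖ := by
      rcases h with h | h
      · exact h.trans (Complex.abs_re_le_norm (⟨x, y⟩ : ℂ))
      · exact h.trans (Complex.abs_im_le_norm (⟨x, y⟩ : ℂ))
    have hn0 : 0 < ‖(⟨x, y⟩ : ℂ)‖ := hZ0.trans_le hn
    have hd : 2 / ‖(⟨x, y⟩ : ℂ)‖ ≤ 2 / Z := div_le_div_of_nonneg_left zero_le_two hZ0 hn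
    have hd2 : (2 / ‖(⟨x, y⟩ : ℂ)‖) ^ 2 ≤ (2 / Z) ^ 2 := pow_le_pow_left₀ (by positivity) hd 2
    exact ⟨(hf.norm_cauchyTr_le (hZR.trans hn) hn0).trans (mul_le_mul_of_nonneg_left hd hm0),
      (hf.norm_cauchyTr'_le (hZR.trans hn) hn0).trans (mul_le_mul_of_nonneg_left hd2 hm0),
      (hg.norm_cauchyTr_le (hZR'.trans hn) hn0).trans (mul_le_mul_of_nonneg_left hd hm0'),
      (hg.norm_cauchyTr'_le (hZR'.trans hn) hn0).trans (mul_le_mul_of_nonneg_left hd2 hm0')⟩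
  have prodle : ∀ {a b α β : ℝ}, |a| ≤ α → |b| ≤ β → |a * b| ≤ α * β := fun h1 h2 => by
    rw [abs_mul]; exact mul_le_mul h1 h2 (abs_nonneg _) ((abs_nonneg _).trans h1)
  have hζx : ∀ x y : ℝ, Z ≤ |x| ∨ Z ≤ |y| →
      |px x y * q x y + p x y * qx x y| ≤ 16 * (m * m') / Z ^ 3 := by
    intro x y h
    obtain ⟨h1, h2, h3, h4⟩ := far x y h
    refine (abs_add_le _ _).trans ((add_le_add (prodle ((hre _).trans h2) ((him _).trans h3))
      (prodle ((hre _).trans h1) ((him _).trans h4))).trans (le_of_eq ?_))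
    field_simp; ring
  have hζy : ∀ x y : ℝ, Z ≤ |x| ∨ Z ≤ |y| →
      |py x y * q x y + p x y * qy x y| ≤ 16 * (m * m') / Z ^ 3 := by
    intro x y h
    obtain ⟨h1, h2, h3, h4⟩ := far x y h
    refine (abs_add_le _ _).trans ((add_le_add (prodle ((him _).trans h2) ((him _).trans h3))
      (prodle ((hre _).trans h1) (((abs_neg _).le.trans (hre _)).trans h4))).trans (le_of_eq ?_))
    field_simp; ring
  have hζ : ∀ x y : ℝ, Z ≤ |x| ∨ Z ≤ |y| → |p x y * q x y| ≤ 4 * (m * m') / Z ^ 2 := by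
    intro x y h
    obtain ⟨h1, h2, h3, h4⟩ := far x y h
    refine (prodle ((hre _).trans h1) ((him _).trans h3)).trans (le_of_eq ?_)
    field_simp; ring
  have side : |∫ y in (1 / 2)..Z, (y - 1 / 2) * ((px Z y * q Z y + p Z y * qx Z y) -
      (px (-Z) y * q (-Z) y + p (-Z) y * qx (-Z) y))| ≤ 32 * (m * m') / Z := by
    have := intervalIntegral.norm_integral_le_of_norm_le_const (a := 1 / 2) (b := Z)
      (C := 32 * (m * m') / Z ^ 2) (f := fun y => (y - 1 / 2) * ((px Z y * q Z y + p Z y * qx Z y) -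
      (px (-Z) y * q (-Z) y + p (-Z) y * qx (-Z) y))) ?_
    · rw [Real.norm_eq_abs] at this
      refine this.trans ?_
      rw [abs_of_nonneg (by linarith), div_mul_eq_mul_div, div_le_div_iff₀ (by positivity) hZ0]
      have : 0 ≤ m * m' := by positivity
      nlinarith [mul_nonneg this hZ0.le]
    · intro y hy
      rw [uIoc_of_le (by linarith)] at hy
      rw [Real.norm_eq_abs]
      have h1 := hζx Z y (Or.inl (le_abs_self _))
      have h2 := hζx (-Z) y (Or.inl (by rw [abs_neg]; exact le_abs_self _))
      refine (prodle (α := Z) ?_ ((abs_sub _ _).trans (add_le_add h1 h2))).trans (le_of_eq ?_)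
      · rw [abs_of_nonneg (by linarith [hy.1])]; linarith [hy.2]
      · field_simp; ring
  have czeta : ∀ y, 0 < y → Continuous fun x => p x y * q x y := fun y hy =>
    continuous_iff_continuousAt.2 fun x => ((hpx' x y hy).mul (hqx' x y hy)).continuousAt
  have top : |∫ x in (-Z)..Z, ((Z - 1 / 2) * (py x Z * q x Z + p x Z * qy x Z) - p x Z * q x Z)| ≤
      40 * (m * m') / Z := by
    have := intervalIntegral.norm_integral_le_of_norm_le_const (a := -Z) (b := Z)
      (C := 20 * (m * m') / Z ^ 2) (f := fun x => (Z - 1 / 2) * (py x Z * q x Z + p x Z * qy x Z)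
        - p x Z * q x Z) ?_
    · rw [Real.norm_eq_abs] at this
      refine this.trans (le_of_eq ?_)
      rw [abs_of_nonneg (by linarith)]
      field_simp; ring
    · intro x hx
      rw [Real.norm_eq_abs]
      have h1 := hζy x Z (Or.inr (le_abs_self _))
      have h2 := hζ x Z (Or.inr (le_abs_self _))
      refine (abs_sub _ _).trans ((add_le_add (prodle (α := Z) ?_ h1) h2).trans (le_of_eq ?_))
      · rw [abs_of_nonneg (by linarith)]; linarith
      · field_simp; ring
  have cy : Continuous fun x => py x Z * q x Z + p x Z * qy x Z := by
    have sl : ∀ {φ : ℝ × ℝ → ℝ}, ContinuousOn φ {p | 0 < p.2} → Continuous fun x => φ (x, Z) :=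
      fun h => h.comp_continuous (by fun_prop : Continuous fun x : ℝ => (x, Z)) fun x => hZ0
    exact ((sl (cim f1)).neg.mul (sl (cim g0)).neg).add ((sl (cre f0)).mul (sl (cre g1)).neg)
  have split : ∫ x in (-Z)..Z, ((Z - 1 / 2) * (py x Z * q x Z + p x Z * qy x Z) - p x Z * q x Z +
      p x (1 / 2) * q x (1 / 2)) =
      (∫ x in (-Z)..Z, ((Z - 1 / 2) * (py x Z * q x Z + p x Z * qy x Z) - p x Z * q x Z)) +
      ∫ x in (-Z)..Z, p x (1 / 2) * q x (1 / 2) :=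
    intervalIntegral.integral_add
      ((((cy.const_mul _).sub (czeta Z hZ0))).intervalIntegrable _ _)
      ((czeta (1 / 2) one_half_pos).intervalIntegrable _ _)
  rw [split] at green
  have hfin : 72 * (m * m') / Z = 32 * (m * m') / Z + 40 * (m * m') / Z := by ring
  rw [hfin]
  rw [abs_le] at bulk side top ⊢
  constructor <;> linarith [bulk.1, bulk.2, side.1, side.2, top.1, top.2]

end BoundedBump

theorem abs_mul_inv_sq_add_le (u : ℝ) {y : ℝ} (hy : 1 / 2 ≤ y) : |u * (u ^ 2 + y ^ 2)⁻¹| ≤ 1 := by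
  have h : 0 < u ^ 2 + y ^ 2 := by positivity
  rw [← div_eq_mul_inv, abs_div, abs_of_pos h, div_le_one h]
  nlinarith [sq_nonneg (|u| - 1 / 2), sq_abs u]

namespace BoundedBump
variable {f g : ℝ → ℝ} {M R M' R' : ℝ}

theorem integral_re_mul_im (hf : BoundedBump f M R) (hg : BoundedBump g M' R') :
    Integrable (fun x : ℝ => (cauchyTr f ⟨x, 1 / 2⟩).re * -(cauchyTr g ⟨x, 1 / 2⟩).im) ∧
    ∫ x : ℝ, (cauchyTr f ⟨x, 1 / 2⟩).re * -(cauchyTr g ⟨x, 1 / 2⟩).im =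
      Real.pi⁻¹ * ∫ x, g x * ∫ t, f t * ((x - t) * ((x - t) ^ 2 + 1)⁻¹) := by
  have hπ := Real.pi_pos
  set U : ℝ → ℝ := fun x => (cauchyTr f ⟨x, 1 / 2⟩).re with hU
  have hhalf : (0 : ℝ) < 1 / 2 := by norm_num
  have cU : Continuous U := continuous_iff_continuousAt.2 fun x =>
    (hasDerivAt_horizontal (hf.hasDerivAt_cauchyTr (z := ⟨x, 1 / 2⟩) hhalf)).complex_re.continuousAt
  have hUeq : ∀ x, U x = ∫ t, f t * (Real.pi⁻¹ * (x - t) * ((t - x) ^ 2 + (1 / 2) ^ 2)⁻¹) :=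
    fun x => hf.re_cauchyTr hhalf
  set P : ℝ → ℝ := fun u => Real.pi⁻¹ * (1 / 2) * (u ^ 2 + (1 / 2) ^ 2)⁻¹ with hP
  have hPi : Integrable P := by
    have := integrable_poisson 0 hhalf
    simpa [hP] using this
  have cP : Continuous P := by
    simp only [hP]
    refine continuous_const.mul (Continuous.inv₀ (by fun_prop) fun u => by positivity)
  set Cj : ℝ → ℝ := fun u => Real.pi⁻¹ * u * (u ^ 2 + (1 / 2) ^ 2)⁻¹ with hCj
  have cC : Continuous Cj := by
    simp only [hCj]
    refine Continuous.mul (by fun_prop) (Continuous.inv₀ (by fun_prop) fun u => by positivity)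
  have hCb : ∀ u, |Cj u| ≤ 1 := fun u => by
    simp only [hCj]
    rw [mul_assoc, abs_mul, abs_of_pos (inv_pos.2 hπ)]
    exact mul_le_one₀ (inv_le_one_of_one_le₀ (by linarith [Real.pi_gt_three])) (abs_nonneg _)
      (abs_mul_inv_sq_add_le u le_rfl)
  have hUC : ∀ x, U x = ∫ t, f t * Cj (x - t) := fun x => by
    rw [hUeq]
    refine integral_congr_ae (ae_of_all _ fun t => ?_)
    simp only [hCj]; rw [← neg_sub x t, neg_sq]
  have hUb : ∀ x, |U x| ≤ ∫ t, f t := fun x => by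
    rw [hUC, ← Real.norm_eq_abs]
    refine (norm_integral_le_of_norm_le hf.integrable (ae_of_all _ fun t => ?_))
    rw [norm_mul, Real.norm_of_nonneg (hf.nonneg t), Real.norm_eq_abs]
    exact mul_le_of_le_one_right (hf.nonneg t) (hCb _)
  have hWP : ∀ x, -(cauchyTr g ⟨x, 1 / 2⟩).im = ∫ s, g s * P (x - s) := fun x => by
    rw [hg.neg_im_cauchyTr hhalf]
    refine integral_congr_ae (ae_of_all _ fun t => ?_)
    simp only [hP]; rw [← neg_sub x t, neg_sq]
  have hconv : Integrable (fun p : ℝ × ℝ => g p.2 * P (p.1 - p.2)) := by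
    simpa [Measure.volume_eq_prod] using hg.integrable.convolution_integrand
      (ContinuousLinearMap.mul ℝ ℝ) hPi
  have hconvU : Integrable (fun p : ℝ × ℝ => U p.1 * (g p.2 * P (p.1 - p.2))) :=
    hconv.bdd_mul (c := ∫ t, f t) (by fun_prop) (ae_of_all _ fun p => hUb p.1)
  have hexp : ∀ x, U x * -(cauchyTr g ⟨x, 1 / 2⟩).im = ∫ s, U x * (g s * P (x - s)) := fun x => by
    rw [integral_const_mul, hWP]
  constructor
  · exact Integrable.congr hconvU.integral_prod_left (ae_of_all _ fun x => (hexp x).symm)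
  have hfp : ∀ s, Integrable (fun p : ℝ × ℝ => f p.2 * Cj (p.1 - p.2) * P (p.1 - s)) := by
    intro s
    have h1 : Integrable (fun p : ℝ × ℝ => P (p.1 - s) * f p.2) :=
      (hPi.comp_sub_right s).mul_prod hf.integrable
    have h2 := h1.bdd_mul (c := 1) (f := fun p : ℝ × ℝ => Cj (p.1 - p.2)) (by fun_prop)
      (ae_of_all _ fun p => hCb _)
    refine h2.congr (ae_of_all _ fun p => ?_)
    simp only; ring
  have hker : ∀ s t : ℝ, ∫ x, Cj (x - t) * P (x - s) =
      Real.pi⁻¹ * ((s - t) * ((s - t) ^ 2 + 1)⁻¹) := by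
    intro s t
    have h := integral_conjPoisson_mul_poisson (s - t)
    rw [← integral_sub_right_eq_self _ s] at h
    calc _ = ∫ x, Real.pi⁻¹ * Real.pi⁻¹ * (((x - s + (s - t)) * ((x - s + (s - t)) ^ 2 + 1 / 4)⁻¹) *
          (1 / 2 * ((x - s) ^ 2 + 1 / 4)⁻¹)) := by
          refine integral_congr_ae (ae_of_all _ fun x => ?_)
          simp only [hCj, hP, sub_add_sub_cancel]; norm_num; ring
      _ = _ := by rw [integral_const_mul, h]; field_simp
  refine (integral_congr_ae (ae_of_all _ hexp)).trans ?_
  rw [integral_integral_swap hconvU, ← integral_const_mul]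
  refine integral_congr_ae (ae_of_all _ fun s => ?_)
  calc ∫ x, U x * (g s * P (x - s)) = g s * ∫ x, ∫ t, f t * Cj (x - t) * P (x - s) := by
        rw [← integral_const_mul]
        refine integral_congr_ae (ae_of_all _ fun x => ?_)
        simp only
        rw [integral_mul_const, ← hUC]; ring
    _ = g s * ∫ t, f t * ∫ x, Cj (x - t) * P (x - s) := by
        rw [integral_integral_swap (hfp s)]
        simp_rw [mul_assoc, integral_const_mul]
    _ = _ := by
        simp_rw [hker, mul_left_comm _ (Real.pi⁻¹), integral_const_mul]
        ring

end BoundedBump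

/-- Modular bound for the bilinear form of the conjugate Poisson kernel. -/
theorem conjPoisson_form_le (A B : YoungFunction) {K : ℝ}
    (hAfin : ∀ t : ℝ, 0 ≤ t → A.toFun t < ⊤) (hBfin : ∀ t : ℝ, 0 ≤ t → B.toFun t < ⊤)
    (hK : ∀ t : ℝ, 0 < t →
        (∫⁻ s in Set.Ioo (0 : ℝ) t, B.toFun s / ENNReal.ofReal (s ^ 2))
            ≤ A.toFun (K * t) / ENNReal.ofReal t ∧
        (∫⁻ s in Set.Ioo (0 : ℝ) t, A.conj s / ENNReal.ofReal (s ^ 2))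
            ≤ B.conj (K * t) / ENNReal.ofReal t) (hK1 : 1 ≤ K)
    {f g : ℝ → ℝ} {M R M' R' : ℝ} (hf : BoundedBump f M R) (hg : BoundedBump g M' R') :
    ENNReal.ofReal |∫ x, g x * ∫ t, f t * ((x - t) * ((x - t) ^ 2 + 1)⁻¹)| ≤
      4000 * ∫⁻ t, (A.toFun (96 * K * f t) + B.conj (96 * K * g t)) := by
  set I := ∫⁻ t, (A.toFun (96 * K * f t) + B.conj (96 * K * g t)) with hI
  by_cases hItop : I = ⊤
  · rw [hItop, ENNReal.mul_top (by norm_num)]; exact le_top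
  have hE : 500 * I ≠ ⊤ := ENNReal.mul_ne_top (by norm_num) hItop
  obtain ⟨hInt, heq⟩ := hf.integral_re_mul_im hg
  set J := ∫ x, g x * ∫ t, f t * ((x - t) * ((x - t) ^ 2 + 1)⁻¹) with hJ
  have hle : |Real.pi⁻¹ * J| ≤ 2 * (500 * I).toReal + 0 := by
    have h1 : Tendsto (fun Z : ℝ => |∫ x in (-Z)..Z,
        (cauchyTr f ⟨x, 1 / 2⟩).re * -(cauchyTr g ⟨x, 1 / 2⟩).im|) atTop
        (nhds |Real.pi⁻¹ * J|) := by
      rw [← heq]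
      exact (intervalIntegral_tendsto_integral hInt tendsto_neg_atTop_atBot tendsto_id).abs
    have h2 : Tendsto (fun Z : ℝ => 2 * (500 * I).toReal + 72 * ((∫ t, f t) * ∫ t, g t) / Z) atTop
        (nhds (2 * (500 * I).toReal + 0)) :=
      (tendsto_id.const_div_atTop _).const_add _
    refine le_of_tendsto_of_tendsto h1 h2 ?_
    filter_upwards [eventually_ge_atTop 1, eventually_ge_atTop (2 * R),
      eventually_ge_atTop (2 * R')] with Z hZ1 hZ2 hZ3
    exact hf.abs_intervalIntegral_re_mul_im_le hg hE
      (lintegral_energy_le A B hAfin hBfin hK hK1 hf hg) hZ1 hZ2 hZ3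
  have hπ := Real.pi_pos
  rw [abs_mul, abs_of_pos (inv_pos.2 hπ), inv_mul_le_iff₀ hπ, ENNReal.toReal_mul] at hle
  have h4 : |J| ≤ 4000 * I.toReal := by
    refine hle.trans ?_
    have := Real.pi_le_four
    have h5 : (0 : ℝ) ≤ I.toReal := ENNReal.toReal_nonneg
    norm_num
    nlinarith
  refine (ENNReal.ofReal_le_ofReal h4).trans ?_
  rw [ENNReal.ofReal_mul (by norm_num), ENNReal.ofReal_toReal hItop]
  norm_num

/-- Bounded measurable functions with bounded support. -/
structure IsTest (f : ℝ → ℝ) : Prop where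
  meas : Measurable f
  bdd : ∃ M, ∀ t, |f t| ≤ M
  supp : ∃ R, ∀ t, R < |t| → f t = 0

namespace IsTest
variable {f g : ℝ → ℝ}

theorem posPart (hf : IsTest f) : ∃ M R, BoundedBump (fun t => max (f t) 0) M R := by
  obtain ⟨M, hM⟩ := hf.bdd
  obtain ⟨R, hR⟩ := hf.supp
  exact ⟨M, R, hf.meas.max measurable_const, fun t => le_max_right _ _,
    fun t => max_le ((le_abs_self _).trans (hM t)) ((abs_nonneg _).trans (hM t)),
    fun t ht => by simp [hR t ht]⟩

theorem mul_bdd (hf : IsTest f) {φ : ℝ → ℝ} (hφ : Measurable φ) {C : ℝ} (hC : ∀ t, |φ t| ≤ C) :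
    IsTest (fun t => f t * φ t) := by
  obtain ⟨M, hM⟩ := hf.bdd
  obtain ⟨R, hR⟩ := hf.supp
  exact ⟨hf.meas.mul hφ, ⟨M * C, fun t => by
    rw [abs_mul]; exact mul_le_mul (hM t) (hC t) (abs_nonneg _) ((abs_nonneg _).trans (hM t))⟩,
    ⟨R, fun t ht => by simp [hR t ht]⟩⟩

theorem neg (hf : IsTest f) : IsTest (fun t => -f t) := by
  simpa using hf.mul_bdd (φ := fun _ => -1) measurable_const (C := 1) (by simp)

theorem comp_mul (hf : IsTest f) {l : ℝ} (hl : 0 < l) : IsTest (fun t => f (l * t)) := by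
  obtain ⟨M, hM⟩ := hf.bdd
  obtain ⟨R, hR⟩ := hf.supp
  refine ⟨hf.meas.comp (measurable_const_mul l), ⟨M, fun t => hM _⟩, R / l, fun t ht => hR _ ?_⟩
  rw [div_lt_iff₀ hl] at ht
  rw [abs_mul, abs_of_pos hl]; linarith

theorem integrable (hf : IsTest f) : Integrable f := by
  obtain ⟨M, R, h⟩ := hf.posPart
  obtain ⟨M', R', h'⟩ := hf.neg.posPart
  refine (h.integrable.sub h'.integrable).congr (ae_of_all _ fun t => ?_)
  simp only [Pi.sub_apply]
  rcases le_total (f t) 0 with h | h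
  · rw [max_eq_right h, max_eq_left (by linarith)]; ring
  · rw [max_eq_left h, max_eq_right (by linarith)]; ring

end IsTest

theorem integrable_mul_comp_sub {f k : ℝ → ℝ} (hf : Integrable f) (hk : Measurable k) {C : ℝ}
    (hC : ∀ u, |k u| ≤ C) (x : ℝ) : Integrable fun t => f t * k (x - t) :=
  hf.mul_bdd (c := C) (hk.comp (measurable_const.sub measurable_id)).aestronglyMeasurable
    (ae_of_all _ fun _ => hC _)

theorem integrable_form {f g k : ℝ → ℝ} (hf : Integrable f) (hg : Integrable g)
    (hk : Measurable k) {C : ℝ} (hC : ∀ u, |k u| ≤ C) :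
    Integrable (fun p : ℝ × ℝ => g p.1 * (f p.2 * k (p.1 - p.2))) := by
  have h1 : Integrable (fun p : ℝ × ℝ => g p.1 * f p.2) := hg.mul_prod hf
  have := h1.mul_bdd (g := fun p : ℝ × ℝ => k (p.1 - p.2)) (c := C)
    (hk.comp (measurable_fst.sub measurable_snd)).aestronglyMeasurable (ae_of_all _ fun t => hC _)
  exact this.congr (ae_of_all _ fun p => by simp only; ring)

theorem integrable_form_left {f g k : ℝ → ℝ} (hf : Integrable f) (hg : Integrable g)
    (hk : Measurable k) {C : ℝ} (hC : ∀ u, |k u| ≤ C) :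
    Integrable (fun x => g x * ∫ t, f t * k (x - t)) := by
  have := (integrable_form hf hg hk hC).integral_prod_left
  simpa [integral_const_mul] using this

theorem integral_inv_one_add_sub_sq (x : ℝ) :
    ∫⁻ t : ℝ, ENNReal.ofReal (1 + (x - t) ^ 2)⁻¹ = ENNReal.ofReal Real.pi := by
  rw [← ofReal_integral_eq_lintegral_ofReal]
  · congr 1
    rw [integral_sub_left_eq_self (fun u : ℝ => (1 + u ^ 2)⁻¹), integral_univ_inv_one_add_sq]
  · exact integrable_inv_one_add_sq.comp_sub_left x
  · exact ae_of_all _ fun t => by positivity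

theorem lintegral_comp_inv_mul {l : ℝ} (hl : 0 < l) {φ : ℝ → ENNReal} (hφ : Measurable φ) :
    ∫⁻ t, φ (l⁻¹ * t) = ENNReal.ofReal l * ∫⁻ t, φ t := by
  have hli : l⁻¹ ≠ 0 := (inv_pos.2 hl).ne'
  rw [← lintegral_map hφ (measurable_const_mul l⁻¹), Real.map_volume_mul_left hli,
    lintegral_smul_measure, inv_inv, abs_of_pos hl, smul_eq_mul]

/-- Expansion of a bilinear form in differences. -/
theorem integral_form_sub {f1 f2 g1 g2 k : ℝ → ℝ} (i1 : Integrable f1) (i2 : Integrable f2)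
    (j1 : Integrable g1) (j2 : Integrable g2) (hk : Measurable k) {C : ℝ} (hC : ∀ u, |k u| ≤ C) :
    ∫ x, (g1 x - g2 x) * ∫ t, (f1 t - f2 t) * k (x - t) =
      (∫ x, g1 x * ∫ t, f1 t * k (x - t)) - (∫ x, g1 x * ∫ t, f2 t * k (x - t)) -
      ((∫ x, g2 x * ∫ t, f1 t * k (x - t)) - (∫ x, g2 x * ∫ t, f2 t * k (x - t))) := by
  have hx : ∀ x, ∫ t, (f1 t - f2 t) * k (x - t) =
      (∫ t, f1 t * k (x - t)) - ∫ t, f2 t * k (x - t) := fun x => by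
    rw [← integral_sub (integrable_mul_comp_sub i1 hk hC x) (integrable_mul_comp_sub i2 hk hC x)]
    exact integral_congr_ae (ae_of_all _ fun t => sub_mul _ _ _)
  have a := integral_sub (integrable_form_left i1 j1 hk hC) (integrable_form_left i2 j1 hk hC)
  have b := integral_sub (integrable_form_left i1 j2 hk hC) (integrable_form_left i2 j2 hk hC)
  have c := integral_sub
    ((integrable_form_left i1 j1 hk hC).sub (integrable_form_left i2 j1 hk hC))
    ((integrable_form_left i1 j2 hk hC).sub (integrable_form_left i2 j2 hk hC))
  simp only [Pi.sub_apply] at c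
  rw [← a, ← b, ← c]
  refine integral_congr_ae (ae_of_all _ fun x => ?_)
  simp only [hx]
  ring

/-- Finite-valued Young functions satisfying the two Hardy-type integral conditions. -/
structure HardyPair (A B : YoungFunction) (K : ℝ) : Prop where
  left_lt_top : ∀ t : ℝ, 0 ≤ t → A.toFun t < ⊤
  right_lt_top : ∀ t : ℝ, 0 ≤ t → B.toFun t < ⊤
  cond : ∀ t : ℝ, 0 < t →
        (∫⁻ s in Set.Ioo (0 : ℝ) t, B.toFun s / ENNReal.ofReal (s ^ 2))
            ≤ A.toFun (K * t) / ENNReal.ofReal t ∧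
        (∫⁻ s in Set.Ioo (0 : ℝ) t, A.conj s / ENNReal.ofReal (s ^ 2))
            ≤ B.conj (K * t) / ENNReal.ofReal t
  one_le : 1 ≤ K

section Forms
variable {A B : YoungFunction} {K : ℝ}

/-- The conjugate Poisson form bound for signed functions. -/
theorem conjPoisson_form_le_of_isTest (hAB : HardyPair A B K) {f g : ℝ → ℝ} (hf : IsTest f)
    (hg : IsTest g) :
    ENNReal.ofReal |∫ x, g x * ∫ t, f t * ((x - t) * ((x - t) ^ 2 + 1)⁻¹)| ≤
      16000 * ∫⁻ t, (A.toFun (96 * K * |f t|) + B.conj (96 * K * |g t|)) := by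
  have hK1 := hAB.one_le
  have hK0 : 0 < K := by linarith
  set k : ℝ → ℝ := fun u => u * (u ^ 2 + 1)⁻¹ with hk
  have hkm : Measurable k := by simp only [hk]; fun_prop
  have hkb : ∀ u, |k u| ≤ 1 := fun u => by
    have := abs_mul_inv_sq_add_le u (y := 1) (by norm_num)
    rwa [one_pow] at this
  have hp := hf.posPart
  have hn := hf.neg.posPart
  have hgp := hg.posPart
  have hgn := hg.neg.posPart
  set I := ∫⁻ t, (A.toFun (96 * K * |f t|) + B.conj (96 * K * |g t|)) with hI
  have key : ∀ {F G : ℝ → ℝ}, (∃ M R, BoundedBump F M R) → (∃ M R, BoundedBump G M R) →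
      (∀ t, F t ≤ |f t|) → (∀ t, G t ≤ |g t|) →
      ENNReal.ofReal |∫ x, G x * ∫ t, F t * k (x - t)| ≤ 4000 * I := by
    rintro F G ⟨M, R, hF⟩ ⟨M', R', hG⟩ h1 h2
    refine (conjPoisson_form_le A B hAB.left_lt_top hAB.right_lt_top hAB.cond hAB.one_le
      hF hG).trans (mul_le_mul_right ?_ _)
    refine lintegral_mono fun t => add_le_add ?_ ?_
    · exact A.mono (mul_nonneg (by positivity) (hF.nonneg t))
        (mul_le_mul_of_nonneg_left (h1 t) (by positivity))
    · exact B.conj_mono (mul_le_mul_of_nonneg_left (h2 t) (by positivity))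
  have hpos : ∀ a : ℝ, max a 0 ≤ |a| := fun a => max_le (le_abs_self a) (abs_nonneg a)
  have hneg : ∀ a : ℝ, max (-a) 0 ≤ |a| := fun a => max_le (neg_le_abs a) (abs_nonneg a)
  have hdec : ∀ a : ℝ, a = max a 0 - max (-a) 0 := fun a => by
    rcases le_total a 0 with h | h
    · rw [max_eq_right h, max_eq_left (by linarith)]; ring
    · rw [max_eq_left h, max_eq_right (by linarith)]; ring
  have i1 : Integrable fun t => max (f t) 0 := by obtain ⟨_, _, h⟩ := hp; exact h.integrable
  have i2 : Integrable fun t => max (-f t) 0 := by obtain ⟨_, _, h⟩ := hn; exact h.integrable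
  have j1 : Integrable fun t => max (g t) 0 := by obtain ⟨_, _, h⟩ := hgp; exact h.integrable
  have j2 : Integrable fun t => max (-g t) 0 := by obtain ⟨_, _, h⟩ := hgn; exact h.integrable
  have a11 := key hp hgp (fun t => hpos _) (fun t => hpos _)
  have a12 := key hp hgn (fun t => hpos _) (fun t => hneg _)
  have a21 := key hn hgp (fun t => hneg _) (fun t => hpos _)
  have a22 := key hn hgn (fun t => hneg _) (fun t => hneg _)
  have e := integral_form_sub i1 i2 j1 j2 hkm hkb
  simp only [← hdec] at e
  have h4 : ∀ a b c d : ℝ, |a - b - (c - d)| ≤ |a| + |b| + (|c| + |d|) := fun a b c d =>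
    (abs_sub _ _).trans (add_le_add (abs_sub _ _) (abs_sub _ _))
  refine (ENNReal.ofReal_le_ofReal ((congrArg abs e).trans_le (h4 _ _ _ _))).trans ?_
  rw [ENNReal.ofReal_add (by positivity) (by positivity),
    ENNReal.ofReal_add (by positivity) (by positivity),
    ENNReal.ofReal_add (by positivity) (by positivity)]
  refine (add_le_add (add_le_add a11 a21) (add_le_add a12 a22)).trans (le_of_eq ?_)
  rw [← add_mul, ← add_mul]; norm_num

/-- Modular bound for the bilinear form with kernel `sinc`. -/
theorem sinc_form_le (hAB : HardyPair A B K) {K' : ℝ} (hKK' : 96 * K ≤ K')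
    (hBA : ∀ t : ℝ, 0 ≤ t → B.toFun t ≤ A.toFun (K' * t))
    {f g : ℝ → ℝ} (hf : IsTest f) (hg : IsTest g) :
    ENNReal.ofReal |∫ x, g x * ∫ t, f t * Real.sinc (x - t)| ≤
      40000 * ∫⁻ t, (A.toFun (K' * |f t|) + B.conj (K' * |g t|)) := by
  have hK1 := hAB.one_le
  have hK0 : 0 < K := by linarith
  have hK'1 : 1 ≤ K' := by linarith
  set k : ℝ → ℝ := fun u => u * (u ^ 2 + 1)⁻¹ with hk
  have hkm : Measurable k := by simp only [hk]; fun_prop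
  have hkb : ∀ u, |k u| ≤ 1 := fun u => by
    have := abs_mul_inv_sq_add_le u (y := 1) (by norm_num)
    rwa [one_pow] at this
  set r : ℝ → ℝ := fun u => Real.sinc u - Real.sin u * k u with hr
  have hrm : Measurable r := Real.continuous_sinc.measurable.sub
    (Real.continuous_sin.measurable.mul hkm)
  have hrb : ∀ u, |r u| ≤ (1 + u ^ 2)⁻¹ := by
    intro u
    have h0 : (0 : ℝ) < 1 + u ^ 2 := by positivity
    have : r u = Real.sinc u * (1 + u ^ 2)⁻¹ := by
      rcases eq_or_ne u 0 with rfl | hu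
      · simp [hr, hk]
      · simp only [hr, hk]
        rw [Real.sinc_of_ne_zero hu, add_comm (u ^ 2) 1]
        field_simp; ring
    rw [this, abs_mul, abs_of_pos (inv_pos.2 h0)]
    exact mul_le_of_le_one_left (inv_pos.2 h0).le (Real.abs_sinc_le_one u)
  have hrb1 : ∀ u, |r u| ≤ 1 := fun u =>
    (hrb u).trans (inv_le_one_of_one_le₀ (by nlinarith [sq_nonneg u]))
  set I := ∫⁻ t, (A.toFun (K' * |f t|) + B.conj (K' * |g t|)) with hI
  have key : ∀ {φ ψ : ℝ → ℝ}, Measurable φ → Measurable ψ → (∀ t, |φ t| ≤ 1) → (∀ t, |ψ t| ≤ 1) →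
      ENNReal.ofReal |∫ x, g x * ψ x * ∫ t, f t * φ t * k (x - t)| ≤ 16000 * I := by
    intro φ ψ h1 h2 h3 h4
    refine (conjPoisson_form_le_of_isTest hAB (hf.mul_bdd h1 h3)
      (hg.mul_bdd h2 h4)).trans (mul_le_mul_right (lintegral_mono fun t => ?_) _)
    have e1 : |f t * φ t| ≤ |f t| := by
      rw [abs_mul]; exact mul_le_of_le_one_right (abs_nonneg _) (h3 t)
    have e2 : |g t * ψ t| ≤ |g t| := by
      rw [abs_mul]; exact mul_le_of_le_one_right (abs_nonneg _) (h4 t)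
    refine add_le_add (A.mono ?_ ?_) (B.conj_mono ?_)
    · positivity
    · exact mul_le_mul hKK' e1 (abs_nonneg _) (by linarith)
    · exact mul_le_mul hKK' e2 (abs_nonneg _) (by linarith)
  have s1 := key Real.continuous_cos.measurable Real.continuous_sin.measurable
    Real.abs_cos_le_one Real.abs_sin_le_one
  have s2 := key Real.continuous_sin.measurable Real.continuous_cos.measurable
    Real.abs_sin_le_one Real.abs_cos_le_one
  have hf' := hf.integrable
  have hg' := hg.integrable
  have ifc := (hf.mul_bdd Real.continuous_cos.measurable Real.abs_cos_le_one).integrable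
  have ifs := (hf.mul_bdd Real.continuous_sin.measurable Real.abs_sin_le_one).integrable
  have igc := (hg.mul_bdd Real.continuous_cos.measurable Real.abs_cos_le_one).integrable
  have igs := (hg.mul_bdd Real.continuous_sin.measurable Real.abs_sin_le_one).integrable
  have s3 : ENNReal.ofReal |∫ x, g x * ∫ t, f t * r (x - t)| ≤ 4 * I := by
    have hmf := hf.meas
    have hmg := hg.meas
    have mB : Measurable fun t => B.toFun |f t| := B.measurable_comp_abs hf.meas
    have mB' : Measurable fun x => B.conj |g x| := B.conj_measurable_comp (by fun_prop)
    have mk : Measurable (fun p : ℝ × ℝ => ENNReal.ofReal (1 + (p.1 - p.2) ^ 2)⁻¹) := by fun_prop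
    rw [← Real.enorm_eq_ofReal_abs]
    calc _ ≤ ∫⁻ x, ‖g x * ∫ t, f t * r (x - t)‖ₑ := enorm_integral_le_lintegral_enorm _
      _ ≤ ∫⁻ x, ∫⁻ t, (B.toFun |f t| + B.conj |g x|) * ENNReal.ofReal (1 + (x - t) ^ 2)⁻¹ := by
          refine lintegral_mono fun x => ?_
          rw [← integral_const_mul]
          refine (enorm_integral_le_lintegral_enorm _).trans (lintegral_mono fun t => ?_)
          rw [Real.enorm_eq_ofReal_abs, abs_mul, abs_mul, ← mul_assoc, mul_comm |g x|]
          rw [ENNReal.ofReal_mul (by positivity)]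
          exact mul_le_mul' (B.young (abs_nonneg _) _) (ENNReal.ofReal_le_ofReal (hrb _))
      _ = (∫⁻ x, ∫⁻ t, B.toFun |f t| * ENNReal.ofReal (1 + (x - t) ^ 2)⁻¹) +
          ∫⁻ x, ∫⁻ t, B.conj |g x| * ENNReal.ofReal (1 + (x - t) ^ 2)⁻¹ := by
          rw [← lintegral_add_left]
          · refine lintegral_congr fun x => ?_
            rw [← lintegral_add_left (by fun_prop)]
            simp_rw [add_mul]
          · exact Measurable.lintegral_prod_right'
              (f := fun p : ℝ × ℝ => B.toFun |f p.2| * ENNReal.ofReal (1 + (p.1 - p.2) ^ 2)⁻¹)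
              ((mB.comp measurable_snd).mul mk)
      _ = (∫⁻ t, B.toFun |f t|) * ENNReal.ofReal Real.pi +
          (∫⁻ x, B.conj |g x|) * ENNReal.ofReal Real.pi := by
          rw [lintegral_lintegral_swap ((mB.comp measurable_snd).mul mk).aemeasurable]
          congr 1
          · rw [← lintegral_mul_const _ mB]
            refine lintegral_congr fun t => ?_
            rw [lintegral_const_mul _ (by fun_prop), ← integral_inv_one_add_sub_sq t]
            congr 1
            exact lintegral_congr fun x => by rw [← neg_sub, neg_sq]
          · rw [← lintegral_mul_const _ mB']
            refine lintegral_congr fun x => ?_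
            rw [lintegral_const_mul _ (by fun_prop), ← integral_inv_one_add_sub_sq x]
      _ = ENNReal.ofReal Real.pi * ∫⁻ t, (B.toFun |f t| + B.conj |g t|) := by
          rw [lintegral_add_left mB]; ring
      _ ≤ 4 * I := by
          refine mul_le_mul' ?_ (lintegral_mono fun t => add_le_add (hBA _ (abs_nonneg _))
            (B.conj_mono ?_))
          · rw [show (4 : ENNReal) = ENNReal.ofReal 4 by norm_num]
            exact ENNReal.ofReal_le_ofReal Real.pi_le_four
          · exact le_mul_of_one_le_left (abs_nonneg _) hK'1
  have e : ∫ x, g x * ∫ t, f t * Real.sinc (x - t) =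
      (∫ x, g x * Real.sin x * ∫ t, f t * Real.cos t * k (x - t)) -
      (∫ x, g x * Real.cos x * ∫ t, f t * Real.sin t * k (x - t)) +
      ∫ x, g x * ∫ t, f t * r (x - t) := by
    have L1 := integrable_form_left ifc igs hkm hkb
    have L2 := integrable_form_left ifs igc hkm hkb
    have L3 := integrable_form_left hf' hg' hrm hrb1
    have a := integral_sub L1 L2
    have b := integral_add (L1.sub L2) L3
    simp only [Pi.sub_apply] at b
    rw [← a, ← b]
    refine integral_congr_ae (ae_of_all _ fun x => ?_)
    have M1 := (integrable_mul_comp_sub ifc hkm hkb x).const_mul (Real.sin x)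
    have M2 := (integrable_mul_comp_sub ifs hkm hkb x).const_mul (Real.cos x)
    have M3 := integrable_mul_comp_sub hf' hrm hrb1 x
    have hx : ∫ t, f t * Real.sinc (x - t) = Real.sin x * (∫ t, f t * Real.cos t * k (x - t)) -
        Real.cos x * (∫ t, f t * Real.sin t * k (x - t)) + ∫ t, f t * r (x - t) := by
      have a := integral_sub M1 M2
      have b := integral_add (M1.sub M2) M3
      simp only [Pi.sub_apply] at b
      rw [← integral_const_mul, ← integral_const_mul, ← a, ← b]
      refine integral_congr_ae (ae_of_all _ fun t => ?_)
      simp only [hr]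
      rw [Real.sin_sub]; ring
    simp only [hx]; ring
  have h3 : ∀ a b c : ℝ, |a - b + c| ≤ |a| + |b| + |c| := fun a b c =>
    (abs_add_le _ _).trans (add_le_add (abs_sub _ _) le_rfl)
  rw [e]
  refine (ENNReal.ofReal_le_ofReal (h3 _ _ _)).trans ?_
  rw [ENNReal.ofReal_add (by positivity) (by positivity),
    ENNReal.ofReal_add (by positivity) (by positivity)]
  refine (add_le_add (add_le_add s1 s2) s3).trans ?_
  rw [← add_mul, ← add_mul]
  exact mul_le_mul_left (by norm_num) _

/-- Modular bound for the bilinear form of the Dirichlet kernel, uniform in the frequency. -/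
theorem dirichlet_form_le_of_isTest (hAB : HardyPair A B K) {K' : ℝ} (hKK' : 96 * K ≤ K')
    (hBA : ∀ t : ℝ, 0 ≤ t → B.toFun t ≤ A.toFun (K' * t)) {l : ℝ} (hl : 0 < l)
    {f g : ℝ → ℝ} (hf : IsTest f) (hg : IsTest g) :
    ENNReal.ofReal |∫ x, g x * ∫ t, f t * (l / Real.pi * Real.sinc (l * (x - t)))| ≤
      40000 * ∫⁻ t, (A.toFun (K' * |f t|) + B.conj (K' * |g t|)) := by
  have hli : 0 < l⁻¹ := inv_pos.2 hl
  have hπ := Real.pi_pos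
  have h := sinc_form_le hAB hKK' hBA (hf.comp_mul hli) (hg.comp_mul hli)
  have e1 : ∫ x, g (l⁻¹ * x) * ∫ t, f (l⁻¹ * t) * Real.sinc (x - t) =
      l * Real.pi * ∫ x, g x * ∫ t, f t * (l / Real.pi * Real.sinc (l * (x - t))) := by
    have i1 : ∀ x, ∫ t, f (l⁻¹ * t) * Real.sinc (x - t) =
        Real.pi * ∫ t, f t * (l / Real.pi * Real.sinc (l * (l⁻¹ * x - t))) := by
      intro x
      have := Measure.integral_comp_mul_left
        (fun t => f t * Real.sinc (l * (l⁻¹ * x - t))) l⁻¹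
      rw [inv_inv, abs_of_pos hl, smul_eq_mul] at this
      have h2 : ∫ t, f t * (l / Real.pi * Real.sinc (l * (l⁻¹ * x - t))) =
          l / Real.pi * ∫ t, f t * Real.sinc (l * (l⁻¹ * x - t)) := by
        rw [← integral_const_mul]
        exact integral_congr_ae (ae_of_all _ fun t => by simp only; ring)
      rw [h2, ← mul_assoc, mul_div_cancel₀ _ hπ.ne', ← this]
      refine integral_congr_ae (ae_of_all _ fun t => ?_)
      simp only
      rw [← mul_sub, mul_inv_cancel_left₀ hl.ne']
    simp_rw [i1]
    have := Measure.integral_comp_mul_left (fun x => g x * (Real.pi *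
      ∫ t, f t * (l / Real.pi * Real.sinc (l * (x - t))))) l⁻¹
    rw [inv_inv, abs_of_pos hl, smul_eq_mul] at this
    rw [this, mul_assoc, ← integral_const_mul Real.pi]
    congr 1
    exact integral_congr_ae (ae_of_all _ fun t => mul_left_comm _ _ _)
  have e2 : ∫⁻ t, (A.toFun (K' * |f (l⁻¹ * t)|) + B.conj (K' * |g (l⁻¹ * t)|)) =
      ENNReal.ofReal l * ∫⁻ t, (A.toFun (K' * |f t|) + B.conj (K' * |g t|)) := by
    have hK0 : 0 ≤ K' := by linarith [hAB.one_le]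
    have hmf := hf.meas
    have hmg := hg.meas
    exact lintegral_comp_inv_mul hl (φ := fun t => A.toFun (K' * |f t|) + B.conj (K' * |g t|))
      (((A.measurable_comp (by fun_prop) fun t => by positivity)).add
        (B.conj_measurable_comp (by fun_prop)))
  rw [e1, e2, abs_mul, abs_of_pos (by positivity), ENNReal.ofReal_mul (by positivity),
    ENNReal.ofReal_mul hl.le, mul_left_comm, mul_assoc] at h
  have h2 := (ENNReal.mul_le_mul_iff_right (by simpa using hl) ENNReal.ofReal_ne_top).1 h
  refine le_trans ?_ h2
  refine le_mul_of_one_le_left zero_le ?_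
  rw [← ENNReal.ofReal_one]
  exact ENNReal.ofReal_le_ofReal (by linarith [Real.pi_gt_three])

end Forms

theorem iteratedDeriv_exp_neg_sq_hasDerivAt (k : ℕ) (x : ℝ) :
    HasDerivAt (iteratedDeriv k fun y : ℝ => Real.exp (-y ^ 2))
      (iteratedDeriv (k + 1) (fun y : ℝ => Real.exp (-y ^ 2)) x) x := by
  have h : ContDiff ℝ (k + 1 : ℕ) fun y : ℝ => Real.exp (-y ^ 2) := by fun_prop
  rw [iteratedDeriv_succ]
  exact (h.differentiable_iteratedDeriv k (by exact_mod_cast Nat.lt_succ_self k) x).hasDerivAt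

theorem iteratedDeriv_exp_neg_sq_add_two (k : ℕ) (x : ℝ) :
    iteratedDeriv (k + 2) (fun y : ℝ => Real.exp (-y ^ 2)) x =
      -2 * x * iteratedDeriv (k + 1) (fun y : ℝ => Real.exp (-y ^ 2)) x -
        2 * (k + 1) * iteratedDeriv k (fun y : ℝ => Real.exp (-y ^ 2)) x := by
  have H := iteratedDeriv_exp_neg_sq_hasDerivAt
  have h1 : ∀ x : ℝ, iteratedDeriv 1 (fun y : ℝ => Real.exp (-y ^ 2)) x =
      -2 * x * Real.exp (-x ^ 2) := fun x => by
    have h : HasDerivAt (fun y : ℝ => Real.exp (-y ^ 2)) (Real.exp (-x ^ 2) * -(2 * x)) x := by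
      simpa using ((hasDerivAt_pow 2 x).neg).exp
    rw [iteratedDeriv_one, h.deriv]; ring
  induction k generalizing x with
  | zero =>
    have h2 : HasDerivAt (fun x => -2 * x * iteratedDeriv 0 (fun y : ℝ => Real.exp (-y ^ 2)) x)
        (-2 * 1 * iteratedDeriv 0 (fun y : ℝ => Real.exp (-y ^ 2)) x + -2 * x *
          iteratedDeriv (0 + 1) (fun y : ℝ => Real.exp (-y ^ 2)) x) x :=
      ((hasDerivAt_id x).const_mul (-2)).mul (H 0 x)
    have h3 : iteratedDeriv (0 + 1) (fun y : ℝ => Real.exp (-y ^ 2)) =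
        fun x => -2 * x * iteratedDeriv 0 (fun y : ℝ => Real.exp (-y ^ 2)) x := by
      funext y; rw [zero_add, h1, iteratedDeriv_zero]
    have := H (0 + 1) x
    rw [h3] at this
    rw [show 0 + 2 = 0 + 1 + 1 from rfl, this.unique h2, h3]
    push_cast; ring
  | succ k ih =>
    have h2 : HasDerivAt (fun x => -2 * x * iteratedDeriv (k + 1) (fun y : ℝ => Real.exp (-y ^ 2)) x
        - 2 * (k + 1) * iteratedDeriv k (fun y : ℝ => Real.exp (-y ^ 2)) x)
        (-2 * 1 * iteratedDeriv (k + 1) (fun y : ℝ => Real.exp (-y ^ 2)) x + -2 * x *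
          iteratedDeriv (k + 1 + 1) (fun y : ℝ => Real.exp (-y ^ 2)) x -
          2 * (k + 1) * iteratedDeriv (k + 1) (fun y : ℝ => Real.exp (-y ^ 2)) x) x :=
      (((hasDerivAt_id x).const_mul (-2)).mul (H (k + 1) x)).sub ((H k x).const_mul _)
    have := H (k + 2) x
    rw [funext fun x => ih x] at this
    rw [show k + 1 + 2 = k + 2 + 1 from rfl, this.unique h2]
    push_cast; ring

/-- The coefficient `√(2k)` in the recurrences of the Hermite functions. -/
noncomputable def hermiteCoeff (k : ℕ) : ℝ := Real.sqrt (2 * k)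

theorem hermiteCoeff_sq (k : ℕ) : hermiteCoeff k ^ 2 = 2 * k := Real.sq_sqrt (by positivity)

/-- The normalizing factor of the `k`-th Hermite function. -/
noncomputable def hermiteNorm (k : ℕ) : ℝ :=
  (-1 : ℝ) ^ k * (Real.pi ^ (-(1 : ℝ) / 4) * (2 : ℝ) ^ (-(k : ℝ) / 2) *
      ((k.factorial : ℝ)) ^ (-(1 : ℝ) / 2))

theorem hermiteFun_eq (k : ℕ) (x : ℝ) : hermiteFun k x = hermiteNorm k * Real.exp (x ^ 2 / 2) *
    iteratedDeriv k (fun y : ℝ => Real.exp (-y ^ 2)) x := rfl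

theorem hermiteCoeff_mul_norm (k : ℕ) :
    hermiteCoeff (k + 1) * hermiteNorm (k + 1) = -hermiteNorm k := by
  have h1 : (2 : ℝ) ^ (-((k + 1 : ℕ) : ℝ) / 2) = (2 : ℝ) ^ (-(k : ℝ) / 2) * (Real.sqrt 2)⁻¹ := by
    rw [Real.sqrt_eq_rpow, ← Real.rpow_neg (by norm_num), ← Real.rpow_add (by norm_num)]
    congr 1; push_cast; ring
  have h2 : (((k + 1).factorial : ℕ) : ℝ) ^ (-(1 : ℝ) / 2) =
      (k.factorial : ℝ) ^ (-(1 : ℝ) / 2) * (Real.sqrt (k + 1))⁻¹ := by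
    rw [Nat.factorial_succ, Nat.cast_mul, Real.mul_rpow (by positivity) (by positivity),
      Real.sqrt_eq_rpow, ← Real.rpow_neg (by positivity), mul_comm]
    congr 2
    · push_cast; ring
    · ring
  have h3 : hermiteCoeff (k + 1) = Real.sqrt 2 * Real.sqrt (k + 1) := by
    rw [hermiteCoeff, Real.sqrt_mul (by norm_num)]; push_cast; rfl
  have h4 : Real.sqrt 2 ≠ 0 := by positivity
  have h5 : Real.sqrt ((k : ℝ) + 1) ≠ 0 := by positivity
  rw [hermiteNorm, hermiteNorm, h1, h2, h3, pow_succ]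
  field_simp

/-- The derivative of the Hermite function `h_k`, in closed form. -/
noncomputable def hermiteDer (k : ℕ) (x : ℝ) : ℝ :=
  x * hermiteFun k x - hermiteCoeff (k + 1) * hermiteFun (k + 1) x

theorem hermiteFun_hasDerivAt (k : ℕ) (x : ℝ) :
    HasDerivAt (hermiteFun k) (hermiteDer k x) x := by
  have h := iteratedDeriv_exp_neg_sq_hasDerivAt k x
  have h1 : HasDerivAt (fun x : ℝ => Real.exp (x ^ 2 / 2)) (Real.exp (x ^ 2 / 2) * x) x := by
    have : HasDerivAt (fun x : ℝ => x ^ 2 / 2) x x := by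
      simpa using (hasDerivAt_pow 2 x).div_const 2
    exact this.exp
  have h2 := (h1.const_mul (hermiteNorm k)).mul h
  refine h2.congr_deriv ?_
  rw [hermiteDer, hermiteFun_eq, hermiteFun_eq]
  linear_combination (Real.exp (x ^ 2 / 2) *
    iteratedDeriv (k + 1) (fun y : ℝ => Real.exp (-y ^ 2)) x) * hermiteCoeff_mul_norm k

theorem hermiteFun_continuous (k : ℕ) : Continuous (hermiteFun k) :=
  continuous_iff_continuousAt.2 fun x => (hermiteFun_hasDerivAt k x).continuousAt

theorem hermiteDer_continuous (k : ℕ) : Continuous (hermiteDer k) := by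
  have := hermiteFun_continuous k
  have := hermiteFun_continuous (k + 1)
  unfold hermiteDer; fun_prop

theorem hermiteFun_add_two (k : ℕ) (x : ℝ) :
    hermiteCoeff (k + 2) * hermiteFun (k + 2) x =
      2 * x * hermiteFun (k + 1) x - hermiteCoeff (k + 1) * hermiteFun k x := by
  have hs : hermiteCoeff (k + 1) ≠ 0 := by
    rw [hermiteCoeff]; exact (Real.sqrt_pos.2 (by positivity)).ne'
  have h2 : hermiteCoeff (k + 1) ^ 2 = 2 * (k + 1) := by rw [hermiteCoeff_sq]; push_cast; ring
  have n1 := hermiteCoeff_mul_norm k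
  have n2 := hermiteCoeff_mul_norm (k + 1)
  apply mul_left_cancel₀ hs
  simp only [hermiteFun_eq]
  rw [iteratedDeriv_exp_neg_sq_add_two]
  set G := iteratedDeriv k (fun y : ℝ => Real.exp (-y ^ 2)) x
  set G' := iteratedDeriv (k + 1) (fun y : ℝ => Real.exp (-y ^ 2)) x
  rw [show k + 1 + 1 = k + 2 from rfl] at n2
  linear_combination hermiteCoeff (k + 1) * (Real.exp (x ^ 2 / 2) *
    (-2 * x * G' - 2 * (k + 1) * G)) * n2 + 2 * (k + 1) * Real.exp (x ^ 2 / 2) * G * n1 +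
    hermiteNorm k * Real.exp (x ^ 2 / 2) * G * h2

theorem hermiteFun_succ_hasDerivAt (k : ℕ) (x : ℝ) : HasDerivAt (hermiteFun (k + 1))
    (-x * hermiteFun (k + 1) x + hermiteCoeff (k + 1) * hermiteFun k x) x := by
  refine (hermiteFun_hasDerivAt (k + 1) x).congr_deriv ?_
  rw [hermiteDer, hermiteFun_add_two]; ring

theorem hermiteDer_hasDerivAt (k : ℕ) (x : ℝ) :
    HasDerivAt (hermiteDer k) ((x ^ 2 - (2 * k + 1)) * hermiteFun k x) x := by
  have h := ((hasDerivAt_id x).mul (hermiteFun_hasDerivAt k x)).sub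
    ((hermiteFun_succ_hasDerivAt k x).const_mul (hermiteCoeff (k + 1)))
  refine h.congr_deriv ?_
  have h2 : hermiteCoeff (k + 1) ^ 2 = 2 * (k + 1) := by rw [hermiteCoeff_sq]; push_cast; ring
  simp only [id, hermiteDer]
  linear_combination -hermiteFun k x * h2

/-- The Christoffel–Darboux formula for Hermite functions. -/
theorem sub_mul_sum_hermiteFun (n : ℕ) (x y : ℝ) :
    (x - y) * ∑ k ∈ Finset.range (n + 1), hermiteFun k x * hermiteFun k y =
      ((x - y) * (hermiteFun n x * hermiteFun n y) +
        (hermiteFun n x * hermiteDer n y - hermiteDer n x * hermiteFun n y)) / 2 := by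
  have key : (x - y) * ∑ k ∈ Finset.range (n + 1), hermiteFun k x * hermiteFun k y =
      hermiteCoeff (n + 1) * (hermiteFun (n + 1) x * hermiteFun n y -
        hermiteFun n x * hermiteFun (n + 1) y) / 2 := by
    induction n with
    | zero =>
      have h : ∀ x, hermiteCoeff 1 * hermiteFun 1 x = 2 * x * hermiteFun 0 x := fun x => by
        have n0 := hermiteCoeff_mul_norm 0
        have h1 := iteratedDeriv_exp_neg_sq_hasDerivAt 0 x
        rw [iteratedDeriv_zero] at h1
        have h2 : HasDerivAt (fun y : ℝ => Real.exp (-y ^ 2)) (Real.exp (-x ^ 2) * -(2 * x)) x := by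
          simpa using ((hasDerivAt_pow 2 x).neg).exp
        have h3 := h1.unique h2
        rw [zero_add] at n0 h3
        rw [hermiteFun_eq, hermiteFun_eq, iteratedDeriv_zero, h3]
        linear_combination (Real.exp (x ^ 2 / 2) * (Real.exp (-x ^ 2) * -(2 * x))) * n0
      rw [zero_add, Finset.sum_range_one]
      linear_combination (-hermiteFun 0 y / 2) * h x + (hermiteFun 0 x / 2) * h y
    | succ n ih =>
      rw [Finset.sum_range_succ, mul_add, ih]
      have a := hermiteFun_add_two n x
      have b := hermiteFun_add_two n y
      linear_combination (-hermiteFun (n + 1) y / 2) * a + (hermiteFun (n + 1) x / 2) * b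
  rw [key, hermiteDer, hermiteDer]; ring

/-- The slowly varying amplitude of a solution of `h'' = (x² - l²) h`, with `d = h' / l`. -/
noncomputable def phaseAmp (l : ℝ) (h d : ℝ → ℝ) (x : ℝ) : ℂ :=
  (h x + d x * Complex.I) * Complex.exp (Complex.I * (l * x : ℝ))

section Amp
variable {l T : ℝ} {h d : ℝ → ℝ}

theorem norm_phaseAmp_sq (x : ℝ) : ‖phaseAmp l h d x‖ ^ 2 = h x ^ 2 + d x ^ 2 := by
  rw [phaseAmp, norm_mul, mul_comm Complex.I, Complex.norm_exp_ofReal_mul_I, mul_one,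
    ← Complex.normSq_eq_norm_sq, Complex.normSq_add_mul_I]

theorem phaseAmp_hasDerivAt (hl : 0 < l) (hh : ∀ x, HasDerivAt h (l * d x) x)
    (hd : ∀ x, HasDerivAt d ((x ^ 2 - l ^ 2) / l * h x) x) (x : ℝ) :
    HasDerivAt (phaseAmp l h d)
      (Complex.I * (x ^ 2 / l * h x : ℝ) * Complex.exp (Complex.I * (l * x : ℝ))) x := by
  have h1 : HasDerivAt (fun x : ℝ => Complex.exp (Complex.I * (l * x : ℝ)))
      (Complex.exp (Complex.I * (l * x : ℝ)) * (Complex.I * (l * 1 : ℝ))) x :=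
    ((((hasDerivAt_id x).const_mul l).ofReal_comp).const_mul Complex.I).cexp
  have h2 := ((hh x).ofReal_comp.add ((hd x).ofReal_comp.mul_const Complex.I)).mul h1
  refine h2.congr_deriv ?_
  have hl' : (l : ℂ) ≠ 0 := by exact_mod_cast hl.ne'
  push_cast
  simp only [Pi.add_apply]
  field_simp
  linear_combination (d x * l ^ 2) * Complex.I_sq

theorem abs_le_norm_phaseAmp (x : ℝ) : |h x| ≤ ‖phaseAmp l h d x‖ := by
  refine abs_le_of_sq_le_sq ?_ (norm_nonneg _)
  rw [norm_phaseAmp_sq]; nlinarith [sq_nonneg (d x)]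

theorem norm_phaseAmp_sub_le_aux (hl : 0 < l) (hh : ∀ x, HasDerivAt h (l * d x) x)
    (hd : ∀ x, HasDerivAt d ((x ^ 2 - l ^ 2) / l * h x) x) {M : ℝ}
    (hM : ∀ x ∈ Icc (-T) T, ‖phaseAmp l h d x‖ ≤ M) {x y : ℝ} (hx : x ∈ Icc (-T) T)
    (hy : y ∈ Icc (-T) T) :
    ‖phaseAmp l h d y - phaseAmp l h d x‖ ≤ T ^ 2 / l * M * |y - x| := by
  refine (convex_Icc (-T) T).norm_image_sub_le_of_norm_hasDerivWithin_le
    (fun z hz => (phaseAmp_hasDerivAt hl hh hd z).hasDerivWithinAt) (fun z hz => ?_) hx hy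
  rw [norm_mul, norm_mul, Complex.norm_I, one_mul, mul_comm Complex.I,
    Complex.norm_exp_ofReal_mul_I, mul_one, Complex.norm_real, Real.norm_eq_abs, abs_mul,
    abs_of_nonneg (by positivity)]
  have : z ^ 2 ≤ T ^ 2 := sq_le_sq' hz.1 hz.2
  exact mul_le_mul (by gcongr) ((abs_le_norm_phaseAmp z).trans (hM z hz)) (abs_nonneg _)
    (by positivity)

theorem norm_phaseAmp_le (hl : 0 < l) (hT : 0 ≤ T) (hTl : 2 * T ^ 3 ≤ l)
    (hh : ∀ x, HasDerivAt h (l * d x) x)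
    (hd : ∀ x, HasDerivAt d ((x ^ 2 - l ^ 2) / l * h x) x) {x : ℝ} (hx : x ∈ Icc (-T) T) :
    ‖phaseAmp l h d x‖ ≤ 2 * ‖phaseAmp l h d 0‖ := by
  have hc : Continuous (phaseAmp l h d) :=
    continuous_iff_continuousAt.2 fun x => (phaseAmp_hasDerivAt hl hh hd x).continuousAt
  obtain ⟨z, hz, hzm⟩ := isCompact_Icc.exists_isMaxOn (s := Icc (-T) T) ⟨x, hx⟩
    hc.norm.continuousOn
  have h0 : (0 : ℝ) ∈ Icc (-T) T := ⟨by linarith, hT⟩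
  have h1 := norm_phaseAmp_sub_le_aux hl hh hd (fun y hy => hzm hy) h0 hz
  have h2 : |z - 0| ≤ T := by rw [sub_zero]; exact abs_le.2 hz
  have h3 : T ^ 2 / l * ‖phaseAmp l h d z‖ * |z - 0| ≤ ‖phaseAmp l h d z‖ / 2 := by
    calc _ ≤ T ^ 2 / l * ‖phaseAmp l h d z‖ * T := by gcongr
      _ = T ^ 3 / l * ‖phaseAmp l h d z‖ := by ring
      _ ≤ 1 / 2 * ‖phaseAmp l h d z‖ := by
          refine mul_le_mul_of_nonneg_right ?_ (norm_nonneg _)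
          rw [div_le_iff₀ hl]; linarith
      _ = _ := by ring
  have h4 : ‖phaseAmp l h d x‖ ≤ ‖phaseAmp l h d z‖ := hzm hx
  have h5 := norm_sub_norm_le (phaseAmp l h d z) (phaseAmp l h d 0)
  linarith

theorem norm_phaseAmp_sub_le (hl : 0 < l) (hT : 0 ≤ T) (hTl : 2 * T ^ 3 ≤ l)
    (hh : ∀ x, HasDerivAt h (l * d x) x)
    (hd : ∀ x, HasDerivAt d ((x ^ 2 - l ^ 2) / l * h x) x) {x y : ℝ} (hx : x ∈ Icc (-T) T)
    (hy : y ∈ Icc (-T) T) :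
    ‖phaseAmp l h d y - phaseAmp l h d x‖ ≤ 2 * T ^ 2 / l * ‖phaseAmp l h d 0‖ * |y - x| := by
  refine (norm_phaseAmp_sub_le_aux hl hh hd
    (fun y hy => norm_phaseAmp_le hl hT hTl hh hd hy) hx hy).trans (le_of_eq (by ring))

theorem abs_wronskian_sub_le (x y : ℝ) :
    |(h x * d y - d x * h y) - ‖phaseAmp l h d x‖ ^ 2 * Real.sin (l * (x - y))| ≤
      ‖phaseAmp l h d x‖ * ‖phaseAmp l h d y - phaseAmp l h d x‖ := by
  set Z := phaseAmp l h d with hZ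
  have e1 : h x * d y - d x * h y =
      ((starRingEnd ℂ) (Z x) * Z y * Complex.exp ((l * (x - y) : ℝ) * Complex.I)).im := by
    have : (starRingEnd ℂ) (Z x) * Z y * Complex.exp ((l * (x - y) : ℝ) * Complex.I) =
        (h x - d x * Complex.I) * (h y + d y * Complex.I) := by
      have e : (starRingEnd ℂ) (Complex.exp (Complex.I * (l * x : ℝ))) =
          Complex.exp (-(Complex.I * (l * x : ℝ))) := by
        rw [← Complex.exp_conj, map_mul, Complex.conj_I, Complex.conj_ofReal, neg_mul]
      have e' : Complex.exp (-(Complex.I * (l * x : ℝ))) * Complex.exp (Complex.I * (l * y : ℝ)) *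
          Complex.exp ((l * (x - y) : ℝ) * Complex.I) = 1 := by
        rw [← Complex.exp_add, ← Complex.exp_add, ← Complex.exp_zero]
        congr 1; push_cast; ring
      simp only [hZ, phaseAmp, map_mul, map_add, Complex.conj_I, Complex.conj_ofReal, e]
      linear_combination (h x + d x * -Complex.I) * (h y + d y * Complex.I) * e'
    rw [this]; simp [sub_eq_add_neg]
  have e2 : ‖Z x‖ ^ 2 * Real.sin (l * (x - y)) =
      ((starRingEnd ℂ) (Z x) * Z x * Complex.exp ((l * (x - y) : ℝ) * Complex.I)).im := by
    rw [mul_comm ((starRingEnd ℂ) (Z x)), Complex.mul_conj, Complex.im_ofReal_mul,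
      Complex.exp_ofReal_mul_I_im, Complex.normSq_eq_norm_sq]
  rw [e1, e2, ← Complex.sub_im]
  refine (Complex.abs_im_le_norm _).trans (le_of_eq ?_)
  rw [← sub_mul, ← mul_sub, norm_mul, norm_mul, Complex.norm_exp_ofReal_mul_I, mul_one,
    Complex.norm_conj]

/-- Approximation of the Wronskian kernel by a modulated Dirichlet kernel. -/
theorem abs_wronskian_kernel_sub_le (hl : 0 < l) (hT : 0 ≤ T) (hTl : 2 * T ^ 3 ≤ l)
    (hh : ∀ x, HasDerivAt h (l * d x) x)
    (hd : ∀ x, HasDerivAt d ((x ^ 2 - l ^ 2) / l * h x) x) {x y : ℝ} (hx : x ∈ Icc (-T) T)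
    (hy : y ∈ Icc (-T) T) (hxy : x ≠ y) :
    |((x - y) * (h x * h y) + l * (h x * d y - d x * h y)) / 2 / (x - y) -
      Real.pi / 2 * l * (h x ^ 2 + d x ^ 2) * (l / Real.pi * Real.sinc (l * (x - y)))| ≤
      2 * (h 0 ^ 2 + d 0 ^ 2) * (1 + T ^ 2) := by
  have hxy' : x - y ≠ 0 := sub_ne_zero.2 hxy
  have hpos : 0 < |x - y| := abs_pos.2 hxy'
  have e : ((x - y) * (h x * h y) + l * (h x * d y - d x * h y)) / 2 / (x - y) -
      Real.pi / 2 * l * (h x ^ 2 + d x ^ 2) * (l / Real.pi * Real.sinc (l * (x - y))) =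
      h x * h y / 2 + l / 2 * (((h x * d y - d x * h y) -
        ‖phaseAmp l h d x‖ ^ 2 * Real.sin (l * (x - y))) / (x - y)) := by
    rw [norm_phaseAmp_sq, Real.sinc_of_ne_zero (mul_ne_zero hl.ne' hxy')]
    have := Real.pi_ne_zero
    field_simp
    ring
  rw [e, ← norm_phaseAmp_sq (l := l)]
  set N := ‖phaseAmp l h d 0‖ with hN
  have hN0 : 0 ≤ N := norm_nonneg _
  have b1 : |h x * h y / 2| ≤ 2 * N ^ 2 := by
    have a := (abs_le_norm_phaseAmp (l := l) (h := h) (d := d) x).trans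
      (norm_phaseAmp_le hl hT hTl hh hd hx)
    have b := (abs_le_norm_phaseAmp (l := l) (h := h) (d := d) y).trans
      (norm_phaseAmp_le hl hT hTl hh hd hy)
    rw [abs_div, abs_mul, abs_two]
    nlinarith [mul_le_mul a b (abs_nonneg _) (by positivity)]
  have b2 : |l / 2 * (((h x * d y - d x * h y) -
        ‖phaseAmp l h d x‖ ^ 2 * Real.sin (l * (x - y))) / (x - y))| ≤ 2 * N ^ 2 * T ^ 2 := by
    rw [abs_mul, abs_of_pos (by positivity : 0 < l / 2), abs_div]
    have a := (abs_wronskian_sub_le (l := l) (h := h) (d := d) x y).trans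
      (mul_le_mul (norm_phaseAmp_le hl hT hTl hh hd hx)
        (norm_phaseAmp_sub_le hl hT hTl hh hd hx hy) (norm_nonneg _) (by positivity))
    rw [abs_sub_comm y x] at a
    calc _ ≤ l / 2 * (2 * N * (2 * T ^ 2 / l * N * |x - y|) / |x - y|) := by gcongr
      _ = _ := by field_simp
  refine (abs_add_le _ _).trans ((add_le_add b1 b2).trans (le_of_eq (by ring)))

theorem abs_amp_sub_le (hl : 0 < l) (hT : 0 ≤ T) (hTl : 2 * T ^ 3 ≤ l)
    (hh : ∀ x, HasDerivAt h (l * d x) x)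
    (hd : ∀ x, HasDerivAt d ((x ^ 2 - l ^ 2) / l * h x) x) {x : ℝ} (hx : x ∈ Icc (-T) T) :
    |l * (h x ^ 2 + d x ^ 2) - l * (h 0 ^ 2 + d 0 ^ 2)| ≤ 6 * (h 0 ^ 2 + d 0 ^ 2) * T ^ 3 := by
  have h0 : (0 : ℝ) ∈ Icc (-T) T := ⟨by linarith, hT⟩
  rw [← norm_phaseAmp_sq (l := l), ← norm_phaseAmp_sq (l := l)]
  have a := norm_phaseAmp_le hl hT hTl hh hd hx
  have b := norm_phaseAmp_sub_le hl hT hTl hh hd h0 hx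
  have h2 : |x - 0| ≤ T := by rw [sub_zero]; exact abs_le.2 hx
  set N := ‖phaseAmp l h d 0‖ with hN
  have hN0 : 0 ≤ N := norm_nonneg _
  have c := (abs_norm_sub_norm_le (phaseAmp l h d x) (phaseAmp l h d 0)).trans b
  rw [← mul_sub, abs_mul, abs_of_pos hl, sq_sub_sq, abs_mul, abs_of_nonneg (by positivity)]
  calc _ ≤ l * ((2 * N + N) * (2 * T ^ 2 / l * N * T)) := by
        gcongr
        exact c.trans (by gcongr)
    _ = _ := by field_simp; ring

end Amp

theorem hermiteFun_one_zero : hermiteFun 1 0 = 0 := by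
  have h2 : HasDerivAt (fun y : ℝ => Real.exp (-y ^ 2)) (Real.exp (-0 ^ 2) * -(2 * 0)) (0 : ℝ) := by
    simpa using ((hasDerivAt_pow 2 (0 : ℝ)).neg).exp
  rw [hermiteFun_eq, iteratedDeriv_one, h2.deriv]; simp

theorem hermiteFun_odd_zero (m : ℕ) : hermiteFun (2 * m + 1) 0 = 0 := by
  induction m with
  | zero => exact hermiteFun_one_zero
  | succ m ih =>
    have h := hermiteFun_add_two (2 * m + 1) 0
    rw [ih] at h
    have hs : hermiteCoeff (2 * m + 1 + 2) ≠ 0 := by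
      rw [hermiteCoeff]; exact (Real.sqrt_pos.2 (by positivity)).ne'
    have : hermiteCoeff (2 * m + 1 + 2) * hermiteFun (2 * m + 1 + 2) 0 = 0 := by rw [h]; ring
    exact (mul_eq_zero.1 this).resolve_left hs

theorem hermiteFun_even_zero_succ (m : ℕ) :
    (2 * m + 2) * hermiteFun (2 * m + 2) 0 ^ 2 = (2 * m + 1) * hermiteFun (2 * m) 0 ^ 2 := by
  have h := hermiteFun_add_two (2 * m) 0
  have h2 : hermiteCoeff (2 * m + 2) ^ 2 = 2 * (2 * m + 2) := by
    rw [hermiteCoeff_sq]; push_cast; ring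
  have h1 : hermiteCoeff (2 * m + 1) ^ 2 = 2 * (2 * m + 1) := by
    rw [hermiteCoeff_sq]; push_cast; ring
  have h3 : (hermiteCoeff (2 * m + 2) * hermiteFun (2 * m + 2) 0) ^ 2 =
      (hermiteCoeff (2 * m + 1) * hermiteFun (2 * m) 0) ^ 2 := by rw [h]; ring
  rw [mul_pow, mul_pow, h1, h2] at h3
  linarith

theorem hermiteFun_even_zero_wallis (m : ℕ) :
    (hermiteFun (2 * m) 0 ^ 2) ^ 2 * (Real.pi * (2 * m + 1) * Real.Wallis.W m) = 1 := by
  induction m with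
  | zero =>
    have : hermiteFun 0 0 ^ 4 = Real.pi⁻¹ := by
      rw [hermiteFun]
      simp only [pow_zero, one_mul, iteratedDeriv_zero, Nat.factorial_zero]
      norm_num
      rw [← Real.rpow_natCast, ← Real.rpow_mul Real.pi_pos.le]
      norm_num [Real.rpow_neg_one]
    rw [← pow_mul]; norm_num [this, Real.Wallis.W, Real.pi_ne_zero]
  | succ m ih =>
    have h := hermiteFun_even_zero_succ m
    rw [Real.Wallis.W_succ, show 2 * (m + 1) = 2 * m + 2 by ring]
    have h' : hermiteFun (2 * m + 2) 0 ^ 2 = (2 * m + 1) / (2 * m + 2) * hermiteFun (2 * m) 0 ^ 2 := by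
      field_simp; linarith
    rw [h']
    have a : (2 * (m : ℝ) + 1) ≠ 0 := by positivity
    have b : (2 * (m : ℝ) + 3) ≠ 0 := by positivity
    have c : (2 * (m : ℝ) + 2) ≠ 0 := by positivity
    calc _ = (hermiteFun (2 * m) 0 ^ 2) ^ 2 * (Real.pi * (2 * m + 1) * Real.Wallis.W m) := by
          push_cast
          rw [show 2 * ((m : ℝ) + 1) + 1 = 2 * m + 3 by ring]
          field_simp
      _ = 1 := ih

/-- The frequency `√(2n+1)` of the `n`-th Hermite function. -/
noncomputable def hermiteFreq (n : ℕ) : ℝ := Real.sqrt (2 * n + 1)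

theorem hermiteFreq_pos (n : ℕ) : 0 < hermiteFreq n := Real.sqrt_pos.2 (by positivity)
theorem hermiteFreq_sq (n : ℕ) : hermiteFreq n ^ 2 = 2 * n + 1 := Real.sq_sqrt (by positivity)

/-- The squared amplitude of the `n`-th Hermite function. -/
noncomputable def hermiteAmp (n : ℕ) (x : ℝ) : ℝ :=
  hermiteFreq n * (hermiteFun n x ^ 2 + (hermiteDer n x / hermiteFreq n) ^ 2)

theorem hermiteAmp_zero_sq (n : ℕ) : ∃ r : ℝ, |r - 2| ≤ 1 / ((n / 2 : ℕ) + 1) ∧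
    hermiteAmp n 0 ^ 2 * (Real.pi * Real.Wallis.W (n / 2)) = r := by
  have hl := hermiteFreq_sq n
  have hd : hermiteDer n 0 ^ 2 = (2 * (n + 1)) * hermiteFun (n + 1) 0 ^ 2 := by
    have := hermiteCoeff_sq (n + 1)
    rw [hermiteDer, zero_mul, zero_sub, neg_sq, mul_pow, this]; push_cast; ring
  have ha : hermiteAmp n 0 ^ 2 = (2 * n + 1) *
      (hermiteFun n 0 ^ 2 + (2 * (n + 1)) * hermiteFun (n + 1) 0 ^ 2 / (2 * n + 1)) ^ 2 := by
    rw [hermiteAmp, mul_pow, hl, div_pow, hd, hl]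
  obtain ⟨m, hm | hm⟩ := Nat.even_or_odd' n
  · have h1 : n / 2 = m := by omega
    have h2 : hermiteFun (n + 1) 0 = 0 := by rw [hm]; exact hermiteFun_odd_zero m
    refine ⟨(4 * m + 1) / (2 * m + 1), ?_, ?_⟩
    · rw [h1, show ((4 * m + 1) / (2 * m + 1) - 2 : ℝ) = -(1 / (2 * m + 1)) by field_simp; ring,
        abs_neg, abs_of_pos (by positivity)]
      gcongr; linarith [(Nat.cast_nonneg m : (0 : ℝ) ≤ m)]
    · have w := hermiteFun_even_zero_wallis m
      rw [ha, h2, h1, eq_div_iff (by positivity)]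
      subst hm
      push_cast
      linear_combination (4 * m + 1 : ℝ) * w
  · have h1 : n / 2 = m := by omega
    have h2 : hermiteFun n 0 = 0 := by rw [hm]; exact hermiteFun_odd_zero m
    refine ⟨4 * (2 * m + 1) / (4 * m + 3), ?_, ?_⟩
    · rw [h1, show (4 * (2 * m + 1) / (4 * m + 3) - 2 : ℝ) = -(2 / (4 * m + 3)) by field_simp; ring,
        abs_neg, abs_of_pos (by positivity), div_le_div_iff₀ (by positivity) (by positivity)]
      linarith [(Nat.cast_nonneg m : (0 : ℝ) ≤ m)]
    · have w := hermiteFun_even_zero_wallis m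
      have h := hermiteFun_even_zero_succ m
      rw [ha, h2, h1]
      subst hm
      have e : (2 * (((2 * m + 1 : ℕ) : ℝ) + 1)) * hermiteFun (2 * m + 1 + 1) 0 ^ 2 =
          2 * (2 * m + 1) * hermiteFun (2 * m) 0 ^ 2 := by
        push_cast; rw [show 2 * m + 1 + 1 = 2 * m + 2 from rfl]; linarith
      rw [e]
      have p : (2 * ((2 * m + 1 : ℕ) : ℝ) + 1) = 4 * m + 3 := by push_cast; ring
      rw [p]
      have q : (4 * (m : ℝ) + 3) ≠ 0 := by positivity
      field_simp
      linear_combination (4 * (2 * m + 1) : ℝ) * w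

theorem tendsto_hermiteAmp_zero :
    Tendsto (fun n => hermiteAmp n 0) atTop (nhds (2 / Real.pi)) := by
  have hπ := Real.pi_pos
  have hdiv : Tendsto (fun n : ℕ => n / 2) atTop atTop := Nat.tendsto_div_const_atTop (by norm_num)
  choose r hr1 hr2 using hermiteAmp_zero_sq
  have h1 : Tendsto (fun n : ℕ => 1 / (((n / 2 : ℕ) : ℝ) + 1)) atTop (nhds 0) :=
    tendsto_one_div_add_atTop_nhds_zero_nat.comp hdiv
  have hr : Tendsto r atTop (nhds 2) := by
    rw [tendsto_iff_norm_sub_tendsto_zero]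
    exact squeeze_zero (fun _ => norm_nonneg _) hr1 h1
  have hW := (Real.Wallis.tendsto_W_nhds_pi_div_two.comp hdiv).const_mul Real.pi
  have h3 := (hr.div hW (by positivity)).sqrt
  have : Real.sqrt (2 / (Real.pi * (Real.pi / 2))) = 2 / Real.pi := by
    rw [show 2 / (Real.pi * (Real.pi / 2)) = (2 / Real.pi) ^ 2 by field_simp]
    exact Real.sqrt_sq (by positivity)
  rw [this] at h3
  refine h3.congr fun n => ?_
  have hp : 0 < Real.Wallis.W (n / 2) := Real.Wallis.W_pos _
  have ha : 0 ≤ hermiteAmp n 0 := mul_nonneg (hermiteFreq_pos n).le (by positivity)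
  simp only [Pi.div_apply, Function.comp]
  rw [← hr2, mul_div_assoc, div_self (by positivity), mul_one, Real.sqrt_sq ha]

/-- The kernel of the Hermite partial sums. -/
noncomputable def hermiteKernel (n : ℕ) (x y : ℝ) : ℝ :=
  ∑ k ∈ Finset.range (n + 1), hermiteFun k x * hermiteFun k y

theorem abs_hermiteKernel_sub_le {n : ℕ} {T : ℝ} (hT : 0 ≤ T) (hTl : 2 * T ^ 3 ≤ hermiteFreq n)
    {x y : ℝ} (hx : x ∈ Icc (-T) T) (hy : y ∈ Icc (-T) T) (hxy : x ≠ y) :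
    |hermiteKernel n x y - Real.pi / 2 * hermiteAmp n x *
        (hermiteFreq n / Real.pi * Real.sinc (hermiteFreq n * (x - y)))| ≤
      2 * hermiteAmp n 0 * (1 + T ^ 2) / hermiteFreq n ∧
    |hermiteAmp n x - hermiteAmp n 0| ≤ 6 * hermiteAmp n 0 * T ^ 3 / hermiteFreq n := by
  have hl := hermiteFreq_pos n
  have hh : ∀ x, HasDerivAt (hermiteFun n)
      (hermiteFreq n * (fun x => hermiteDer n x / hermiteFreq n) x) x := fun x =>
    (hermiteFun_hasDerivAt n x).congr_deriv (by field_simp)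
  have hd : ∀ x, HasDerivAt (fun x => hermiteDer n x / hermiteFreq n)
      ((x ^ 2 - hermiteFreq n ^ 2) / hermiteFreq n * hermiteFun n x) x := fun x =>
    ((hermiteDer_hasDerivAt n x).div_const _).congr_deriv (by rw [hermiteFreq_sq]; ring)
  constructor
  · have h := abs_wronskian_kernel_sub_le hl hT hTl hh hd hx hy hxy
    have e : hermiteKernel n x y = ((x - y) * (hermiteFun n x * hermiteFun n y) +
        hermiteFreq n * (hermiteFun n x * (hermiteDer n y / hermiteFreq n) -
          hermiteDer n x / hermiteFreq n * hermiteFun n y)) / 2 / (x - y) := by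
      rw [eq_div_iff (sub_ne_zero.2 hxy), mul_comm, hermiteKernel, sub_mul_sum_hermiteFun]
      field_simp
    rw [e]
    refine (le_of_eq ?_).trans (h.trans (le_of_eq ?_))
    · rw [hermiteAmp]; congr 2; ring
    · rw [hermiteAmp]; field_simp
  · refine (abs_amp_sub_le hl hT hTl hh hd hx).trans (le_of_eq ?_)
    rw [hermiteAmp]; field_simp

/-- Kernels which on the squares `(-T n, T n)²` are, up to a small error, Dirichlet kernels with
slowly varying amplitude. -/
structure KernelAsymp (k : ℕ → ℝ → ℝ → ℝ) (T l : ℕ → ℝ) (c : ℕ → ℝ → ℝ) (ε : ℕ → ℝ) : Prop where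
  freq_pos : ∀ n, 0 < l n
  freq_tendsto : Tendsto l atTop atTop
  amp_meas : ∀ n, Measurable (c n)
  amp_le : ∀ᶠ n in atTop, ∀ x, |x| < T n → |c n x| ≤ 2
  amp_tendsto : ∀ x, Tendsto (fun n => c n x) atTop (nhds 1)
  err_nonneg : ∀ᶠ n in atTop, 0 ≤ ε n
  err_tendsto : Tendsto (fun n => T n * ε n) atTop (nhds 0)
  approx : ∀ᶠ n in atTop, ∀ x y, |x| < T n → |y| < T n → x ≠ y →
    |k n x y - c n x * (l n / Real.pi * Real.sinc (l n * (x - y)))| ≤ ε n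

theorem tendsto_cube_div_hermiteFreq {T : ℕ → ℝ} (hTpos : ∀ n, 0 < T n)
    (hTslow : Tendsto (fun n : ℕ => T n / (n : ℝ) ^ ((1 : ℝ) / 34)) atTop (nhds 0)) :
    Tendsto (fun n => T n ^ 3 / hermiteFreq n) atTop (nhds 0) := by
  have h := hTslow.pow 3
  rw [zero_pow (by norm_num)] at h
  refine squeeze_zero' (Eventually.of_forall fun n => ?_) ?_ h
  · have := hTpos n; have := hermiteFreq_pos n; positivity
  · filter_upwards [eventually_ge_atTop 1] with n hn
    have hn' : (1 : ℝ) ≤ n := by exact_mod_cast hn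
    have hT := hTpos n
    rw [div_pow]
    have h1 : ((n : ℝ) ^ ((1 : ℝ) / 34)) ^ 3 ≤ hermiteFreq n := by
      rw [← Real.rpow_natCast, ← Real.rpow_mul (by positivity), hermiteFreq, Real.sqrt_eq_rpow]
      calc _ ≤ (n : ℝ) ^ ((1 : ℝ) / 2) := Real.rpow_le_rpow_of_exponent_le hn' (by norm_num)
        _ ≤ _ := Real.rpow_le_rpow (by positivity) (by linarith) (by norm_num)
    have := hermiteFreq_pos n
    gcongr

theorem hermite_kernelAsymp {T : ℕ → ℝ} (hTpos : ∀ n, 0 < T n) (hTinf : Tendsto T atTop atTop)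
    (hTslow : Tendsto (fun n : ℕ => T n / (n : ℝ) ^ ((1 : ℝ) / 34)) atTop (nhds 0)) :
    KernelAsymp hermiteKernel T hermiteFreq (fun n x => Real.pi / 2 * hermiteAmp n x)
      (fun n => 2 * hermiteAmp n 0 * (1 + T n ^ 2) / hermiteFreq n) := by
  have hπ := Real.pi_pos
  have hcube := tendsto_cube_div_hermiteFreq hTpos hTslow
  have hamp := tendsto_hermiteAmp_zero
  have ha0 : ∀ n x, 0 ≤ hermiteAmp n x := fun n x =>
    mul_nonneg (hermiteFreq_pos n).le (by positivity)
  have hsmall : ∀ᶠ n in atTop, 2 * T n ^ 3 ≤ hermiteFreq n := by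
    filter_upwards [hcube.eventually_le_const (show (0 : ℝ) < 1 / 2 by norm_num)] with n hn
    rw [div_le_iff₀ (hermiteFreq_pos n)] at hn; linarith
  have hmem : ∀ {n : ℕ} {x : ℝ}, |x| < T n → x ∈ Icc (-T n) (T n) := fun h => abs_le.1 h.le
  have hdiff : ∀ᶠ n in atTop, ∀ x, |x| < T n →
      |hermiteAmp n x - hermiteAmp n 0| ≤ 6 * hermiteAmp n 0 * (T n ^ 3 / hermiteFreq n) := by
    filter_upwards [hsmall] with n hn x hx
    rw [← mul_div_assoc]
    obtain ⟨y, hy, hxy⟩ : ∃ y ∈ Icc (-T n) (T n), x ≠ y := by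
      by_cases h : x = 0
      · exact ⟨T n, ⟨by linarith [hTpos n], le_rfl⟩, h ▸ (hTpos n).ne⟩
      · exact ⟨0, ⟨by linarith [hTpos n], (hTpos n).le⟩, h⟩
    exact (abs_hermiteKernel_sub_le (hTpos n).le hn (hmem hx) hy hxy).2
  have hbound : Tendsto (fun n => 6 * hermiteAmp n 0 * (T n ^ 3 / hermiteFreq n)) atTop (nhds 0) := by
    simpa using (hamp.const_mul 6).mul hcube
  have hamp1 : Tendsto (fun n => Real.pi / 2 * hermiteAmp n 0) atTop (nhds 1) := by
    have := hamp.const_mul (Real.pi / 2)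
    rwa [show Real.pi / 2 * (2 / Real.pi) = 1 by field_simp] at this
  refine ⟨hermiteFreq_pos, ?_, fun n => ?_, ?_, fun x => ?_, ?_, ?_, ?_⟩
  · refine tendsto_atTop_mono (fun n => Real.sqrt_le_sqrt ?_)
      (Real.tendsto_sqrt_atTop.comp tendsto_natCast_atTop_atTop)
    linarith [(Nat.cast_nonneg n : (0 : ℝ) ≤ n)]
  · have h1 := (hermiteFun_continuous n).measurable
    have h2 := (hermiteDer_continuous n).measurable
    unfold hermiteAmp; fun_prop
  · filter_upwards [hdiff, hbound.eventually_le_const (show (0 : ℝ) < 1 / 4 by norm_num),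
      hamp1.eventually_le_const (show (1 : ℝ) < 3 / 2 by norm_num)] with n h1 h2 h3 x hx
    rw [abs_of_nonneg (mul_nonneg (by positivity) (ha0 n x))]
    have h4 := (le_abs_self _).trans ((h1 x hx).trans h2)
    nlinarith [Real.pi_le_four]
  · have h1 : Tendsto (fun n => hermiteAmp n x - hermiteAmp n 0) atTop (nhds 0) := by
      rw [tendsto_zero_iff_abs_tendsto_zero]
      refine squeeze_zero' (Eventually.of_forall fun n => abs_nonneg _) ?_ hbound
      filter_upwards [hdiff, hTinf.eventually_gt_atTop |x|] with n h1 h2 using h1 x h2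
    have := hamp1.add (h1.const_mul (Real.pi / 2))
    rw [mul_zero, add_zero] at this
    exact this.congr fun n => by ring
  · refine Eventually.of_forall fun n => ?_
    have := ha0 n 0; have := hermiteFreq_pos n; positivity
  · have h1 : Tendsto (fun n => T n * (1 + T n ^ 2) / hermiteFreq n) atTop (nhds 0) := by
      refine squeeze_zero' (Eventually.of_forall fun n => ?_) ?_ (by simpa using hcube.const_mul 2)
      · have := hTpos n; have := hermiteFreq_pos n; positivity
      · filter_upwards [hTinf.eventually_ge_atTop 1] with n hn
        have := hermiteFreq_pos n
        rw [← mul_div_assoc]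
        refine div_le_div_of_nonneg_right ?_ this.le
        nlinarith [mul_nonneg (by linarith : 0 ≤ T n) (by nlinarith : 0 ≤ T n ^ 2 - 1)]
    have := (hamp.const_mul 2).mul h1
    rw [mul_zero] at this
    exact this.congr fun n => by ring
  · filter_upwards [hsmall] with n hn x y hx hy hxy
    exact (abs_hermiteKernel_sub_le (hTpos n).le hn (hmem hx) (hmem hy) hxy).1

theorem hermiteKernel_continuous (n : ℕ) :
    Continuous fun p : ℝ × ℝ => hermiteKernel n p.1 p.2 := by
  have h := hermiteFun_continuous
  unfold hermiteKernel
  exact continuous_finsetSum _ fun k _ => ((h k).comp continuous_fst).mul ((h k).comp continuous_snd)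

/-- The truncated partial sum is an integral operator. -/
theorem hermitePartialSum_eq_integral {n : ℕ} {f : ℝ → ℝ} (hf : Integrable f) {R : ℝ}
    (hR : ∀ x, R < |x| → f x = 0) (x : ℝ) :
    hermitePartialSum n f x = ∫ y, f y * hermiteKernel n x y := by
  have hi : ∀ k, Integrable fun y => f y * hermiteFun k y := fun k => by
    obtain ⟨C, hC⟩ := (isCompact_Icc (a := -R) (b := R)).exists_bound_of_continuousOn
      (hermiteFun_continuous k).continuousOn
    have hm : Measurable fun y => (Icc (-R) R).indicator (hermiteFun k) y :=
      (hermiteFun_continuous k).measurable.indicator measurableSet_Icc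
    have := hf.mul_bdd (g := fun y => (Icc (-R) R).indicator (hermiteFun k) y) (c := max C 0)
      hm.aestronglyMeasurable (ae_of_all _ fun y => by
        by_cases hy : y ∈ Icc (-R) R
        · rw [indicator_of_mem hy]; exact (hC y hy).trans (le_max_left _ _)
        · rw [indicator_of_notMem hy, norm_zero]; exact le_max_right _ _)
    refine this.congr (ae_of_all _ fun y => ?_)
    by_cases hy : y ∈ Icc (-R) R
    · simp only [indicator_of_mem hy]
    · have : f y = 0 := hR y (by
        by_contra h; exact hy (abs_le.1 (not_lt.1 h)))
      simp [this]
  rw [hermitePartialSum]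
  have : ∀ y, f y * hermiteKernel n x y =
      ∑ k ∈ Finset.range (n + 1), f y * hermiteFun k y * hermiteFun k x := fun y => by
    rw [hermiteKernel, Finset.mul_sum]
    exact Finset.sum_congr rfl fun k _ => by ring
  simp_rw [this]
  rw [integral_finsetSum _ fun k _ => (hi k).mul_const _]
  exact Finset.sum_congr rfl fun k _ => (integral_mul_const _ _).symm

/-- The integral operator with kernel `κ`, truncated to `(-τ, τ)` on both sides. -/
noncomputable def truncOp (κ : ℝ → ℝ → ℝ) (τ : ℝ) (f : ℝ → ℝ) (x : ℝ) : ℝ :=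
  (Ioo (-τ) τ).indicator (fun x => ∫ y, (Ioo (-τ) τ).indicator f y * κ x y) x

section TruncOp
variable {κ : ℝ → ℝ → ℝ} {τ : ℝ} {f g : ℝ → ℝ}

theorem exists_kernel_bound (hκ : Continuous fun p : ℝ × ℝ => κ p.1 p.2) (τ : ℝ) :
    ∃ C, 0 ≤ C ∧ ∀ x ∈ Ioo (-τ) τ, ∀ y ∈ Ioo (-τ) τ, |κ x y| ≤ C := by
  obtain ⟨C, hC⟩ := ((isCompact_Icc (a := -τ) (b := τ)).prod
    (isCompact_Icc (a := -τ) (b := τ))).exists_bound_of_continuousOn hκ.continuousOn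
  exact ⟨max C 0, le_max_right _ _, fun x hx y hy =>
    (hC (x, y) ⟨Ioo_subset_Icc_self hx, Ioo_subset_Icc_self hy⟩).trans (le_max_left _ _)⟩

theorem measurable_truncOp (hκ : Continuous fun p : ℝ × ℝ => κ p.1 p.2) (hf : Measurable f) :
    Measurable (truncOp κ τ f) := by
  refine Measurable.indicator ?_ measurableSet_Ioo
  have : StronglyMeasurable fun p : ℝ × ℝ => (Ioo (-τ) τ).indicator f p.2 * κ p.1 p.2 :=
    (((hf.indicator measurableSet_Ioo).comp measurable_snd).mul hκ.measurable).stronglyMeasurable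
  exact this.integral_prod_right.measurable

theorem integrable_truncOp_integrand (hκ : Continuous fun p : ℝ × ℝ => κ p.1 p.2)
    (hf : IntegrableOn f (Ioo (-τ) τ)) {x : ℝ} (hx : x ∈ Ioo (-τ) τ) :
    Integrable fun y => (Ioo (-τ) τ).indicator f y * κ x y := by
  obtain ⟨C, hC0, hC⟩ := exists_kernel_bound hκ τ
  have h1 : Continuous fun y => κ x y := hκ.comp (by fun_prop : Continuous fun y => (x, y))
  have h2 := (hf.integrable_indicator measurableSet_Ioo).mul_bdd
    (g := (Ioo (-τ) τ).indicator (κ x)) (c := C)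
    (h1.measurable.indicator measurableSet_Ioo).aestronglyMeasurable (ae_of_all _ fun y => by
      by_cases hy : y ∈ Ioo (-τ) τ
      · rw [indicator_of_mem hy]; exact hC x hx y hy
      · rw [indicator_of_notMem hy, norm_zero]; exact hC0)
  refine h2.congr (ae_of_all _ fun y => ?_)
  by_cases hy : y ∈ Ioo (-τ) τ
  · simp only [indicator_of_mem hy]
  · simp only [indicator_of_notMem hy, zero_mul]

theorem exists_abs_truncOp_le (hκ : Continuous fun p : ℝ × ℝ => κ p.1 p.2) :
    ∃ C, 0 ≤ C ∧ ∀ f : ℝ → ℝ, IntegrableOn f (Ioo (-τ) τ) →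
      ∀ x, |truncOp κ τ f x| ≤ C * ∫ y in Ioo (-τ) τ, |f y| := by
  obtain ⟨C, hC0, hC⟩ := exists_kernel_bound hκ τ
  refine ⟨C, hC0, fun f hf x => ?_⟩
  have h0 : 0 ≤ C * ∫ y in Ioo (-τ) τ, |f y| :=
    mul_nonneg hC0 (integral_nonneg fun _ => abs_nonneg _)
  rw [truncOp]
  by_cases hx : x ∈ Ioo (-τ) τ
  · rw [indicator_of_mem hx, ← integral_const_mul, ← integral_indicator measurableSet_Ioo]
    refine (abs_integral_le_integral_abs).trans (integral_mono
      (integrable_truncOp_integrand hκ hf hx).abs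
      ((integrable_indicator_iff measurableSet_Ioo).2 (hf.abs.const_mul C)) fun y => ?_)
    simp only
    by_cases hy : y ∈ Ioo (-τ) τ
    · rw [indicator_of_mem hy, indicator_of_mem hy, abs_mul, mul_comm]
      exact mul_le_mul_of_nonneg_right (hC x hx y hy) (abs_nonneg _)
    · rw [indicator_of_notMem hy, indicator_of_notMem hy]; simp
  · rw [indicator_of_notMem hx, abs_zero]; exact h0

theorem truncOp_add (hκ : Continuous fun p : ℝ × ℝ => κ p.1 p.2)
    (hf : IntegrableOn f (Ioo (-τ) τ)) (hg : IntegrableOn g (Ioo (-τ) τ)) (x : ℝ) :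
    truncOp κ τ (fun y => f y + g y) x = truncOp κ τ f x + truncOp κ τ g x := by
  rw [truncOp, truncOp, truncOp]
  by_cases hx : x ∈ Ioo (-τ) τ
  · simp only [indicator_of_mem hx]
    rw [← integral_add (integrable_truncOp_integrand hκ hf hx)
      (integrable_truncOp_integrand hκ hg hx)]
    refine integral_congr_ae (ae_of_all _ fun y => ?_)
    by_cases hy : y ∈ Ioo (-τ) τ
    · simp only [indicator_of_mem hy, add_mul]
    · simp only [indicator_of_notMem hy, zero_mul, add_zero]
  · simp only [indicator_of_notMem hx, add_zero]

theorem truncOp_congr (h : ∀ y ∈ Ioo (-τ) τ, f y = g y) : truncOp κ τ f = truncOp κ τ g := by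
  have : (Ioo (-τ) τ).indicator f = (Ioo (-τ) τ).indicator g := indicator_congr h
  funext x
  rw [truncOp, truncOp, this]

theorem truncOp_const_mul (a : ℝ) (x : ℝ) :
    truncOp κ τ (fun y => a * f y) x = a * truncOp κ τ f x := by
  rw [truncOp, truncOp]
  by_cases hx : x ∈ Ioo (-τ) τ
  · simp only [indicator_of_mem hx]
    rw [← integral_const_mul]
    refine integral_congr_ae (ae_of_all _ fun y => ?_)
    by_cases hy : y ∈ Ioo (-τ) τ
    · simp only [indicator_of_mem hy, mul_assoc]
    · simp only [indicator_of_notMem hy, zero_mul, mul_zero]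
  · simp only [indicator_of_notMem hx, mul_zero]

end TruncOp

theorem truncOp_hermiteKernel {f : ℝ → ℝ} {n : ℕ} {τ : ℝ} (hf : IntegrableOn f (Ioo (-τ) τ)) :
    truncOp (hermiteKernel n) τ f = (Ioo (-τ) τ).indicator
      (hermitePartialSum n ((Ioo (-τ) τ).indicator f)) := by
  funext x
  rw [truncOp]
  congr 1
  funext x
  refine (hermitePartialSum_eq_integral (hf.integrable_indicator measurableSet_Ioo)
    (R := τ) (fun y hy => indicator_of_notMem (s := Ioo (-τ) τ)
      (fun h => lt_asymm hy (abs_lt.2 h)) _) x).symm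

theorem IsTest.indicator {f : ℝ → ℝ} (hf : IsTest f) {s : Set ℝ} (hs : MeasurableSet s) :
    IsTest (s.indicator f) := by
  obtain ⟨M, hM⟩ := hf.bdd
  obtain ⟨R, hR⟩ := hf.supp
  refine ⟨hf.meas.indicator hs, ⟨M, fun t => ?_⟩, R, fun t ht => ?_⟩
  · by_cases h : t ∈ s
    · rw [indicator_of_mem h]; exact hM t
    · rw [indicator_of_notMem h, abs_zero]; exact (abs_nonneg _).trans (hM t)
  · by_cases h : t ∈ s
    · rw [indicator_of_mem h]; exact hR t ht
    · rw [indicator_of_notMem h]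

theorem isTest_truncOp {κ : ℝ → ℝ → ℝ} (hκ : Continuous fun p : ℝ × ℝ => κ p.1 p.2) {τ : ℝ}
    {f : ℝ → ℝ} (hf : Measurable f) (hfi : IntegrableOn f (Ioo (-τ) τ)) :
    IsTest (truncOp κ τ f) := by
  obtain ⟨C, hC0, hC⟩ := exists_abs_truncOp_le (τ := τ) hκ
  refine ⟨measurable_truncOp hκ hf, ⟨_, fun x => hC f hfi x⟩, τ, fun t ht => ?_⟩
  exact indicator_of_notMem (s := Ioo (-τ) τ) (fun h => lt_asymm ht (abs_lt.2 h)) _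

theorem abs_dirichlet_le {l : ℝ} (hl : 0 < l) (u : ℝ) :
    |l / Real.pi * Real.sinc (l * u)| ≤ l / Real.pi := by
  have : 0 < l / Real.pi := div_pos hl Real.pi_pos
  rw [abs_mul, abs_of_pos this]
  exact mul_le_of_le_one_right this.le (Real.abs_sinc_le_one _)

theorem measurable_dirichlet (l : ℝ) :
    Measurable fun u : ℝ => l / Real.pi * Real.sinc (l * u) :=
  (Real.continuous_sinc.comp (continuous_const_mul l)).measurable.const_mul _

theorem abs_truncOp_sub_le {κ : ℝ → ℝ → ℝ} (hκ : Continuous fun p : ℝ × ℝ => κ p.1 p.2)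
    {τ l ε : ℝ} (hl : 0 < l) {c : ℝ → ℝ}
    (happ : ∀ x y, |x| < τ → |y| < τ → x ≠ y →
      |κ x y - c x * (l / Real.pi * Real.sinc (l * (x - y)))| ≤ ε)
    {f : ℝ → ℝ} (hf : IntegrableOn f (Ioo (-τ) τ)) {x : ℝ} (hx : |x| < τ) :
    |truncOp κ τ f x - c x * ∫ y, (Ioo (-τ) τ).indicator f y *
      (l / Real.pi * Real.sinc (l * (x - y)))| ≤ ε * ∫ y in Ioo (-τ) τ, |f y| := by
  have hx' : x ∈ Ioo (-τ) τ := abs_lt.1 hx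
  have i1 := integrable_truncOp_integrand hκ hf hx'
  have i2 := (integrable_mul_comp_sub (hf.integrable_indicator measurableSet_Ioo)
    (measurable_dirichlet l) (abs_dirichlet_le hl) x).const_mul (c x)
  rw [truncOp, indicator_of_mem hx', ← integral_const_mul, ← integral_sub i1 i2,
    ← integral_const_mul, ← integral_indicator measurableSet_Ioo]
  refine abs_integral_le_integral_abs.trans (integral_mono_ae (i1.sub i2).abs
      ((integrable_indicator_iff measurableSet_Ioo).2 (hf.abs.const_mul ε)) ?_)
  filter_upwards [show ∀ᵐ y : ℝ, y ≠ x from by simp [ae_iff]] with y hy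
  by_cases hyI : y ∈ Ioo (-τ) τ
  · simp only [indicator_of_mem hyI]
    rw [mul_left_comm (c x), ← mul_sub, abs_mul, mul_comm]
    exact mul_le_mul_of_nonneg_right (happ x y hx (abs_lt.2 hyI) hy.symm) (abs_nonneg _)
  · simp only [indicator_of_notMem hyI]; simp

theorem YoungFunction.comp_mul_abs_measurable (B : YoungFunction) {g : ℝ → ℝ} (hg : Measurable g)
    {C : ℝ} (hC : 0 ≤ C) : Measurable fun t => B.toFun (C * |g t|) :=
  B.measurable_comp (by fun_prop) fun t => by positivity

section Bound
variable {A B : YoungFunction} {K K' : ℝ}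

/-- The product of two local `L¹` norms is controlled by modulars. -/
theorem ofReal_integral_mul_integral_le (B : YoungFunction) {τ : ℝ} {f g : ℝ → ℝ}
    (hf : IsTest f) (hg : IsTest g) :
    ENNReal.ofReal ((∫ y in Ioo (-τ) τ, |g y|) * ∫ y in Ioo (-τ) τ, |f y|) ≤
      ENNReal.ofReal (2 * τ) * ∫⁻ t, (B.toFun |f t| + B.conj |g t|) := by
  have hfm := hf.meas
  have hgm := hg.meas
  have e : ∀ {h : ℝ → ℝ}, IsTest h → ENNReal.ofReal (∫ y in Ioo (-τ) τ, |h y|) =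
      ∫⁻ y in Ioo (-τ) τ, ENNReal.ofReal |h y| := fun hh =>
    ofReal_integral_eq_lintegral_ofReal hh.integrable.integrableOn.abs
      (ae_of_all _ fun _ => abs_nonneg _)
  have hv : volume (Ioo (-τ) τ) = ENNReal.ofReal (2 * τ) := by
    rw [Real.volume_Ioo]; congr 1; ring
  rw [ENNReal.ofReal_mul (integral_nonneg fun _ => abs_nonneg _), e hf, e hg,
    ← lintegral_mul_const _ (by fun_prop)]
  calc ∫⁻ x in Ioo (-τ) τ, ENNReal.ofReal |g x| * ∫⁻ y in Ioo (-τ) τ, ENNReal.ofReal |f y|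
      = ∫⁻ x in Ioo (-τ) τ, ∫⁻ y in Ioo (-τ) τ, ENNReal.ofReal (|f y| * |g x|) := by
        refine lintegral_congr fun x => ?_
        rw [← lintegral_const_mul _ (by fun_prop)]
        refine lintegral_congr fun y => ?_
        rw [mul_comm, ENNReal.ofReal_mul (abs_nonneg _)]
    _ ≤ ∫⁻ x in Ioo (-τ) τ, ∫⁻ y in Ioo (-τ) τ, (B.toFun |f y| + B.conj |g x|) :=
        lintegral_mono fun x => lintegral_mono fun y => B.young (abs_nonneg _) _
    _ = ENNReal.ofReal (2 * τ) *
        ((∫⁻ t in Ioo (-τ) τ, B.toFun |f t|) + ∫⁻ t in Ioo (-τ) τ, B.conj |g t|) := by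
        have hBm : Measurable fun t => B.toFun |f t| := B.measurable_comp_abs hfm
        have hCm : Measurable fun t => B.conj |g t| := B.conj_measurable_comp (by fun_prop)
        simp_rw [lintegral_add_left hBm, lintegral_const]
        rw [lintegral_add_left measurable_const, lintegral_const, lintegral_mul_const _ hCm,
          Measure.restrict_apply_univ, hv]
        ring
    _ ≤ _ := by
        rw [lintegral_add_left (B.measurable_comp_abs hfm)]
        exact mul_le_mul_right (add_le_add (setLIntegral_le_lintegral _ _)
          (setLIntegral_le_lintegral _ _)) _

theorem eventually_truncOp_form_le (hAB : HardyPair A B K) (hKK' : 96 * K ≤ K')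
    (hBA : ∀ t : ℝ, 0 ≤ t → B.toFun t ≤ A.toFun (K' * t))
    {k : ℕ → ℝ → ℝ → ℝ} {T l : ℕ → ℝ} {c : ℕ → ℝ → ℝ} {ε : ℕ → ℝ}
    (hk : KernelAsymp k T l c ε) (hkc : ∀ n, Continuous fun p : ℝ × ℝ => k n p.1 p.2)
    (hT : ∀ n, 0 < T n) :
    ∀ᶠ n in atTop, ∀ f g : ℝ → ℝ, IsTest f → IsTest g →
      ENNReal.ofReal |∫ x, g x * truncOp (k n) (T n) f x| ≤
        40001 * ∫⁻ t, (A.toFun (K' * |f t|) + B.conj (2 * K' * |g t|)) := by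
  filter_upwards [hk.amp_le, hk.err_nonneg, hk.approx,
    hk.err_tendsto.eventually_le_const (show (0:ℝ) < 1 / 2 by norm_num)]
    with n hamp hε0 happ hε f g hf hg
  have hl := hk.freq_pos n
  have hcm := hk.amp_meas n
  have hτ := hT n
  generalize T n = τ at *
  generalize ε n = e at *
  generalize l n = l at *
  generalize c n = c at *
  have hκ := hkc n
  generalize k n = κ at *
  have hK0 : 0 < K' := by linarith [hAB.one_le]
  set I := Ioo (-τ) τ with hI
  set φ := I.indicator c with hφ
  have hφ2 : ∀ t, |φ t| ≤ 2 := fun t => by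
    by_cases h : t ∈ I
    · rw [hφ, indicator_of_mem h]; exact hamp t (abs_lt.2 h)
    · rw [hφ, indicator_of_notMem h, abs_zero]; norm_num
  have hf' : IsTest (I.indicator f) := hf.indicator measurableSet_Ioo
  have hg' : IsTest (fun t => g t * φ t) := hg.mul_bdd (hcm.indicator measurableSet_Ioo) hφ2
  have hS : IsTest (truncOp κ τ f) := isTest_truncOp hκ hf.meas hf.integrable.integrableOn
  obtain ⟨M, hM⟩ := hS.bdd
  have i1 : Integrable fun x => g x * truncOp κ τ f x := (hg.mul_bdd hS.meas hM).integrable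
  have i2 := integrable_form_left hf'.integrable hg'.integrable (measurable_dirichlet l)
    (abs_dirichlet_le hl)
  set P := ∫ x, g x * φ x * ∫ t, I.indicator f t * (l / Real.pi * Real.sinc (l * (x - t))) with hP
  have hsub : |(∫ x, g x * truncOp κ τ f x) - P| ≤
      e * ((∫ y in I, |g y|) * ∫ y in I, |f y|) := by
    rw [hP, ← integral_sub i1 i2]
    have : e * ((∫ y in I, |g y|) * ∫ y in I, |f y|) =
        ∫ x, I.indicator (fun x => |g x| * (e * ∫ y in I, |f y|)) x := by
      rw [integral_indicator measurableSet_Ioo, integral_mul_const]; ring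
    rw [this]
    refine abs_integral_le_integral_abs.trans (integral_mono (i1.sub i2).abs
      ((integrable_indicator_iff measurableSet_Ioo).2
        (hg.integrable.integrableOn.abs.mul_const _)) fun x => ?_)
    simp only
    by_cases hx : x ∈ I
    · rw [indicator_of_mem hx, hφ, indicator_of_mem hx, mul_assoc, ← mul_sub, abs_mul]
      exact mul_le_mul_of_nonneg_left (abs_truncOp_sub_le hκ hl happ hf.integrable.integrableOn
        (abs_lt.2 hx)) (abs_nonneg _)
    · rw [indicator_of_notMem hx, hφ, indicator_of_notMem hx, truncOp, indicator_of_notMem hx]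
      simp
  have hfm := hf.meas
  have hgm := hg.meas
  set X := ∫⁻ t, (A.toFun (K' * |f t|) + B.conj (2 * K' * |g t|)) with hX
  have b1 : ENNReal.ofReal |P| ≤ 40000 * X := by
    refine (dirichlet_form_le_of_isTest hAB hKK' hBA hl hf' hg').trans
      (mul_le_mul_right (lintegral_mono fun t => add_le_add (A.mono (by positivity) ?_)
        (B.conj_mono ?_)) _)
    · refine mul_le_mul_of_nonneg_left ?_ hK0.le
      by_cases h : t ∈ I
      · rw [indicator_of_mem h]
      · rw [indicator_of_notMem h, abs_zero]; exact abs_nonneg _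
    · rw [abs_mul]
      nlinarith [mul_le_mul_of_nonneg_left (hφ2 t) (mul_nonneg hK0.le (abs_nonneg (g t)))]
  have b2 : ENNReal.ofReal (e * ((∫ y in I, |g y|) * ∫ y in I, |f y|)) ≤ X := by
    rw [ENNReal.ofReal_mul hε0]
    refine (mul_le_mul_right (ofReal_integral_mul_integral_le B hf hg) _).trans ?_
    rw [← mul_assoc, ← ENNReal.ofReal_mul hε0]
    refine (mul_le_mul_left (ENNReal.ofReal_le_one.2
      (by nlinarith : e * (2 * τ) ≤ 1)) _).trans ?_
    rw [one_mul]
    refine lintegral_mono fun t => add_le_add (hBA _ (abs_nonneg _)) (B.conj_mono ?_)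
    exact le_mul_of_one_le_left (abs_nonneg _) (by linarith [hAB.one_le])
  have b3 : |∫ x, g x * truncOp κ τ f x| ≤
      |P| + e * ((∫ y in I, |g y|) * ∫ y in I, |f y|) := by
    have := abs_sub_abs_le_abs_sub (∫ x, g x * truncOp κ τ f x) P
    linarith
  refine (ENNReal.ofReal_le_ofReal b3).trans ((ENNReal.ofReal_add_le).trans ?_)
  calc _ ≤ 40000 * X + X := add_le_add b1 b2
    _ = _ := by ring

end Bound

/-- Duality: a bilinear modular estimate for test functions yields a modular estimate. -/
theorem lintegral_modular_le_of_form_le {B : YoungFunction} (hB : ∀ t, 0 ≤ t → B.toFun t < ⊤)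
    {S : ℝ → ℝ} (hS : IsTest S) {X : ENNReal} {C L : ℝ} (hC : 0 < C) (hL : 0 < L)
    (h : ∀ g, IsTest g → ENNReal.ofReal |∫ x, g x * S x| ≤
      ENNReal.ofReal C * (X + ∫⁻ t, B.conj (L * |g t|))) :
    ∫⁻ x, B.toFun (|S x| / (2 * C * L)) ≤ X := by
  obtain ⟨b, hb, hb0, hbe⟩ := B.exists_subgradient hB
  obtain ⟨R, hR⟩ := hS.supp
  obtain ⟨M, hM⟩ := hS.bdd
  have hM0 : 0 ≤ M := (abs_nonneg _).trans (hM 0)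
  have hSm := hS.meas
  have hCL : 0 < 2 * C * L := by positivity
  set F : ℝ → ℝ := fun x => |S x| / (2 * C * L) with hF
  have hF0 : ∀ x, 0 ≤ F x := fun x => by positivity
  have hFm : Measurable F := by fun_prop
  have hFM : ∀ x, F x ≤ M / (2 * C * L) := fun x =>
    div_le_div_of_nonneg_right (hM x) hCL.le
  have hbm : Monotone fun s => b (max s 0) := fun s t hst =>
    hb (mem_Ici.2 (le_max_right _ _)) (mem_Ici.2 (le_max_right _ _)) (max_le_max_right 0 hst)
  have hbF : Measurable fun x => b (F x) := by
    simpa only [Function.comp_def, max_eq_left (hF0 _)] using hbm.measurable.comp hFm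
  have hbFM : ∀ x, b (F x) ≤ b (M / (2 * C * L)) := fun x =>
    hb (mem_Ici.2 (hF0 x)) (mem_Ici.2 (by positivity)) (hFM x)
  set s : ℝ → ℝ := fun x => if 0 ≤ S x then 1 else -1 with hs
  have hsm : Measurable s := Measurable.ite (measurableSet_le measurable_const hSm)
    measurable_const measurable_const
  have hs1 : ∀ x, |s x| = 1 := fun x => by simp only [hs]; split_ifs <;> simp
  have hsS : ∀ x, s x * S x = |S x| := fun x => by
    simp only [hs]; split_ifs with h
    · rw [one_mul, abs_of_nonneg h]
    · rw [abs_of_neg (not_le.1 h)]; ring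
  set J : Set ℝ := Icc (-R) R with hJ
  have hout : ∀ x, x ∉ J → S x = 0 := fun x hx => hR x (by
    by_contra h
    exact hx (abs_le.1 (not_lt.1 h)))
  have hFout : ∀ x, x ∉ J → F x = 0 := fun x hx => by simp [hF, hout x hx]
  set G : ℝ → ℝ := J.indicator fun x => b (F x) * s x / L with hG
  have hGt : IsTest G := by
    refine ⟨((hbF.mul hsm).div_const L).indicator measurableSet_Icc,
      ⟨b (M / (2 * C * L)) / L, fun t => ?_⟩, R, fun t ht => ?_⟩
    · have : 0 ≤ b (M / (2 * C * L)) := hb0 _ (by positivity)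
      by_cases ht : t ∈ J
      · rw [hG, indicator_of_mem ht, abs_div, abs_mul, hs1, mul_one, abs_of_pos hL,
          abs_of_nonneg (hb0 _ (hF0 t))]
        exact div_le_div_of_nonneg_right (hbFM t) hL.le
      · rw [hG, indicator_of_notMem ht, abs_zero]; positivity
    · exact indicator_of_notMem (s := J) (fun h => by have := abs_le.2 h; linarith) _
  have h1 := h G hGt
  have hInt : Integrable fun x => F x * b (F x) := by
    have h2 : IsTest F := ⟨hFm, ⟨_, fun t => (abs_of_nonneg (hF0 t)).le.trans (hFM t)⟩, R,
      fun t ht => by simp [hF, hR t ht]⟩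
    exact (h2.mul_bdd hbF (C := b (M / (2 * C * L))) fun t => by
      rw [abs_of_nonneg (hb0 _ (hF0 t))]; exact hbFM t).integrable
  have e1 : ∫ x, G x * S x = 2 * C * ∫ x, F x * b (F x) := by
    rw [← integral_const_mul]
    refine integral_congr_ae (ae_of_all _ fun x => ?_)
    by_cases hx : x ∈ J
    · simp only [hG, indicator_of_mem hx]
      rw [div_mul_eq_mul_div, mul_assoc, hsS]
      simp only [hF]
      field_simp
    · simp only [hG, indicator_of_notMem hx, hFout x hx]; ring
  set Z := ∫⁻ x, ENNReal.ofReal (F x * b (F x)) with hZ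
  have hZt : Z ≠ ⊤ := hInt.lintegral_lt_top.ne
  have hFb0 : ∀ x, 0 ≤ F x * b (F x) := fun x => mul_nonneg (hF0 x) (hb0 _ (hF0 x))
  have e2 : ENNReal.ofReal |∫ x, G x * S x| = ENNReal.ofReal C * (2 * Z) := by
    rw [e1, abs_of_nonneg (mul_nonneg (by positivity) (integral_nonneg hFb0)),
      ENNReal.ofReal_mul (by positivity), ofReal_integral_eq_lintegral_ofReal hInt
        (ae_of_all _ hFb0), mul_comm 2 C, ENNReal.ofReal_mul hC.le,
      ENNReal.ofReal_ofNat, mul_assoc]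
  set Y := ∫⁻ t, B.conj (L * |G t|) with hY
  rw [e2] at h1
  have h2 : 2 * Z ≤ X + Y :=
    (ENNReal.mul_le_mul_iff_right (by simpa using hC) ENNReal.ofReal_ne_top).1 h1
  have h3 : (∫⁻ x, B.toFun (F x)) + Y ≤ Z := by
    rw [hY, hZ, ← lintegral_add_left (B.measurable_comp hFm hF0)]
    refine lintegral_mono fun x => ?_
    by_cases hx : x ∈ J
    · simp only [hG, indicator_of_mem hx]
      rw [abs_div, abs_mul, hs1, mul_one, abs_of_pos hL, abs_of_nonneg (hb0 _ (hF0 x)),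
        mul_div_cancel₀ _ hL.ne']
      exact hbe _ (hF0 x)
    · simp only [hG, indicator_of_notMem hx, hFout x hx]
      rw [abs_zero, mul_zero, B.conj_zero, B.zero']; simp
  have hYZ : Y ≤ Z := le_add_self.trans h3
  have hYt : Y ≠ ⊤ := (hYZ.trans_lt hZt.lt_top).ne
  have h4 : (∫⁻ x, B.toFun (F x)) + Y ≤ X + Y := by
    refine (ENNReal.add_le_add_iff_right hYt).1 ?_
    calc (∫⁻ x, B.toFun (F x)) + Y + Y ≤ Z + Z := add_le_add h3 hYZ
      _ = 2 * Z := (two_mul Z).symm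
      _ ≤ X + Y := h2
      _ ≤ _ := le_self_add
  exact (ENNReal.add_le_add_iff_right hYt).1 h4

section Bound
variable {A B : YoungFunction} {K K' : ℝ}

theorem eventually_modular_truncOp_le_of_isTest (hAB : HardyPair A B K) (hKK' : 96 * K ≤ K')
    (hBA : ∀ t : ℝ, 0 ≤ t → B.toFun t ≤ A.toFun (K' * t))
    {k : ℕ → ℝ → ℝ → ℝ} {T l : ℕ → ℝ} {c : ℕ → ℝ → ℝ} {ε : ℕ → ℝ}
    (hk : KernelAsymp k T l c ε) (hkc : ∀ n, Continuous fun p : ℝ × ℝ => k n p.1 p.2)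
    (hT : ∀ n, 0 < T n) :
    ∀ᶠ n in atTop, ∀ f : ℝ → ℝ, IsTest f →
      ∫⁻ x, B.toFun (|truncOp (k n) (T n) f x| / (2 * 40001 * (2 * K'))) ≤
        ∫⁻ t, A.toFun (K' * |f t|) := by
  have hK0 : 0 < K' := by linarith [hAB.one_le]
  filter_upwards [eventually_truncOp_form_le hAB hKK' hBA hk hkc hT] with n hn f hf
  refine lintegral_modular_le_of_form_le hAB.right_lt_top
    (isTest_truncOp (hkc n) hf.meas hf.integrable.integrableOn) (by norm_num)
    (by positivity : 0 < 2 * K') fun g hg => ?_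
  refine (hn f g hf hg).trans_eq ?_
  rw [lintegral_add_left (A.comp_mul_abs_measurable hf.meas hK0.le)]
  congr 1
  norm_num

end Bound

/-- The set where both the variable and the function are at most `m`. -/
def truncSet (f : ℝ → ℝ) (m : ℕ) : Set ℝ := {x | |x| ≤ m ∧ |f x| ≤ m}

theorem measurableSet_truncSet {f : ℝ → ℝ} (hf : Measurable f) (m : ℕ) :
    MeasurableSet (truncSet f m) :=
  (measurableSet_le (measurable_norm (α := ℝ)) measurable_const).inter
    (measurableSet_le hf.norm measurable_const)

theorem isTest_indicator_truncSet {f : ℝ → ℝ} (hf : Measurable f) (m : ℕ) :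
    IsTest ((truncSet f m).indicator f) := by
  refine ⟨hf.indicator (measurableSet_truncSet hf m), ⟨m, fun t => ?_⟩, m, fun t ht => ?_⟩
  · by_cases h : t ∈ truncSet f m
    · rw [indicator_of_mem h]; exact h.2
    · rw [indicator_of_notMem h, abs_zero]; exact Nat.cast_nonneg m
  · exact indicator_of_notMem (s := truncSet f m) (fun h => absurd h.1 (not_le.2 ht)) _

theorem eventually_mem_truncSet (f : ℝ → ℝ) (x : ℝ) : ∀ᶠ m : ℕ in atTop, x ∈ truncSet f m := by
  filter_upwards [eventually_ge_atTop ⌈max |x| |f x|⌉₊] with m hm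
  have := (Nat.le_ceil (max |x| |f x|)).trans (Nat.cast_le.2 hm)
  exact ⟨(le_max_left _ _).trans this, (le_max_right _ _).trans this⟩

theorem tendsto_indicator_truncSet (f : ℝ → ℝ) (x : ℝ) :
    Tendsto (fun m => (truncSet f m).indicator f x) atTop (nhds (f x)) :=
  tendsto_const_nhds.congr' ((eventually_mem_truncSet f x).mono fun _ hm =>
    (indicator_of_mem hm f).symm)

theorem abs_indicator_le (s : Set ℝ) (f : ℝ → ℝ) (x : ℝ) : |s.indicator f x| ≤ |f x| := by
  by_cases h : x ∈ s
  · rw [indicator_of_mem h]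
  · rw [indicator_of_notMem h, abs_zero]; exact abs_nonneg _

theorem abs_sub_indicator_le (s : Set ℝ) (f : ℝ → ℝ) (x : ℝ) :
    |f x - s.indicator f x| ≤ |f x| := by
  by_cases h : x ∈ s
  · rw [indicator_of_mem h, sub_self, abs_zero]; exact abs_nonneg _
  · rw [indicator_of_notMem h, sub_zero]

theorem tendsto_truncOp_truncSet {κ : ℝ → ℝ → ℝ} (hκ : Continuous fun p : ℝ × ℝ => κ p.1 p.2)
    {τ : ℝ} {f : ℝ → ℝ} (hf : Measurable f) (hfi : IntegrableOn f (Ioo (-τ) τ)) (x : ℝ) :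
    Tendsto (fun m => truncOp κ τ ((truncSet f m).indicator f) x) atTop
      (nhds (truncOp κ τ f x)) := by
  rw [truncOp]
  by_cases hx : x ∈ Ioo (-τ) τ
  · simp only [truncOp, indicator_of_mem hx]
    refine tendsto_integral_of_dominated_convergence _ (fun m => ?_)
      (integrable_truncOp_integrand hκ hfi hx).norm (fun m => ae_of_all _ fun y => ?_)
      (ae_of_all _ fun y => ?_)
    · have h1 : Continuous fun y => κ x y := hκ.comp (by fun_prop : Continuous fun y => (x, y))
      exact (((hf.indicator (measurableSet_truncSet hf m)).indicator measurableSet_Ioo).mul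
        h1.measurable).aestronglyMeasurable
    · rw [norm_mul, norm_mul]
      refine mul_le_mul_of_nonneg_right ?_ (norm_nonneg _)
      rw [indicator_indicator, inter_comm, ← indicator_indicator]
      exact abs_indicator_le _ _ _
    · refine Tendsto.mul_const _ ?_
      by_cases hy : y ∈ Ioo (-τ) τ
      · simp only [indicator_of_mem hy]; exact tendsto_indicator_truncSet f y
      · simp only [indicator_of_notMem hy]; exact tendsto_const_nhds
  · simp only [truncOp, indicator_of_notMem hx]; exact tendsto_const_nhds

namespace YoungFunction

theorem le_liminf (B : YoungFunction) {u : ℕ → ℝ} {a : ℝ} (ha : 0 ≤ a)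
    (hu : Tendsto u atTop (nhds a)) :
    B.toFun a ≤ liminf (fun n => B.toFun (u n)) atTop := by
  rcases ha.eq_or_lt with rfl | ha
  · rw [B.zero']; exact zero_le
  refine le_of_forall_lt fun η hη => ?_
  obtain ⟨ζ, hηζ, hζ⟩ := exists_between hη
  refine hηζ.trans_le (le_liminf_of_le (by isBoundedDefault) ?_)
  have h1 := (B.leftContinuous' a ha).eventually (lt_mem_nhds hζ)
  have h2 : ∀ᶠ s in nhdsWithin a (Iio a), 0 < s :=
    mem_nhdsWithin_of_mem_nhds (lt_mem_nhds ha)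
  obtain ⟨s, hs, hs0, hsa⟩ := (h1.and (h2.and self_mem_nhdsWithin)).exists
  filter_upwards [hu.eventually (lt_mem_nhds hsa)] with n hn
  exact hs.le.trans (B.mono hs0.le hn.le)

theorem locallyIntegrable (A : YoungFunction) {f : ℝ → ℝ} (hf : Measurable f)
    (h : ∫⁻ x, A.toFun |f x| < ⊤) : LocallyIntegrable f := by
  obtain ⟨t₀, C, _, _, hlin⟩ := A.exists_le_linear
  refine (locallyIntegrable_iff).2 fun k hk => ⟨hf.aestronglyMeasurable, ?_⟩
  rw [HasFiniteIntegral]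
  calc ∫⁻ a in k, ‖f a‖ₑ ≤ ∫⁻ a in k, (ENNReal.ofReal t₀ + ENNReal.ofReal C * A.toFun |f a|) :=
        lintegral_mono fun a => by
          rw [Real.enorm_eq_ofReal_abs]; exact hlin _ (abs_nonneg _)
    _ = ENNReal.ofReal t₀ * volume k + ENNReal.ofReal C * ∫⁻ a in k, A.toFun |f a| := by
        rw [lintegral_add_left measurable_const, lintegral_const, Measure.restrict_apply_univ,
          lintegral_const_mul _ (A.measurable_comp_abs hf)]
    _ < ⊤ := ENNReal.add_lt_top.2 ⟨ENNReal.mul_lt_top ENNReal.ofReal_lt_top hk.measure_lt_top,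
        ENNReal.mul_lt_top ENNReal.ofReal_lt_top
          ((setLIntegral_le_lintegral _ _).trans_lt h)⟩

end YoungFunction

section Bound
variable {A B : YoungFunction} {K K' : ℝ}

theorem eventually_modular_truncOp_le (hAB : HardyPair A B K) (hKK' : 96 * K ≤ K')
    (hBA : ∀ t : ℝ, 0 ≤ t → B.toFun t ≤ A.toFun (K' * t))
    {k : ℕ → ℝ → ℝ → ℝ} {T l : ℕ → ℝ} {c : ℕ → ℝ → ℝ} {ε : ℕ → ℝ}
    (hk : KernelAsymp k T l c ε) (hkc : ∀ n, Continuous fun p : ℝ × ℝ => k n p.1 p.2)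
    (hT : ∀ n, 0 < T n) :
    ∀ᶠ n in atTop, ∀ f : ℝ → ℝ, Measurable f → LocallyIntegrable f →
      ∫⁻ x, B.toFun (|truncOp (k n) (T n) f x| / (2 * 40001 * (2 * K'))) ≤
        ∫⁻ t, A.toFun (K' * |f t|) := by
  have hK0 : 0 < K' := by linarith [hAB.one_le]
  filter_upwards [eventually_modular_truncOp_le_of_isTest hAB hKK' hBA hk hkc hT]
    with n hn f hf hfl
  have hfi : IntegrableOn f (Ioo (-T n) (T n)) :=
    ((locallyIntegrable_iff.1 hfl) _ (isCompact_Icc (a := -T n) (b := T n))).mono_set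
      Ioo_subset_Icc_self
  set M := 2 * 40001 * (2 * K') with hM
  have hM0 : 0 < M := by positivity
  calc ∫⁻ x, B.toFun (|truncOp (k n) (T n) f x| / M)
      ≤ ∫⁻ x, liminf (fun m => B.toFun
          (|truncOp (k n) (T n) ((truncSet f m).indicator f) x| / M)) atTop :=
        lintegral_mono fun x => B.le_liminf (by positivity)
          ((tendsto_truncOp_truncSet (hkc n) hf hfi x).abs.div_const M)
    _ ≤ liminf (fun m => ∫⁻ x, B.toFun
          (|truncOp (k n) (T n) ((truncSet f m).indicator f) x| / M)) atTop := by
        refine lintegral_liminf_le fun m => B.measurable_comp ?_ fun x => by positivity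
        have := measurable_truncOp (τ := T n) (hkc n) (hf.indicator (measurableSet_truncSet hf m))
        fun_prop
    _ ≤ ∫⁻ t, A.toFun (K' * |f t|) := by
        refine (liminf_le_liminf (Eventually.of_forall fun m =>
          (hn _ (isTest_indicator_truncSet hf m)).trans
          (lintegral_mono fun t => A.mono (by positivity)
            (mul_le_mul_of_nonneg_left (abs_indicator_le (truncSet f m) f t) hK0.le)))).trans_eq ?_
        exact liminf_const _

end Bound

section
open scoped ContDiff

namespace YoungFunction
variable {A : YoungFunction}

theorem measurable_comp_sub {f g : ℝ → ℝ} (hf : Measurable f) (hg : Measurable g) {C : ℝ}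
    (hC : 0 ≤ C) : Measurable fun x => A.toFun (C * |f x - g x|) :=
  A.comp_mul_abs_measurable (hf.sub hg) hC

/-- Modular convergence of truncations. -/
theorem tendsto_lintegral_truncSet (hA : ∀ t, 0 ≤ t → A.toFun t < ⊤) {f : ℝ → ℝ}
    (hf : Measurable f) {C : ℝ} (hC : 0 ≤ C) (hfin : ∫⁻ x, A.toFun (C * |f x|) < ⊤) :
    Tendsto (fun m => ∫⁻ x, A.toFun (C * |f x - (truncSet f m).indicator f x|)) atTop
      (nhds 0) := by
  have := tendsto_lintegral_of_dominated_convergence (F := fun m x =>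
    A.toFun (C * |f x - (truncSet f m).indicator f x|)) (f := fun _ => 0) (μ := volume)
    (fun x => A.toFun (C * |f x|))
    (fun m => measurable_comp_sub hf (hf.indicator (measurableSet_truncSet hf m)) hC)
    (fun m => ae_of_all _ fun x => A.mono (by positivity)
      (mul_le_mul_of_nonneg_left (abs_sub_indicator_le _ _ _) hC)) hfin.ne
    (ae_of_all _ fun x => A.tendsto_zero hA ?_ fun m => by positivity)
  · simpa using this
  · simpa using ((tendsto_const_nhds (x := f x)).sub
      (tendsto_indicator_truncSet f x)).abs.const_mul C

end YoungFunction

/-- Modular approximation of a test function by smooth compactly supported functions. -/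
theorem IsTest.exists_smooth_approx {A : YoungFunction} (hA : ∀ t, 0 ≤ t → A.toFun t < ⊤)
    {f : ℝ → ℝ} (hf : IsTest f) {C : ℝ} (hC : 0 ≤ C) {δ : ENNReal} (hδ : 0 < δ) :
    ∃ g : ℝ → ℝ, ContDiff ℝ ∞ g ∧ HasCompactSupport g ∧
      ∫⁻ x, A.toFun (C * |f x - g x|) ≤ δ := by
  obtain ⟨M, hM⟩ := hf.bdd
  obtain ⟨R, hR⟩ := hf.supp
  have hM0 : 0 ≤ M := (abs_nonneg _).trans (hM 0)
  let φ : ℕ → ContDiffBump (0 : ℝ) := fun j =>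
    ⟨1 / ((j : ℝ) + 1) / 2, 1 / ((j : ℝ) + 1), by positivity, half_lt_self (by positivity)⟩
  have hφ1 : ∀ j, (φ j).rOut = 1 / ((j : ℝ) + 1) := fun j => rfl
  have hφle : ∀ j, (φ j).rOut ≤ 1 := fun j => by
    rw [hφ1, div_le_one (by positivity)]; linarith [(Nat.cast_nonneg j : (0:ℝ) ≤ j)]
  let g : ℕ → ℝ → ℝ := fun j =>
    convolution ((φ j).normed volume) f (ContinuousLinearMap.lsmul ℝ ℝ) volume
  have hgs : ∀ j, ContDiff ℝ ∞ (g j) := fun j =>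
    (φ j).hasCompactSupport_normed.contDiff_convolution_left _ (φ j).contDiff_normed
      hf.integrable.locallyIntegrable
  have hgM : ∀ j x, |g j x| ≤ M := fun j x => by
    have := dist_convolution_le (z₀ := (0:ℝ)) (x₀ := x) hM0 (φ j).support_normed_eq.subset
      (φ j).nonneg_normed ((φ j).integral_normed (μ := volume)) hf.meas.aestronglyMeasurable
      (fun y _ => by rw [dist_zero_right]; exact hM y)
    rwa [dist_zero_right] at this
  have hg0 : ∀ j x, R + 1 < |x| → g j x = 0 := fun j x hx => by
    have h0 : ∀ y ∈ Metric.ball x (φ j).rOut, f y = 0 := fun y hy => by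
      refine hR y ?_
      have h1 : |y - x| < 1 := (Metric.mem_ball.1 hy).trans_le (hφle j)
      have h2 := abs_sub_abs_le_abs_sub x y
      rw [abs_sub_comm] at h2
      linarith
    have hx0 : f x = 0 := h0 x (Metric.mem_ball_self (φ j).rOut_pos)
    exact ((φ j).normed_convolution_eq_right fun y hy => (h0 y hy).trans hx0.symm).trans hx0
  have hlim : ∀ᵐ x, Tendsto (fun j => g j x) atTop (nhds (f x)) :=
    ContDiffBump.ae_convolution_tendsto_right_of_locallyIntegrable (K := 2)
      tendsto_one_div_add_atTop_nhds_zero_nat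
      (Eventually.of_forall fun j => by
        change 1 / ((j : ℝ) + 1) ≤ 2 * (1 / ((j : ℝ) + 1) / 2); linarith)
      hf.integrable.locallyIntegrable
  have hconv : Tendsto (fun j => ∫⁻ x, A.toFun (C * |f x - g j x|)) atTop (nhds 0) := by
    have := tendsto_lintegral_of_dominated_convergence (F := fun j x =>
      A.toFun (C * |f x - g j x|)) (f := fun _ => 0) (μ := volume)
      ((Icc (-(|R| + 1)) (|R| + 1)).indicator fun _ => A.toFun (C * (2 * M)))
      (fun j => YoungFunction.measurable_comp_sub hf.meas (hgs j).continuous.measurable hC)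
      (fun j => ae_of_all _ fun x => ?_) ?_ ?_
    · simpa using this
    · by_cases hx : x ∈ Icc (-(|R| + 1)) (|R| + 1)
      · rw [indicator_of_mem hx]
        refine A.mono (by positivity) (mul_le_mul_of_nonneg_left ?_ hC)
        have := abs_sub (f x) (g j x)
        linarith [hM x, hgM j x]
      · rw [indicator_of_notMem hx]
        have hx' : |R| + 1 < |x| := by
          by_contra h
          exact hx (abs_le.1 (not_lt.1 h))
        have := le_abs_self R
        simp only
        rw [hR x (by linarith), hg0 j x (by linarith), sub_self, abs_zero, mul_zero, A.zero']
    · rw [lintegral_indicator_const measurableSet_Icc]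
      exact (ENNReal.mul_lt_top (hA _ (by positivity)) (by simp)).ne
    · filter_upwards [hlim] with x hx
      refine A.tendsto_zero hA ?_ fun m => by positivity
      simpa using ((tendsto_const_nhds (x := f x)).sub hx).abs.const_mul C
  obtain ⟨j, hj⟩ := (hconv.eventually (ge_mem_nhds hδ)).exists
  refine ⟨g j, hgs j, HasCompactSupport.intro (isCompact_Icc (a := -(R + 1)) (b := R + 1))
    fun x hx => hg0 j x ?_, hj⟩
  by_contra h
  exact hx (abs_le.1 (not_lt.1 h))

theorem exists_smooth_approx {A : YoungFunction} (hA : ∀ t, 0 ≤ t → A.toFun t < ⊤)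
    {f : ℝ → ℝ} (hf : Measurable f) {C : ℝ} (hC : 0 ≤ C)
    (hfin : ∫⁻ x, A.toFun (2 * C * |f x|) < ⊤) {δ : ENNReal} (hδ : 0 < δ) :
    ∃ g : ℝ → ℝ, ContDiff ℝ ∞ g ∧ HasCompactSupport g ∧
      ∫⁻ x, A.toFun (C * |f x - g x|) ≤ δ := by
  have hδ2 : 0 < δ / 2 := ENNReal.half_pos hδ.ne'
  have hC2 : 0 ≤ 2 * C := by positivity
  obtain ⟨m, hm⟩ := ((YoungFunction.tendsto_lintegral_truncSet hA hf hC2 hfin).eventually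
    (ge_mem_nhds hδ2)).exists
  obtain ⟨g, hg1, hg2, hg3⟩ := (isTest_indicator_truncSet hf m).exists_smooth_approx hA hC2 hδ2
  refine ⟨g, hg1, hg2, ?_⟩
  have hfm := hf.indicator (measurableSet_truncSet hf m)
  calc ∫⁻ x, A.toFun (C * |f x - g x|)
      ≤ ∫⁻ x, (A.toFun (2 * C * |f x - (truncSet f m).indicator f x|) +
          A.toFun (2 * C * |(truncSet f m).indicator f x - g x|)) := by
        refine lintegral_mono fun x => ?_
        rw [mul_assoc, mul_assoc]
        refine (A.mono (by positivity) ?_).trans (A.add_le (by positivity) (by positivity))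
        rw [← mul_add]
        exact mul_le_mul_of_nonneg_left (abs_sub_le _ _ _) hC
    _ ≤ δ / 2 + δ / 2 := by
        rw [lintegral_add_left (YoungFunction.measurable_comp_sub hf hfm hC2)]
        exact add_le_add hm hg3
    _ = δ := ENNReal.add_halves δ

end

section
open scoped ContDiff FourierTransform

theorem integral_cexp_eq_dirichlet {l : ℝ} (u : ℝ) :
    ∫ ξ in (-(l / (2 * Real.pi)))..(l / (2 * Real.pi)),
      Complex.exp ((2 * Real.pi * u * ξ : ℝ) * Complex.I) =
    ((l / Real.pi * Real.sinc (l * u) : ℝ) : ℂ) := by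
  have hπ := Real.pi_ne_zero
  have hπ' : (Real.pi : ℂ) ≠ 0 := Complex.ofReal_ne_zero.2 hπ
  rcases eq_or_ne l 0 with rfl | hl
  · simp
  rcases eq_or_ne u 0 with rfl | hu
  · simp
    field_simp
    norm_num
  have hu' : (u : ℂ) ≠ 0 := Complex.ofReal_ne_zero.2 hu
  have hl' : (l : ℂ) ≠ 0 := Complex.ofReal_ne_zero.2 hl
  have h := integral_exp_mul_complex (a := -(l / (2 * Real.pi))) (b := l / (2 * Real.pi))
    (c := 2 * Real.pi * u * Complex.I) (by simp [hπ, hu])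
  have e : ∀ ξ : ℝ, Complex.exp ((2 * Real.pi * u * ξ : ℝ) * Complex.I) =
      Complex.exp (2 * Real.pi * u * Complex.I * ξ) := fun ξ => by
    congr 1; push_cast; ring
  simp_rw [e]
  rw [h, Real.sinc_of_ne_zero (mul_ne_zero hl hu)]
  have e1 : (2 * Real.pi * u * Complex.I) * ((l / (2 * Real.pi) : ℝ) : ℂ) =
      (l * u : ℂ) * Complex.I := by push_cast; field_simp
  have e2 : (2 * Real.pi * u * Complex.I) * ((-(l / (2 * Real.pi)) : ℝ) : ℂ) =
      -(l * u : ℂ) * Complex.I := by push_cast; field_simp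
  rw [e1, e2]
  push_cast
  rw [Complex.sin]
  field_simp
  linear_combination (Complex.exp (l * u * Complex.I) - Complex.exp (-(l * u * Complex.I))) *
    (Complex.I_sq)

theorem dirichlet_integral_eq_fourier {g : ℝ → ℝ} (hg : Integrable g) {l : ℝ} (hl : 0 < l)
    (x : ℝ) :
    ((∫ y, g y * (l / Real.pi * Real.sinc (l * (x - y))) : ℝ) : ℂ) =
      ∫ ξ in (-(l / (2 * Real.pi)))..(l / (2 * Real.pi)),
        Complex.exp ((2 * Real.pi * x * ξ : ℝ) * Complex.I) * 𝓕 (fun y => (g y : ℂ)) ξ := by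
  have hπ := Real.pi_pos
  have ha : -(l / (2 * Real.pi)) ≤ l / (2 * Real.pi) := by
    have : 0 < l / (2 * Real.pi) := by positivity
    linarith
  have hG : Integrable fun y => (g y : ℂ) := hg.ofReal
  have e1 : ∀ ξ : ℝ, Complex.exp ((2 * Real.pi * x * ξ : ℝ) * Complex.I) *
      𝓕 (fun y => (g y : ℂ)) ξ =
      ∫ y, (g y : ℂ) * Complex.exp ((2 * Real.pi * (x - y) * ξ : ℝ) * Complex.I) := fun ξ => by
    rw [Real.fourier_real_eq_integral_exp_smul, ← integral_const_mul]
    refine integral_congr_ae (ae_of_all _ fun y => ?_)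
    simp only [smul_eq_mul]
    rw [← mul_assoc, ← Complex.exp_add, mul_comm]
    congr 2
    push_cast; ring
  simp_rw [e1]
  rw [intervalIntegral.integral_of_le ha, integral_integral_swap]
  · rw [← integral_complex_ofReal]
    refine integral_congr_ae (ae_of_all _ fun y => ?_)
    simp only
    rw [integral_const_mul, ← intervalIntegral.integral_of_le ha, integral_cexp_eq_dirichlet]
    push_cast; rfl
  · set a := l / (2 * Real.pi)
    have h1 : Integrable (fun p : ℝ × ℝ => (1 : ℂ) * (g p.2 : ℂ))
        ((volume.restrict (Ioc (-a) a)).prod volume) :=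
      (integrable_const (1 : ℂ)).mul_prod hG
    have := h1.mul_bdd (g := fun p : ℝ × ℝ =>
      Complex.exp ((2 * Real.pi * (x - p.2) * p.1 : ℝ) * Complex.I)) (c := 1)
      (by fun_prop : Continuous fun p : ℝ × ℝ =>
        Complex.exp ((2 * Real.pi * (x - p.2) * p.1 : ℝ) * Complex.I)).aestronglyMeasurable
      (ae_of_all _ fun p => (Complex.norm_exp_ofReal_mul_I _).le)
    refine this.congr (ae_of_all _ fun p => ?_)
    simp only [one_mul, Function.uncurry]

theorem integrable_fourier_of_smooth {g : ℝ → ℝ} (hg : ContDiff ℝ ∞ g)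
    (hgc : HasCompactSupport g) : Integrable (𝓕 (fun y => (g y : ℂ))) := by
  have h1 : ContDiff ℝ ∞ fun y => (g y : ℂ) := Complex.ofRealCLM.contDiff.comp hg
  have h2 : HasCompactSupport fun y => (g y : ℂ) := hgc.comp_left Complex.ofReal_zero
  exact (𝓕 (h2.toSchwartzMap h1)).integrable

section Dirichlet
variable {g : ℝ → ℝ}

theorem tendsto_dirichlet_integral (hg : ContDiff ℝ ∞ g) (hgc : HasCompactSupport g)
    {l : ℕ → ℝ} (hl0 : ∀ n, 0 < l n) (hl : Tendsto l atTop atTop) (x : ℝ) :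
    Tendsto (fun n => ∫ y, g y * (l n / Real.pi * Real.sinc (l n * (x - y)))) atTop
      (nhds (g x)) := by
  have hπ := Real.pi_pos
  have hi : Integrable g := hg.continuous.integrable_of_hasCompactSupport hgc
  have hF := integrable_fourier_of_smooth hg hgc
  have hinv : 𝓕⁻ (𝓕 (fun y => (g y : ℂ))) x = g x :=
    hi.ofReal.fourierInv_fourier_eq hF
      (Complex.continuous_ofReal.comp hg.continuous).continuousAt
  have hInt : Integrable fun ξ : ℝ => Complex.exp ((2 * Real.pi * x * ξ : ℝ) * Complex.I) *
      𝓕 (fun y => (g y : ℂ)) ξ := by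
    refine (hF.mul_bdd (g := fun ξ : ℝ => Complex.exp ((2 * Real.pi * x * ξ : ℝ) * Complex.I))
      (c := 1) (by fun_prop : Continuous fun ξ : ℝ =>
        Complex.exp ((2 * Real.pi * x * ξ : ℝ) * Complex.I)).aestronglyMeasurable
      (ae_of_all _ fun ξ => (Complex.norm_exp_ofReal_mul_I _).le)).congr
      (ae_of_all _ fun ξ => mul_comm _ _)
  rw [Real.fourierInv_eq'] at hinv
  have hl' : Tendsto (fun n => l n / (2 * Real.pi)) atTop atTop :=
    hl.atTop_div_const (by positivity)
  have := intervalIntegral_tendsto_integral hInt (tendsto_neg_atTop_atBot.comp hl') hl'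
  have e : ∫ ξ : ℝ, Complex.exp ((2 * Real.pi * x * ξ : ℝ) * Complex.I) *
      𝓕 (fun y => (g y : ℂ)) ξ = g x := by
    rw [← hinv]
    refine integral_congr_ae (ae_of_all _ fun ξ => ?_)
    simp only [smul_eq_mul, RCLike.inner_apply, conj_trivial]
    congr 3
    push_cast; ring
  rw [e] at this
  refine (tendsto_ofReal_iff' (𝕜 := ℂ)).1 ?_
  refine this.congr fun n => ?_
  exact (dirichlet_integral_eq_fourier hi (hl0 n) x).symm

theorem exists_abs_dirichlet_integral_le (hg : ContDiff ℝ ∞ g) (hgc : HasCompactSupport g) :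
    ∃ C, 0 ≤ C ∧ ∀ l, 0 < l → ∀ x,
      |∫ y, g y * (l / Real.pi * Real.sinc (l * (x - y)))| ≤ C / (1 + |x|) := by
  have hπ := Real.pi_pos
  have hi : Integrable g := hg.continuous.integrable_of_hasCompactSupport hgc
  have hF := integrable_fourier_of_smooth hg hgc
  obtain ⟨R, hR⟩ := hgc.isCompact.isBounded.subset_closedBall 0
  set r := max R 1 with hr
  have hr1 : 1 ≤ r := le_max_right _ _
  set C₁ := ∫ ξ, ‖𝓕 (fun y => (g y : ℂ)) ξ‖ with hC₁
  set C₂ := ∫ y, |g y| with hC₂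
  have hC₁0 : 0 ≤ C₁ := integral_nonneg fun _ => norm_nonneg _
  have hC₂0 : 0 ≤ C₂ := integral_nonneg fun _ => abs_nonneg _
  refine ⟨C₁ * (1 + 2 * r) + C₂ * 4, by positivity, fun l hl x => ?_⟩
  have hx0 : 0 < 1 + |x| := by positivity
  rw [le_div_iff₀ hx0]
  have b1 : |∫ y, g y * (l / Real.pi * Real.sinc (l * (x - y)))| ≤ C₁ := by
    have ha : -(l / (2 * Real.pi)) ≤ l / (2 * Real.pi) := by
      have : 0 < l / (2 * Real.pi) := by positivity
      linarith
    rw [← Real.norm_eq_abs, ← Complex.norm_real, dirichlet_integral_eq_fourier hi hl,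
      intervalIntegral.integral_of_le ha]
    refine (norm_integral_le_integral_norm _).trans ?_
    simp_rw [norm_mul, Complex.norm_exp_ofReal_mul_I, one_mul]
    exact setIntegral_le_integral hF.norm (ae_of_all _ fun _ => norm_nonneg _)
  rcases le_or_gt |x| (2 * r) with hx | hx
  · calc _ ≤ C₁ * (1 + 2 * r) := mul_le_mul b1 (by linarith) hx0.le hC₁0
      _ ≤ _ := by linarith
  · have hs0 : ∀ y, r < |y| → g y = 0 := fun y hy => by
      by_contra h
      have := hR (subset_tsupport g h)
      rw [Metric.mem_closedBall, dist_zero_right, Real.norm_eq_abs] at this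
      linarith [le_max_left R 1]
    have b2 : |∫ y, g y * (l / Real.pi * Real.sinc (l * (x - y)))| ≤ 2 / |x| * C₂ := by
      rw [hC₂, ← integral_const_mul]
      refine abs_integral_le_integral_abs.trans (integral_mono
        (integrable_mul_comp_sub hi (measurable_dirichlet l) (abs_dirichlet_le hl) x).abs
        (hi.abs.const_mul _) fun y => ?_)
      simp only
      rw [abs_mul, mul_comm]
      rcases le_or_gt |y| r with hy | hy
      · refine mul_le_mul_of_nonneg_right ?_ (abs_nonneg _)
        have h1 : |x| / 2 ≤ |x - y| := by
          have := abs_sub_abs_le_abs_sub x y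
          linarith
        have hx1 : 0 < |x - y| := by linarith
        rw [Real.sinc_of_ne_zero (mul_ne_zero hl.ne' (abs_pos.1 hx1)), abs_mul, abs_div, abs_div,
          abs_mul, abs_of_pos hl, abs_of_pos hπ]
        have hsin := Real.abs_sin_le_one (l * (x - y))
        calc l / Real.pi * (|Real.sin (l * (x - y))| / (l * |x - y|))
            = |Real.sin (l * (x - y))| / (Real.pi * |x - y|) := by field_simp
          _ ≤ 1 / (|x| / 2) := by
            refine div_le_div₀ zero_le_one hsin (by linarith) ?_
            nlinarith [Real.pi_gt_three]
          _ = 2 / |x| := by field_simp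
      · rw [hs0 y hy, abs_zero, mul_zero, mul_zero]
    calc _ ≤ 2 / |x| * C₂ * (1 + |x|) := mul_le_mul_of_nonneg_right b2 hx0.le
      _ = C₂ * (2 * (1 + |x|) / |x|) := by ring
      _ ≤ C₂ * 4 := by
        refine mul_le_mul_of_nonneg_left ?_ hC₂0
        rw [div_le_iff₀ (by linarith)]; linarith
      _ ≤ _ := by
        have : 0 ≤ C₁ * (1 + 2 * r) := by positivity
        linarith

end Dirichlet

end

section
open scoped ContDiff

theorem lintegral_eq_of_even {φ : ℝ → ENNReal} (hφ : Measurable φ) (h : ∀ x, φ (-x) = φ x) :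
    ∫⁻ x, φ x = 2 * ∫⁻ x in Ioi 0, φ x := by
  have e : ∫⁻ x in Iic 0, φ x = ∫⁻ x in Ioi 0, φ x := by
    have := (Measure.measurePreserving_neg (volume : Measure ℝ)).setLIntegral_comp_preimage
      (s := Iic 0) measurableSet_Iic hφ
    rw [← this, setLIntegral_congr Ioi_ae_eq_Ici]
    simp [h]
  rw [← lintegral_add_compl φ (measurableSet_Ioi (a := (0:ℝ))), compl_Ioi, e, two_mul]

namespace YoungFunction

theorem lintegral_div_one_add_abs_lt_top (B : YoungFunction) (hB : ∀ t, 0 ≤ t → B.toFun t < ⊤)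
    {κ : ℝ} (hκ : 0 < κ)
    (h : (∫⁻ t in Set.Ioi (0 : ℝ), B.toFun (κ * Real.log (1 + 1 / t))) < ⊤) {C : ℝ}
    (hC : 0 ≤ C) : ∫⁻ x : ℝ, B.toFun (C / (1 + |x|)) < ⊤ := by
  set φ : ℝ → ENNReal := fun t => B.toFun (κ / (1 + |t|)) with hφ
  have hφm : Measurable φ := B.measurable_comp (by fun_prop) fun t => by positivity
  have hφt : ∫⁻ t, φ t < ⊤ := by
    rw [lintegral_eq_of_even hφm fun x => by simp only [hφ, abs_neg]]
    refine ENNReal.mul_lt_top (by norm_num) (lt_of_le_of_lt ?_ h)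
    refine setLIntegral_mono' measurableSet_Ioi fun t (ht : 0 < t) => B.mono (by positivity) ?_
    rw [div_eq_mul_inv, abs_of_pos ht]
    refine mul_le_mul_of_nonneg_left ?_ hκ.le
    have := Real.one_sub_inv_le_log_of_pos (show 0 < 1 + 1 / t by positivity)
    refine le_trans (le_of_eq ?_) this
    field_simp
    ring
  set l := 2 * (C / κ + 1) with hl
  have hl0 : 0 < l := by positivity
  have hCl : 2 * C ≤ κ * l := by rw [hl]; field_simp; linarith
  have hlt : ∫⁻ t, φ (l⁻¹ * t) < ⊤ := by
    rw [lintegral_comp_inv_mul hl0 hφm]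
    exact ENNReal.mul_lt_top ENNReal.ofReal_lt_top hφt
  have hψm : Measurable ((Icc (-l) l).indicator fun _ => B.toFun C) :=
    measurable_const.indicator measurableSet_Icc
  calc ∫⁻ x : ℝ, B.toFun (C / (1 + |x|))
      ≤ ∫⁻ x, ((Icc (-l) l).indicator (fun _ => B.toFun C) x + φ (l⁻¹ * x)) := by
        refine lintegral_mono fun x => ?_
        by_cases hx : x ∈ Icc (-l) l
        · rw [indicator_of_mem hx]
          refine le_add_right (B.mono (by positivity) (div_le_self hC ?_))
          linarith [abs_nonneg x]
        · refine le_add_left (B.mono (by positivity) ?_)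
          have hx' : l < |x| := by
            by_contra h'
            exact hx (abs_le.1 (not_lt.1 h'))
          rw [abs_mul, abs_of_pos (inv_pos.2 hl0), div_le_div_iff₀ (by positivity) (by positivity)]
          have : l⁻¹ * |x| * l = |x| := by field_simp
          have h3 : C * (1 + l⁻¹ * |x|) * l ≤ κ * (1 + |x|) * l := by nlinarith
          exact le_of_mul_le_mul_right h3 hl0
    _ = (∫⁻ x, (Icc (-l) l).indicator (fun _ => B.toFun C) x) + ∫⁻ x, φ (l⁻¹ * x) :=
        lintegral_add_left hψm _
    _ < ⊤ := by
        rw [lintegral_indicator_const measurableSet_Icc]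
        exact ENNReal.add_lt_top.2 ⟨ENNReal.mul_lt_top (hB _ hC) (by simp), hlt⟩

end YoungFunction

theorem tendsto_modular_truncOp_of_smooth {B : YoungFunction} (hB : ∀ t, 0 ≤ t → B.toFun t < ⊤)
    {κ : ℝ} (hκ : 0 < κ)
    (hlogB : (∫⁻ t in Set.Ioi (0 : ℝ), B.toFun (κ * Real.log (1 + 1 / t))) < ⊤)
    {k : ℕ → ℝ → ℝ → ℝ} {T l : ℕ → ℝ} {c : ℕ → ℝ → ℝ} {ε : ℕ → ℝ}
    (hk : KernelAsymp k T l c ε) (hkc : ∀ n, Continuous fun p : ℝ × ℝ => k n p.1 p.2)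
    (hT : Tendsto T atTop atTop) {g : ℝ → ℝ} (hg : ContDiff ℝ ∞ g) (hgc : HasCompactSupport g)
    {C : ℝ} (hC : 0 ≤ C) :
    Tendsto (fun n => ∫⁻ x, B.toFun (C * |truncOp (k n) (T n) g x - g x|)) atTop (nhds 0) := by
  have hi : Integrable g := hg.continuous.integrable_of_hasCompactSupport hgc
  have hgm : Measurable g := hg.continuous.measurable
  obtain ⟨D, hD0, hD⟩ := exists_abs_dirichlet_integral_le hg hgc
  obtain ⟨R, hR⟩ := hgc.isCompact.isBounded.subset_closedBall 0
  have hgR : ∀ y, R < |y| → g y = 0 := fun y hy => by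
    by_contra h
    have := hR (subset_tsupport g h)
    rw [Metric.mem_closedBall, dist_zero_right, Real.norm_eq_abs] at this
    linarith
  obtain ⟨M, hM⟩ := hgc.exists_bound_of_continuous hg.continuous
  have hM0 : 0 ≤ M := (norm_nonneg _).trans (hM 0)
  have hgM : ∀ x, |g x| ≤ M * (1 + |R|) / (1 + |x|) := fun x => by
    rw [le_div_iff₀ (by positivity)]
    rcases le_or_gt |x| R with hx | hx
    · exact mul_le_mul (hM x) (by linarith [le_abs_self R]) (by positivity) hM0
    · rw [hgR x hx, abs_zero, zero_mul]; positivity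
  set N := ∫ y, |g y| with hN
  have hN0 : 0 ≤ N := integral_nonneg fun _ => abs_nonneg _
  set E := 2 * D + N + M * (1 + |R|) with hE
  have hE0 : 0 ≤ E := by positivity
  have hεlim : Tendsto ε atTop (nhds 0) := by
    refine squeeze_zero' hk.err_nonneg ?_ hk.err_tendsto
    filter_upwards [hk.err_nonneg, hT.eventually_ge_atTop 1] with n h1 h2
    exact le_mul_of_one_le_left h1 h2
  have hεT : ∀ᶠ n in atTop, ε n * (1 + T n) ≤ 1 := by
    have : Tendsto (fun n => ε n * (1 + T n)) atTop (nhds 0) := by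
      have := hεlim.add hk.err_tendsto
      rw [add_zero] at this
      exact this.congr fun n => by ring
    exact this.eventually_le_const one_pos
  have hkey : ∀ᶠ n in atTop, ∀ x, |x| < T n → |truncOp (k n) (T n) g x -
      c n x * ∫ y, g y * (l n / Real.pi * Real.sinc (l n * (x - y)))| ≤ ε n * N := by
    filter_upwards [hk.approx, hT.eventually_gt_atTop R, hk.err_nonneg] with n happ hRT hε x hx
    have := abs_truncOp_sub_le (hkc n) (hk.freq_pos n) happ (hi.integrableOn) hx
    have e : (Ioo (-T n) (T n)).indicator g = g := by
      refine indicator_eq_self.2 fun y hy => abs_lt.1 ?_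
      by_contra h
      exact hy (hgR y (by linarith))
    rw [e] at this
    refine this.trans (mul_le_mul_of_nonneg_left ?_ hε)
    exact setIntegral_le_integral hi.abs (ae_of_all _ fun _ => abs_nonneg _)
  have hbound : ∀ᶠ n in atTop, ∀ x, |truncOp (k n) (T n) g x - g x| ≤ E / (1 + |x|) := by
    filter_upwards [hkey, hεT, hk.amp_le, hk.err_nonneg] with n h1 h2 h3 h4 x
    have hx0 : 0 < 1 + |x| := by positivity
    have hEx : E / (1 + |x|) =
        2 * (D / (1 + |x|)) + N / (1 + |x|) + M * (1 + |R|) / (1 + |x|) := by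
      rw [hE]; ring
    rw [hEx]
    rcases lt_or_ge |x| (T n) with hx | hx
    · have a1 := h1 x hx
      have a2 : |c n x * ∫ y, g y * (l n / Real.pi * Real.sinc (l n * (x - y)))| ≤
          2 * (D / (1 + |x|)) := by
        rw [abs_mul]
        exact mul_le_mul (h3 x hx) (hD _ (hk.freq_pos n) x) (abs_nonneg _) (by norm_num)
      have a3 : ε n * N ≤ N / (1 + |x|) := by
        rw [le_div_iff₀ hx0]
        nlinarith [mul_le_mul_of_nonneg_left hx.le h4]
      have a4 := hgM x
      rw [abs_le] at a1 a2 a4 ⊢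
      constructor <;> linarith
    · have : truncOp (k n) (T n) g x = 0 :=
        indicator_of_notMem (s := Ioo (-T n) (T n)) (fun h => by
          have := abs_lt.2 h; linarith) _
      rw [this, zero_sub, abs_neg]
      have : 0 ≤ 2 * (D / (1 + |x|)) + N / (1 + |x|) := by positivity
      linarith [hgM x]
  have hpt : ∀ x, Tendsto (fun n => truncOp (k n) (T n) g x) atTop (nhds (g x)) := fun x => by
    have t1 := (hk.amp_tendsto x).mul
      (tendsto_dirichlet_integral hg hgc hk.freq_pos hk.freq_tendsto x)
    rw [one_mul] at t1
    have t2 : Tendsto (fun n => truncOp (k n) (T n) g x -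
      c n x * ∫ y, g y * (l n / Real.pi * Real.sinc (l n * (x - y)))) atTop (nhds 0) := by
      refine squeeze_zero_norm' (a := fun n => ε n * N) ?_ (by simpa using hεlim.mul_const N)
      filter_upwards [hkey, hT.eventually_gt_atTop |x|] with n h1 h2 using h1 x h2
    have := t2.add t1
    simpa using this
  have := tendsto_lintegral_filter_of_dominated_convergence (μ := volume) (l := atTop)
    (F := fun n x => B.toFun (C * |truncOp (k n) (T n) g x - g x|)) (f := fun _ => 0)
    (fun x => B.toFun (C * E / (1 + |x|)))
    (Eventually.of_forall fun n => YoungFunction.measurable_comp_sub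
      (measurable_truncOp (hkc n) hgm) hgm hC)
    (hbound.mono fun n hn => ae_of_all _ fun x => B.mono (by positivity) (by
      rw [mul_div_assoc]; exact mul_le_mul_of_nonneg_left (hn x) hC))
    (B.lintegral_div_one_add_abs_lt_top hB hκ hlogB (by positivity)).ne
    (ae_of_all _ fun x => B.tendsto_zero hB (by
      simpa using ((hpt x).sub_const (g x)).abs.const_mul C) fun n => by positivity)
  simpa using this

section Bound
variable {A B : YoungFunction} {K K' : ℝ}

/-- Sufficiency: modular convergence of the truncated operators on `E^A`. -/
theorem tendsto_modular_truncOp (hAB : HardyPair A B K) (hKK' : 96 * K ≤ K')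
    (hBA : ∀ t : ℝ, 0 ≤ t → B.toFun t ≤ A.toFun (K' * t)) {κ : ℝ} (hκ : 0 < κ)
    (hlogB : (∫⁻ t in Set.Ioi (0 : ℝ), B.toFun (κ * Real.log (1 + 1 / t))) < ⊤)
    {k : ℕ → ℝ → ℝ → ℝ} {T l : ℕ → ℝ} {c : ℕ → ℝ → ℝ} {ε : ℕ → ℝ}
    (hk : KernelAsymp k T l c ε) (hkc : ∀ n, Continuous fun p : ℝ × ℝ => k n p.1 p.2)
    (hTpos : ∀ n, 0 < T n) (hT : Tendsto T atTop atTop) {f : ℝ → ℝ} (hf : Measurable f)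
    (hfA : ∀ c' : ℝ, 0 < c' → (∫⁻ x : ℝ, A.toFun (c' * |f x|)) < ⊤) :
    Tendsto (fun n => ∫⁻ x, B.toFun |truncOp (k n) (T n) f x - f x|) atTop (nhds 0) := by
  have hK0 : 0 < K' := by linarith [hAB.one_le]
  have hA := hAB.left_lt_top
  set M := 2 * 40001 * (2 * K') with hM
  have hM0 : 0 < M := by positivity
  set C := 4 * M * K' with hC
  have hC0 : 0 < C := by positivity
  have hloc : LocallyIntegrable f := A.locallyIntegrable hf (by simpa using hfA 1 one_pos)
  refine ENNReal.tendsto_nhds_zero.2 fun δ hδ => ?_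
  have hδ3 : 0 < δ / 3 := ENNReal.div_pos hδ.ne' (by norm_num)
  obtain ⟨g, hg, hgc, hfg⟩ := exists_smooth_approx hA hf hC0.le (hfA _ (by positivity)) hδ3
  have hgm : Measurable g := hg.continuous.measurable
  have hgi : Integrable g := hg.continuous.integrable_of_hasCompactSupport hgc
  have hsub : LocallyIntegrable fun x => f x - g x := hloc.sub hgi.locallyIntegrable
  filter_upwards [eventually_modular_truncOp_le hAB hKK' hBA hk hkc hTpos,
    (ENNReal.tendsto_nhds_zero.1 (tendsto_modular_truncOp_of_smooth hAB.right_lt_top hκ hlogB hk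
      hkc hT hg hgc (show (0:ℝ) ≤ 4 by norm_num))) _ hδ3] with n h1 h2
  have hio : ∀ {h : ℝ → ℝ}, LocallyIntegrable h → IntegrableOn h (Ioo (-T n) (T n)) :=
    fun hh => ((locallyIntegrable_iff.1 hh) _ (isCompact_Icc (a := -T n) (b := T n))).mono_set
      Ioo_subset_Icc_self
  set w : ℝ → ℝ := fun x => f x - g x with hw
  have hwm : Measurable w := hf.sub hgm
  have e1 : ∀ x, truncOp (k n) (T n) f x =
      truncOp (k n) (T n) w x + truncOp (k n) (T n) g x := fun x => by
    rw [← truncOp_add (hkc n) (hio hsub) (hio hgi.locallyIntegrable)]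
    congr 1
    funext y
    simp only [hw, sub_add_cancel]
  have h3 := h1 (fun x => 4 * M * w x) (hwm.const_mul _) (hsub.smul (4 * M))
  have b1 : ∫⁻ x, B.toFun (4 * |truncOp (k n) (T n) w x|) ≤ δ / 3 := by
    calc ∫⁻ x, B.toFun (4 * |truncOp (k n) (T n) w x|)
        = ∫⁻ x, B.toFun (|truncOp (k n) (T n) (fun x => 4 * M * w x) x| / M) := by
          refine lintegral_congr fun x => ?_
          rw [truncOp_const_mul, abs_mul, abs_of_pos (show 0 < 4 * M by positivity)]
          congr 1
          field_simp
      _ ≤ ∫⁻ t, A.toFun (K' * |4 * M * w t|) := h3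
      _ = ∫⁻ t, A.toFun (C * |f t - g t|) := by
          refine lintegral_congr fun x => ?_
          rw [abs_mul, abs_of_pos (show 0 < 4 * M by positivity), ← mul_assoc, hC, mul_comm K']
      _ ≤ _ := hfg
  have b3 : ∫⁻ x, B.toFun (4 * |w x|) ≤ δ / 3 := by
    refine le_trans (lintegral_mono fun x => ?_) hfg
    refine (hBA _ (by positivity)).trans (A.mono (by positivity) ?_)
    rw [← mul_assoc]
    refine mul_le_mul_of_nonneg_right ?_ (abs_nonneg _)
    rw [hC]
    nlinarith [hAB.one_le]
  have hwS : Measurable (truncOp (k n) (T n) w) := measurable_truncOp (hkc n) hwm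
  have hgS : Measurable (truncOp (k n) (T n) g) := measurable_truncOp (hkc n) hgm
  calc ∫⁻ x, B.toFun |truncOp (k n) (T n) f x - f x|
      ≤ ∫⁻ x, (B.toFun (4 * |truncOp (k n) (T n) w x|) +
          (B.toFun (4 * |truncOp (k n) (T n) g x - g x|) + B.toFun (4 * |w x|))) := by
        refine lintegral_mono fun x => ?_
        have h4 : |truncOp (k n) (T n) f x - f x| ≤ |truncOp (k n) (T n) w x| +
            (|truncOp (k n) (T n) g x - g x| + |w x|) := by
          have : truncOp (k n) (T n) f x - f x = truncOp (k n) (T n) w x +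
            ((truncOp (k n) (T n) g x - g x) - w x) := by rw [e1]; simp only [hw]; ring
          rw [this]
          exact (abs_add_le _ _).trans (add_le_add le_rfl (abs_sub _ _))
        refine (B.mono (abs_nonneg _) h4).trans
          ((B.add_le (abs_nonneg _) (by positivity)).trans (add_le_add
            (B.mono (by positivity) (by linarith [abs_nonneg (truncOp (k n) (T n) w x)])) ?_))
        rw [mul_add]
        refine (B.add_le (by positivity) (by positivity)).trans_eq ?_
        rw [← mul_assoc, ← mul_assoc]
        norm_num
    _ ≤ δ / 3 + (δ / 3 + δ / 3) := by
        rw [lintegral_add_left (B.comp_mul_abs_measurable hwS (by norm_num)),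
          lintegral_add_left (YoungFunction.measurable_comp_sub hgS hgm (by norm_num))]
        exact add_le_add b1 (add_le_add h2 b3)
    _ = δ := by rw [← add_assoc]; exact ENNReal.add_thirds δ

end Bound

end

theorem lintegral_Ioo_div_sq (φ : ℝ → ENNReal) {t : ℝ} (ht : 0 < t) :
    ∫⁻ s in Ioo 0 t, φ s / ENNReal.ofReal (s ^ 2) =
      (∫⁻ x in Ioi 1, φ (t / x)) / ENNReal.ofReal t := by
  have him : (fun x : ℝ => t / x) '' Ioi 1 = Ioo 0 t := by
    ext s
    constructor
    · rintro ⟨x, hx, rfl⟩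
      have hx : 1 < x := hx
      exact ⟨by positivity, div_lt_self ht hx⟩
    · rintro ⟨h0, h1⟩
      exact ⟨t / s, (one_lt_div h0).2 h1, by field_simp⟩
  have hd : ∀ x ∈ Ioi (1 : ℝ), HasDerivWithinAt (fun x : ℝ => t / x) (-t / x ^ 2) (Ioi 1) x :=
    fun x hx => by
      have hx0 : x ≠ 0 := (zero_lt_one.trans (show 1 < x from hx)).ne'
      have := ((hasDerivAt_inv hx0).const_mul t).hasDerivWithinAt (s := Ioi 1)
      simp only [div_eq_mul_inv]
      refine this.congr_deriv ?_
      ring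
  have hinj : InjOn (fun x : ℝ => t / x) (Ioi 1) := fun x hx y hy h => by
    have hx0 : x ≠ 0 := (zero_lt_one.trans (show 1 < x from hx)).ne'
    have hy0 : y ≠ 0 := (zero_lt_one.trans (show 1 < y from hy)).ne'
    have h : t / x = t / y := h
    field_simp at h
    exact h.symm
  rw [← him, lintegral_image_eq_lintegral_abs_deriv_mul measurableSet_Ioi hd hinj,
    div_eq_mul_inv, ← lintegral_mul_const' _ _ (by simpa using ht)]
  refine setLIntegral_congr_fun measurableSet_Ioi fun x hx => ?_
  have hx0 : 0 < x := zero_lt_one.trans (show 1 < x from hx)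
  have h1 : |(-t / x ^ 2)| = t / x ^ 2 := by
    rw [abs_div, abs_neg, abs_of_pos ht, abs_of_pos (by positivity)]
  simp only [h1]
  rw [div_eq_mul_inv (φ _), mul_left_comm, ← ENNReal.ofReal_inv_of_pos (by positivity),
    ← ENNReal.ofReal_mul (by positivity), ← ENNReal.ofReal_inv_of_pos ht]
  congr 2
  field_simp

namespace YoungFunction

/-- The conjugate is the increasing limit of values at measurably chosen points. -/
theorem exists_conj_selection (A : YoungFunction) (hA : ∀ t, 0 ≤ t → A.toFun t < ⊤) :
    ∃ τ : ℕ → ℝ → ℝ, (∀ n, Measurable (τ n)) ∧ (∀ n s, 0 ≤ τ n s) ∧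
      (∀ n, ∃ M, ∀ s, τ n s ≤ M) ∧
      (∀ n s, A.toFun (τ n s) ≤ ENNReal.ofReal (τ n s * s)) ∧
      (∀ s, Monotone fun n => ENNReal.ofReal (τ n s * s) - A.toFun (τ n s)) ∧
      ∀ s, A.conj s ≤ ⨆ n, (ENNReal.ofReal (τ n s * s) - A.toFun (τ n s)) := by
  obtain ⟨e, he⟩ := exists_surjective_nat ℚ
  set q : ℕ → ℝ := fun n => |(e n : ℝ)| with hq
  set v : ℝ → ℝ → ENNReal := fun r s => ENNReal.ofReal (r * s) - A.toFun r with hv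
  let τ : ℕ → ℝ → ℝ := fun n => Nat.rec (fun _ => 0)
    (fun n τ s => if v (τ s) s < v (q n) s then q n else τ s) n
  have hτ0 : ∀ s, τ 0 s = 0 := fun _ => rfl
  have hτs : ∀ n s, τ (n + 1) s = if v (τ n s) s < v (q n) s then q n else τ n s :=
    fun _ _ => rfl
  have hpos : ∀ n s, 0 ≤ τ n s := by
    intro n s
    induction n with
    | zero => exact (hτ0 s).ge
    | succ n ih => rw [hτs]; split_ifs <;> [exact abs_nonneg _; exact ih]
  have hvm : ∀ {r : ℝ → ℝ}, Measurable r → (∀ s, 0 ≤ r s) → Measurable fun s => v (r s) s :=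
    fun hr h0 => (hr.mul measurable_id).ennreal_ofReal.sub (A.measurable_comp hr h0)
  have hmeas : ∀ n, Measurable (τ n) := by
    intro n
    induction n with
    | zero => exact measurable_const
    | succ n ih =>
      have : τ (n + 1) = fun s => if v (τ n s) s < v (q n) s then q n else τ n s :=
        funext (hτs n)
      rw [this]
      exact Measurable.ite (measurableSet_lt (hvm ih (hpos n))
        (hvm measurable_const fun _ => abs_nonneg _)) measurable_const ih
  have hstep : ∀ n s, max (v (τ n s) s) (v (q n) s) ≤ v (τ (n + 1) s) s := by
    intro n s
    rw [hτs]
    split_ifs with h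
    · exact max_le h.le le_rfl
    · exact max_le le_rfl (not_lt.1 h)
  refine ⟨τ, hmeas, hpos, ?_, ?_, fun s => monotone_nat_of_le_succ fun n =>
    (le_max_left _ _).trans (hstep n s), fun s => ?_⟩
  · intro n
    induction n with
    | zero => exact ⟨0, fun s => (hτ0 s).le⟩
    | succ n ih =>
      obtain ⟨M, hM⟩ := ih
      refine ⟨max (q n) M, fun s => ?_⟩
      rw [hτs]
      split_ifs
      · exact le_max_left _ _
      · exact (hM s).trans (le_max_right _ _)
  · intro n s
    induction n with
    | zero => rw [hτ0, A.zero']; exact zero_le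
    | succ n ih =>
      rw [hτs]
      split_ifs with h
      · have : 0 < v (q n) s := lt_of_le_of_lt zero_le h
        exact (tsub_pos_iff_lt.1 this).le
      · exact ih
  · refine iSup_le fun r => le_of_forall_lt fun D hD => ?_
    have hcont : Tendsto (fun r' : ℝ => ENNReal.ofReal (r' * s) - A.toFun r.1)
        (nhdsWithin r.1 (Iio r.1)) (nhds (ENNReal.ofReal (r.1 * s) - A.toFun r.1)) := by
      refine ENNReal.Tendsto.sub ?_ tendsto_const_nhds (Or.inr (hA _ r.2).ne)
      exact (ENNReal.continuous_ofReal.comp (by fun_prop : Continuous fun r' : ℝ => r' * s)).tendsto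
        _ |>.mono_left nhdsWithin_le_nhds
    have hr0 : 0 < r.1 := lt_of_le_of_ne r.2 fun h => by
      rw [← h] at hD
      simp at hD
    obtain ⟨a, ha, hab⟩ := (mem_nhdsLT_iff_exists_Ioo_subset' hr0).1
      ((tendsto_order.1 hcont).1 D hD)
    obtain ⟨p, hp1, hp2⟩ := exists_rat_btwn (max_lt ha hr0)
    obtain ⟨n, rfl⟩ := he p
    have hp0 : (0 : ℝ) ≤ e n := (le_max_right _ _).trans hp1.le
    have h1 : D < v (q n) s := by
      refine lt_of_lt_of_le (hab ⟨(le_max_left _ _).trans_lt hp1, hp2⟩) ?_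
      simp only [hv, hq, abs_of_nonneg hp0]
      exact tsub_le_tsub_left (A.mono hp0 hp2.le) _
    exact h1.trans_le (((le_max_right _ _).trans (hstep n s)).trans
      (le_iSup (fun n => v (τ n s) s) (n + 1)))

/-- A nearly optimal test function for the integral of the conjugate. -/
theorem exists_test_of_lt_lintegral_conj (A : YoungFunction) (hA : ∀ t, 0 ≤ t → A.toFun t < ⊤)
    {t : ℝ} (ht : 0 ≤ t) {D : ENNReal} (hD : D < ∫⁻ x in Ioi 1, A.conj (t / x)) :
    ∃ f : ℝ → ℝ, IsTest f ∧ (∀ x, 0 ≤ f x) ∧ (∀ x, f x ≠ 0 → 1 < x) ∧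
      D + ∫⁻ x, A.toFun (f x) < ENNReal.ofReal (∫ x, f x * (t / x)) := by
  obtain ⟨τ, hm, h0, hb, hle, hmono, hsup⟩ := A.exists_conj_selection hA
  have hdm : Measurable fun x : ℝ => t / x := measurable_const.div measurable_id
  set f : ℕ → ℝ → ℝ := fun n => (Ioo 1 ((n : ℝ) + 1)).indicator fun x => τ n (t / x) with hf
  have hfm : ∀ n, Measurable (f n) := fun n => ((hm n).comp hdm).indicator measurableSet_Ioo
  have hf0 : ∀ n x, 0 ≤ f n x := fun n x => indicator_nonneg (fun x _ => h0 _ _) _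
  have hf1 : ∀ n x, f n x ≠ 0 → x ∈ Ioo 1 ((n : ℝ) + 1) := fun n x hx => by
    by_contra h
    exact hx (indicator_of_notMem (s := Ioo 1 ((n : ℝ) + 1)) h _)
  set w : ℕ → ℝ → ENNReal := fun n x => ENNReal.ofReal (f n x * (t / x)) - A.toFun (f n x)
    with hw
  have hwm : ∀ n, Measurable (w n) := fun n =>
    ((hfm n).mul hdm).ennreal_ofReal.sub (A.measurable_comp (hfm n) (hf0 n))
  have hwmono : Monotone w := by
    intro m n hmn x
    by_cases hx : x ∈ Ioo 1 ((m : ℝ) + 1)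
    · have hmn' : (m : ℝ) ≤ n := by exact_mod_cast hmn
      have hx' : x ∈ Ioo 1 ((n : ℝ) + 1) := ⟨hx.1, hx.2.trans_le (by linarith)⟩
      simp only [hw, hf, indicator_of_mem hx, indicator_of_mem hx']
      exact hmono _ hmn
    · simp only [hw, hf, indicator_of_notMem hx]
      simp
  have hI : ∫⁻ x in Ioi 1, A.conj (t / x) ≤ ⨆ n, ∫⁻ x, w n x := by
    rw [← lintegral_iSup hwm hwmono, ← lintegral_indicator measurableSet_Ioi]
    refine lintegral_mono (indicator_le' (fun x hx => ?_) fun _ _ => zero_le)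
    refine (hsup _).trans (iSup_le fun n => ?_)
    obtain ⟨N, hN⟩ := exists_nat_gt x
    have hmax : x ∈ Ioo 1 (((max n N : ℕ) : ℝ) + 1) := by
      refine ⟨hx, hN.trans_le ?_⟩
      push_cast
      linarith [le_max_right (n : ℝ) N]
    refine (hmono _ (le_max_left n N)).trans (le_trans (le_of_eq ?_)
      (le_iSup (fun n => w n x) (max n N)))
    simp only [hw, hf, indicator_of_mem hmax]
  obtain ⟨n, hn⟩ := lt_iSup_iff.1 (hD.trans_le hI)
  obtain ⟨M, hM⟩ := hb n
  have hfM : ∀ x, f n x ≤ max M 0 := fun x =>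
    indicator_le' (fun x _ => (hM _).trans (le_max_left _ _)) (fun _ _ => le_max_right _ _) x
  have hT : IsTest (f n) := ⟨hfm n, ⟨max M 0, fun x => (abs_of_nonneg (hf0 n x)).trans_le (hfM x)⟩,
    n + 1, fun x hx => by
      by_contra h
      have := hf1 n x h
      rw [abs_of_pos (by linarith [this.1])] at hx
      exact lt_asymm hx this.2⟩
  have hInt : Integrable fun x => f n x * (t / x) := by
    have : (fun x => f n x * (t / x)) = fun x => f n x * (Ioi 1).indicator (fun x => t / x) x := by
      funext x
      by_cases hx : f n x = 0
      · simp [hx]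
      · rw [indicator_of_mem (show x ∈ Ioi 1 from (hf1 n x hx).1)]
    rw [this]
    refine (hT.mul_bdd (C := |t|) (hdm.indicator measurableSet_Ioi) fun x => ?_).integrable
    by_cases hx : x ∈ Ioi (1 : ℝ)
    · have hx' : 1 < x := hx
      rw [indicator_of_mem hx, abs_div]
      exact div_le_self (abs_nonneg _) (hx'.le.trans (le_abs_self _))
    · rw [indicator_of_notMem hx]; simp
  have hle' : ∀ x, A.toFun (f n x) ≤ ENNReal.ofReal (f n x * (t / x)) := fun x => by
    by_cases hx : x ∈ Ioo 1 ((n : ℝ) + 1)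
    · simp only [hf, indicator_of_mem hx]; exact hle _ _
    · simp only [hf, indicator_of_notMem hx, A.zero']; exact zero_le
  have hAint : ∫⁻ x, A.toFun (f n x) ≠ ⊤ := by
    refine ((lintegral_mono hle').trans_lt ?_).ne
    exact hInt.lintegral_lt_top
  refine ⟨f n, hT, hf0 n, fun x hx => (hf1 n x hx).1, ?_⟩
  have hnn : 0 ≤ᵐ[volume] fun x => f n x * (t / x) := ae_of_all _ fun x => by
    by_cases hx : f n x = 0
    · simp [hx]
    · have := (hf1 n x hx).1
      have := hf0 n x
      show 0 ≤ f n x * (t / x)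
      positivity
  rw [ofReal_integral_eq_lintegral_ofReal hInt hnn]
  calc D + ∫⁻ x, A.toFun (f n x) < (∫⁻ x, w n x) + ∫⁻ x, A.toFun (f n x) :=
        (ENNReal.add_lt_add_iff_right hAint).2 hn
    _ = ∫⁻ x, (w n x + A.toFun (f n x)) := (lintegral_add_left (hwm n) _).symm
    _ = _ := lintegral_congr fun x => tsub_add_cancel_of_le (hle' x)

end YoungFunction

/-- The Cauchy integral `∫ f(y) / (x - y) dy`. -/
noncomputable def cauchyInt (f : ℝ → ℝ) (x : ℝ) : ℝ := ∫ y, f y / (x - y)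

/-- A test function together with a bounded measurable set at positive distance from its
support. -/
structure SeparatedPair (f : ℝ → ℝ) (E : Set ℝ) : Prop where
  isTest : IsTest f
  meas : MeasurableSet E
  bdd : ∃ R, ∀ x ∈ E, |x| ≤ R
  sep : ∃ d, 0 < d ∧ ∀ x ∈ E, ∀ y, f y ≠ 0 → d ≤ |x - y|

theorem measurable_cauchyInt {f : ℝ → ℝ} (hf : Measurable f) : Measurable (cauchyInt f) := by
  have : StronglyMeasurable fun p : ℝ × ℝ => f p.2 / (p.1 - p.2) :=
    ((hf.comp measurable_snd).div (measurable_fst.sub measurable_snd)).stronglyMeasurable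
  exact this.integral_prod_right.measurable

theorem IsTest.lintegral_lt_top {f : ℝ → ℝ} (hf : IsTest f) {A : YoungFunction}
    (hA : ∀ t, 0 ≤ t → A.toFun t < ⊤) {C : ℝ} (hC : 0 ≤ C) :
    ∫⁻ x, A.toFun (C * |f x|) < ⊤ := by
  obtain ⟨M, hM⟩ := hf.bdd
  obtain ⟨R, hR⟩ := hf.supp
  have hM0 : 0 ≤ M := (abs_nonneg _).trans (hM 0)
  calc ∫⁻ x, A.toFun (C * |f x|) ≤ ∫⁻ x, (Icc (-R) R).indicator (fun _ => A.toFun (C * M)) x := by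
        refine lintegral_mono fun x => ?_
        by_cases hx : x ∈ Icc (-R) R
        · rw [indicator_of_mem hx]
          exact A.mono (by positivity) (mul_le_mul_of_nonneg_left (hM x) hC)
        · rw [indicator_of_notMem hx, hR x (by
            by_contra h
            exact hx (abs_le.1 (not_lt.1 h)))]
          simp [A.zero']
    _ < ⊤ := by
        rw [lintegral_indicator_const measurableSet_Icc]
        exact ENNReal.mul_lt_top (hA _ (by positivity)) (by simp)

namespace SeparatedPair
variable {f : ℝ → ℝ} {E : Set ℝ}

theorem eq_zero (h : SeparatedPair f E) {x : ℝ} (hx : x ∈ E) : f x = 0 := by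
  obtain ⟨d, hd, hs⟩ := h.sep
  by_contra h0
  have := hs x hx x h0
  simp at this
  linarith

theorem exists_div_bound (h : SeparatedPair f E) :
    ∃ C, 0 ≤ C ∧ ∀ x ∈ E, ∀ y, |f y / (x - y)| ≤ C := by
  obtain ⟨d, hd, hs⟩ := h.sep
  obtain ⟨M, hM⟩ := h.isTest.bdd
  have hM0 : 0 ≤ M := (abs_nonneg _).trans (hM 0)
  refine ⟨M / d, by positivity, fun x hx y => ?_⟩
  by_cases h0 : f y = 0
  · simp only [h0, zero_div, abs_zero]; positivity
  · rw [abs_div]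
    exact div_le_div₀ hM0 (hM y) hd (hs x hx y h0)

theorem isTest_div (h : SeparatedPair f E) {x : ℝ} (hx : x ∈ E) :
    IsTest fun y => f y / (x - y) := by
  obtain ⟨C, hC0, hC⟩ := h.exists_div_bound
  obtain ⟨R, hR⟩ := h.isTest.supp
  exact ⟨h.isTest.meas.div (measurable_const.sub measurable_id), ⟨C, hC x hx⟩, R,
    fun t ht => by simp [hR t ht]⟩

theorem lintegral_cauchyInt_lt_top (h : SeparatedPair f E) {B : YoungFunction}
    (hB : ∀ t, 0 ≤ t → B.toFun t < ⊤) {C : ℝ} (hC : 0 ≤ C) :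
    ∫⁻ x in E, B.toFun (C * |cauchyInt f x|) < ⊤ := by
  obtain ⟨D, hD0, hD⟩ := h.exists_div_bound
  obtain ⟨R, hR⟩ := h.isTest.supp
  obtain ⟨R', hR'⟩ := h.bdd
  have hb : ∀ x ∈ E, |cauchyInt f x| ≤ D * (2 * max R 0) := by
    intro x hx
    have e : cauchyInt f x = ∫ y in Icc (-(max R 0)) (max R 0), f y / (x - y) := by
      refine (setIntegral_eq_integral_of_forall_compl_eq_zero fun y hy => ?_).symm
      rw [hR y ?_, zero_div]
      by_contra h'
      exact hy (abs_le.1 ((not_lt.1 h').trans (le_max_left _ _)))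
    rw [e]
    refine (norm_setIntegral_le_of_norm_le_const (f := fun y => f y / (x - y)) (C := D)
      measure_Icc_lt_top fun y _ => hD x hx y).trans
      (le_of_eq ?_)
    rw [Real.volume_real_Icc_of_le (by linarith [le_max_right R 0])]
    ring
  calc ∫⁻ x in E, B.toFun (C * |cauchyInt f x|)
      ≤ ∫⁻ x in E, B.toFun (C * (D * (2 * max R 0))) :=
        setLIntegral_mono' h.meas fun x hx => B.mono (by positivity)
          (mul_le_mul_of_nonneg_left (hb x hx) hC)
    _ < ⊤ := by
        rw [lintegral_const, Measure.restrict_apply_univ]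
        refine ENNReal.mul_lt_top (hB _ (by positivity)) ?_
        refine (measure_mono (t := Icc (-R') R') fun x hx => abs_le.1 (hR' x hx)).trans_lt ?_
        simp

end SeparatedPair

theorem cauchyInt_comp_affine (f : ℝ → ℝ) {L : ℝ} (hL : 0 < L) (s x : ℝ) :
    cauchyInt (fun y => f (L⁻¹ * (y - s))) x = cauchyInt f (L⁻¹ * (x - s)) := by
  set G : ℝ → ℝ := fun z => f z / (L * (L⁻¹ * (x - s) - z)) with hG
  have e1 : cauchyInt (fun y => f (L⁻¹ * (y - s))) x = ∫ y, G (L⁻¹ * (y - s)) := by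
    refine integral_congr_ae (ae_of_all _ fun y => ?_)
    simp only [hG]
    congr 1
    field_simp
    ring
  rw [e1, integral_sub_right_eq_self (fun y => G (L⁻¹ * y)) s,
    Measure.integral_comp_inv_mul_left, abs_of_pos hL, smul_eq_mul, ← integral_const_mul]
  refine integral_congr_ae (ae_of_all _ fun y => ?_)
  simp only [hG]
  field_simp

theorem lintegral_comp_affine {L : ℝ} (hL : 0 < L) (s : ℝ) {φ : ℝ → ENNReal}
    (hφ : Measurable φ) : ∫⁻ x, φ (L⁻¹ * (x - s)) = ENNReal.ofReal L * ∫⁻ x, φ x := by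
  rw [lintegral_sub_right_eq_self (fun x => φ (L⁻¹ * x)) s, lintegral_comp_inv_mul hL hφ]

/-- A separated pair violating a modular inequality can be rescaled and moved far away. -/
theorem SeparatedPair.exists_normalized {A B : YoungFunction}
    (hB : ∀ t, 0 ≤ t → B.toFun t < ⊤) {f : ℝ → ℝ} {E : Set ℝ} (h : SeparatedPair f E)
    {C : ℝ} (hC : 0 ≤ C)
    (hlt : ∫⁻ x, A.toFun |f x| < ∫⁻ x in E, B.toFun (C * |cauchyInt f x|)) (R : ℝ) :
    ∃ g F, SeparatedPair g F ∧ ∫⁻ x, A.toFun |g x| ≤ 1 ∧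
      1 ≤ ∫⁻ x in F, B.toFun (C * |cauchyInt g x|) ∧
      (∀ x ∈ F, R < |x|) ∧ ∀ y, g y ≠ 0 → R < |y| := by
  set β := ∫⁻ x in E, B.toFun (C * |cauchyInt f x|) with hβ
  have hβ0 : β ≠ 0 := (bot_le.trans_lt hlt).ne'
  have hβt : β ≠ ⊤ := (h.lintegral_cauchyInt_lt_top hB hC).ne
  set L := (β⁻¹).toReal with hL
  have hLβ : ENNReal.ofReal L = β⁻¹ := ENNReal.ofReal_toReal (ENNReal.inv_ne_top.2 hβ0)
  have hL0 : 0 < L := ENNReal.toReal_pos (ENNReal.inv_ne_zero.2 hβt) (ENNReal.inv_ne_top.2 hβ0)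
  obtain ⟨r, hr⟩ := h.isTest.supp
  obtain ⟨r', hr'⟩ := h.bdd
  obtain ⟨M, hM⟩ := h.isTest.bdd
  obtain ⟨d, hd, hs⟩ := h.sep
  set s := |R| + L * |r| + L * |r'| + 1 with hsdef
  have hp : Measurable fun x : ℝ => L⁻¹ * (x - s) := by fun_prop
  have hback : ∀ x, x = L * (L⁻¹ * (x - s)) + s := fun x => by field_simp; ring
  have hfar : ∀ x ρ : ℝ, |L⁻¹ * (x - s)| ≤ ρ → s - L * |ρ| ≤ x := fun x ρ hx => by
    have h1 := (abs_le.1 (hx.trans (le_abs_self ρ))).1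
    have h2 := mul_le_mul_of_nonneg_left h1 hL0.le
    rw [hback x]
    linarith
  have hq1 : 0 ≤ L * |r| := by positivity
  have hq2 : 0 ≤ L * |r'| := by positivity
  have hfs : ∀ y, f (L⁻¹ * (y - s)) ≠ 0 → |L⁻¹ * (y - s)| ≤ r := fun y hy => by
    by_contra h'
    exact hy (hr _ (not_le.1 h'))
  have hmap : ∀ x ρ : ℝ, |L⁻¹ * (x - s)| ≤ ρ → |x| ≤ L * |ρ| + |s| := fun x ρ hx => by
    rw [hback x]
    refine (abs_add_le _ _).trans (add_le_add ?_ le_rfl)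
    rw [abs_mul, abs_of_pos hL0]
    exact mul_le_mul_of_nonneg_left (hx.trans (le_abs_self ρ)) hL0.le
  refine ⟨fun y => f (L⁻¹ * (y - s)), (fun x => L⁻¹ * (x - s)) ⁻¹' E, ⟨⟨h.isTest.meas.comp hp,
    ⟨M, fun t => hM _⟩, L * |r| + |s|, fun t ht => ?_⟩, hp h.meas,
    ⟨L * |r'| + |s|, fun x hx => hmap x r' (hr' _ hx)⟩, L * d, by positivity,
    fun x hx y hy => ?_⟩, ?_, ?_, fun x hx => ?_, fun y hy => ?_⟩
  · by_contra h'
    exact absurd (hmap t r (hfs t h')) (not_le.2 ht)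
  · have h1 := hs _ hx _ hy
    have h2 : x - y = L * (L⁻¹ * (x - s) - L⁻¹ * (y - s)) := by field_simp; ring
    rw [h2, abs_mul, abs_of_pos hL0]
    exact mul_le_mul_of_nonneg_left h1 hL0.le
  · rw [lintegral_comp_affine hL0 s (A.measurable_comp_abs h.isTest.meas), hLβ]
    calc _ ≤ β⁻¹ * β := by gcongr
      _ = 1 := ENNReal.inv_mul_cancel hβ0 hβt
  · refine le_of_eq ?_
    have hm : Measurable (E.indicator fun x => B.toFun (C * |cauchyInt f x|)) :=
      (B.comp_mul_abs_measurable (measurable_cauchyInt h.isTest.meas) hC).indicator h.meas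
    rw [← lintegral_indicator (hp h.meas)]
    calc (1 : ENNReal) = β⁻¹ * β := (ENNReal.inv_mul_cancel hβ0 hβt).symm
      _ = ∫⁻ x, E.indicator (fun x => B.toFun (C * |cauchyInt f x|)) (L⁻¹ * (x - s)) := by
        rw [lintegral_comp_affine hL0 s hm, hLβ, lintegral_indicator h.meas]
      _ = _ := lintegral_congr fun x => by
        simp only [cauchyInt_comp_affine f hL0]
        rfl
  · have := hfar x r' (hr' _ hx)
    have h3 := le_abs_self x
    have h4 := le_abs_self R
    linarith
  · have := hfar y r (hfs y hy)
    have h3 := le_abs_self y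
    have h4 := le_abs_self R
    linarith

theorem exists_separatedPair_of_lt_left {A B : YoungFunction} {K t : ℝ} (hK : 0 < K) (ht : 0 < t)
    (h : A.toFun (K * t) < ∫⁻ x in Ioi 1, B.toFun (t / x)) :
    ∃ f E, SeparatedPair f E ∧
      ∫⁻ x, A.toFun |f x| < ∫⁻ x in E, B.toFun (2 / K * |cauchyInt f x|) := by
  have hun : (⋃ n : ℕ, Ioo (1 : ℝ) (n + 1)) = Ioi 1 := by
    ext x
    simp only [mem_iUnion, mem_Ioo, mem_Ioi]
    refine ⟨fun ⟨n, hn⟩ => hn.1, fun hx => ?_⟩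
    obtain ⟨n, hn⟩ := exists_nat_gt x
    exact ⟨n, hx, by linarith⟩
  have hdir : Monotone fun n : ℕ => Ioo (1 : ℝ) (n + 1) := fun m n hmn => by
    have : (m : ℝ) ≤ n := by exact_mod_cast hmn
    exact Ioo_subset_Ioo_right (by linarith)
  rw [← hun, setLIntegral_iUnion_of_directed _ hdir.directed_le] at h
  obtain ⟨n, hn⟩ := lt_iSup_iff.1 h
  have hKt : 0 < K * t := by positivity
  set f : ℝ → ℝ := (Icc (-1) 0).indicator fun _ => K * t with hf
  have hf0 : ∀ y, f y ≠ 0 → y ∈ Icc (-1 : ℝ) 0 := fun y hy => by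
    by_contra h'
    exact hy (indicator_of_notMem (s := Icc (-1 : ℝ) 0) h' _)
  refine ⟨f, Ioo 1 (n + 1), ⟨⟨measurable_const.indicator measurableSet_Icc, ⟨K * t, fun x => ?_⟩,
    1, fun x hx => ?_⟩, measurableSet_Ioo, ⟨n + 1, fun x hx => ?_⟩, 1, one_pos,
    fun x hx y hy => ?_⟩, ?_⟩
  · rw [hf, abs_of_nonneg (indicator_nonneg (fun _ _ => hKt.le) _)]
    exact indicator_le' (fun _ _ => le_rfl) (fun _ _ => hKt.le) x
  · by_contra h'
    have := hf0 x h'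
    rw [abs_of_nonpos this.2] at hx
    linarith [this.1]
  · rw [abs_of_pos (by linarith [hx.1])]; exact hx.2.le
  · rw [abs_of_nonneg (by linarith [hx.1, (hf0 y hy).2])]
    linarith [hx.1, (hf0 y hy).2]
  · calc ∫⁻ x, A.toFun |f x|
        = ∫⁻ x, (Icc (-1 : ℝ) 0).indicator (fun _ => A.toFun (K * t)) x := by
          refine lintegral_congr fun x => ?_
          by_cases hx : x ∈ Icc (-1 : ℝ) 0
          · simp only [hf, indicator_of_mem hx, abs_of_pos hKt]
          · simp only [hf, indicator_of_notMem hx, abs_zero, A.zero']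
      _ = A.toFun (K * t) := by
          rw [lintegral_indicator_const measurableSet_Icc]; simp
      _ < _ := hn
      _ ≤ _ := setLIntegral_mono' measurableSet_Ioo fun x hx => B.mono (by
          have := hx.1; positivity) ?_
    have hx1 : 1 < x := hx.1
    have e : cauchyInt f x = ∫ y in Icc (-1 : ℝ) 0, K * t / (x - y) := by
      rw [cauchyInt, ← integral_indicator measurableSet_Icc]
      refine integral_congr_ae (ae_of_all _ fun y => ?_)
      by_cases hy : y ∈ Icc (-1 : ℝ) 0
      · simp only [hf, indicator_of_mem hy]
      · simp only [hf, indicator_of_notMem hy, zero_div]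
    have hcont : ContinuousOn (fun y => K * t / (x - y)) (Icc (-1 : ℝ) 0) :=
      ContinuousOn.div continuousOn_const (by fun_prop) fun y hy => by
        have := hy.2; intro h0; linarith
    have h1 : K * t / (2 * x) ≤ cauchyInt f x := by
      rw [e]
      calc K * t / (2 * x) = ∫ y in Icc (-1 : ℝ) 0, K * t / (2 * x) := by simp
        _ ≤ _ := setIntegral_mono_on (by simp) (hcont.integrableOn_compact isCompact_Icc)
          measurableSet_Icc fun y hy => div_le_div_of_nonneg_left hKt.le
            (by linarith [hy.2]) (by linarith [hy.1])
    calc t / x = 2 / K * (K * t / (2 * x)) := by field_simp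
      _ ≤ _ := mul_le_mul_of_nonneg_left (h1.trans (le_abs_self _)) (by positivity)

theorem exists_separatedPair_of_lt_right {A B : YoungFunction}
    (hA : ∀ t, 0 ≤ t → A.toFun t < ⊤) {K t : ℝ} (hK : 0 < K) (ht : 0 < t)
    (h : B.conj (K * t) < ∫⁻ x in Ioi 1, A.conj (t / x)) :
    ∃ f E, SeparatedPair f E ∧
      ∫⁻ x, A.toFun |f x| < ∫⁻ x in E, B.toFun (2 / K * |cauchyInt f x|) := by
  obtain ⟨f, hf, hf0, hf1, hlt⟩ := A.exists_test_of_lt_lintegral_conj hA ht.le h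
  have hpair : SeparatedPair f (Ioo (-1) 0) := ⟨hf, measurableSet_Ioo,
    ⟨1, fun x hx => abs_le.2 ⟨hx.1.le, by linarith [hx.2]⟩⟩, 1, one_pos, fun x hx y hy => by
      have := hf1 y hy
      rw [abs_sub_comm, abs_of_nonneg (by linarith [hx.2])]
      linarith [hx.2]⟩
  refine ⟨f, _, hpair, ?_⟩
  set m := ∫ x, f x / x with hm
  have hm0 : 0 ≤ m := integral_nonneg fun x => by
    by_cases hx : f x = 0
    · simp [hx]
    · have := hf1 x hx
      have := hf0 x
      show 0 ≤ f x / x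
      positivity
  have hmt : ∫ x, f x * (t / x) = m / K * (K * t) := by
    have e : m / K * (K * t) = t * m := by field_simp
    rw [e, hm, ← integral_const_mul]
    exact integral_congr_ae (ae_of_all _ fun x => by ring)
  have hlow : ∫⁻ x, A.toFun |f x| < B.toFun (m / K) := by
    simp only [abs_of_nonneg (hf0 _)]
    by_contra hcon
    rw [hmt] at hlt
    refine absurd (B.young (s := m / K) (by positivity) (K * t)) (not_le.2 (lt_of_le_of_lt ?_ hlt))
    rw [add_comm]
    exact add_le_add le_rfl (not_lt.1 hcon)
  refine hlow.trans_le ?_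
  calc B.toFun (m / K) = ∫⁻ x in Ioo (-1 : ℝ) 0, B.toFun (m / K) := by simp
    _ ≤ _ := setLIntegral_mono' measurableSet_Ioo fun x hx => B.mono (by positivity) ?_
  have hInt : Integrable fun y => f y / (2 * y) := by
    have e : (fun y => f y / (2 * y)) = fun y => f y * (Ioi 1).indicator (fun y => 1 / (2 * y)) y := by
      funext y
      by_cases hy : f y = 0
      · simp [hy]
      · rw [indicator_of_mem (show y ∈ Ioi 1 from hf1 y hy)]; ring
    rw [e]
    have hmm : Measurable fun y : ℝ => 1 / (2 * y) := by fun_prop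
    refine (hf.mul_bdd (C := 1) (hmm.indicator measurableSet_Ioi) fun y => ?_).integrable
    by_cases hy : y ∈ Ioi (1 : ℝ)
    · have hy' : 1 < y := hy
      rw [indicator_of_mem hy, abs_of_pos (by positivity), div_le_one (by positivity)]
      linarith
    · rw [indicator_of_notMem hy]; simp
  have h1 : m / 2 ≤ -cauchyInt f x := by
    rw [hm, ← integral_div, cauchyInt, ← integral_neg]
    have e1 : ∀ y, f y / y / 2 = f y / (2 * y) := fun y => by rw [div_div, mul_comm]
    simp only [e1]
    refine integral_mono hInt (hpair.isTest_div hx).integrable.neg fun y => ?_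
    by_cases hy : f y = 0
    · simp [hy]
    · have hy1 := hf1 y hy
      have e2 : -(f y / (x - y)) = f y / (y - x) := by
        rw [← neg_sub y x, div_neg, neg_neg]
      show f y / (2 * y) ≤ -(f y / (x - y))
      rw [e2]
      exact div_le_div_of_nonneg_left (hf0 y) (by linarith [hx.2]) (by linarith [hx.1])
  calc m / K = 2 / K * (m / 2) := by field_simp
    _ ≤ _ := mul_le_mul_of_nonneg_left (h1.trans (neg_le_abs _)) (by positivity)

/-- If one of the two integral conditions fails, some separated pair violates the modular
inequality for the Cauchy integral. -/
theorem exists_separatedPair_of_not {A B : YoungFunction} (hA : ∀ t, 0 ≤ t → A.toFun t < ⊤)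
    {K t : ℝ} (hK : 0 < K) (ht : 0 < t)
    (h : ¬ ((∫⁻ s in Set.Ioo (0 : ℝ) t, B.toFun s / ENNReal.ofReal (s ^ 2))
            ≤ A.toFun (K * t) / ENNReal.ofReal t ∧
        (∫⁻ s in Set.Ioo (0 : ℝ) t, A.conj s / ENNReal.ofReal (s ^ 2))
            ≤ B.conj (K * t) / ENNReal.ofReal t)) :
    ∃ f E, SeparatedPair f E ∧
      ∫⁻ x, A.toFun |f x| < ∫⁻ x in E, B.toFun (2 / K * |cauchyInt f x|) := by
  rw [lintegral_Ioo_div_sq _ ht, lintegral_Ioo_div_sq _ ht] at h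
  by_cases h1 : A.toFun (K * t) < ∫⁻ x in Ioi 1, B.toFun (t / x)
  · exact exists_separatedPair_of_lt_left hK ht h1
  by_cases h2 : B.conj (K * t) < ∫⁻ x in Ioi 1, A.conj (t / x)
  · exact exists_separatedPair_of_lt_right hA hK ht h2
  · exact absurd ⟨ENNReal.div_le_div_right (not_lt.1 h1) _,
      ENNReal.div_le_div_right (not_lt.1 h2) _⟩ h

theorem tendsto_integral_mul_cexp {w : ℝ → ℝ} {l : ℕ → ℝ} (hl : Tendsto l atTop atTop) (x : ℝ) :
    Tendsto (fun n => ∫ y, Complex.exp ((l n * (x - 2 * y) : ℝ) * Complex.I) * (w y : ℂ)) atTop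
      (nhds 0) := by
  have hπ := Real.pi_pos
  have h1 := (Real.tendsto_integral_exp_smul_cocompact (fun y => (w y : ℂ))).comp
    (((hl.atTop_div_const hπ)).mono_right atTop_le_cocompact)
  rw [tendsto_zero_iff_norm_tendsto_zero] at h1 ⊢
  refine h1.congr fun n => ?_
  have e : ∀ y, Complex.exp ((l n * (x - 2 * y) : ℝ) * Complex.I) * (w y : ℂ) =
      Complex.exp ((l n * x : ℝ) * Complex.I) *
        (Real.fourierChar (-(y * (l n / Real.pi))) • (w y : ℂ)) := fun y => by
    rw [Circle.smul_def, Real.fourierChar_apply, smul_eq_mul, ← mul_assoc, ← Complex.exp_add,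
      ← add_mul]
    congr 3
    norm_cast
    field_simp
    ring
  simp only [e]
  rw [integral_const_mul, norm_mul, Complex.norm_exp_ofReal_mul_I, one_mul]
  rfl

theorem integrable_mul_cexp {w : ℝ → ℝ} (hw : Integrable w) (a x : ℝ) :
    Integrable fun y => Complex.exp ((a * (x - 2 * y) : ℝ) * Complex.I) * (w y : ℂ) :=
  hw.ofReal.bdd_mul (c := 1) (by fun_prop : Continuous fun y : ℝ =>
    Complex.exp ((a * (x - 2 * y) : ℝ) * Complex.I)).aestronglyMeasurable
    (ae_of_all _ fun y => (Complex.norm_exp_ofReal_mul_I _).le)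

theorem tendsto_integral_mul_cos {w : ℝ → ℝ} (hw : Integrable w) {l : ℕ → ℝ}
    (hl : Tendsto l atTop atTop) (x : ℝ) :
    Tendsto (fun n => ∫ y, w y * Real.cos (l n * (x - 2 * y))) atTop (nhds 0) := by
  have h := (Complex.continuous_re.tendsto 0).comp (tendsto_integral_mul_cexp (w := w) hl x)
  refine h.congr fun n => ?_
  refine ((integral_re (integrable_mul_cexp hw (l n) x)).symm).trans ?_
  refine integral_congr_ae (ae_of_all _ fun y => ?_)
  simp only [RCLike.re_to_complex, Complex.mul_re, Complex.exp_ofReal_mul_I_re, Complex.ofReal_re,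
    Complex.ofReal_im, mul_zero, sub_zero]
  exact mul_comm _ _

theorem tendsto_integral_mul_sin {w : ℝ → ℝ} (hw : Integrable w) {l : ℕ → ℝ}
    (hl : Tendsto l atTop atTop) (x : ℝ) :
    Tendsto (fun n => ∫ y, w y * Real.sin (l n * (x - 2 * y))) atTop (nhds 0) := by
  have h := (Complex.continuous_im.tendsto 0).comp (tendsto_integral_mul_cexp (w := w) hl x)
  refine h.congr fun n => ?_
  refine ((integral_im (integrable_mul_cexp hw (l n) x)).symm).trans ?_
  refine integral_congr_ae (ae_of_all _ fun y => ?_)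
  simp only [RCLike.im_to_complex, Complex.mul_im, Complex.exp_ofReal_mul_I_im, Complex.ofReal_re,
    Complex.ofReal_im, mul_zero, zero_add]
  exact mul_comm _ _

theorem KernelAsymp.tendsto_err {k : ℕ → ℝ → ℝ → ℝ} {T l : ℕ → ℝ} {c : ℕ → ℝ → ℝ} {ε : ℕ → ℝ}
    (hk : KernelAsymp k T l c ε) (hT : Tendsto T atTop atTop) : Tendsto ε atTop (nhds 0) := by
  refine tendsto_of_tendsto_of_tendsto_of_le_of_le' tendsto_const_nhds hk.err_tendsto
    hk.err_nonneg ?_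
  filter_upwards [hk.err_nonneg, hT.eventually_ge_atTop 1] with n h0 h1
  nlinarith

/-- Asymptotics of the truncated operators on modulated functions off the support. -/
theorem tendsto_truncOp_modulated {k : ℕ → ℝ → ℝ → ℝ} {T l : ℕ → ℝ} {c : ℕ → ℝ → ℝ} {ε : ℕ → ℝ}
    (hk : KernelAsymp k T l c ε) (hkc : ∀ n, Continuous fun p : ℝ × ℝ => k n p.1 p.2)
    (hT : Tendsto T atTop atTop) {f : ℝ → ℝ} {E : Set ℝ} (h : SeparatedPair f E) {x : ℝ}
    (hx : x ∈ E) {φ ψ ρ : ℝ → ℝ} (hφ : Measurable φ) (hφ1 : ∀ a, |φ a| ≤ 1)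
    (hψ1 : ∀ a, |ψ a| ≤ 1) (hρ : Measurable ρ) (hρ1 : ∀ a, |ρ a| ≤ 1)
    (hid : ∀ a b, φ b * Real.sin a = (ψ (a + b) + ρ (a - b)) / 2)
    (hRL : ∀ w : ℝ → ℝ, Integrable w →
      Tendsto (fun n => ∫ y, w y * ρ (l n * (x - 2 * y))) atTop (nhds 0)) :
    Tendsto (fun n => truncOp (k n) (T n) (fun y => f y * φ (l n * y)) x -
      ψ (l n * x) * cauchyInt f x / (2 * Real.pi)) atTop (nhds 0) := by
  have hπ := Real.pi_pos
  set w : ℝ → ℝ := fun y => f y / (x - y) with hw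
  have hwi : Integrable w := (h.isTest_div hx).integrable
  have hf := h.isTest
  obtain ⟨R, hR⟩ := hf.supp
  set I : ℕ → ℝ := fun n => ∫ y, f y * φ (l n * y) * (l n / Real.pi * Real.sinc (l n * (x - y)))
    with hI
  have hIe : ∀ n, I n = ψ (l n * x) * cauchyInt f x / (2 * Real.pi) +
      (∫ y, w y * ρ (l n * (x - 2 * y))) / (2 * Real.pi) := by
    intro n
    have hl0 := hk.freq_pos n
    have i2 : Integrable fun y => w y * ρ (l n * (x - 2 * y)) :=
      hwi.mul_bdd (c := 1) (hρ.comp (by fun_prop : Measurable fun y => l n * (x - 2 * y))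
        ).aestronglyMeasurable (ae_of_all _ fun y => hρ1 _)
    have e : ψ (l n * x) * cauchyInt f x = ∫ y, ψ (l n * x) * w y :=
      (integral_const_mul _ _).symm
    rw [e, ← add_div, ← integral_add (hwi.const_mul _) i2, ← integral_div]
    refine integral_congr_ae (ae_of_all _ fun y => ?_)
    simp only [hw]
    by_cases hy : f y = 0
    · simp [hy]
    · have hxy : x - y ≠ 0 := fun h0 => by
        have : x = y := by linarith
        exact hy (this ▸ h.eq_zero hx)
      rw [Real.sinc_of_ne_zero (mul_ne_zero hl0.ne' hxy)]
      have := hid (l n * (x - y)) (l n * y)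
      rw [show l n * (x - y) + l n * y = l n * x by ring,
        show l n * (x - y) - l n * y = l n * (x - 2 * y) by ring] at this
      generalize ρ (l n * (x - 2 * y)) = r at this ⊢
      field_simp
      linear_combination 2 * this
  have h1 : Tendsto (fun n => truncOp (k n) (T n) (fun y => f y * φ (l n * y)) x - c n x * I n)
      atTop (nhds 0) := by
    refine squeeze_zero_norm' (a := fun n => ε n * ∫ y, |f y|) ?_ (by
      simpa using (hk.tendsto_err hT).mul_const (∫ y, |f y|))
    filter_upwards [hk.approx, hT.eventually_gt_atTop (max R |x|), hk.err_nonneg]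
      with n hn hTn hε
    have hfφ : IsTest fun y => f y * φ (l n * y) :=
      hf.mul_bdd (hφ.comp (measurable_const_mul (l n))) fun t => hφ1 _
    have h2 := abs_truncOp_sub_le (hkc n) (hk.freq_pos n) hn hfφ.integrable.integrableOn
      ((le_max_right _ _).trans_lt hTn)
    have e : (Ioo (-T n) (T n)).indicator (fun y => f y * φ (l n * y)) =
        fun y => f y * φ (l n * y) := by
      refine indicator_eq_self.2 fun y hy => abs_lt.1 ?_
      by_contra h'
      refine hy ?_
      show f y * φ (l n * y) = 0
      rw [hR y ((le_max_left _ _).trans_lt (hTn.trans_le (not_lt.1 h'))), zero_mul]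
    rw [e] at h2
    refine h2.trans (mul_le_mul_of_nonneg_left ?_ hε)
    refine (integral_mono_ae hfφ.integrable.abs.integrableOn hf.integrable.abs.integrableOn
      (ae_of_all _ fun y => ?_)).trans (setIntegral_le_integral hf.integrable.abs
        (ae_of_all _ fun y => abs_nonneg _))
    show |f y * φ (l n * y)| ≤ |f y|
    rw [abs_mul]
    exact mul_le_of_le_one_right (abs_nonneg _) (hφ1 _)
  have h2 : Tendsto (fun n => (c n x - 1) * (ψ (l n * x) * cauchyInt f x / (2 * Real.pi))) atTop
      (nhds 0) := by
    have h3 : Tendsto (fun n => |c n x - 1| * (|cauchyInt f x| / (2 * Real.pi))) atTop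
        (nhds 0) := by
      have := (((hk.amp_tendsto x).sub_const 1).abs).mul_const (|cauchyInt f x| / (2 * Real.pi))
      simpa using this
    refine squeeze_zero_norm (fun n => ?_) h3
    rw [Real.norm_eq_abs, abs_mul, abs_div, abs_mul, abs_of_pos (show 0 < 2 * Real.pi by positivity)]
    refine mul_le_mul_of_nonneg_left (div_le_div_of_nonneg_right ?_ (by positivity))
      (abs_nonneg _)
    exact mul_le_of_le_one_left (abs_nonneg _) (hψ1 _)
  have h3 : Tendsto (fun n => c n x * ((∫ y, w y * ρ (l n * (x - 2 * y))) / (2 * Real.pi))) atTop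
      (nhds 0) := by
    simpa using (hk.amp_tendsto x).mul ((hRL w hwi).div_const (2 * Real.pi))
  have := (h1.add h2).add h3
  simp only [add_zero] at this
  refine this.congr fun n => ?_
  rw [hIe]
  ring

theorem tendsto_truncOp_cos {k : ℕ → ℝ → ℝ → ℝ} {T l : ℕ → ℝ} {c : ℕ → ℝ → ℝ} {ε : ℕ → ℝ}
    (hk : KernelAsymp k T l c ε) (hkc : ∀ n, Continuous fun p : ℝ × ℝ => k n p.1 p.2)
    (hT : Tendsto T atTop atTop) {f : ℝ → ℝ} {E : Set ℝ} (h : SeparatedPair f E) {x : ℝ}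
    (hx : x ∈ E) :
    Tendsto (fun n => truncOp (k n) (T n) (fun y => f y * Real.cos (l n * y)) x -
      Real.sin (l n * x) * cauchyInt f x / (2 * Real.pi)) atTop (nhds 0) :=
  tendsto_truncOp_modulated hk hkc hT h hx (φ := Real.cos) (ψ := Real.sin) (ρ := Real.sin)
    Real.measurable_cos Real.abs_cos_le_one Real.abs_sin_le_one Real.measurable_sin
    Real.abs_sin_le_one (fun a b => by rw [Real.sin_add, Real.sin_sub]; ring)
    fun w hw => tendsto_integral_mul_sin hw hk.freq_tendsto x

theorem tendsto_truncOp_sin {k : ℕ → ℝ → ℝ → ℝ} {T l : ℕ → ℝ} {c : ℕ → ℝ → ℝ} {ε : ℕ → ℝ}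
    (hk : KernelAsymp k T l c ε) (hkc : ∀ n, Continuous fun p : ℝ × ℝ => k n p.1 p.2)
    (hT : Tendsto T atTop atTop) {f : ℝ → ℝ} {E : Set ℝ} (h : SeparatedPair f E) {x : ℝ}
    (hx : x ∈ E) :
    Tendsto (fun n => truncOp (k n) (T n) (fun y => f y * Real.sin (l n * y)) x -
      -Real.cos (l n * x) * cauchyInt f x / (2 * Real.pi)) atTop (nhds 0) :=
  tendsto_truncOp_modulated hk hkc hT h hx (φ := Real.sin) (ψ := fun a => -Real.cos a)
    (ρ := Real.cos) Real.measurable_sin Real.abs_sin_le_one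
    (fun a => (abs_neg _).trans_le (Real.abs_cos_le_one a)) Real.measurable_cos
    Real.abs_cos_le_one (fun a b => by rw [Real.cos_add, Real.cos_sub]; ring)
    fun w hw => tendsto_integral_mul_cos hw hk.freq_tendsto x

theorem half_le_abs_sin_or_abs_cos (θ : ℝ) : 1 / 2 ≤ |Real.sin θ| ∨ 1 / 2 ≤ |Real.cos θ| := by
  by_contra! h
  have h1 := Real.sin_sq_add_cos_sq θ
  rw [← sq_abs, ← sq_abs (Real.cos θ)] at h1
  nlinarith [abs_nonneg (Real.sin θ), abs_nonneg (Real.cos θ), h.1, h.2]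

/-- Among the cosine and sine modulations of `f`, one has large truncated operator on `E`. -/
theorem eventually_exists_modulation {B : YoungFunction} {k : ℕ → ℝ → ℝ → ℝ} {T l : ℕ → ℝ}
    {c : ℕ → ℝ → ℝ} {ε : ℕ → ℝ} (hk : KernelAsymp k T l c ε)
    (hkc : ∀ n, Continuous fun p : ℝ × ℝ => k n p.1 p.2) (hT : Tendsto T atTop atTop)
    {f : ℝ → ℝ} {E : Set ℝ} (h : SeparatedPair f E) {C : ℝ} (hC : 0 ≤ C)
    (hlow : 1 ≤ ∫⁻ x in E, B.toFun (C / (4 * Real.pi) * |cauchyInt f x|)) :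
    ∀ᶠ n in atTop, ∃ φ : ℝ → ℝ, Measurable φ ∧ (∀ y, |φ y| ≤ 1) ∧
      1 / 4 ≤ ∫⁻ x in E, B.toFun (C * |truncOp (k n) (T n) (fun y => f y * φ y) x|) := by
  have hπ := Real.pi_pos
  have hmc : ∀ n, Measurable fun y => Real.cos (l n * y) := fun n =>
    Real.measurable_cos.comp (measurable_const_mul _)
  have hms : ∀ n, Measurable fun y => Real.sin (l n * y) := fun n =>
    Real.measurable_sin.comp (measurable_const_mul _)
  set a : ℕ → ℝ → ℝ := fun n => truncOp (k n) (T n) fun y => f y * Real.cos (l n * y) with ha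
  set b : ℕ → ℝ → ℝ := fun n => truncOp (k n) (T n) fun y => f y * Real.sin (l n * y) with hb
  have ham : ∀ n, Measurable fun x => B.toFun (C * |a n x|) := fun n =>
    B.comp_mul_abs_measurable (measurable_truncOp (hkc n) (h.isTest.meas.mul (hmc n))) hC
  have hbm : ∀ n, Measurable fun x => B.toFun (C * |b n x|) := fun n =>
    B.comp_mul_abs_measurable (measurable_truncOp (hkc n) (h.isTest.meas.mul (hms n))) hC
  have hpt : ∀ x ∈ E, B.toFun (C / (4 * Real.pi) * |cauchyInt f x|) ≤
      liminf (fun n => B.toFun (C * |a n x|) + B.toFun (C * |b n x|)) atTop := by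
    intro x hx
    set H := cauchyInt f x with hH
    set δ : ℕ → ℝ := fun n => |a n x - Real.sin (l n * x) * H / (2 * Real.pi)| +
      |b n x - -Real.cos (l n * x) * H / (2 * Real.pi)| with hδ
    have hδ0 : Tendsto δ atTop (nhds 0) := by
      have := (tendsto_truncOp_cos hk hkc hT h hx).abs.add
        (tendsto_truncOp_sin hk hkc hT h hx).abs
      rwa [abs_zero, add_zero] at this
    have hu : Tendsto (fun n => max 0 (C * (|H| / (4 * Real.pi) - δ n))) atTop
        (nhds (C / (4 * Real.pi) * |H|)) := by
      have h1 := (tendsto_const_nhds (x := (0 : ℝ))).max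
        ((hδ0.const_sub (|H| / (4 * Real.pi))).const_mul C)
      have e : max 0 (C * (|H| / (4 * Real.pi) - 0)) = C / (4 * Real.pi) * |H| := by
        rw [sub_zero, max_eq_right (by positivity)]
        ring
      rwa [e] at h1
    refine (B.le_liminf (by positivity) hu).trans (liminf_le_liminf (Eventually.of_forall fun n => ?_))
    have key : ∀ s A' : ℝ, 1 / 2 ≤ |s| → |A' - s * H / (2 * Real.pi)| ≤ δ n →
        max 0 (C * (|H| / (4 * Real.pi) - δ n)) ≤ C * |A'| := fun s A' hs hA' => by
      refine max_le (by positivity) (mul_le_mul_of_nonneg_left ?_ hC)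
      have h1 : |H| / (4 * Real.pi) ≤ |s * H / (2 * Real.pi)| := by
        rw [abs_div, abs_mul, abs_of_pos (show 0 < 2 * Real.pi by positivity),
          div_le_div_iff₀ (by positivity) (by positivity)]
        have := mul_le_mul_of_nonneg_right hs (abs_nonneg H)
        nlinarith
      have h2 := abs_sub_abs_le_abs_sub (s * H / (2 * Real.pi)) A'
      rw [abs_sub_comm] at h2
      linarith
    rcases half_le_abs_sin_or_abs_cos (l n * x) with h1 | h1
    · refine (B.mono (le_max_left _ _) (key _ (a n x) h1 ?_)).trans le_self_add
      exact le_add_of_nonneg_right (abs_nonneg _)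
    · refine (B.mono (le_max_left _ _) (key _ (b n x) (h1.trans_eq (abs_neg _).symm) ?_)).trans le_add_self
      exact le_add_of_nonneg_left (abs_nonneg _)
  have hF : 1 ≤ liminf (fun n => ∫⁻ x in E, (B.toFun (C * |a n x|) + B.toFun (C * |b n x|)))
      atTop :=
    hlow.trans ((setLIntegral_mono' h.meas hpt).trans
      (lintegral_liminf_le fun n => (ham n).add (hbm n)))
  have hhalf : (1 / 2 : ENNReal) < 1 := by
    rw [one_div]; exact ENNReal.one_half_lt_one
  filter_upwards [eventually_lt_of_lt_liminf (hhalf.trans_le hF)] with n hn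
  rw [lintegral_add_left (ham n)] at hn
  by_contra! hcon
  have h1 := hcon _ (hmc n) fun y => Real.abs_cos_le_one _
  have h2 := hcon _ (hms n) fun y => Real.abs_sin_le_one _
  refine absurd hn (not_lt.2 ((add_le_add h1.le h2.le).trans (le_of_eq ?_)))
  rw [← two_mul, show (4 : ENNReal) = 2 * 2 by norm_num, one_div, one_div,
    ENNReal.mul_inv (by simp) (by simp), ← mul_assoc, ENNReal.mul_inv_cancel (by simp) (by simp),
    one_mul]

theorem IsTest.add {f g : ℝ → ℝ} (hf : IsTest f) (hg : IsTest g) : IsTest fun x => f x + g x := by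
  obtain ⟨M, hM⟩ := hf.bdd
  obtain ⟨R, hR⟩ := hf.supp
  obtain ⟨M', hM'⟩ := hg.bdd
  obtain ⟨R', hR'⟩ := hg.supp
  exact ⟨hf.meas.add hg.meas, ⟨M + M', fun t => (abs_add_le _ _).trans (add_le_add (hM t) (hM' t))⟩,
    max R R', fun t ht => by
      rw [hR t ((le_max_left _ _).trans_lt ht), hR' t ((le_max_right _ _).trans_lt ht), add_zero]⟩

section GlidingHump
variable {A B : YoungFunction} {k : ℕ → ℝ → ℝ → ℝ} {T l : ℕ → ℝ} {c : ℕ → ℝ → ℝ} {ε : ℕ → ℝ}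

/-- One step of the gliding hump: a far away small perturbation spoils modular convergence. -/
theorem exists_hump (hA : ∀ t, 0 ≤ t → A.toFun t < ⊤) (hB : ∀ t, 0 ≤ t → B.toFun t < ⊤)
    (hk : KernelAsymp k T l c ε) (hkc : ∀ n, Continuous fun p : ℝ × ℝ => k n p.1 p.2)
    (hT : Tendsto T atTop atTop)
    (hi : ∀ f, IsTest f →
      Tendsto (fun n => ∫⁻ x, B.toFun |truncOp (k n) (T n) f x - f x|) atTop (nhds 0))
    (hnot : ∀ K : ℝ, 0 < K → ∃ t : ℝ, 0 < t ∧
      ¬ ((∫⁻ s in Set.Ioo (0 : ℝ) t, B.toFun s / ENNReal.ofReal (s ^ 2))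
            ≤ A.toFun (K * t) / ENNReal.ofReal t ∧
        (∫⁻ s in Set.Ioo (0 : ℝ) t, A.conj s / ENNReal.ofReal (s ^ 2))
            ≤ B.conj (K * t) / ENNReal.ofReal t))
    {F : ℝ → ℝ} (hF : IsTest F) (m j : ℕ) :
    ∃ (F' : ℝ → ℝ) (n : ℕ), IsTest F' ∧ m < n ∧ T m ≤ T n ∧
      (∀ y, |y| < T m → F' y = F y) ∧
      (∀ C : ℝ, 0 ≤ C → C ≤ 2 ^ j → ∫⁻ x, A.toFun (C * |F' x|) ≤
        (∫⁻ x, A.toFun (C * |F x|)) + ENNReal.ofReal (C / 2 ^ j)) ∧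
      ∀ f : ℝ → ℝ, (∀ y, |y| < T n → f y = F' y) →
        1 / 8 ≤ ∫⁻ x, B.toFun |truncOp (k n) (T n) f x - f x| := by
  have hπ := Real.pi_pos
  set C₀ : ℝ := (2 ^ j)⁻¹ / 2 with hC₀
  have hC₀0 : 0 < C₀ := by positivity
  obtain ⟨t, ht, hnt⟩ := hnot (8 * Real.pi / C₀) (by positivity)
  obtain ⟨f₀, E₀, h₀, hlt⟩ := exists_separatedPair_of_not hA (by positivity) ht hnt
  obtain ⟨r, hr⟩ := hF.supp
  have hCC : 2 / (8 * Real.pi / C₀) = C₀ / (4 * Real.pi) := by field_simp; norm_num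
  rw [hCC] at hlt
  obtain ⟨f, E, h, hfA, hfB, hER, hfR⟩ := h₀.exists_normalized hB (by positivity) hlt
    (max (T m) r)
  obtain ⟨ρ, hρ⟩ := h.bdd
  have h8 : (0 : ENNReal) < 1 / 8 := by simp
  obtain ⟨n, ⟨φ, hφm, hφ1, hφ⟩, hn1, hn2, hnm⟩ := ((eventually_exists_modulation hk hkc hT h
    hC₀0.le hfB).and ((ENNReal.tendsto_nhds_zero.1 (hi F hF) _ h8).and
    ((hT.eventually_gt_atTop (max ρ (T m))).and (eventually_gt_atTop m)))).exists
  set g : ℝ → ℝ := fun y => (2 ^ j)⁻¹ * (f y * φ y) with hg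
  have hfφ : IsTest fun y => f y * φ y := h.isTest.mul_bdd hφm hφ1
  have hgT : IsTest g := by
    have := hfφ.mul_bdd (φ := fun _ => ((2 : ℝ) ^ j)⁻¹) measurable_const fun _ => le_rfl
    simpa only [hg, mul_comm] using this
  have hg0 : ∀ y, f y = 0 → g y = 0 := fun y hy => by simp [hg, hy]
  have hgR : ∀ y, |y| ≤ max (T m) r → g y = 0 := fun y hy => hg0 y (by
    by_contra h'
    exact absurd (hfR y h') (not_lt.2 hy))
  refine ⟨fun y => F y + g y, n, hF.add hgT, hnm, ((le_max_right _ _).trans_lt hn2).le,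
    fun y hy => ?_, fun C hC0 hC => ?_, fun u hu => ?_⟩
  · show F y + g y = F y
    rw [hgR y (hy.le.trans (le_max_left _ _)), add_zero]
  · have hθ0 : 0 ≤ C / 2 ^ j := by positivity
    calc ∫⁻ x, A.toFun (C * |F x + g x|)
        ≤ ∫⁻ x, (A.toFun (C * |F x|) + ENNReal.ofReal (C / 2 ^ j) * A.toFun |f x|) := by
          refine lintegral_mono fun x => ?_
          by_cases hx : |x| ≤ r
          · simp only [hgR x (hx.trans (le_max_right _ _)), add_zero]
            exact le_self_add
          · simp only [hr x (not_le.1 hx), zero_add]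
            refine le_trans ?_ le_add_self
            refine le_trans (A.mono (by positivity) ?_) (A.le_smul hθ0
              (div_le_one_of_le₀ hC (by positivity)) (abs_nonneg (f x)))
            rw [div_mul_eq_mul_div, mul_div_assoc]
            refine mul_le_mul_of_nonneg_left ?_ hC0
            simp only [hg]
            rw [abs_mul, abs_of_pos (by positivity : (0 : ℝ) < (2 ^ j)⁻¹), abs_mul,
              div_eq_inv_mul]
            exact mul_le_mul_of_nonneg_left (mul_le_of_le_one_right (abs_nonneg _) (hφ1 x))
              (by positivity)
      _ = (∫⁻ x, A.toFun (C * |F x|)) + ENNReal.ofReal (C / 2 ^ j) * ∫⁻ x, A.toFun |f x| := by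
          rw [lintegral_add_left (A.comp_mul_abs_measurable hF.meas hC0),
            lintegral_const_mul _ (A.measurable_comp_abs h.isTest.meas)]
      _ ≤ _ := by
          gcongr
          exact mul_le_of_le_one_right' hfA
  · have e : truncOp (k n) (T n) u = truncOp (k n) (T n) fun y => F y + g y :=
      truncOp_congr fun y hy => hu y (abs_lt.2 hy)
    have hE0 : ∀ x ∈ E, F x = 0 ∧ u x = 0 := fun x hx => by
      have h1 : F x = 0 := hr x ((le_max_right _ _).trans_lt (hER x hx))
      refine ⟨h1, ?_⟩
      rw [hu x ((hρ x hx).trans_lt ((le_max_left _ _).trans_lt hn2))]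
      show F x + g x = 0
      rw [h1, zero_add, hg0 x (h.eq_zero hx)]
    have hmain : 1 / 4 ≤ (∫⁻ x, B.toFun |truncOp (k n) (T n) u x - u x|) + 1 / 8 := by
      calc 1 / 4 ≤ ∫⁻ x in E, B.toFun (C₀ * |truncOp (k n) (T n) (fun y => f y * φ y) x|) := hφ
        _ ≤ ∫⁻ x in E, (B.toFun |truncOp (k n) (T n) u x - u x| +
              B.toFun |truncOp (k n) (T n) F x - F x|) := by
            refine setLIntegral_mono' h.meas fun x hx => ?_
            rw [(hE0 x hx).1, (hE0 x hx).2, sub_zero, sub_zero, e,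
              truncOp_add (hkc n) hF.integrable.integrableOn hgT.integrable.integrableOn]
            have e2 : truncOp (k n) (T n) g x =
                (2 ^ j)⁻¹ * truncOp (k n) (T n) (fun y => f y * φ y) x := truncOp_const_mul _ _
            set a := truncOp (k n) (T n) F x
            set b := truncOp (k n) (T n) g x
            have e3 : C₀ * |truncOp (k n) (T n) (fun y => f y * φ y) x| = |b| / 2 := by
              rw [e2, abs_mul, abs_of_pos (by positivity : (0 : ℝ) < (2 ^ j)⁻¹)]
              ring
            have e4 : |b| / 2 ≤ |a + b| / 2 + |a| / 2 := by
              have := abs_sub (a + b) a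
              rw [add_sub_cancel_left] at this
              linarith
            rw [e3]
            refine (B.mono (by positivity) e4).trans ((B.add_le (by positivity)
              (by positivity)).trans (le_of_eq ?_))
            congr 2 <;> ring
        _ = (∫⁻ x in E, B.toFun |truncOp (k n) (T n) u x - u x|) +
              ∫⁻ x in E, B.toFun |truncOp (k n) (T n) F x - F x| :=
            lintegral_add_right _ (B.measurable_comp_abs
              ((measurable_truncOp (hkc n) hF.meas).sub hF.meas))
        _ ≤ _ := add_le_add (setLIntegral_le_lintegral _ _)
            ((setLIntegral_le_lintegral _ _).trans hn1)
    have h48 : (1 / 4 : ENNReal) = 1 / 8 + 1 / 8 := by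
      rw [← two_mul, show (8 : ENNReal) = 2 * 4 by norm_num, one_div, one_div,
        ENNReal.mul_inv (by simp) (by simp), ← mul_assoc, ENNReal.mul_inv_cancel (by simp)
        (by simp), one_mul]
    rw [h48] at hmain
    exact (ENNReal.add_le_add_iff_right (by simp)).1 hmain

/-- Modular convergence forces the integral conditions. -/
theorem exists_cond_of_tendsto (hA : ∀ t, 0 ≤ t → A.toFun t < ⊤)
    (hB : ∀ t, 0 ≤ t → B.toFun t < ⊤)
    (hk : KernelAsymp k T l c ε) (hkc : ∀ n, Continuous fun p : ℝ × ℝ => k n p.1 p.2)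
    (hT : Tendsto T atTop atTop)
    (hi : ∀ f : ℝ → ℝ, Measurable f →
      (∀ C : ℝ, 0 < C → (∫⁻ x, A.toFun (C * |f x|)) < ⊤) →
      Tendsto (fun n => ∫⁻ x, B.toFun |truncOp (k n) (T n) f x - f x|) atTop (nhds 0)) :
    ∃ K : ℝ, 0 < K ∧ ∀ t : ℝ, 0 < t →
        (∫⁻ s in Set.Ioo (0 : ℝ) t, B.toFun s / ENNReal.ofReal (s ^ 2))
            ≤ A.toFun (K * t) / ENNReal.ofReal t ∧
        (∫⁻ s in Set.Ioo (0 : ℝ) t, A.conj s / ENNReal.ofReal (s ^ 2))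
            ≤ B.conj (K * t) / ENNReal.ofReal t := by
  by_contra hcon
  have hnot : ∀ K : ℝ, 0 < K → ∃ t : ℝ, 0 < t ∧
      ¬ ((∫⁻ s in Set.Ioo (0 : ℝ) t, B.toFun s / ENNReal.ofReal (s ^ 2))
            ≤ A.toFun (K * t) / ENNReal.ofReal t ∧
        (∫⁻ s in Set.Ioo (0 : ℝ) t, A.conj s / ENNReal.ofReal (s ^ 2))
            ≤ B.conj (K * t) / ENNReal.ofReal t) := fun K hK => by
    by_contra h'
    exact hcon ⟨K, hK, fun t ht => by
      by_contra h''
      exact h' ⟨t, ht, h''⟩⟩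
  have hi' : ∀ f, IsTest f →
      Tendsto (fun n => ∫⁻ x, B.toFun |truncOp (k n) (T n) f x - f x|) atTop (nhds 0) :=
    fun f hf => hi f hf.meas fun C hC => hf.lintegral_lt_top hA hC.le
  have step : ∀ (j : ℕ) (p : {F : ℝ → ℝ // IsTest F} × ℕ), ∃ q : {F : ℝ → ℝ // IsTest F} × ℕ,
      p.2 < q.2 ∧ T p.2 ≤ T q.2 ∧ (∀ y, |y| < T p.2 → q.1.1 y = p.1.1 y) ∧
      (∀ C : ℝ, 0 ≤ C → C ≤ 2 ^ j → ∫⁻ x, A.toFun (C * |q.1.1 x|) ≤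
        (∫⁻ x, A.toFun (C * |p.1.1 x|)) + ENNReal.ofReal (C / 2 ^ j)) ∧
      ∀ f : ℝ → ℝ, (∀ y, |y| < T q.2 → f y = q.1.1 y) →
        1 / 8 ≤ ∫⁻ x, B.toFun |truncOp (k q.2) (T q.2) f x - f x| := fun j p => by
    obtain ⟨F', n, h1, h2⟩ := exists_hump hA hB hk hkc hT hi' hnot p.1.2 p.2 j
    exact ⟨⟨⟨F', h1⟩, n⟩, h2⟩
  choose nxt hnxt using step
  have h0 : IsTest fun _ : ℝ => (0 : ℝ) := ⟨measurable_const, ⟨0, by simp⟩, 0, by simp⟩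
  let s : ℕ → {F : ℝ → ℝ // IsTest F} × ℕ := fun j => Nat.rec ⟨⟨_, h0⟩, 0⟩ nxt j
  set F : ℕ → ℝ → ℝ := fun j => (s j).1.1 with hFdef
  set n : ℕ → ℕ := fun j => (s j).2 with hndef
  have hs : ∀ j, s (j + 1) = nxt j (s j) := fun _ => rfl
  have hn : ∀ j, n j < n (j + 1) := fun j => (hnxt j (s j)).1
  have hTn : Monotone fun j => T (n j) :=
    monotone_nat_of_le_succ fun j => (hnxt j (s j)).2.1
  have hFn : ∀ j y, |y| < T (n j) → F (j + 1) y = F j y := fun j => (hnxt j (s j)).2.2.1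
  have hFA : ∀ j (C : ℝ), 0 ≤ C → C ≤ 2 ^ j → ∫⁻ x, A.toFun (C * |F (j + 1) x|) ≤
      (∫⁻ x, A.toFun (C * |F j x|)) + ENNReal.ofReal (C / 2 ^ j) :=
    fun j => (hnxt j (s j)).2.2.2.1
  have hFB : ∀ j (f : ℝ → ℝ), (∀ y, |y| < T (n (j + 1)) → f y = F (j + 1) y) →
      1 / 8 ≤ ∫⁻ x, B.toFun |truncOp (k (n (j + 1))) (T (n (j + 1))) f x - f x| :=
    fun j => (hnxt j (s j)).2.2.2.2
  have hFT : ∀ j, IsTest (F j) := fun j => (s j).1.2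
  have hn_tendsto : Tendsto n atTop atTop := (strictMono_nat_of_lt_succ hn).tendsto_atTop
  have hstab : ∀ i j, i ≤ j → ∀ y, |y| < T (n i) → F j y = F i y := by
    intro i j hij y hy
    induction j, hij using Nat.le_induction with
    | base => rfl
    | succ j hij ih => rw [hFn j y (hy.trans_le (hTn hij)), ih]
  have hex : ∀ y : ℝ, ∃ j, |y| < T (n j) := fun y =>
    ((hT.comp hn_tendsto).eventually_gt_atTop |y|).exists
  choose J hJ using hex
  set f : ℝ → ℝ := fun y => F (J y) y with hf
  have hfF : ∀ j y, |y| < T (n j) → f y = F j y := fun j y hy => by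
    rcases le_total j (J y) with h | h
    · exact hstab _ _ h y hy
    · exact (hstab _ _ h y (hJ y)).symm
  have hev : ∀ y, ∀ᶠ j in atTop, F j y = f y := fun y =>
    (eventually_ge_atTop (J y)).mono fun j hj => hstab _ _ hj y (hJ y)
  have hfm : Measurable f := measurable_of_tendsto_metrizable (fun j => (hFT j).meas)
    (tendsto_pi_nhds.2 fun y => tendsto_const_nhds.congr' ((hev y).mono fun j hj => hj.symm))
  have hfA : ∀ C : ℝ, 0 < C → (∫⁻ x, A.toFun (C * |f x|)) < ⊤ := by
    intro C hC
    obtain ⟨j₀, hj₀⟩ := ((tendsto_pow_atTop_atTop_of_one_lt (one_lt_two (α := ℝ))).eventually_ge_atTop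
      C).exists
    have hbound : ∀ i, ∫⁻ x, A.toFun (C * |F (j₀ + i) x|) ≤
        (∫⁻ x, A.toFun (C * |F j₀ x|)) + ENNReal.ofReal (2 * C - 2 * C / 2 ^ (j₀ + i)) := by
      intro i
      have hpow : ∀ i, 2 * C / 2 ^ i ≤ 2 * C := fun i =>
        div_le_self (by positivity) (one_le_pow₀ one_le_two)
      induction i with
      | zero => exact le_self_add
      | succ i ih =>
        have h1 : C ≤ 2 ^ (j₀ + i) :=
          hj₀.trans (pow_le_pow_right₀ one_le_two (Nat.le_add_right _ _))
        refine (hFA (j₀ + i) C hC.le h1).trans ((add_le_add ih le_rfl).trans (le_of_eq ?_))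
        rw [add_assoc, ← ENNReal.ofReal_add (by linarith [hpow (j₀ + i)]) (by positivity)]
        congr 2
        rw [← add_assoc j₀, pow_succ]
        field_simp
        ring
    calc ∫⁻ x, A.toFun (C * |f x|)
        ≤ ∫⁻ x, liminf (fun j => A.toFun (C * |F j x|)) atTop := by
          refine lintegral_mono fun x => le_liminf_of_le (by isBoundedDefault) ?_
          exact (hev x).mono fun j hj => by rw [hj]
      _ ≤ liminf (fun j => ∫⁻ x, A.toFun (C * |F j x|)) atTop :=
          lintegral_liminf_le fun j => A.comp_mul_abs_measurable (hFT j).meas hC.le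
      _ ≤ (∫⁻ x, A.toFun (C * |F j₀ x|)) + ENNReal.ofReal (2 * C) := by
          refine liminf_le_of_frequently_le' (Eventually.frequently ?_)
          filter_upwards [eventually_ge_atTop j₀] with j hj
          obtain ⟨i, rfl⟩ := Nat.exists_eq_add_of_le hj
          refine (hbound i).trans (add_le_add le_rfl (ENNReal.ofReal_le_ofReal ?_))
          have : 0 ≤ 2 * C / 2 ^ (j₀ + i) := by positivity
          linarith
      _ < ⊤ := ENNReal.add_lt_top.2 ⟨(hFT j₀).lintegral_lt_top hA hC.le, ENNReal.ofReal_lt_top⟩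
  have hlim := (hi f hfm hfA).comp (hn_tendsto.comp (tendsto_add_atTop_nat 1))
  have h8 : (1 / 8 : ENNReal) ≤ 0 := ge_of_tendsto' hlim fun j => hFB j f (hfF (j + 1))
  simp at h8

end GlidingHump

/-- **Characterization of modular convergence of truncated Hermite sums in Orlicz setting.**
Let `A`, `B` be Young functions with `B(t) ≤ A(ct)`, `A` finite-valued and
`∫_0^∞ B(κ log(1+1/t)) dt < ∞` for some `κ > 0`. Then the modular convergence
`∫ B(|χ_n S_n(fχ_n) − f|) → 0` for every `f ∈ E^A(ℝ)` is equivalent to the pair of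
integral conditions on `A`, `B` and their conjugates. -/
theorem hermite_orlicz_modular_convergence_iff
    (A B : YoungFunction)
    (c : ℝ) (hc : 0 < c) (hBA : ∀ t : ℝ, 0 < t → B.toFun t ≤ A.toFun (c * t))
    (hAfin : ∀ t : ℝ, 0 ≤ t → A.toFun t < ⊤)
    (hlogB : ∃ κ : ℝ, 0 < κ ∧
      (∫⁻ t in Set.Ioi (0 : ℝ), B.toFun (κ * Real.log (1 + 1 / t))) < ⊤)
    (T : ℕ → ℝ) (hTpos : ∀ n, 0 < T n)
    (hTinf : Tendsto T atTop atTop)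
    (hTslow : Tendsto (fun n : ℕ => T n / (n : ℝ) ^ ((1 : ℝ) / 34)) atTop (nhds 0)) :
    (∀ f : ℝ → ℝ, Measurable f →
        (∀ c' : ℝ, 0 < c' → (∫⁻ x : ℝ, A.toFun (c' * |f x|)) < ⊤) →
        Tendsto (fun n : ℕ =>
            ∫⁻ x : ℝ, B.toFun
              (|Set.indicator (Set.Ioo (-(T n)) (T n))
                  (hermitePartialSum n (Set.indicator (Set.Ioo (-(T n)) (T n)) f)) x - f x|))
          atTop (nhds 0))
    ↔
    (∃ K : ℝ, 0 < K ∧ ∀ t : ℝ, 0 < t →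
        (∫⁻ s in Set.Ioo (0 : ℝ) t, B.toFun s / ENNReal.ofReal (s ^ 2))
            ≤ A.toFun (K * t) / ENNReal.ofReal t ∧
        (∫⁻ s in Set.Ioo (0 : ℝ) t, A.conj s / ENNReal.ofReal (s ^ 2))
            ≤ B.conj (K * t) / ENNReal.ofReal t) := by
  obtain ⟨κ, hκ, hκB⟩ := hlogB
  have hBA' : ∀ t : ℝ, 0 ≤ t → B.toFun t ≤ A.toFun (c * t) := fun t ht => by
    rcases ht.eq_or_lt with rfl | ht
    · simp [B.zero']
    · exact hBA t ht
  have hBfin : ∀ t : ℝ, 0 ≤ t → B.toFun t < ⊤ := fun t ht =>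
    (hBA' t ht).trans_lt (hAfin _ (mul_nonneg hc.le ht))
  have hk := hermite_kernelAsymp hTpos hTinf hTslow
  have htrunc : ∀ f : ℝ → ℝ, Measurable f →
      (∀ c' : ℝ, 0 < c' → (∫⁻ x : ℝ, A.toFun (c' * |f x|)) < ⊤) → ∀ n,
      Set.indicator (Set.Ioo (-(T n)) (T n))
        (hermitePartialSum n (Set.indicator (Set.Ioo (-(T n)) (T n)) f)) =
      truncOp (hermiteKernel n) (T n) f := fun f hf hfA n => by
    have hfl : LocallyIntegrable f :=
      A.locallyIntegrable hf (by simpa only [one_mul] using hfA 1 one_pos)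
    exact (truncOp_hermiteKernel (((locallyIntegrable_iff.1 hfl) _
      (isCompact_Icc (a := -T n) (b := T n))).mono_set Ioo_subset_Icc_self)).symm
  constructor
  · intro hi
    refine exists_cond_of_tendsto hAfin hBfin hk hermiteKernel_continuous hTinf fun f hf hfA => ?_
    simpa only [htrunc f hf hfA] using hi f hf hfA
  · rintro ⟨K, hK, hcond⟩ f hf hfA
    have hAB : HardyPair A B (max K 1) := by
      refine ⟨hAfin, hBfin, fun t ht => ⟨(hcond t ht).1.trans ?_, (hcond t ht).2.trans ?_⟩,
        le_max_right _ _⟩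
      · exact ENNReal.div_le_div_right (A.mono (mul_pos hK ht).le
          (mul_le_mul_of_nonneg_right (le_max_left _ _) ht.le)) _
      · exact ENNReal.div_le_div_right (B.conj_mono
          (mul_le_mul_of_nonneg_right (le_max_left _ _) ht.le)) _
    simp only [htrunc f hf hfA]
    exact tendsto_modular_truncOp hAB (le_max_left _ c)
      (fun t ht => (hBA' t ht).trans (A.mono (mul_nonneg hc.le ht)
        (mul_le_mul_of_nonneg_right (le_max_right _ _) ht)))
      hκ hκB hk hermiteKernel_continuous hTpos hTinf hf hfA
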